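/- Let g ≥ 2 and n ≥ 2, and let ρ ∈ HIT_n. Let sl_n(ℝ) denote the real vector space of n×n real matrices of trace zero, on which Γ_g acts by γ · X = ρ(γ) X ρ(γ)⁻¹. Then the real vector space of 1-cocycles Z¹(Γ_g, sl_n(ℝ)) = { u : Γ_g → sl_n(ℝ) | u(γδ) = u(γ) + ρ(γ) u(δ) ρ(γ)⁻¹ for all γ, δ ∈ Γ_g } has real dimension (2g−1)(n²−1). -/

import Mathlib

open Matrix MvPolynomial
open scoped commutatorElement

/-- `SL n K`: the special linear group of `n × n` matrices over `K`. -/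
abbrev SL (n : ℕ) (K : Type) [CommRing K] := Matrix.SpecialLinearGroup (Fin n) K

/-- Topology on `SL n ℝ` induced from the space of matrices (the Euclidean topology). -/
instance (n : ℕ) (K : Type) [CommRing K] [TopologicalSpace K] :
    TopologicalSpace (SL n K) :=
  TopologicalSpace.induced (fun A => (A : Matrix (Fin n) (Fin n) K)) inferInstance

/-- The relator `[a₁,b₁][a₂,b₂]⋯[a_g,b_g]` of the genus-`g` surface group;
`(i, false)` is the generator `aᵢ` and `(i, true)` is `bᵢ`. -/
def surfaceRelator (g : ℕ) : FreeGroup (Fin g × Bool) :=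
  (List.ofFn fun i : Fin g =>
    ⁅FreeGroup.of (i, false), FreeGroup.of (i, true)⁆).prod

/-- The surface group `Γ_g` of genus `g`. -/
abbrev SurfaceGroup (g : ℕ) : Type :=
  PresentedGroup ({surfaceRelator g} : Set (FreeGroup (Fin g × Bool)))

/-- The tuple `(ρ(a₁), ρ(b₁), …, ρ(a_g), ρ(b_g))` of matrices associated to a
representation `ρ : Γ_g → SL n ℝ`. -/
def repTuple {g n : ℕ} (ρ : SurfaceGroup g →* SL n ℝ) :
    (Fin g × Bool) → Matrix (Fin n) (Fin n) ℝ :=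
  fun x => (ρ (PresentedGroup.of x) : Matrix (Fin n) (Fin n) ℝ)

/-- `Hom(Γ_g, SL_n(K))` as a subset of `K^{2g·n²}`: the `2g`-tuples of matrices of
determinant one whose product of commutators is the identity. -/
def RepVariety (g n : ℕ) (K : Type) [CommRing K] :
    Set ((Fin g × Bool) → Matrix (Fin n) (Fin n) K) :=
  {A | (∀ x, (A x).det = 1) ∧
    (List.ofFn fun i : Fin g =>
      A (i, false) * A (i, true) * (A (i, false))⁻¹ * (A (i, true))⁻¹).prod = 1}

/-- `ρ₀ : Γ_g → SL₂(ℝ)` is discrete and faithful: injective with discrete image. -/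
def IsDiscreteFaithful {g : ℕ} (ρ₀ : SurfaceGroup g →* SL 2 ℝ) : Prop :=
  Function.Injective ρ₀ ∧ DiscreteTopology (ρ₀.range : Subgroup (SL 2 ℝ))

/-- `j : SL₂(ℝ) → SL_n(ℝ)` is a continuous homomorphism acting irreducibly on `ℝⁿ`. -/
def IsIrreducibleEmbedding (n : ℕ) (j : SL 2 ℝ →* SL n ℝ) : Prop :=
  Continuous j ∧
  ∀ W : Submodule ℝ (Fin n → ℝ),
    (∀ A : SL 2 ℝ, ∀ v ∈ W, (j A : Matrix (Fin n) (Fin n) ℝ).mulVec v ∈ W) →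
    W = ⊥ ∨ W = ⊤

/-- A tuple in `ℝ^{2g·n²}` is a Teichmüller representation if it comes from `j ∘ ρ₀` with
`ρ₀` discrete and faithful and `j` continuous and irreducible. -/
def IsTeichmuller (g n : ℕ) (T : (Fin g × Bool) → Matrix (Fin n) (Fin n) ℝ) : Prop :=
  ∃ (ρ₀ : SurfaceGroup g →* SL 2 ℝ) (j : SL 2 ℝ →* SL n ℝ),
    IsDiscreteFaithful ρ₀ ∧ IsIrreducibleEmbedding n j ∧
    T = repTuple (j.comp ρ₀)

/-- The Hitchin component: the connected component (Euclidean topology) of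
`Hom(Γ_g, SL_n(ℝ))` containing the Teichmüller representation `T`. -/
def HIT (g n : ℕ) (T : (Fin g × Bool) → Matrix (Fin n) (Fin n) ℝ) :
    Set ((Fin g × Bool) → Matrix (Fin n) (Fin n) ℝ) :=
  connectedComponentIn (RepVariety g n ℝ) T

/-- A subgroup `H ≤ SL_n(ℝ)` is Zariski-dense in `SL_n(ℝ)`. -/
def IsZariskiDense (n : ℕ) (H : Subgroup (SL n ℝ)) : Prop :=
  ∀ P : MvPolynomial (Fin n × Fin n) ℝ,
    (∀ h ∈ H, eval (fun p => (h : Matrix (Fin n) (Fin n) ℝ) p.1 p.2) P = 0) →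
    ∀ A : SL n ℝ, eval (fun p => (A : Matrix (Fin n) (Fin n) ℝ) p.1 p.2) P = 0

/-- A subgroup `Γ ≤ SL_n(ℝ)` is strongly dense: every pair of noncommuting elements
generates a Zariski-dense subgroup. -/
def IsStronglyDense (n : ℕ) (Γ : Subgroup (SL n ℝ)) : Prop :=
  ∀ x ∈ Γ, ∀ y ∈ Γ, x * y ≠ y * x → IsZariskiDense n (Subgroup.closure {x, y})

/-- The space `Z¹(Γ_g, sl_n(ℝ))` of 1-cocycles for the adjoint action
`γ · X = ρ(γ) X ρ(γ)⁻¹` of `Γ_g` on trace-zero matrices: functions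
`u : Γ_g → sl_n(ℝ)` with `u(γδ) = u(γ) + ρ(γ) u(δ) ρ(γ)⁻¹`. -/
def cocycles {g n : ℕ} (ρ : SurfaceGroup g →* SL n ℝ) :
    Submodule ℝ (SurfaceGroup g → Matrix (Fin n) (Fin n) ℝ) where
  carrier := {u | (∀ γ, (u γ).trace = 0) ∧
    ∀ γ δ, u (γ * δ) = u γ + (ρ γ : Matrix (Fin n) (Fin n) ℝ) * u δ *
      (((ρ γ)⁻¹ : SL n ℝ) : Matrix (Fin n) (Fin n) ℝ)}
  zero_mem' := ⟨fun γ => by simp, fun γ δ => by simp⟩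
  add_mem' := fun hu hv => by
    refine ⟨fun γ => ?_, fun γ δ => ?_⟩
    · simp [Matrix.trace_add, hu.1 γ, hv.1 γ]
    · simp only [Pi.add_apply, hu.2 γ δ, hv.2 γ δ, mul_add, add_mul]
      abel
  smul_mem' := fun c u hu => by
    refine ⟨fun γ => ?_, fun γ δ => ?_⟩
    · simp [hu.1 γ]
    · simp only [Pi.smul_apply, hu.2 γ δ, smul_add, Matrix.mul_smul, Matrix.smul_mul]



/-! ## Combinatorics of the surface group -/
namespace SG

def ga {g : ℕ} (i : Fin g) : SurfaceGroup g := PresentedGroup.of (i, false)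
def gb {g : ℕ} (i : Fin g) : SurfaceGroup g := PresentedGroup.of (i, true)
def W {g : ℕ} : Fin (g + 1) → SurfaceGroup g := Fin.partialProd fun i => ⁅ga i, gb i⁆

lemma partialProd_last {M : Type*} [Monoid M] {n : ℕ} (f : Fin n → M) :
    Fin.partialProd f (Fin.last n) = (List.ofFn f).prod := by
  simp only [Fin.partialProd, Fin.val_last]
  rw [List.take_of_length_le (by simp)]

lemma W_zero {g : ℕ} : (W 0 : SurfaceGroup g) = 1 := Fin.partialProd_zero _
lemma W_succ {g : ℕ} (i : Fin g) : W i.succ = W i.castSucc * ⁅ga i, gb i⁆ :=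
  Fin.partialProd_succ _ _

lemma map_relator {g : ℕ} {G : Type*} [Group G] (q : FreeGroup (Fin g × Bool) →* G) :
    q (surfaceRelator g) =
      (List.ofFn fun i : Fin g => ⁅q (FreeGroup.of (i, false)), q (FreeGroup.of (i, true))⁆).prod := by
  rw [surfaceRelator, map_list_prod, List.map_ofFn]
  congr 2
  funext i
  exact map_commutatorElement q _ _

lemma W_last {g : ℕ} : (W (Fin.last g) : SurfaceGroup g) = 1 := by
  have h : PresentedGroup.mk ({surfaceRelator g} : Set (FreeGroup (Fin g × Bool)))
      (surfaceRelator g) = 1 :=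
    PresentedGroup.one_of_mem (Set.mem_singleton _)
  rw [W, partialProd_last, ← h]
  rw [map_relator]
  rfl

def al {g : ℕ} (i : Fin g) : SurfaceGroup g :=
  W i.castSucc * ga i * (gb i)⁻¹ * (ga i)⁻¹ * (W i.castSucc)⁻¹
def yy {g : ℕ} (i : Fin g) : SurfaceGroup g := W i.succ * (ga i)⁻¹ * (W i.castSucc)⁻¹

lemma comm_yy_al {g : ℕ} (i : Fin g) : ⁅yy i, al i⁆ = W i.succ * (W i.castSucc)⁻¹ := by
  simp only [yy, al, W_succ, commutatorElement_def]
  group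

/-- lifting out of the surface group. -/
lemma lift_relator {g : ℕ} {G : Type*} [Group G] (f : Fin g × Bool → G) :
    FreeGroup.lift f (surfaceRelator g) =
      Fin.partialProd (fun i => ⁅f (i, false), f (i, true)⁆) (Fin.last g) := by
  rw [partialProd_last, surfaceRelator, map_list_prod, List.map_ofFn]
  congr 2
  funext i
  simp [commutatorElement_def]

def phiFun {g : ℕ} : Fin g × Bool → SurfaceGroup g
  | (i, false) => yy i.rev
  | (i, true) => al i.rev

lemma phi_partial {g : ℕ} (j : Fin (g + 1)) :
    Fin.partialProd (fun i : Fin g => ⁅phiFun (i, false), phiFun (i, true)⁆) j = (W j.rev)⁻¹ := by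
  induction j using Fin.induction with
  | zero => rw [Fin.partialProd_zero, Fin.rev_zero, W_last, inv_one]
  | succ i ih =>
    rw [Fin.partialProd_succ, ih]
    simp only [phiFun]
    rw [comm_yy_al, Fin.rev_castSucc, Fin.rev_succ]
    group

def phi (g : ℕ) : SurfaceGroup g →* SurfaceGroup g :=
  PresentedGroup.toGroup (f := phiFun) (by
    intro r hr
    rw [Set.mem_singleton_iff.1 hr, lift_relator, phi_partial, Fin.rev_last, W_zero, inv_one])

lemma phi_ga {g : ℕ} (i : Fin g) : phi g (ga i) = yy i.rev := PresentedGroup.toGroup.of _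
lemma phi_gb {g : ℕ} (i : Fin g) : phi g (gb i) = al i.rev := PresentedGroup.toGroup.of _

lemma phi_W {g : ℕ} (j : Fin (g + 1)) : phi g (W j) = (W j.rev)⁻¹ := by
  rw [← phi_partial, W]
  induction j using Fin.induction with
  | zero => simp [Fin.partialProd_zero]
  | succ i ih =>
    rw [Fin.partialProd_succ, Fin.partialProd_succ, map_mul, ih, map_commutatorElement, phi_ga, phi_gb]
    rfl

lemma phi_yy {g : ℕ} (i : Fin g) : phi g (yy i) = ga i.rev := by
  rw [yy, map_mul, map_mul, map_inv, map_inv, phi_W, phi_W, phi_ga, Fin.rev_succ, Fin.rev_castSucc,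
    yy]
  group

lemma phi_al {g : ℕ} (i : Fin g) : phi g (al i) = gb i.rev := by
  rw [al]
  simp only [map_mul, map_inv, phi_W, phi_ga, phi_gb, Fin.rev_castSucc, yy, al, W_succ,
    commutatorElement_def]
  group

lemma gen_induction {g : ℕ} (H : Subgroup (SurfaceGroup g)) (ha : ∀ i, ga i ∈ H)
    (hb : ∀ i, gb i ∈ H) : H = ⊤ := by
  rw [eq_top_iff, ← PresentedGroup.closure_range_of, Subgroup.closure_le]
  rintro _ ⟨⟨i, b⟩, rfl⟩
  cases b
  · exact ha i
  · exact hb i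

lemma phi_phi {g : ℕ} (x : SurfaceGroup g) : phi g (phi g x) = x := by
  have : MonoidHom.eqLocus ((phi g).comp (phi g)) (MonoidHom.id _) = ⊤ := by
    apply gen_induction
    · intro i
      change phi g (phi g _) = _
      rw [phi_ga, phi_yy, Fin.rev_rev]; rfl
    · intro i
      change phi g (phi g _) = _
      rw [phi_gb, phi_al, Fin.rev_rev]; rfl
  have h : x ∈ MonoidHom.eqLocus ((phi g).comp (phi g)) (MonoidHom.id _) := by
    rw [this]; trivial
  exact h

lemma gen_induction' {g : ℕ} (H : Subgroup (SurfaceGroup g)) (ha : ∀ i, al i ∈ H)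
    (hy : ∀ i, yy i ∈ H) : H = ⊤ := by
  have : H.comap (phi g) = ⊤ := by
    apply gen_induction
    · intro i
      rw [Subgroup.mem_comap, phi_ga]; exact hy _
    · intro i
      rw [Subgroup.mem_comap, phi_gb]; exact ha _
  rw [eq_top_iff]
  intro x _
  have h : phi g x ∈ H.comap (phi g) := by rw [this]; trivial
  rw [Subgroup.mem_comap, phi_phi] at h
  exact h

/-! ### crossed homomorphisms -/

lemma fin_telescope {M : Type*} [AddCommGroup M] {n : ℕ} (F : Fin (n + 1) → M) :
    ∑ i : Fin n, (F i.succ - F i.castSucc) = F (Fin.last n) - F 0 := by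
  induction n with
  | zero => simp
  | succ n ih =>
    rw [Fin.sum_univ_castSucc]
    have := ih (fun i => F i.castSucc)
    simp only [← Fin.succ_castSucc] at this ⊢
    rw [this]
    simp

section crossed
variable {M : Type*} [AddCommGroup M] [Module ℝ M]

/-- crossed homomorphism. -/
def IsCross {G : Type*} [Group G] (A : G →* Module.End ℝ M) (u : G → M) : Prop :=
  ∀ x y, u (x * y) = u x + A x (u y)

namespace IsCross
variable {G : Type*} [Group G] {A : G →* Module.End ℝ M} {u : G → M}

lemma one (h : IsCross A u) : u 1 = 0 := by
  have := h 1 1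
  simpa using this

lemma inv (h : IsCross A u) (x : G) : u x⁻¹ = - A x⁻¹ (u x) := by
  have := h x⁻¹ x
  rw [inv_mul_cancel, h.one] at this
  exact eq_neg_of_add_eq_zero_left this.symm

lemma comm (h : IsCross A u) (a b : G) :
    u ⁅a, b⁆ = u a - A (a * b * a⁻¹) (u a) + (A a (u b) - A ⁅a, b⁆ (u b)) := by
  rw [commutatorElement_def, h, h, h, h.inv, h.inv]
  simp only [map_mul, map_neg, Module.End.mul_apply]
  abel

lemma partialProd (h : IsCross A u) {n : ℕ} (a b : Fin n → G) :
    u (Fin.partialProd (fun i => ⁅a i, b i⁆) (Fin.last n)) =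
      ∑ i : Fin n, A (Fin.partialProd (fun i => ⁅a i, b i⁆) i.castSucc)
        (u (a i) - A (a i * b i * (a i)⁻¹) (u (a i)) + (A (a i) (u (b i)) - A ⁅a i, b i⁆ (u (b i)))) := by
  have := fin_telescope (fun i => u (Fin.partialProd (fun i => ⁅a i, b i⁆) i))
  simp only [Fin.partialProd_zero, h.one, sub_zero] at this
  rw [← this]
  refine Finset.sum_congr rfl fun i _ => ?_
  rw [Fin.partialProd_succ, h, h.comm, add_sub_cancel_left]

end IsCross

/-- The Fox sum. -/
def foxSum {g : ℕ} {G : Type*} [Group G] (A : G →* Module.End ℝ M) (a b : Fin g → G)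
    (m : Fin g × Bool → M) : M :=
  ∑ i : Fin g, A (Fin.partialProd (fun i => ⁅a i, b i⁆) i.castSucc)
        (m (i, false) - A (a i * b i * (a i)⁻¹) (m (i, false)) +
          (A (a i) (m (i, true)) - A ⁅a i, b i⁆ (m (i, true))))

lemma exists_cross {g : ℕ} (A : SurfaceGroup g →* Module.End ℝ M) (m : Fin g × Bool → M)
    (hm : foxSum A ga gb m = 0) :
    ∃ u : SurfaceGroup g → M, IsCross A u ∧ ∀ x, u (PresentedGroup.of x) = m x := by
  classical
  have hAinv : ∀ x v, A x (A x⁻¹ v) = v := fun x v => by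
    rw [← Module.End.mul_apply, ← map_mul, mul_inv_cancel, map_one]; rfl
  have hAinv' : ∀ x v, A x⁻¹ (A x v) = v := fun x v => by
    rw [← Module.End.mul_apply, ← map_mul, inv_mul_cancel, map_one]; rfl
  let f : Fin g × Bool → Equiv.Perm M := fun x =>
    { toFun := fun v => A (PresentedGroup.of x) v + m x
      invFun := fun v => A (PresentedGroup.of x)⁻¹ (v - m x)
      left_inv := fun v => by simp [hAinv']
      right_inv := fun v => by simp [hAinv] }
  let q : FreeGroup (Fin g × Bool) →* SurfaceGroup g := PresentedGroup.mk _
  have haff : ∀ w : FreeGroup (Fin g × Bool), ∀ v, FreeGroup.lift f w v =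
      A (q w) v + FreeGroup.lift f w 0 := by
    intro w
    induction w using FreeGroup.induction_on with
    | C1 => intro v; simp
    | of x => 
      intro v
      rw [FreeGroup.lift_apply_of]
      change A (PresentedGroup.of x) v + m x = _ + (A (PresentedGroup.of x) 0 + m x)
      rw [map_zero, zero_add]
      rfl
    | inv_of x _ =>
      intro v
      rw [map_inv, FreeGroup.lift_apply_of]
      change A (PresentedGroup.of x)⁻¹ (v - m x) = _ + (A (PresentedGroup.of x)⁻¹ (0 - m x))
      have : q (FreeGroup.of x)⁻¹ = (PresentedGroup.of x)⁻¹ := map_inv q _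
      rw [this]
      change _ = A (PresentedGroup.of x)⁻¹ v + _
      rw [← map_add]
      congr 1; abel
    | mul x y hx hy =>
      intro v
      rw [map_mul, Equiv.Perm.mul_apply, hy v, hx, Equiv.Perm.mul_apply, hx (FreeGroup.lift f y 0),
        map_add, map_mul, map_mul, Module.End.mul_apply, add_assoc]
  have hcr : IsCross (A.comp q) (fun w => FreeGroup.lift f w 0) := by
    intro x y
    simp only [map_mul, Equiv.Perm.mul_apply]
    rw [haff x]
    exact add_comm _ _
  have hrel : FreeGroup.lift f (surfaceRelator g) = 1 := by
    ext v
    rw [haff]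
    have h1 : q (surfaceRelator g) = 1 := PresentedGroup.one_of_mem (Set.mem_singleton _)
    rw [h1, map_one]
    have h2 := hcr.partialProd (fun i : Fin g => FreeGroup.of (i, false))
      (fun i => FreeGroup.of (i, true))
    have h3 : surfaceRelator g = Fin.partialProd (fun i : Fin g =>
      ⁅FreeGroup.of (i, false), FreeGroup.of (i, true)⁆) (Fin.last g) := by
      rw [partialProd_last]; rfl
    rw [← h3] at h2
    have hW : ∀ i : Fin (g + 1), q (Fin.partialProd (fun i : Fin g =>
      ⁅FreeGroup.of (i, false), FreeGroup.of (i, true)⁆) i) = W i := by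
      intro i
      induction i using Fin.induction with
      | zero => simp [W_zero]
      | succ i ih => 
        rw [Fin.partialProd_succ, map_mul, ih, W_succ, map_commutatorElement]; rfl
    have h4 : foxSum A ga gb m = FreeGroup.lift f (surfaceRelator g) 0 := by
      rw [h2, foxSum]
      refine Finset.sum_congr rfl fun i _ => ?_
      have e1 : ∀ x, FreeGroup.lift f (FreeGroup.of x) 0 = m x := fun x => by
        rw [FreeGroup.lift_apply_of]
        change A _ 0 + m x = m x
        simp
      simp only [MonoidHom.comp_apply, hW, e1, map_mul, map_inv, map_commutatorElement]
      rfl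
    rw [← h4, hm]
    simp
  let L : SurfaceGroup g →* Equiv.Perm M := PresentedGroup.toGroup (f := f) (by
    intro r hr
    rw [Set.mem_singleton_iff.1 hr, hrel])
  refine ⟨fun γ => L γ 0, ?_, ?_⟩
  · intro x y
    obtain ⟨x, rfl⟩ := PresentedGroup.mk_surjective _ x
    obtain ⟨y, rfl⟩ := PresentedGroup.mk_surjective _ y
    exact hcr x y
  · intro x
    change L _ 0 = _
    have : L (PresentedGroup.of x) = f x := PresentedGroup.toGroup.of _
    rw [this]
    change A _ 0 + m x = m x
    simp

lemma IsCross.foxSum_eq_zero {g : ℕ} {A : SurfaceGroup g →* Module.End ℝ M} {u : SurfaceGroup g → M}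
    (h : IsCross A u) : foxSum A ga gb (fun x => u (PresentedGroup.of x)) = 0 := by
  have := h.partialProd (ga (g := g)) gb
  rw [foxSum]
  have h2 : Fin.partialProd (fun i : Fin g => ⁅ga i, gb i⁆) (Fin.last g) = 1 := W_last
  rw [h2, h.one] at this
  exact this.symm

lemma foxSum_eq {g : ℕ} (A : SurfaceGroup g →* Module.End ℝ M) (m : Fin g × Bool → M) :
    foxSum A ga gb m = ∑ i : Fin g, ((A (W i.castSucc) (m (i, false))
        - A (al i)⁻¹ (A (W i.castSucc) (m (i, false)))) +
      (A (W i.castSucc * ga i) (m (i, true)) - A (yy i) (A (W i.castSucc * ga i) (m (i, true))))) := by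
  rw [foxSum]
  refine Finset.sum_congr rfl fun i _ => ?_
  change A (W i.castSucc) _ = _
  have h1 : (al i)⁻¹ * W i.castSucc = W i.castSucc * (ga i * gb i * (ga i)⁻¹) := by
    rw [al]; group
  have h2 : yy i * (W i.castSucc * ga i) = W i.castSucc * ⁅ga i, gb i⁆ := by
    rw [yy, W_succ]; group
  simp only [← Module.End.mul_apply, ← map_mul A, h1, h2]
  simp only [map_add, map_sub, map_mul, Module.End.mul_apply]

lemma IsCross.ext_gen {g : ℕ} {A : SurfaceGroup g →* Module.End ℝ M} {u v : SurfaceGroup g → M}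
    (hu : IsCross A u) (hv : IsCross A v)
    (h : ∀ x, u (PresentedGroup.of x) = v (PresentedGroup.of x)) : u = v := by
  let H : Subgroup (SurfaceGroup g) :=
    { carrier := {x | u x = v x}
      one_mem' := by change u 1 = v 1; rw [hu.one, hv.one]
      mul_mem' := by intro a b ha hb; change u _ = v _; rw [hu, hv, ha, hb]
      inv_mem' := by intro a ha; change u _ = v _; rw [hu.inv, hv.inv, ha] }
  have : H = ⊤ := gen_induction H (fun i => h _) (fun i => h _)
  funext x
  have hx : x ∈ H := by rw [this]; trivial
  exact hx

end crossed
end SG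


namespace SG

lemma slmul {n : ℕ} (A B : SL n ℝ) : ((A * B : SL n ℝ) : Matrix (Fin n) (Fin n) ℝ) =
    (A : Matrix (Fin n) (Fin n) ℝ) * (B : Matrix (Fin n) (Fin n) ℝ) := rfl
lemma slone {n : ℕ} : ((1 : SL n ℝ) : Matrix (Fin n) (Fin n) ℝ) = 1 := rfl
lemma sl_mul_inv {n : ℕ} (A : SL n ℝ) : (A : Matrix (Fin n) (Fin n) ℝ) *
    ((A⁻¹ : SL n ℝ) : Matrix (Fin n) (Fin n) ℝ) = 1 := by
  rw [← slmul, mul_inv_cancel, slone]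
lemma sl_inv_mul {n : ℕ} (A : SL n ℝ) : ((A⁻¹ : SL n ℝ) : Matrix (Fin n) (Fin n) ℝ) *
    (A : Matrix (Fin n) (Fin n) ℝ) = 1 := by
  rw [← slmul, inv_mul_cancel, slone]

abbrev sl (n : ℕ) : Submodule ℝ (Matrix (Fin n) (Fin n) ℝ) :=
  LinearMap.ker (Matrix.traceLinearMap (Fin n) ℝ ℝ)

lemma mem_sl {n : ℕ} {X : Matrix (Fin n) (Fin n) ℝ} : X ∈ sl n ↔ X.trace = 0 := Iff.rfl

lemma finrank_sl {n : ℕ} (hn : 1 ≤ n) : Module.finrank ℝ (sl n) = n ^ 2 - 1 := by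
  have h := LinearMap.finrank_range_add_finrank_ker (Matrix.traceLinearMap (Fin n) ℝ ℝ)
  have h2 : LinearMap.range (Matrix.traceLinearMap (Fin n) ℝ ℝ) = ⊤ := by
    rw [LinearMap.range_eq_top]
    intro c
    refine ⟨Matrix.single ⟨0, hn⟩ ⟨0, hn⟩ c, ?_⟩
    simp
  rw [h2, finrank_top, Module.finrank_matrix, Module.finrank_self] at h
  simp only [Fintype.card_fin, mul_one] at h
  rw [pow_two]
  change Module.finrank ℝ (LinearMap.ker _) = _
  omega

def Ad {g n : ℕ} (ρ : SurfaceGroup g →* SL n ℝ) : SurfaceGroup g →* Module.End ℝ (sl n) where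
  toFun γ :=
    { toFun := fun X => ⟨(ρ γ : Matrix (Fin n) (Fin n) ℝ) * X.1 * ((ρ γ)⁻¹ : SL n ℝ), by
        rw [mem_sl, Matrix.trace_mul_comm, ← Matrix.mul_assoc, sl_inv_mul, one_mul]
        exact X.2⟩
      map_add' := fun X Y => by ext1; simp [mul_add, add_mul]
      map_smul' := fun c X => by ext1; simp }
  map_one' := by ext1 X; ext1; simp
  map_mul' γ δ := by
    ext1 X; ext1
    simp only [map_mul, _root_.mul_inv_rev, slmul, LinearMap.coe_mk, AddHom.coe_mk,
      Module.End.mul_apply, Matrix.mul_assoc]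

lemma Ad_coe {g n : ℕ} (ρ : SurfaceGroup g →* SL n ℝ) (γ) (X : sl n) :
    (Ad ρ γ X : Matrix (Fin n) (Fin n) ℝ) =
      (ρ γ : Matrix (Fin n) (Fin n) ℝ) * X.1 * ((ρ γ)⁻¹ : SL n ℝ) := rfl

/-- The Fox differential as a linear map. -/
def foxLin {g : ℕ} {M : Type*} [AddCommGroup M] [Module ℝ M] (A : SurfaceGroup g →* Module.End ℝ M) :
    (Fin g × Bool → M) →ₗ[ℝ] M where
  toFun m := foxSum A ga gb m
  map_add' m m' := by
    simp only [foxSum, ← Finset.sum_add_distrib]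
    refine Finset.sum_congr rfl fun i _ => ?_
    simp only [Pi.add_apply, map_add, map_sub]
    abel
  map_smul' c m := by
    simp only [foxSum, Finset.smul_sum]
    refine Finset.sum_congr rfl fun i _ => ?_
    simp only [Pi.smul_apply, map_add, map_sub, map_smul, RingHom.id_apply, smul_add, smul_sub]

lemma eq_trace_form {n : ℕ} (l : Matrix (Fin n) (Fin n) ℝ →ₗ[ℝ] ℝ) :
    ∃ Y : Matrix (Fin n) (Fin n) ℝ, ∀ X, l X = (Y * X).trace := by
  refine ⟨Matrix.of fun i j => l (Matrix.single j i 1), fun X => ?_⟩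
  conv_lhs => rw [Matrix.matrix_eq_sum_single X]
  simp only [map_sum, Matrix.trace, Matrix.diag, Matrix.mul_apply, Matrix.of_apply]
  rw [Finset.sum_comm]
  refine Finset.sum_congr rfl fun i _ => Finset.sum_congr rfl fun j _ => ?_
  rw [← mul_one (X j i), ← smul_eq_mul (X j i), ← Matrix.smul_single, map_smul]
  simp [mul_comm]

lemma fox_surj {g n : ℕ} (hn : 1 ≤ n) (ρ : SurfaceGroup g →* SL n ℝ)
    (h : ∀ X : Matrix (Fin n) (Fin n) ℝ, X.trace = 0 →
      (∀ γ, (ρ γ : Matrix (Fin n) (Fin n) ℝ) * X = X * (ρ γ : Matrix (Fin n) (Fin n) ℝ)) → X = 0) :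
    LinearMap.range (foxLin (Ad ρ)) = ⊤ := by
  classical
  by_contra hne
  obtain ⟨l, hl0, hl⟩ := Submodule.exists_le_ker_of_lt_top _ (lt_top_iff_ne_top.2 hne)
  have hfox : ∀ m, l (foxSum (Ad ρ) ga gb m) = 0 := fun m => hl ⟨m, rfl⟩
  have hinv : ∀ x v, Ad ρ x (Ad ρ x⁻¹ v) = v := fun x v => by
    rw [← Module.End.mul_apply, ← map_mul, mul_inv_cancel, map_one]; rfl
  have hinv' : ∀ x v, Ad ρ x⁻¹ (Ad ρ x v) = v := fun x v => by
    rw [← Module.End.mul_apply, ← map_mul, inv_mul_cancel, map_one]; rfl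
  have ha : ∀ (i : Fin g) v, l (Ad ρ (al i)⁻¹ v) = l v := by
    intro i v
    have := hfox (Pi.single (i, false) (Ad ρ (W i.castSucc)⁻¹ v))
    rw [foxSum_eq, Finset.sum_eq_single i] at this
    · simp only [Pi.single_eq_same, hinv] at this
      simp at this
      linarith
    · intro j _ hj
      simp [hj]
    · simp
  have hy : ∀ (i : Fin g) v, l (Ad ρ (yy i) v) = l v := by
    intro i v
    have := hfox (Pi.single (i, true) (Ad ρ (W i.castSucc * ga i)⁻¹ v))
    rw [foxSum_eq, Finset.sum_eq_single i] at this
    · simp only [Pi.single_eq_same, hinv] at this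
      simp at this
      linarith
    · intro j _ hj
      simp [hj]
    · simp
  let H : Subgroup (SurfaceGroup g) :=
    { carrier := {γ | ∀ v, l (Ad ρ γ v) = l v}
      one_mem' := by intro v; simp
      mul_mem' := by
        intro a b ha hb v
        rw [map_mul, Module.End.mul_apply, ha, hb]
      inv_mem' := by
        intro a ha v
        have := ha (Ad ρ a⁻¹ v)
        rw [hinv] at this
        exact this.symm }
  have hH : H = ⊤ := gen_induction' H (fun i => inv_mem_iff.1 (ha i)) (fun i => hy i)
  have hall : ∀ γ v, l (Ad ρ γ v) = l v := fun γ => by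
    have : γ ∈ H := by rw [hH]; trivial
    exact this
  have hn0 : (n : ℝ) ≠ 0 := by positivity
  let pr : Matrix (Fin n) (Fin n) ℝ →ₗ[ℝ] sl n :=
    { toFun := fun X => ⟨X - (X.trace / n) • (1 : Matrix (Fin n) (Fin n) ℝ), by
        rw [mem_sl]; simp [hn0]⟩
      map_add' := fun X Y => by ext1; simp [add_div, add_smul]; abel
      map_smul' := fun c X => by ext1; simp [mul_div_assoc, mul_smul, smul_sub] }
  have hpr : ∀ X : sl n, pr X.1 = X := fun X => by
    ext1
    change X.1 - (X.1.trace / n) • (1 : Matrix (Fin n) (Fin n) ℝ) = X.1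
    rw [mem_sl.1 X.2]; simp
  obtain ⟨Y, hY⟩ := eq_trace_form (l ∘ₗ pr)
  have hYt : Y.trace = 0 := by
    have := hY 1
    rw [mul_one] at this
    rw [← this, LinearMap.comp_apply]
    have : pr 1 = 0 := by
      ext1
      change (1 : Matrix (Fin n) (Fin n) ℝ) - (trace (1 : Matrix (Fin n) (Fin n) ℝ) / n) • (1 : Matrix (Fin n) (Fin n) ℝ) = 0
      simp [hn0]
    rw [this, map_zero]
  have hprAd : ∀ γ X, pr ((ρ γ : Matrix (Fin n) (Fin n) ℝ) * X * ((ρ γ)⁻¹ : SL n ℝ)) = Ad ρ γ (pr X) := by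
    intro γ X
    have e : (ρ γ : Matrix (Fin n) (Fin n) ℝ) * ((ρ γ)⁻¹ : SL n ℝ) = 1 := sl_mul_inv _
    have e' : (((ρ γ)⁻¹ : SL n ℝ) : Matrix (Fin n) (Fin n) ℝ) * (ρ γ) = 1 := sl_inv_mul _
    ext1
    rw [Ad_coe]
    change _ - (trace _ / (n : ℝ)) • (1 : Matrix (Fin n) (Fin n) ℝ) = _ * (X - (X.trace / n) • (1 : Matrix (Fin n) (Fin n) ℝ)) * _
    rw [mul_sub, sub_mul, Matrix.mul_smul, Matrix.smul_mul, mul_one, e, Matrix.trace_mul_comm,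
      ← Matrix.mul_assoc, e', one_mul]
  have hcomm : ∀ γ, (ρ γ : Matrix (Fin n) (Fin n) ℝ) * Y = Y * (ρ γ : Matrix (Fin n) (Fin n) ℝ) := by
    intro γ
    have key : ∀ X : Matrix (Fin n) (Fin n) ℝ,
        (((((ρ γ)⁻¹ : SL n ℝ) : Matrix (Fin n) (Fin n) ℝ) * Y * (ρ γ)) * X).trace = (Y * X).trace := by
      intro X
      rw [← hY X, LinearMap.comp_apply, ← hall γ, ← hprAd, ← LinearMap.comp_apply, hY]
      rw [Matrix.mul_assoc, Matrix.mul_assoc, Matrix.trace_mul_comm]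
      simp only [Matrix.mul_assoc]
    have h1 : (((ρ γ)⁻¹ : SL n ℝ) : Matrix (Fin n) (Fin n) ℝ) * Y * (ρ γ) = Y := by
      ext i j
      have := key (Matrix.single j i 1)
      simpa [Matrix.trace_mul_single] using this
    have e : (ρ γ : Matrix (Fin n) (Fin n) ℝ) * ((ρ γ)⁻¹ : SL n ℝ) = 1 := sl_mul_inv _
    conv_lhs => rw [← h1]
    rw [← Matrix.mul_assoc, ← Matrix.mul_assoc, e, one_mul]
  have hY0 := h Y hYt hcomm
  apply hl0
  ext X
  rw [← hpr X, ← LinearMap.comp_apply, hY, hY0]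
  simp

lemma cocycle_cross {g n : ℕ} {ρ : SurfaceGroup g →* SL n ℝ} (u : SurfaceGroup g → Matrix (Fin n) (Fin n) ℝ)
    (hu : u ∈ cocycles ρ) :
    ∃ v : SurfaceGroup g → sl n, (∀ γ, (v γ).1 = u γ) ∧ IsCross (Ad ρ) v := by
  refine ⟨fun γ => ⟨u γ, hu.1 γ⟩, fun γ => rfl, fun γ δ => ?_⟩
  apply Subtype.ext
  exact hu.2 γ δ

def cocRestr {g n : ℕ} (ρ : SurfaceGroup g →* SL n ℝ) :
    cocycles ρ →ₗ[ℝ] (Fin g × Bool → sl n) where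
  toFun u x := ⟨u.1 (PresentedGroup.of x), u.2.1 _⟩
  map_add' u v := by
    funext x; apply Subtype.ext; rfl
  map_smul' c u := by
    funext x; apply Subtype.ext; rfl

lemma cocRestr_apply {g n : ℕ} (ρ : SurfaceGroup g →* SL n ℝ) (u : cocycles ρ) (x) :
    (cocRestr ρ u x).1 = u.1 (PresentedGroup.of x) := rfl

lemma cocRestr_inj {g n : ℕ} (ρ : SurfaceGroup g →* SL n ℝ) : Function.Injective (cocRestr ρ) := by
  intro u u' huu
  obtain ⟨v, hv, hc⟩ := cocycle_cross u.1 u.2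
  obtain ⟨v', hv', hc'⟩ := cocycle_cross u'.1 u'.2
  have : v = v' := by
    apply hc.ext_gen hc'
    intro x
    apply Subtype.ext
    rw [hv, hv', ← cocRestr_apply, huu, cocRestr_apply]
  apply Subtype.ext
  funext γ
  rw [← hv, ← hv', this]

lemma cocRestr_range {g n : ℕ} (ρ : SurfaceGroup g →* SL n ℝ) :
    LinearMap.range (cocRestr ρ) = LinearMap.ker (foxLin (Ad ρ)) := by
  apply le_antisymm
  · rintro _ ⟨u, rfl⟩
    obtain ⟨v, hv, hc⟩ := cocycle_cross u.1 u.2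
    have := hc.foxSum_eq_zero
    rw [LinearMap.mem_ker]
    have e : cocRestr ρ u = fun x => v (PresentedGroup.of x) := by
      funext x
      apply Subtype.ext
      rw [hv, cocRestr_apply]
    rw [e]
    exact this
  · intro m hm
    obtain ⟨u, hu, hum⟩ := exists_cross (Ad ρ) m hm
    refine ⟨⟨fun γ => (u γ).1, fun γ => (u γ).2, fun γ δ => ?_⟩, ?_⟩
    · exact congrArg Subtype.val (hu γ δ)
    · funext x
      apply Subtype.ext
      rw [cocRestr_apply, ← hum]

theorem finrank_of_centralizer {g n : ℕ} (hn : 1 ≤ n) (ρ : SurfaceGroup g →* SL n ℝ)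
    (h : ∀ X : Matrix (Fin n) (Fin n) ℝ, X.trace = 0 →
      (∀ γ, (ρ γ : Matrix (Fin n) (Fin n) ℝ) * X = X * (ρ γ : Matrix (Fin n) (Fin n) ℝ)) → X = 0) :
    Module.finrank ℝ (cocycles ρ) = (2 * g - 1) * (n ^ 2 - 1) := by
  have hr := LinearMap.finrank_range_add_finrank_ker (foxLin (Ad ρ))
  rw [fox_surj hn ρ h, finrank_top, Module.finrank_pi_fintype, ← cocRestr_range,
    LinearMap.finrank_range_of_inj (cocRestr_inj ρ)] at hr
  generalize Module.finrank ℝ (cocycles ρ) = N at hr ⊢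
  rw [finrank_sl hn] at hr
  simp only [Finset.sum_const, Finset.card_univ, Fintype.card_prod, Fintype.card_fin,
    Fintype.card_bool, smul_eq_mul] at hr
  generalize n ^ 2 - 1 = k at hr ⊢
  rw [Nat.sub_mul, mul_comm 2 g]
  omega

end SG


/-! ## One-endedness of the surface group -/
namespace SG
section oneended
variable {g : ℕ}

abbrev KG (g : ℕ) := MonoidAlgebra ℝ (SurfaceGroup g)

noncomputable def em (x : SurfaceGroup g) : KG g := MonoidAlgebra.single x 1

lemma em_mul (x y : SurfaceGroup g) : em (x * y) = em x * em y := by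
  simp [em, MonoidAlgebra.single_mul_single]
lemma em_one : em (1 : SurfaceGroup g) = 1 := rfl
lemma em_coeff (x : KG g) (h δ : SurfaceGroup g) : (x * em h).coeff δ = x.coeff (δ * h⁻¹) := by
  simp [em, MonoidAlgebra.coeff_mul_single_apply]

noncomputable def cvec (g : ℕ) : Fin g × Bool → KG g
  | (i, false) => em (W i.succ)⁻¹ - em ((gb i)⁻¹ * (W i.succ)⁻¹)
  | (i, true) => em ((ga i)⁻¹ * (W i.castSucc)⁻¹) - em (W i.castSucc)⁻¹

abbrev NG (g : ℕ) := (Fin g × Bool → KG g) ⧸ (Submodule.span (KG g) {cvec g})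

noncomputable def A0 (g : ℕ) : SurfaceGroup g →* Module.End ℝ (NG g) :=
  ((Algebra.lsmul ℝ ℝ (NG g) : KG g →ₐ[ℝ] Module.End ℝ (NG g)) : KG g →* Module.End ℝ (NG g)).comp
    (MonoidAlgebra.of ℝ (SurfaceGroup g))

lemma A0_apply (x : SurfaceGroup g) (v : NG g) : A0 g x v = em x • v := rfl

noncomputable def ee (x : Fin g × Bool) : NG g := Submodule.Quotient.mk (Pi.single x 1)

def zz : Fin g × Bool → SurfaceGroup g
  | (i, false) => yy i
  | (i, true) => al i

lemma smul_ee (k : Fin g × Bool → KG g) :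
    ∑ x, k x • ee x = (Submodule.Quotient.mk k : NG g) := by
  have : k = ∑ x, k x • (Pi.single x (1 : KG g) : Fin g × Bool → KG g) := by
    funext y
    simp [Finset.sum_apply, Pi.single_apply]
  conv_rhs => rw [this]
  simp only [ee, ← Submodule.mkQ_apply]
  rw [map_sum]
  simp only [map_smul]

lemma exists_dd (g : ℕ) : ∃ d : SurfaceGroup g → NG g, IsCross (A0 g) d ∧ ∀ x, d (zz x) = ee x := by
  let m : Fin g × Bool → NG g := fun x => ee (x.1.rev, x.2)
  have hfox : foxSum ((A0 g).comp (phi g)) ga gb m = 0 := by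
    rw [foxSum_eq]
    have h0 : (Submodule.Quotient.mk (cvec g) : NG g) = 0 := by
      rw [Submodule.Quotient.mk_eq_zero]
      exact Submodule.mem_span_singleton_self _
    rw [← smul_ee, Fintype.sum_prod_type] at h0
    rw [← h0, ← Equiv.sum_comp Fin.revPerm]
    refine Finset.sum_congr rfl fun i _ => ?_
    have e1 : ∀ i : Fin g, phi g (W i.castSucc * ga i) = (ga i.rev)⁻¹ * (W i.rev.castSucc)⁻¹ := by
      intro i; rw [map_mul, phi_W, phi_ga, Fin.rev_castSucc, yy]; group
    simp only [MonoidHom.comp_apply, map_inv, e1, phi_W, phi_al, phi_yy, Fin.rev_castSucc,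
      Fintype.sum_bool, cvec, A0_apply, m, Fin.revPerm_apply, sub_smul, smul_smul, ← em_mul, Fin.rev_rev]
    rw [mul_inv_cancel_left]
    abel
  obtain ⟨u, hu, hum⟩ := exists_cross _ m hfox
  refine ⟨fun x => u (phi g x), fun x y => ?_, ?_⟩
  · beta_reduce
    rw [map_mul, hu, MonoidHom.comp_apply, phi_phi]
  · rintro ⟨i, b⟩
    cases b
    · simp only [zz]
      rw [phi_yy]
      refine (hum (i.rev, false)).trans ?_
      simp [m]
    · simp only [zz]
      rw [phi_al]
      refine (hum (i.rev, true)).trans ?_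
      simp [m]

lemma fd_aux (f : SurfaceGroup g → ℝ)
    (hf : ∀ x : Fin g × Bool, {γ | f (γ * PresentedGroup.of x) - f γ ≠ 0}.Finite) :
    ∃ φ : SurfaceGroup g →₀ ℝ, ∀ (x : Fin g × Bool) γ,
      f (γ * PresentedGroup.of x) - f γ = φ (γ * PresentedGroup.of x) - φ γ := by
  obtain ⟨d, hd, hdz⟩ := exists_dd g
  let m : Fin g × Bool → KG g := fun x => MonoidAlgebra.ofCoeff
    (Finsupp.ofSupportFinite (fun γ => f (γ * PresentedGroup.of x) - f γ) (hf x))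
  have hm : ∀ x γ, (m x).coeff γ = f (γ * PresentedGroup.of x) - f γ := fun x γ => rfl
  have hma : ∀ i γ, (m (i, false)).coeff γ = f (γ * ga i) - f γ := fun x γ => rfl
  have hmb : ∀ i γ, (m (i, true)).coeff γ = f (γ * gb i) - f γ := fun x γ => rfl
  let nn : Fin g × Bool → KG g := fun x => match x with
    | (i, false) => - (m (i, true) * em (W i.succ)⁻¹)
    | (i, true) => m (i, false) * em (W i.castSucc)⁻¹
  let s : KG g →ₗ[ℝ] NG g := 
    (Finsupp.linearCombination ℝ d) ∘ₗ (MonoidAlgebra.coeffLinearEquiv ℝ).toLinearMap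
  have hs1 : ∀ γ (r : ℝ), s (MonoidAlgebra.single γ r) = r • d γ := by
    intro γ r
    change Finsupp.linearCombination ℝ d (Finsupp.single γ r) = _
    simp
  have hs : ∀ (k : KG g) z, s (k * (em z - 1)) = k • d z := by
    intro k z
    induction k using MonoidAlgebra.induction_linear with
    | zero => simp
    | add a b ha hb => rw [add_mul, map_add, ha, hb, add_smul]
    | single γ r =>
      rw [mul_sub, mul_one, em, MonoidAlgebra.single_mul_single, mul_one, map_sub, hs1, hs1, hd,
        smul_add, add_sub_cancel_left, A0_apply, em, ← smul_assoc, MonoidAlgebra.smul_single,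
        smul_eq_mul, mul_one]
  have hsum : ∑ x, nn x * (em (zz x) - 1) = 0 := by
    ext δ
    rw [MonoidAlgebra.coeff_sum, Finset.sum_apply', Fintype.sum_prod_type]
    have ht := fin_telescope (fun i => f (δ * W i))
    rw [W_last, W_zero, sub_self] at ht
    rw [MonoidAlgebra.coeff_zero, Finsupp.zero_apply, ← neg_zero, ← ht, ← Finset.sum_neg_distrib]
    refine Finset.sum_congr rfl fun i _ => ?_
    rw [Fintype.sum_bool]
    simp only [nn, zz]
    rw [mul_sub, mul_sub, mul_one, mul_one, neg_mul, mul_assoc, mul_assoc, ← em_mul, ← em_mul]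
    simp only [MonoidAlgebra.coeff_sub, MonoidAlgebra.coeff_neg, Finsupp.sub_apply,
      Finsupp.neg_apply, em_coeff, hma, hmb]
    have e1 : δ * ((W i.castSucc)⁻¹ * al i)⁻¹ = δ * W i.castSucc * ga i * gb i * (ga i)⁻¹ := by
      rw [al]; group
    have e2 : δ * ((W i.succ)⁻¹ * yy i)⁻¹ = δ * W i.castSucc * ga i := by
      rw [yy]; group
    have e3 : δ * (W i.succ)⁻¹⁻¹ * gb i = δ * W i.castSucc * ga i * gb i * (ga i)⁻¹ := by
      rw [W_succ, commutatorElement_def]; group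
    rw [e1, e2, e3]
    simp only [inv_inv, inv_mul_cancel_right]
    ring
  have h0 := congrArg s hsum
  rw [map_sum, map_zero] at h0
  simp only [hs, hdz] at h0
  rw [smul_ee, Submodule.Quotient.mk_eq_zero, Submodule.mem_span_singleton] at h0
  obtain ⟨φ, hφ⟩ := h0
  refine ⟨φ.coeff, ?_⟩
  rintro ⟨i, b⟩ γ
  cases b
  · have h1 := congrFun hφ (i, true)
    have h2 := congrArg (fun k : KG g => k.coeff (γ * (W i.castSucc)⁻¹)) h1
    simp only [Pi.smul_apply, smul_eq_mul, cvec, nn, mul_sub, MonoidAlgebra.coeff_sub,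
      Finsupp.sub_apply, em_coeff, hma] at h2
    simp only [_root_.mul_inv_rev, inv_inv, mul_assoc, inv_mul_cancel_left, inv_mul_cancel, mul_one] at h2
    exact h2.symm
  · have h1 := congrFun hφ (i, false)
    have h2 := congrArg (fun k : KG g => k.coeff (γ * (W i.succ)⁻¹)) h1
    simp only [Pi.smul_apply, smul_eq_mul, cvec, nn, mul_sub, MonoidAlgebra.coeff_sub,
      MonoidAlgebra.coeff_neg, Finsupp.neg_apply,
      Finsupp.sub_apply, em_coeff, hmb] at h2
    simp only [_root_.mul_inv_rev, inv_inv, mul_assoc, inv_mul_cancel_left, inv_mul_cancel, mul_one] at h2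
    change f (γ * gb i) - f γ = φ.coeff (γ * gb i) - φ.coeff γ
    linarith

lemma const_of_gen {α : Type*} (f : SurfaceGroup g → α)
    (hf : ∀ (x : Fin g × Bool) γ, f (γ * PresentedGroup.of x) = f γ) : ∀ γ, f γ = f 1 := by
  let H : Subgroup (SurfaceGroup g) :=
    { carrier := {x | ∀ γ, f (γ * x) = f γ}
      one_mem' := by intro γ; rw [mul_one]
      mul_mem' := by intro a b ha hb γ; rw [← mul_assoc, hb, ha]
      inv_mem' := by
        intro a ha γ
        have := ha (γ * a⁻¹)
        rw [inv_mul_cancel_right] at this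
        exact this.symm }
  have : H = ⊤ := gen_induction H (fun i => hf _) (fun i => hf _)
  intro x
  have hx : x ∈ H := by rw [this]; trivial
  have := hx 1
  rwa [one_mul] at this

theorem one_ended (A : Set (SurfaceGroup g))
    (hA : ∀ x : Fin g × Bool, {γ | ¬ (γ * PresentedGroup.of x ∈ A ↔ γ ∈ A)}.Finite) :
    A.Finite ∨ Aᶜ.Finite := by
  classical
  let f : SurfaceGroup g → ℝ := fun γ => if γ ∈ A then 1 else 0
  obtain ⟨φ, hφ⟩ := fd_aux f (by
    intro x
    refine (hA x).subset ?_
    intro γ hγ hc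
    apply hγ
    simp [f, hc])
  have hc := const_of_gen (fun γ => f γ - φ γ) (by
    intro x γ
    have := hφ x γ
    linarith)
  by_cases ht : f 1 - φ 1 = 0
  · left
    refine φ.support.finite_toSet.subset ?_
    intro γ hγ
    simp only [Finset.mem_coe, Finsupp.mem_support_iff]
    have := hc γ
    simp only [ht] at this
    simp only [f, hγ, if_true] at this
    intro h
    rw [h] at this
    norm_num at this
  · right
    refine φ.support.finite_toSet.subset ?_
    intro γ hγ
    simp only [Finset.mem_coe, Finsupp.mem_support_iff]
    have := hc γ
    have h2 : γ ∉ A := hγ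
    simp only [f, h2, if_false] at this
    intro h
    rw [h] at this
    apply ht
    simp only [f]
    rw [← this]
    simp

end oneended
end SG


/-! ## Total nonnegativity -/
namespace TP

def TNN {m n : ℕ} (T : Matrix (Fin m) (Fin n) ℝ) : Prop :=
  ∀ (k : ℕ) (r : Fin k → Fin m) (c : Fin k → Fin n), StrictMono r → StrictMono c →
    0 ≤ (T.submatrix r c).det

lemma TNN.sub {m n m' n' : ℕ} {T : Matrix (Fin m) (Fin n) ℝ} (h : TNN T) {r : Fin m' → Fin m}
    {c : Fin n' → Fin n} (hr : StrictMono r) (hc : StrictMono c) : TNN (T.submatrix r c) := by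
  intro k r' c' hr' hc'
  rw [Matrix.submatrix_submatrix]
  exact h k _ _ (hr.comp hr') (hc.comp hc')

lemma TNN.entry {m n : ℕ} {T : Matrix (Fin m) (Fin n) ℝ} (h : TNN T) (i j) : 0 ≤ T i j := by
  have := h 1 (fun _ => i) (fun _ => j) (Subsingleton.strictMono _) (Subsingleton.strictMono _)
  simpa using this

lemma TNN.two {m n : ℕ} {T : Matrix (Fin m) (Fin n) ℝ} (h : TNN T) {i i' : Fin m} {j j' : Fin n}
    (hi : i < i') (hj : j < j') : T i j' * T i' j ≤ T i j * T i' j' := by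
  have := h 2 ![i, i'] ![j, j'] (by
    intro a b hab
    fin_cases a <;> fin_cases b <;> simp_all) (by
    intro a b hab
    fin_cases a <;> fin_cases b <;> simp_all)
  rw [Matrix.det_fin_two] at this
  simp at this
  linarith

lemma TNN.transpose {m n : ℕ} {T : Matrix (Fin m) (Fin n) ℝ} (h : TNN T) : TNN Tᵀ := by
  intro k r c hr hc
  rw [← Matrix.transpose_submatrix, Matrix.det_transpose]
  exact h k c r hc hr

lemma det_rev {k : ℕ} (A : Matrix (Fin k) (Fin k) ℝ) : (A.submatrix Fin.rev Fin.rev).det = A.det :=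
  Matrix.det_submatrix_equiv_self Fin.revPerm A

lemma TNN.rev {m n : ℕ} {T : Matrix (Fin m) (Fin n) ℝ} (h : TNN T) :
    TNN (T.submatrix Fin.rev Fin.rev) := by
  intro k r c hr hc
  rw [Matrix.submatrix_submatrix, ← det_rev, Matrix.submatrix_submatrix]
  refine h k _ _ ?_ ?_
  · intro a b hab
    simp only [Function.comp]
    rw [Fin.rev_lt_rev]
    apply hr
    rwa [Fin.rev_lt_rev]
  · intro a b hab
    simp only [Function.comp]
    rw [Fin.rev_lt_rev]
    apply hc
    rwa [Fin.rev_lt_rev]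

/-- Schur complement of the top-left entry. -/
noncomputable def schur {m n : ℕ} (B : Matrix (Fin (m + 1)) (Fin (n + 1)) ℝ) : Matrix (Fin m) (Fin n) ℝ :=
  Matrix.of fun i j => B i.succ j.succ - B i.succ 0 / B 0 0 * B 0 j.succ

lemma det_schur {n : ℕ} (B : Matrix (Fin (n + 1)) (Fin (n + 1)) ℝ) (h : B 0 0 ≠ 0) :
    B.det = B 0 0 * (schur B).det := by
  let B' : Matrix (Fin (n + 1)) (Fin (n + 1)) ℝ := Matrix.of fun i j =>
    Fin.cases (B 0 j) (fun i' => B i'.succ j - B i'.succ 0 / B 0 0 * B 0 j) i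
  have h1 : B.det = B'.det := by
    refine Matrix.det_eq_of_forall_row_eq_smul_add_const (A := B) (B := B')
      (fun i => Fin.cases 0 (fun i' => B i'.succ 0 / B 0 0) i) 0 rfl ?_
    intro i j
    refine Fin.cases ?_ (fun i' => ?_) i
    · simp [B']
    · simp [B']
  rw [h1, Matrix.det_succ_column_zero, Fin.sum_univ_succ]
  have h2 : ∀ i : Fin n, B' i.succ 0 = 0 := by
    intro i
    simp [B', h]
  simp only [h2]
  simp
  rfl

lemma schur_sub {m n m' n' : ℕ} (B : Matrix (Fin (m + 1)) (Fin (n + 1)) ℝ) (r : Fin m' → Fin m)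
    (c : Fin n' → Fin n) : (schur B).submatrix r c =
    schur (B.submatrix (Fin.cons 0 (Fin.succ ∘ r) : Fin (m' + 1) → Fin (m + 1))
      (Fin.cons 0 (Fin.succ ∘ c) : Fin (n' + 1) → Fin (n + 1))) := by
  ext i j
  simp [schur]

lemma strictMono_cons {k n : ℕ} {r : Fin k → Fin n} (hr : StrictMono r) :
    StrictMono (Fin.cons 0 (Fin.succ ∘ r) : Fin (k + 1) → Fin (n + 1)) := by
  intro a b
  refine Fin.cases ?_ (fun a' => ?_) a
  · refine Fin.cases ?_ (fun b' => ?_) b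
    · simp
    · simp
  · refine Fin.cases ?_ (fun b' => ?_) b
    · simp
    · simp only [Fin.succ_lt_succ_iff, Fin.cons_succ, Function.comp]
      intro h; exact hr h

lemma TNN.schur {m n : ℕ} {B : Matrix (Fin (m + 1)) (Fin (n + 1)) ℝ} (hB : TNN B) (h : B 0 0 ≠ 0) :
    TNN (schur B) := by
  intro k r c hr hc
  have h1 := hB (k + 1) _ _ (strictMono_cons hr) (strictMono_cons hc)
  rw [det_schur _ (by simpa using h), ← schur_sub] at h1
  have h2 : 0 < B 0 0 := lt_of_le_of_ne (hB.entry _ _) h.symm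
  simp only [Matrix.submatrix_apply, Fin.cons_zero] at h1
  exact nonneg_of_mul_nonneg_right h1 h2

lemma TNN.zero_zero {n : ℕ} {B : Matrix (Fin (n + 1)) (Fin (n + 1)) ℝ} (hB : TNN B) (h : B.det ≠ 0) :
    B 0 0 ≠ 0 := by
  intro h0
  by_cases hr : ∀ j, B 0 j = 0
  · exact h (Matrix.det_eq_zero_of_row_eq_zero 0 hr)
  by_cases hc : ∀ i, B i 0 = 0
  · exact h (Matrix.det_eq_zero_of_column_eq_zero 0 hc)
  push Not at hr hc
  obtain ⟨j, hj⟩ := hr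
  obtain ⟨i, hi⟩ := hc
  have hj0 : 0 < j := Fin.pos_of_ne_zero (by rintro rfl; exact hj h0)
  have hi0 : 0 < i := Fin.pos_of_ne_zero (by rintro rfl; exact hi h0)
  have := hB.two hi0 hj0
  rw [h0, zero_mul] at this
  have h1 : 0 < B 0 j := lt_of_le_of_ne (hB.entry _ _) hj.symm
  have h2 : 0 < B i 0 := lt_of_le_of_ne (hB.entry _ _) hi.symm
  have := mul_pos h1 h2
  linarith

lemma TNN.castSucc_det {n : ℕ} {B : Matrix (Fin (n + 1)) (Fin (n + 1)) ℝ} (hB : TNN B)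
    (h : B.det ≠ 0) : (B.submatrix Fin.castSucc Fin.castSucc).det ≠ 0 := by
  induction n with
  | zero => simp
  | succ n ih =>
    have h0 := hB.zero_zero h
    have hS := hB.schur h0
    have hd : (TP.schur B).det ≠ 0 := by
      intro hd
      rw [det_schur _ h0, hd, mul_zero] at h
      exact h rfl
    have := ih hS hd
    rw [det_schur _ (by simpa using h0)]
    refine mul_ne_zero (by simpa using h0) ?_
    rw [schur_sub] at this
    convert this using 4
    · funext i; refine Fin.cases ?_ (fun i => ?_) i <;> simp
    · funext i; refine Fin.cases ?_ (fun i => ?_) i <;> simp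

lemma TNN.succ_det {n : ℕ} {B : Matrix (Fin (n + 1)) (Fin (n + 1)) ℝ} (hB : TNN B)
    (h : B.det ≠ 0) : (B.submatrix Fin.succ Fin.succ).det ≠ 0 := by
  have := hB.rev.castSucc_det (by rwa [det_rev])
  rw [← det_rev] at this
  convert this using 2
  ext i j
  simp [Fin.rev_castSucc]

def sh {n : ℕ} (k d : ℕ) (h : k + d ≤ n) : Fin k → Fin n := fun t => ⟨t + d, by omega⟩

lemma sh_strictMono {n k d : ℕ} (h : k + d ≤ n) : StrictMono (sh k d h) := by
  intro a b hab
  simp only [sh, Fin.mk_lt_mk]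
  have : a.1 < b.1 := hab
  omega

lemma TNN.contig {n : ℕ} {B : Matrix (Fin n) (Fin n) ℝ} (hB : TNN B) (h : B.det ≠ 0) (k i : ℕ)
    (hk : k + i ≤ n) : (B.submatrix (sh k i hk) (sh k i hk)).det ≠ 0 := by
  induction n generalizing i with
  | zero =>
    obtain rfl : k = 0 := by omega
    simp
  | succ n ih =>
    by_cases hi : i = 0
    · subst hi
      by_cases hkn : k = n + 1
      · subst hkn
        convert h using 2
        ext a b; rfl
      · have := ih (hB.sub (Fin.strictMono_castSucc) (Fin.strictMono_castSucc)) (hB.castSucc_det h) 0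
          (by omega)
        convert this using 2
        ext a b; rfl
    · have := ih (hB.sub (Fin.strictMono_succ) (Fin.strictMono_succ)) (hB.succ_det h) (i - 1)
          (by omega)
      convert this using 2
      ext a b
      simp only [Matrix.submatrix_apply]
      congr 1 <;> (ext; simp [sh]; omega)

/-- Plucker relation for determinants with two varying columns. -/
lemma plucker {k : ℕ} (B : Matrix (Fin k) (Fin k) ℝ) (p q : Fin k) (hpq : p ≠ q) (a b c e : Fin k → ℝ) :
    let F : (Fin k → ℝ) → (Fin k → ℝ) → ℝ := fun x y => ((B.updateCol p x).updateCol q y).det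
    F a b * F c e = F c b * F a e + F a c * F b e := by
  intro F
  by_cases hF : ∀ x y, F x y = 0
  · simp [hF]
  push Not at hF
  obtain ⟨x0, y0, h0⟩ := hF
  set B0 := (B.updateCol p x0).updateCol q y0 with hB0
  have hsol : ∀ v, ∃ w, B0 *ᵥ w = v := fun v => by
    refine ⟨B0⁻¹ *ᵥ v, ?_⟩
    rw [Matrix.mulVec_mulVec, Matrix.mul_nonsing_inv _ (isUnit_iff_ne_zero.2 h0), Matrix.one_mulVec]
  have key : ∀ w w', F (B0 *ᵥ w) (B0 *ᵥ w') = B0.det * (w p * w' q - w q * w' p) := by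
    intro w w'
    have e1 : (B.updateCol p (B0 *ᵥ w)).updateCol q (B0 *ᵥ w') =
        B0 * ((1 : Matrix (Fin k) (Fin k) ℝ).updateCol p w).updateCol q w' := by
      rw [Matrix.mul_updateCol, Matrix.mul_updateCol, mul_one]
      ext i j
      by_cases hq : j = q
      · subst hq; simp
      · by_cases hp : j = p
        · subst hp; simp [hq]
        · simp [hq, hp, hB0]
    have e2 : (((1 : Matrix (Fin k) (Fin k) ℝ).updateCol p w).updateCol q w').det =
        w p * w' q - w q * w' p := by
      have e3 : ((1 : Matrix (Fin k) (Fin k) ℝ).updateCol p w).updateCol q w' = 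
        1 + Matrix.of (fun i (j : Fin 2) => if j = 0 then w i - (if i = p then 1 else 0)
              else w' i - (if i = q then 1 else 0))
          * Matrix.of (fun (j : Fin 2) i => if j = 0 then (if i = p then (1 : ℝ) else 0)
              else (if i = q then (1 : ℝ) else 0)) := by
        ext i j
        simp only [Matrix.add_apply, Matrix.mul_apply, Fin.sum_univ_two, Matrix.of_apply]
        by_cases hq : j = q
        · subst hq
          simp [hpq.symm, Matrix.one_apply]
        · by_cases hp : j = p
          · subst hp
            simp [hpq, hq, Matrix.one_apply]
          · simp [hp, hq]
      rw [e3, Matrix.det_one_add_mul_comm, Matrix.det_fin_two]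
      simp [Matrix.mul_apply, Matrix.one_apply, hpq, hpq.symm, mul_sub, sub_mul]
      ring
    change Matrix.det _ = _
    rw [e1, Matrix.det_mul, e2]
  obtain ⟨a, rfl⟩ := hsol a
  obtain ⟨b, rfl⟩ := hsol b
  obtain ⟨c, rfl⟩ := hsol c
  obtain ⟨e, rfl⟩ := hsol e
  simp only [key]
  ring


lemma exists_gap {k n : ℕ} (J : Fin k → Fin n) (hJ : StrictMono J)
    (h : ¬ ∃ (d : ℕ) (hd : k + d ≤ n), J = sh k d hd) :
    ∃ p q : Fin k, q.1 = p.1 + 1 ∧ (J p).1 + 1 < (J q).1 := by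
  by_contra hcon
  push Not at hcon
  apply h
  rcases Nat.eq_zero_or_pos k with rfl | hk
  · exact ⟨0, by omega, by ext x; exact x.elim0⟩
  have key : ∀ t (ht : t < k), (J ⟨t, ht⟩).1 = t + (J ⟨0, hk⟩).1 := by
    intro t
    induction t with
    | zero => intro ht; simp
    | succ t ih =>
      intro ht
      have h1 := ih (by omega)
      have h2 := hcon ⟨t, by omega⟩ ⟨t + 1, ht⟩ rfl
      have h3 : J ⟨t, by omega⟩ < J ⟨t + 1, ht⟩ := hJ (by simp)
      have h4 : (J ⟨t, by omega⟩).1 < (J ⟨t + 1, ht⟩).1 := h3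
      omega
  refine ⟨(J ⟨0, hk⟩).1, ?_, ?_⟩
  · have := key (k - 1) (by omega)
    have := (J ⟨k - 1, by omega⟩).2
    omega
  · ext x
    simp only [sh]
    exact key x.1 x.2

def PosMinors {n : ℕ} (T : Matrix (Fin n) (Fin n) ℝ) (k : ℕ) : Prop :=
  ∀ (r c : Fin k → Fin n), StrictMono r → StrictMono c → (∀ t, r t ≤ c t) →
    0 < (T.submatrix r c).det

lemma det_updateCol_single {k : ℕ} (B : Matrix (Fin (k + 1)) (Fin (k + 1)) ℝ) (q : Fin (k + 1)) :
    (B.updateCol q (Pi.single q 1)).det = (B.submatrix q.succAbove q.succAbove).det := by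
  rw [Matrix.det_succ_column _ q, Finset.sum_eq_single q]
  · simp only [Matrix.updateCol_self, Pi.single_eq_same, mul_one]
    rw [Even.neg_one_pow (by simp), one_mul]
    congr 1
    ext i j
    simp [Matrix.updateCol_ne]
  · intro b _ hb
    simp [hb]
  · simp

lemma strictMono_update {k n : ℕ} {J : Fin k → Fin n} (hJ : StrictMono J) {p : Fin k} {c : Fin n}
    (h1 : ∀ x < p, J x < c) (h2 : ∀ x, p < x → c < J x) : StrictMono (Function.update J p c) := by
  intro x y hxy
  by_cases hx : x = p
  · subst hx
    simp [hxy.ne', h2 _ hxy]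
  · by_cases hy : y = p
    · subst hy
      simp [hx, h1 _ hxy]
    · simp [hx, hy, hJ hxy]

lemma colmove {n k : ℕ} {T : Matrix (Fin n) (Fin n) ℝ} (hT : TNN T) (hprev : PosMinors T k)
    (I : Fin (k + 1) → Fin n) (hI : StrictMono I)
    (hstep1 : ∀ (d : ℕ) (hd : k + 1 + d ≤ n), (∀ t, I t ≤ sh (k + 1) d hd t) →
      0 < (T.submatrix I (sh (k + 1) d hd)).det) :
    ∀ (N : ℕ) (J : Fin (k + 1) → Fin n), StrictMono J → (∀ t, I t ≤ J t) →
      ∑ t, (n - (J t).1) ≤ N → 0 < (T.submatrix I J).det := by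
  intro N
  induction N with
  | zero =>
    intro J hJ hIJ hN
    have h1 := Finset.sum_eq_zero_iff.1 (Nat.le_zero.1 hN) 0 (Finset.mem_univ _)
    have := (J 0).2
    omega
  | succ N ih =>
    intro J hJ hIJ hN
    by_cases hh : ∃ (d : ℕ) (hd : k + 1 + d ≤ n), J = sh (k + 1) d hd
    · obtain ⟨d, hd, rfl⟩ := hh
      exact hstep1 d hd hIJ
    obtain ⟨p, q, hpq, hgap⟩ := exists_gap J hJ hh
    have hne : p ≠ q := by rintro rfl; omega
    have hlt : p < q := by rw [Fin.lt_def]; omega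
    let c : Fin n := ⟨(J p).1 + 1, by have := (J q).2; omega⟩
    have hJc : J p < c := by rw [Fin.lt_def]; simp [c]
    have hcJ : c < J q := by rw [Fin.lt_def]; simpa [c] using hgap
    have hJle : ∀ x, p < x → J q ≤ J x := by
      intro x hx
      apply hJ.monotone
      rw [Fin.le_def]; rw [Fin.lt_def] at hx; omega
    have hJle' : ∀ x, x < q → J x ≤ J p := by
      intro x hx
      apply hJ.monotone
      rw [Fin.le_def]; rw [Fin.lt_def] at hx; omega
    have m1 : StrictMono (Function.update J p c) := strictMono_update hJ
      (fun x hx => (hJ hx).trans hJc) (fun x hx => hcJ.trans_le (hJle x hx))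
    have m2 : StrictMono (Function.update J q c) := strictMono_update hJ
      (fun x hx => (hJle' x hx).trans_lt hJc) (fun x hx => hcJ.trans (hJ hx))
    have m3 : StrictMono (Function.update J p (J q) ∘ q.succAbove) := by
      intro x y hxy
      have h1 : q.succAbove x < q.succAbove y := Fin.strictMono_succAbove q hxy
      have h2 := Fin.succAbove_ne q x
      have h3 := Fin.succAbove_ne q y
      simp only [Function.comp]
      generalize q.succAbove x = x' at *
      generalize q.succAbove y = y' at *
      by_cases hx : x' = p
      · subst hx
        have : q < y' := by
          rw [Fin.lt_def] at *
          have : y'.1 ≠ q.1 := fun h => h3 (Fin.ext h)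
          omega
        simp [h1.ne', hJ this]
      · by_cases hy : y' = p
        · subst hy
          simp [hx, hJ (h1.trans hlt)]
        · simp [hx, hy, hJ h1]
    have hP := plucker (T.submatrix I J) p q hne (fun i => T (I i) (J p)) (fun i => T (I i) (J q))
      (fun i => T (I i) c) (Pi.single q 1)
    simp only at hP
    rw [det_updateCol_single, det_updateCol_single, det_updateCol_single] at hP
    have f1 : ((T.submatrix I J).updateCol p (fun i => T (I i) (J p))).updateCol q
        (fun i => T (I i) (J q)) = T.submatrix I J := by
      ext i j
      by_cases hq : j = q
      · subst hq; simp
      · by_cases hp : j = p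
        · subst hp; simp [hq]
        · simp [hq, hp]
    have f2 : ((T.submatrix I J).updateCol p (fun i => T (I i) c)).updateCol q
        (fun i => T (I i) (J q)) = T.submatrix I (Function.update J p c) := by
      ext i j
      by_cases hq : j = q
      · subst hq; simp [hne.symm]
      · by_cases hp : j = p
        · subst hp; simp [hq]
        · simp [hq, hp]
    have f3 : ((T.submatrix I J).updateCol p (fun i => T (I i) (J p))).updateCol q
        (fun i => T (I i) c) = T.submatrix I (Function.update J q c) := by
      ext i j
      by_cases hq : j = q
      · subst hq; simp
      · by_cases hp : j = p
        · subst hp; simp [hq]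
        · simp [hq, hp]
    have f4 : ∀ x : Fin n, ((T.submatrix I J).updateCol p (fun i => T (I i) x)) =
        T.submatrix I (Function.update J p x) := by
      intro x
      ext i j
      by_cases hp : j = p
      · subst hp; simp
      · simp [hp]
    rw [f1, f2, f3, f4, f4, f4, Function.update_eq_self] at hP
    simp only [Matrix.submatrix_submatrix] at hP
    have hs := Fin.strictMono_succAbove q
    have g1 : 0 < (T.submatrix I (Function.update J p c)).det := by
      apply ih _ m1
      · intro t
        by_cases ht : t = p
        · subst ht; simp [(hIJ t).trans hJc.le]
        · simp [ht, hIJ t]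
      · have : ∑ t, (n - (Function.update J p c t).1) < ∑ t, (n - (J t).1) := by
          apply Finset.sum_lt_sum
          · intro t _
            by_cases ht : t = p
            · subst ht; simp [c]; omega
            · simp [ht]
          · refine ⟨p, Finset.mem_univ _, ?_⟩
            have := (J q).2
            simp [c]; omega
        omega
    have g2 : 0 < (T.submatrix (I ∘ q.succAbove) (J ∘ q.succAbove)).det :=
      hprev _ _ (hI.comp hs) (hJ.comp hs) (fun t => hIJ _)
    have g3 := hT _ _ _ hI m2
    have g4 := hT _ _ _ (hI.comp hs) m3
    have g5 := hT _ _ _ hI hJ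
    refine lt_of_le_of_ne g5 ?_
    intro h0
    rw [← h0, zero_mul] at hP
    have := mul_pos g1 g2
    have := mul_nonneg g3 g4
    linarith

/-- anti-transpose -/
def tau {n : ℕ} (T : Matrix (Fin n) (Fin n) ℝ) : Matrix (Fin n) (Fin n) ℝ :=
  Tᵀ.submatrix Fin.rev Fin.rev

lemma strictMono_rev {k n : ℕ} {r : Fin k → Fin n} (hr : StrictMono r) :
    StrictMono (Fin.rev ∘ r ∘ Fin.rev) := by
  intro a b hab
  simp only [Function.comp]
  rw [Fin.rev_lt_rev]
  apply hr
  rwa [Fin.rev_lt_rev]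

lemma tau_minor {k n : ℕ} (T : Matrix (Fin n) (Fin n) ℝ) (r c : Fin k → Fin n) :
    ((tau T).submatrix (Fin.rev ∘ c ∘ Fin.rev) (Fin.rev ∘ r ∘ Fin.rev)).det =
      (T.submatrix r c).det := by
  rw [← Matrix.det_transpose (T.submatrix r c), ← det_rev (T.submatrix r c)ᵀ]
  congr 1
  ext i j
  simp [tau]

lemma TNN.tau {n : ℕ} {T : Matrix (Fin n) (Fin n) ℝ} (h : TNN T) : TNN (tau T) :=
  TNN.rev h.transpose

lemma PosMinors.tau {n k : ℕ} {T : Matrix (Fin n) (Fin n) ℝ} (h : PosMinors T k) :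
    PosMinors (tau T) k := by
  intro r c hr hc hrc
  have := h (Fin.rev ∘ c ∘ Fin.rev) (Fin.rev ∘ r ∘ Fin.rev) (strictMono_rev hc) (strictMono_rev hr)
    (fun t => by simp only [Function.comp, Fin.rev_le_rev]; exact hrc _)
  rw [← tau_minor] at this
  convert this using 3 <;> (funext i; simp)

/-- Upper triangular TNN with nonzero corner minors: all admissible minors positive. -/
theorem posMinors {n : ℕ} {T : Matrix (Fin n) (Fin n) ℝ} (hT : TNN T)
    (hc : ∀ (k d : ℕ) (h : k + d = n),
      (T.submatrix (sh k 0 (by omega)) (sh k d h.le)).det ≠ 0) (k : ℕ) : PosMinors T k := by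
  induction k with
  | zero => intro r c _ _ _; simp
  | succ k ih =>
    have base : ∀ (i j : ℕ) (hi : k + 1 + i ≤ n) (hj : k + 1 + j ≤ n), i ≤ j →
        0 < (T.submatrix (sh (k + 1) i hi) (sh (k + 1) j hj)).det := by
      intro i j hi hj hij
      refine lt_of_le_of_ne (hT _ _ _ (sh_strictMono _) (sh_strictMono _)) ?_
      have h1 := hc (n - (j - i)) (j - i) (by omega)
      have h2 := TNN.contig (hT.sub (sh_strictMono (by omega)) (sh_strictMono (by omega))) h1 (k + 1) i
        (by omega)
      symm
      convert h2 using 2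
      ext a b
      simp only [Matrix.submatrix_apply]
      congr 1 <;> (ext; simp [sh]; try omega)
    have step1 : ∀ (I : Fin (k + 1) → Fin n), StrictMono I → ∀ (j : ℕ) (hj : k + 1 + j ≤ n),
        (∀ t, I t ≤ sh (k + 1) j hj t) → 0 < (T.submatrix I (sh (k + 1) j hj)).det := by
      intro I hI j hj hIj
      rw [← tau_minor]
      refine colmove hT.tau ih.tau _ (strictMono_rev (sh_strictMono _)) ?_ _ _ (strictMono_rev hI) ?_ le_rfl
      · intro d hd hle
        have e1 : (sh (k + 1) d hd : Fin (k + 1) → Fin n) = Fin.rev ∘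
            (sh (k + 1) (n - (k + 1 + d)) (by omega)) ∘ Fin.rev := by
          funext t; ext; simp [sh, Fin.val_rev]; omega
        rw [e1, tau_minor]
        apply base
        have := hle 0
        rw [Fin.le_def] at this
        simp [sh, Fin.val_rev] at this
        omega
      · intro t
        simp only [Function.comp, Fin.rev_le_rev]
        exact hIj _
    intro I J hI hJ hIJ
    exact colmove hT ih I hI (step1 I hI) _ J hJ hIJ le_rfl

end TP


/-! ## Triangular matrices, antidiagonal matrices -/
namespace TP

abbrev Mat (n : ℕ) := Matrix (Fin n) (Fin n) ℝ

def Up {n : ℕ} (A : Mat n) : Prop := ∀ i j, j < i → A i j = 0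

lemma Up.bt {n : ℕ} {A : Mat n} (h : Up A) : A.BlockTriangular id := fun i j hij => h i j hij

lemma Up.mul {n : ℕ} {A B : Mat n} (hA : Up A) (hB : Up B) : Up (A * B) :=
  fun i j hij => (hA.bt.mul hB.bt) hij

lemma Up.smul {n : ℕ} {A : Mat n} (hA : Up A) (c : ℝ) : Up (c • A) :=
  fun i j hij => by simp [hA i j hij]

lemma Up.det {n : ℕ} {A : Mat n} (hA : Up A) : A.det = ∏ i, A i i :=
  Matrix.det_of_upperTriangular hA.bt

lemma up_diagonal {n : ℕ} (d : Fin n → ℝ) : Up (diagonal d) := fun i j hij => by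
  rw [diagonal_apply_ne _ hij.ne']

lemma up_one {n : ℕ} : Up (1 : Mat n) := fun i j hij => Matrix.one_apply_ne hij.ne'

lemma Up.inv {n : ℕ} {A : Mat n} (hA : Up A) (h : A.det ≠ 0) : Up A⁻¹ := by
  have : Invertible A := A.invertibleOfIsUnitDet (isUnit_iff_ne_zero.2 h)
  exact fun i j hij => (Matrix.blockTriangular_inv_of_blockTriangular hA.bt) hij

lemma Up.diag_ne {n : ℕ} {A : Mat n} (hA : Up A) (h : A.det ≠ 0) (i) : A i i ≠ 0 := by
  rw [hA.det, Finset.prod_ne_zero_iff] at h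
  exact h i (Finset.mem_univ _)

lemma minv {n : ℕ} {A : Mat n} (h : A.det ≠ 0) : A * A⁻¹ = 1 :=
  Matrix.mul_nonsing_inv _ (isUnit_iff_ne_zero.2 h)

lemma invm {n : ℕ} {A : Mat n} (h : A.det ≠ 0) : A⁻¹ * A = 1 :=
  Matrix.nonsing_inv_mul _ (isUnit_iff_ne_zero.2 h)

lemma minvl {n : ℕ} {A : Mat n} (h : A.det ≠ 0) (B : Mat n) : A * (A⁻¹ * B) = B := by
  rw [← Matrix.mul_assoc, minv h, Matrix.one_mul]

lemma invml {n : ℕ} {A : Mat n} (h : A.det ≠ 0) (B : Mat n) : A⁻¹ * (A * B) = B := by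
  rw [← Matrix.mul_assoc, invm h, Matrix.one_mul]

lemma det_inv_ne {n : ℕ} {A : Mat n} (h : A.det ≠ 0) : A⁻¹.det ≠ 0 := by
  rw [Matrix.det_nonsing_inv, Ring.inverse_eq_inv']
  exact inv_ne_zero h

lemma det_mul_ne {n : ℕ} {A B : Mat n} (h : A.det ≠ 0) (h' : B.det ≠ 0) : (A * B).det ≠ 0 := by
  rw [Matrix.det_mul]; exact (mul_ne_zero h h')

structure Anti {n : ℕ} (J : Mat n) : Prop where
  z : ∀ r c, r ≠ Fin.rev c → J r c = 0
  ne : ∀ c, J (Fin.rev c) c ≠ 0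
  alt : ∀ c c' : Fin n, c'.1 = c.1 + 1 → J (Fin.rev c) c * J (Fin.rev c') c' < 0

lemma Anti.mul_apply {n : ℕ} {J : Mat n} (hJ : Anti J) (A : Mat n) (i j) :
    (A * J) i j = A i (Fin.rev j) * J (Fin.rev j) j := by
  rw [Matrix.mul_apply, Finset.sum_eq_single (Fin.rev j)]
  · intro b _ hb; rw [hJ.z _ _ hb, mul_zero]
  · simp

lemma Anti.apply_mul {n : ℕ} {J : Mat n} (hJ : Anti J) (A : Mat n) (i j) :
    (J * A) i j = J i (Fin.rev i) * A (Fin.rev i) j := by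
  rw [Matrix.mul_apply, Finset.sum_eq_single (Fin.rev i)]
  · intro b _ hb
    rw [hJ.z _ _ (fun h => hb (by rw [h, Fin.rev_rev])), zero_mul]
  · simp

lemma Anti.ne' {n : ℕ} {J : Mat n} (hJ : Anti J) (i) : J i (Fin.rev i) ≠ 0 := by
  have := hJ.ne (Fin.rev i); rwa [Fin.rev_rev] at this

lemma Anti.det_ne {n : ℕ} {J : Mat n} (hJ : Anti J) : J.det ≠ 0 := by
  let K : Mat n := Matrix.of fun i j => if i = Fin.rev j then (J j i)⁻¹ else 0
  have : J * K = 1 := by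
    ext i j
    rw [hJ.apply_mul]
    by_cases h : i = j
    · subst h; simp [K, hJ.ne' i]
    · simp [K, h, Matrix.one_apply]
  intro h0
  have h1 := congrArg Matrix.det this
  rw [Matrix.det_mul, h0, zero_mul, Matrix.det_one] at h1
  exact zero_ne_one h1

/-- `J⁻¹ A J` entries -/
lemma Anti.conj_apply {n : ℕ} {J : Mat n} (hJ : Anti J) {A U : Mat n} (h : A * J = J * U) (i j) :
    U i j = A (Fin.rev i) (Fin.rev j) * J (Fin.rev j) j / J (Fin.rev i) i := by
  have := congrFun (congrFun h (Fin.rev i)) j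
  rw [hJ.mul_apply, hJ.apply_mul, Fin.rev_rev] at this
  rw [this, mul_div_cancel_left₀ _ (hJ.ne i)]

lemma Anti.lower {n : ℕ} {J : Mat n} (hJ : Anti J) {A U : Mat n} (h : A * J = J * U) (hU : Up U) :
    Up Aᵀ := by
  intro i j hij
  have h1 := hJ.conj_apply h (Fin.rev j) (Fin.rev i)
  rw [hU _ _ (by rwa [Fin.rev_lt_rev])] at h1
  simp only [Fin.rev_rev] at h1
  rw [eq_comm, div_eq_zero_iff, mul_eq_zero] at h1
  rcases h1 with (h1 | h1) | h1
  · exact h1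
  · exact absurd h1 (hJ.ne' i)
  · exact absurd h1 (hJ.ne' j)

def Jp {n : ℕ} (J : Mat n) (e : Bool) : Mat n := if e then J else 1

lemma Anti.Jp_det {n : ℕ} {J : Mat n} (hJ : Anti J) (e : Bool) : (Jp J e).det ≠ 0 := by
  cases e
  · simp [Jp]
  · simpa [Jp] using hJ.det_ne

lemma Anti.diag_Jp {n : ℕ} {J : Mat n} (hJ : Anti J) (d : Fin n → ℝ) (e : Bool) :
    ∃ d', diagonal d * Jp J e = Jp J e * diagonal d' := by
  cases e
  · exact ⟨d, by simp [Jp]⟩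
  · refine ⟨d ∘ Fin.rev, ?_⟩
    simp only [Jp, if_true]
    ext i j
    rw [hJ.apply_mul, Matrix.diagonal_mul, Matrix.diagonal_apply]
    by_cases h : Fin.rev i = j
    · subst h; simp [mul_comm]
    · rw [if_neg h, hJ.z i j (fun h' => h (by rw [h', Fin.rev_rev]))]; simp

/-- block multiplication of minors -/
lemma det_sub_mul {n k : ℕ} (A B : Mat n) (r c s : Fin k → Fin n) (hs : Function.Injective s)
    (h : ∀ i j l, l ∉ Set.range s → A (r i) l * B l (c j) = 0) :
    ((A * B).submatrix r c).det = (A.submatrix r s).det * (B.submatrix s c).det := by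
  rw [← Matrix.det_mul]
  congr 1
  ext i j
  simp only [Matrix.submatrix_apply, Matrix.mul_apply]
  rw [← Finset.sum_subset (Finset.subset_univ (Finset.univ.image s))]
  · rw [Finset.sum_image (fun a _ b _ h => hs h)]
  · intro l _ hl
    apply h
    simpa using hl

lemma sh_range {n k d : ℕ} (h : k + d ≤ n) (l : Fin n) : l ∈ Set.range (sh k d h) ↔ d ≤ l.1 ∧ l.1 < k + d := by
  constructor
  · rintro ⟨x, rfl⟩
    simp [sh]
  · rintro ⟨h1, h2⟩
    exact ⟨⟨l.1 - d, by omega⟩, by ext; simp [sh]; omega⟩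

lemma sh_inj {n k d : ℕ} (h : k + d ≤ n) : Function.Injective (sh k d h) :=
  (sh_strictMono h).injective

lemma Up.sub {n : ℕ} {A : Mat n} (hA : Up A) {k : ℕ} {r : Fin k → Fin n} (hr : StrictMono r) :
    Up (A.submatrix r r) := fun _ _ hij => hA _ _ (hr hij)

lemma Up.sub_det {n : ℕ} {A : Mat n} (hA : Up A) (h : A.det ≠ 0) {k : ℕ} {r : Fin k → Fin n}
    (hr : StrictMono r) : (A.submatrix r r).det ≠ 0 := by
  rw [(hA.sub hr).det]
  exact Finset.prod_ne_zero_iff.2 fun i _ => hA.diag_ne h _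

structure GoodPair {n : ℕ} (J TL TR : Mat n) : Prop where
  tl : TNN TL
  tr : TNN TR
  dl : TL.det ≠ 0
  dr : TR.det ≠ 0
  ul : Up TL
  ur : Up TRᵀ
  ub : Up (TR⁻¹ * TL * J)

lemma GoodPair.posL {n : ℕ} {J TL TR : Mat n} (hJ : Anti J) (h : GoodPair J TL TR) (k : ℕ) :
    PosMinors TL k := by
  refine posMinors h.tl ?_ k
  intro k d hk
  have h0 : TR * (TR⁻¹ * TL * J) = TL * J := by
    rw [Matrix.mul_assoc TR⁻¹, minvl h.dr]
  have hB : (TR⁻¹ * TL * J).det ≠ 0 := det_mul_ne (det_mul_ne (det_inv_ne h.dr) h.dl) hJ.det_ne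
  have h1 := det_sub_mul TL J (sh k 0 (by omega)) (sh k 0 (by omega)) (sh k d (by omega)) (sh_inj _) (by
    intro i j l hl
    rw [hJ.z, mul_zero]
    rintro rfl
    apply hl
    rw [sh_range]
    have := j.2
    simp [sh, Fin.val_rev]
    omega)
  have h2 := det_sub_mul TR (TR⁻¹ * TL * J) (sh k 0 (by omega)) (sh k 0 (by omega))
      (sh k 0 (by omega)) (sh_inj _) (by
    intro i j l hl
    rw [sh_range] at hl
    rw [h.ub l _ (by rw [Fin.lt_def]; simp [sh] at hl ⊢; omega), mul_zero])
  rw [h0, h1] at h2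
  have h3 : (TR.submatrix (sh k 0 (by omega)) (sh k 0 (by omega))).det ≠ 0 := by
    have := h.ur.sub_det (by rw [Matrix.det_transpose]; exact h.dr) (sh_strictMono (n := n) (k := k) (d := 0) (by omega))
    rwa [← Matrix.transpose_submatrix, Matrix.det_transpose] at this
  have h4 := h.ub.sub_det hB (sh_strictMono (n := n) (k := k) (d := 0) (by omega))
  exact left_ne_zero_of_mul (h2 ▸ mul_ne_zero h3 h4)

lemma GoodPair.posR {n : ℕ} {J TL TR : Mat n} (hJ : Anti J) (h : GoodPair J TL TR) (k : ℕ) :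
    PosMinors TRᵀ k := by
  refine posMinors h.tr.transpose ?_ k
  intro k d hk
  have h0 : TR * (TR⁻¹ * TL * J) = TL * J := by
    rw [Matrix.mul_assoc TR⁻¹, minvl h.dr]
  have h2 := det_sub_mul TR (TR⁻¹ * TL * J) (sh k d (by omega)) (sh k 0 (by omega))
      (sh k 0 (by omega)) (sh_inj _) (by
    intro i j l hl
    rw [sh_range] at hl
    rw [h.ub l _ (by rw [Fin.lt_def]; simp [sh] at hl ⊢; omega), mul_zero])
  have h1 := det_sub_mul TL J (sh k d (by omega)) (sh k 0 (by omega)) (sh k d (by omega)) (sh_inj _) (by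
    intro i j l hl
    rw [hJ.z, mul_zero]
    rintro rfl
    apply hl
    rw [sh_range]
    have := j.2
    simp [sh, Fin.val_rev]
    omega)
  rw [h0, h1] at h2
  have h3 := h.ul.sub_det h.dl (sh_strictMono (n := n) (k := k) (d := d) (by omega))
  have h4 : (J.submatrix (sh k d (by omega)) (sh k 0 (by omega))).det ≠ 0 := by
    have hd : (1 : Mat n).det ≠ 0 := by simp
    have h5 := det_sub_mul J J⁻¹ (sh k d (by omega)) (sh k d (by omega)) (sh k 0 (by omega)) (sh_inj _) (by
      intro i j l hl
      rw [hJ.z, zero_mul]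
      intro h'
      apply hl
      rw [sh_range]
      have := i.2
      have h6 := congrArg Fin.val h'
      simp [sh, Fin.val_rev] at h6 ⊢
      omega)
    rw [minv hJ.det_ne] at h5
    have h6 := up_one.sub_det hd (sh_strictMono (n := n) (k := k) (d := d) (by omega))
    rw [h5] at h6
    exact left_ne_zero_of_mul h6
  have h7 := mul_ne_zero h3 h4
  rw [h2] at h7
  rw [← Matrix.transpose_submatrix, Matrix.det_transpose]
  exact left_ne_zero_of_mul h7

/-- nonadmissible minors vanish -/
lemma Up.minor_zero {n k : ℕ} {A : Mat n} (hA : Up A) {r c : Fin k → Fin n} (hr : StrictMono r)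
    (hc : StrictMono c) {t : Fin k} (ht : c t < r t) : (A.submatrix r c).det = 0 := by
  rw [Matrix.det_apply]
  apply Finset.sum_eq_zero
  intro σ _
  have : ∃ j, j ≤ t ∧ t ≤ σ j := by
    by_contra hcon
    push Not at hcon
    have h1 : (Finset.Iic t).image σ ⊆ Finset.Iio t := by
      intro x hx
      simp only [Finset.mem_image, Finset.mem_Iic] at hx
      obtain ⟨j, hj, rfl⟩ := hx
      simpa using hcon j hj
    have h2 := Finset.card_le_card h1
    rw [Finset.card_image_of_injective _ σ.injective] at h2
    simp at h2
  obtain ⟨j, hj, hj'⟩ := this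
  rw [Finset.prod_eq_zero (Finset.mem_univ j), smul_zero]
  apply hA
  calc c j ≤ c t := hc.monotone hj
    _ < r t := ht
    _ ≤ r (σ j) := (hr.monotone hj')

lemma eventually_TNN {n : ℕ} {ι : Type*} {l : Filter ι} {T : ι → Mat n} {T0 : Mat n}
    (hT : Filter.Tendsto T l (nhds T0)) (hup : ∀ᶠ x in l, Up (T x)) (hpos : ∀ k, PosMinors T0 k) :
    ∀ᶠ x in l, TNN (T x) := by
  have key : ∀ᶠ x in l, ∀ (k : Fin (n + 1)) (r c : Fin k → Fin n), StrictMono r → StrictMono c →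
      (∀ t, r t ≤ c t) → 0 < ((T x).submatrix r c).det := by
    rw [Filter.eventually_all]; intro k
    rw [Filter.eventually_all]; intro r
    rw [Filter.eventually_all]; intro c
    by_cases h : StrictMono r ∧ StrictMono c ∧ (∀ t, r t ≤ c t)
    · have h1 : Filter.Tendsto (fun x => ((T x).submatrix r c).det) l
          (nhds ((T0.submatrix r c).det)) := by
        have : Continuous fun A : Mat n => (A.submatrix r c).det := by fun_prop
        exact (this.tendsto T0).comp hT
      filter_upwards [h1.eventually (lt_mem_nhds (hpos k r c h.1 h.2.1 h.2.2))] with x hx _ _ _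
      exact hx
    · refine Filter.Eventually.of_forall fun x h1 h2 h3 => ?_
      exact absurd ⟨h1, h2, h3⟩ h
  filter_upwards [key, hup] with x hx hu k r c hr hc
  have hk : k < n + 1 := by
    have := Fintype.card_le_of_injective r hr.injective
    simp at this
    omega
  by_cases h : ∀ t, r t ≤ c t
  · exact (hx ⟨k, hk⟩ r c hr hc h).le
  · push Not at h
    obtain ⟨t, ht⟩ := h
    rw [hu.minor_zero hr hc ht]

lemma isClosed_TNN {n : ℕ} : IsClosed {A : Mat n | TNN A} := by
  have : {A : Mat n | TNN A} = ⋂ (k : ℕ), ⋂ (r : Fin k → Fin n), ⋂ (c : Fin k → Fin n),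
      ⋂ (_ : StrictMono r), ⋂ (_ : StrictMono c), {A | 0 ≤ (A.submatrix r c).det} := by
    ext A; simp [TNN]
  rw [this]
  refine isClosed_iInter fun k => isClosed_iInter fun r => isClosed_iInter fun c =>
    isClosed_iInter fun _ => isClosed_iInter fun _ => ?_
  exact isClosed_le continuous_const (by fun_prop)

lemma isClosed_Up {n : ℕ} : IsClosed {A : Mat n | Up A} := by
  have : {A : Mat n | Up A} = ⋂ (i : Fin n), ⋂ (j : Fin n), ⋂ (_ : j < i), {A | A i j = 0} := by
    ext A; simp [Up]
  rw [this]
  refine isClosed_iInter fun i => isClosed_iInter fun j => isClosed_iInter fun _ => ?_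
  exact isClosed_eq (by fun_prop) continuous_const

lemma tendsto_inv {n : ℕ} {ι : Type*} {l : Filter ι} {T : ι → Mat n} {T0 : Mat n}
    (hT : Filter.Tendsto T l (nhds T0)) (h : T0.det ≠ 0) :
    Filter.Tendsto (fun x => (T x)⁻¹) l (nhds T0⁻¹) := by
  simp only [Matrix.inv_def, Ring.inverse_eq_inv']
  have h1 : Continuous fun A : Mat n => A.det := by fun_prop
  have h2 : Continuous fun A : Mat n => A.adjugate := by fun_prop
  exact (((h1.tendsto T0).comp hT).inv₀ h).smul ((h2.tendsto T0).comp hT)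

lemma tendsto_det {n : ℕ} {ι : Type*} {l : Filter ι} {T : ι → Mat n} {T0 : Mat n}
    (hT : Filter.Tendsto T l (nhds T0)) : Filter.Tendsto (fun x => (T x).det) l (nhds T0.det) := by
  have h1 : Continuous fun A : Mat n => A.det := by fun_prop
  exact (h1.tendsto T0).comp hT

lemma tendsto_entry {n : ℕ} {ι : Type*} {l : Filter ι} {T : ι → Mat n} {T0 : Mat n}
    (hT : Filter.Tendsto T l (nhds T0)) (i j) : Filter.Tendsto (fun x => T x i j) l (nhds (T0 i j)) := by
  have h1 : Continuous fun A : Mat n => A i j := by fun_prop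
  exact (h1.tendsto T0).comp hT

lemma tendsto_mul {n : ℕ} {ι : Type*} {l : Filter ι} {T T' : ι → Mat n} {T0 T0' : Mat n}
    (hT : Filter.Tendsto T l (nhds T0)) (hT' : Filter.Tendsto T' l (nhds T0')) :
    Filter.Tendsto (fun x => T x * T' x) l (nhds (T0 * T0')) := by
  have h1 : Continuous fun p : Mat n × Mat n => p.1 * p.2 := by fun_prop
  exact (h1.tendsto (T0, T0')).comp (hT.prodMk_nhds hT')

end TP


/-! ## Split systems -/
namespace TP

structure Aut (G : Type) [Group G] where
  S : Type
  E : Type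
  fS : Fintype S
  dS : DecidableEq S
  fE : Fintype E
  src : E → S
  lt : E → S
  rt : E → S
  gL : E → G
  gR : E → G
  sg : E → ℝ
  hsg : ∀ σ, sg σ = 1 ∨ sg σ = -1
  s0 : S
  al : G
  pg : S → G
  qg : S → G
  pe : S → Bool
  qe : S → Bool
  hLp : ∀ σ, ∃ m : ℤ, gL σ * pg (lt σ) = pg (src σ) * al ^ m
  hLpe : ∀ σ, pe (lt σ) = pe (src σ)
  hRq : ∀ σ, ∃ m : ℤ, gR σ * qg (rt σ) = qg (src σ) * al ^ m
  hRqe : ∀ σ, qe (rt σ) = qe (src σ)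
  hmid : ∀ σ, ∃ m : ℤ, gL σ * qg (lt σ) = gR σ * pg (rt σ) * al ^ m
  hmide : ∀ σ, qe (lt σ) = pe (rt σ)
  h1 : ∀ s, ∃ σ σ', src σ = s ∧ src σ' = rt σ ∧ lt σ' = s0
  h2 : ∀ s, Relation.ReflTransGen (fun s t => ∃ σ, src σ = s ∧ (lt σ = t ∨ rt σ = t)) s0 s
  σy : E
  σy' : E
  σz : E
  hy : lt σy = src σy
  hy' : rt σy' = src σy'
  gy : gL σy = al
  gy' : gR σy' = al
  sgy' : sg σy' = 1
  hzl : lt σz = src σy'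
  hzr : rt σz = src σy
  gzl : gL σz = 1
  gzr : gR σz = 1
  sgz : sg σz = 1
  py : pg (src σy) = 1
  pye : pe (src σy) = false
  qy' : qg (src σy') = 1
  qye' : qe (src σy') = false
  p0 : pg s0 = 1
  p0e : pe s0 = false
  q0 : qg s0 = 1
  q0e : qe s0 = true

attribute [instance] Aut.fS Aut.dS Aut.fE

variable {G : Type} [Group G] {n : ℕ}

lemma hom_inv_mul (ρ : G →* Mat n) (γ : G) : ρ γ⁻¹ * ρ γ = 1 := by
  rw [← map_mul]; simp

lemma hom_mul_inv (ρ : G →* Mat n) (γ : G) : ρ γ * ρ γ⁻¹ = 1 := by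
  rw [← map_mul]; simp

lemma hom_det (ρ : G →* Mat n) (γ : G) : (ρ γ).det ≠ 0 := by
  intro h
  have := congrArg Matrix.det (hom_mul_inv ρ γ)
  rw [Matrix.det_mul, h, zero_mul, Matrix.det_one] at this
  exact zero_ne_one this

noncomputable def Aut.TL (A : Aut G) (ρ : G →* Mat n) (M : A.S → Mat n) (σ : A.E) : Mat n :=
  (M (A.src σ))⁻¹ * (ρ (A.gL σ) * M (A.lt σ))

noncomputable def Aut.TR (A : Aut G) (ρ : G →* Mat n) (M : A.S → Mat n) (σ : A.E) : Mat n :=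
  A.sg σ • ((M (A.src σ))⁻¹ * (ρ (A.gR σ) * M (A.rt σ)))

noncomputable def Aut.Bz (A : Aut G) (J : Mat n) (ρ : G →* Mat n) (M : A.S → Mat n) : Mat n :=
  (A.TR ρ M A.σz)⁻¹ * A.TL ρ M A.σz * J

structure Fr (A : Aut G) (J : Mat n) (ρ : G →* Mat n) (M : A.S → Mat n) (d : Fin n → ℝ) : Prop where
  det : ∀ s, (M s).det ≠ 0
  dpos : ∀ i, 0 < d i
  eig : ρ A.al * M A.s0 = M A.s0 * diagonal d
  up : ∀ s, Up ((M s)⁻¹ * (ρ (A.pg s) * (M A.s0 * Jp J (A.pe s))))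
  uq : ∀ s, Up (J⁻¹ * ((M s)⁻¹ * (ρ (A.qg s) * (M A.s0 * Jp J (A.qe s)))))

lemma eig_zpow {ρ : G →* Mat n} {a : G} {N : Mat n} {d : Fin n → ℝ} (hd : ∀ i, 0 < d i)
    (h : ρ a * N = N * diagonal d) (m : ℤ) : ρ (a ^ m) * N = N * diagonal (fun i => d i ^ m) := by
  have hinv : ρ a⁻¹ * N = N * diagonal (fun i => (d i)⁻¹) := by
    have h1 : N = N * diagonal d * diagonal (fun i => (d i)⁻¹) := by
      rw [Matrix.mul_assoc, diagonal_mul_diagonal]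
      simp [(hd _).ne']
    calc ρ a⁻¹ * N = ρ a⁻¹ * (N * diagonal d * diagonal (fun i => (d i)⁻¹)) := by rw [← h1]
      _ = ρ a⁻¹ * ρ a * N * diagonal (fun i => (d i)⁻¹) := by rw [← h]; simp only [Matrix.mul_assoc]
      _ = _ := by rw [hom_inv_mul, Matrix.one_mul]
  induction m using Int.induction_on with
  | zero => simp
  | succ i ih =>
    rw [_root_.zpow_add_one, map_mul, Matrix.mul_assoc, h, ← Matrix.mul_assoc, ih, Matrix.mul_assoc,
      diagonal_mul_diagonal]
    simp [zpow_add_one₀, (hd _).ne']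
  | pred i ih =>
    rw [_root_.zpow_sub_one, map_mul, Matrix.mul_assoc, hinv, ← Matrix.mul_assoc, ih, Matrix.mul_assoc,
      diagonal_mul_diagonal]
    simp [zpow_sub_one₀, (hd _).ne']

lemma eig_zpow_Jp {J : Mat n} (hJ : Anti J) {ρ : G →* Mat n} {a : G} {N : Mat n} {d : Fin n → ℝ}
    (hd : ∀ i, 0 < d i) (h : ρ a * N = N * diagonal d) (m : ℤ) (e : Bool) :
    ∃ d', ρ (a ^ m) * (N * Jp J e) = N * Jp J e * diagonal d' := by
  obtain ⟨d', hd'⟩ := hJ.diag_Jp (fun i => d i ^ m) e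
  exact ⟨d', by rw [← Matrix.mul_assoc, eig_zpow hd h, Matrix.mul_assoc, hd', Matrix.mul_assoc]⟩

variable {A : Aut G} {J : Mat n} {ρ : G →* Mat n} {M : A.S → Mat n} {d : Fin n → ℝ}

lemma sg_ne (A : Aut G) (σ) : A.sg σ ≠ 0 := by
  rcases A.hsg σ with h | h <;> rw [h] <;> norm_num

lemma Fr.detL (h : Fr A J ρ M d) (σ) : (A.TL ρ M σ).det ≠ 0 :=
  det_mul_ne (det_inv_ne (h.det _)) (det_mul_ne (hom_det _ _) (h.det _))

lemma Fr.detR (h : Fr A J ρ M d) (σ) : (A.TR ρ M σ).det ≠ 0 := by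
  rw [Aut.TR, Matrix.det_smul]
  exact mul_ne_zero (pow_ne_zero _ (sg_ne _ _))
    (det_mul_ne (det_inv_ne (h.det _)) (det_mul_ne (hom_det _ _) (h.det _)))

lemma up_of_mul {X U V : Mat n} (h : X * U = V) (hU : Up U) (hd : U.det ≠ 0) (hV : Up V) : Up X := by
  have : X = V * U⁻¹ := by rw [← h, Matrix.mul_assoc, minv hd, Matrix.mul_one]
  rw [this]
  exact hV.mul (hU.inv hd)

lemma Fr.upL (hJ : Anti J) (h : Fr A J ρ M d) (σ) : Up (A.TL ρ M σ) := by
  obtain ⟨m, hm⟩ := A.hLp σ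
  obtain ⟨d', hd'⟩ := eig_zpow_Jp hJ h.dpos h.eig m (A.pe (A.src σ))
  refine up_of_mul (U := (M (A.lt σ))⁻¹ * (ρ (A.pg (A.lt σ)) * (M A.s0 * Jp J (A.pe (A.lt σ)))))
    (V := (M (A.src σ))⁻¹ * (ρ (A.pg (A.src σ)) * (M A.s0 * Jp J (A.pe (A.src σ)))) * diagonal d')
    ?_ (h.up _) ?_ ((h.up _).mul (up_diagonal _))
  · rw [Aut.TL, Matrix.mul_assoc, Matrix.mul_assoc, minvl (h.det _), ← Matrix.mul_assoc (ρ _), ← map_mul,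
      hm, map_mul, A.hLpe, Matrix.mul_assoc (ρ _), hd']
    simp only [Matrix.mul_assoc]
  · exact det_mul_ne (det_inv_ne (h.det _)) (det_mul_ne (hom_det _ _) (det_mul_ne (h.det _) (hJ.Jp_det _)))

lemma Fr.detUQ (hJ : Anti J) (h : Fr A J ρ M d) (s) :
    (J⁻¹ * ((M s)⁻¹ * (ρ (A.qg s) * (M A.s0 * Jp J (A.qe s))))).det ≠ 0 :=
  det_mul_ne (det_inv_ne hJ.det_ne) (det_mul_ne (det_inv_ne (h.det _))
    (det_mul_ne (hom_det _ _) (det_mul_ne (h.det _) (hJ.Jp_det _))))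

lemma Fr.upR (hJ : Anti J) (h : Fr A J ρ M d) (σ) : Up (A.TR ρ M σ)ᵀ := by
  obtain ⟨m, hm⟩ := A.hRq σ
  obtain ⟨d', hd'⟩ := eig_zpow_Jp hJ h.dpos h.eig m (A.qe (A.src σ))
  have key : Up (J⁻¹ * ((M (A.src σ))⁻¹ * (ρ (A.gR σ) * M (A.rt σ))) * J) := by
    refine up_of_mul (U := J⁻¹ * ((M (A.rt σ))⁻¹ * (ρ (A.qg (A.rt σ)) * (M A.s0 * Jp J (A.qe (A.rt σ))))))
      (V := J⁻¹ * ((M (A.src σ))⁻¹ * (ρ (A.qg (A.src σ)) * (M A.s0 * Jp J (A.qe (A.src σ))))) * diagonal d')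
      ?_ (h.uq _) (h.detUQ hJ _) ((h.uq _).mul (up_diagonal _))
    · simp only [Matrix.mul_assoc]
      rw [minvl hJ.det_ne, minvl (h.det _), ← Matrix.mul_assoc (ρ _), ← map_mul,
        hm, map_mul, A.hRqe, Matrix.mul_assoc (ρ _), hd']
      simp only [Matrix.mul_assoc]
  rw [Aut.TR, Matrix.transpose_smul]
  refine (hJ.lower (U := J⁻¹ * ((M (A.src σ))⁻¹ * (ρ (A.gR σ) * M (A.rt σ))) * J) ?_ key).smul _
  rw [Matrix.mul_assoc J⁻¹, minvl hJ.det_ne]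

lemma TR_inv (σ) : (A.TR ρ M σ)⁻¹ = A.sg σ • ((M (A.src σ))⁻¹ * (ρ (A.gR σ) * M (A.rt σ)))⁻¹ := by
  rw [Aut.TR]
  rcases A.hsg σ with h | h <;> rw [h]
  · simp
  · rw [neg_one_smul, neg_one_smul]
    by_cases hd : IsUnit ((M (A.src σ))⁻¹ * (ρ (A.gR σ) * M (A.rt σ))).det
    · apply Matrix.inv_eq_right_inv
      rw [neg_mul_neg, Matrix.mul_nonsing_inv _ hd]
    · rw [Matrix.nonsing_inv_apply_not_isUnit _ hd, Matrix.nonsing_inv_apply_not_isUnit, neg_zero]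
      rw [Matrix.det_neg]
      intro h
      exact hd (isUnit_of_mul_isUnit_right h)

lemma TRinvTL (h : Fr A J ρ M d) (σ) : (A.TR ρ M σ)⁻¹ * A.TL ρ M σ =
    A.sg σ • ((M (A.rt σ))⁻¹ * (ρ ((A.gR σ)⁻¹ * A.gL σ) * M (A.lt σ))) := by
  rw [TR_inv, Matrix.smul_mul, Aut.TL]
  congr 1
  have h1 : (M (A.src σ))⁻¹ * (ρ (A.gR σ) * M (A.rt σ)) *
      ((M (A.rt σ))⁻¹ * (ρ ((A.gR σ)⁻¹ * A.gL σ) * M (A.lt σ))) =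
      (M (A.src σ))⁻¹ * (ρ (A.gL σ) * M (A.lt σ)) := by
    simp only [Matrix.mul_assoc]
    rw [minvl (h.det _), ← Matrix.mul_assoc (ρ _), ← map_mul, mul_inv_cancel_left]
  rw [← h1, invml]
  exact det_mul_ne (det_inv_ne (h.det _)) (det_mul_ne (hom_det _ _) (h.det _))

lemma Fr.upB (hJ : Anti J) (h : Fr A J ρ M d) (σ) : Up ((A.TR ρ M σ)⁻¹ * A.TL ρ M σ * J) := by
  obtain ⟨m, hm⟩ := A.hmid σ
  obtain ⟨d', hd'⟩ := eig_zpow_Jp hJ h.dpos h.eig m (A.pe (A.rt σ))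
  rw [TRinvTL h, Matrix.smul_mul]
  refine Up.smul ?_ _
  refine up_of_mul (U := J⁻¹ * ((M (A.lt σ))⁻¹ * (ρ (A.qg (A.lt σ)) * (M A.s0 * Jp J (A.qe (A.lt σ))))))
      (V := (M (A.rt σ))⁻¹ * (ρ (A.pg (A.rt σ)) * (M A.s0 * Jp J (A.pe (A.rt σ)))) * diagonal d')
      ?_ (h.uq _) (h.detUQ hJ _) ((h.up _).mul (up_diagonal _))
  simp only [Matrix.mul_assoc]
  rw [minvl hJ.det_ne, minvl (h.det _), ← Matrix.mul_assoc (ρ _), ← map_mul]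
  have : (A.gR σ)⁻¹ * A.gL σ * A.qg (A.lt σ) = A.pg (A.rt σ) * A.al ^ m := by
    rw [mul_assoc, hm, mul_assoc, inv_mul_cancel_left]
  rw [this, map_mul, A.hmide, Matrix.mul_assoc (ρ _), hd']
  simp only [Matrix.mul_assoc]

structure Pos (A : Aut G) (J : Mat n) (ρ : G →* Mat n) (M : A.S → Mat n) (d : Fin n → ℝ) : Prop
    extends Fr A J ρ M d where
  danti : StrictAnti d
  tl : ∀ σ, TNN (A.TL ρ M σ)
  tr : ∀ σ, TNN (A.TR ρ M σ)
  bz : ∀ i, 0 < A.Bz J ρ M i i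
  bz' : ∀ i i' : Fin n, i'.1 = i.1 + 1 → A.Bz J ρ M i i' ≤ 0

lemma Pos.good (hJ : Anti J) (h : Pos A J ρ M d) (σ) : GoodPair J (A.TL ρ M σ) (A.TR ρ M σ) where
  tl := h.tl σ
  tr := h.tr σ
  dl := h.toFr.detL σ
  dr := h.toFr.detR σ
  ul := h.toFr.upL hJ σ
  ur := h.toFr.upR hJ σ
  ub := h.toFr.upB hJ σ

/-- Collar lemma, abstract: strictness. -/
lemma collar (hJ : Anti J) {U B Ut T' : Mat n} (hU : ∀ k, PosMinors U k)
    (uU : Up U) (hT' : ∀ k, PosMinors T'ᵀ k) (hUt : T' * J = J * Ut) (uUt : Up Ut) (uB : Up B)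
    (hUB : U * B = B * Ut) (hB : ∀ i, 0 < B i i) (hdU : ∀ i, U i i = d i) (hdUt : ∀ i, Ut i i = d i)
    (i i' : Fin n) (hi : i'.1 = i.1 + 1) : (d i - d i') * B i i' < 0 := by
  have hlt : i < i' := by rw [Fin.lt_def]; omega
  have e1 := congrFun (congrFun hUB i) i'
  have two : ∀ X Y : Mat n, Up X → Up Y → (X * Y) i i' = X i i * Y i i' + X i i' * Y i' i' := by
    intro X Y hX hY
    rw [Matrix.mul_apply, ← Finset.sum_subset (Finset.subset_univ {i, i'}), Finset.sum_pair hlt.ne]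
    intro x _ hx
    simp only [Finset.mem_insert, Finset.mem_singleton, not_or] at hx
    rcases lt_or_gt_of_ne hx.1 with h | h
    · rw [hX _ _ h, zero_mul]
    · have : i' < x := by
        rw [Fin.lt_def] at h ⊢
        have : x.1 ≠ i'.1 := fun h' => hx.2 (Fin.ext h')
        omega
      rw [hY _ _ this, mul_zero]
  rw [two U B uU uB, two B Ut uB uUt, hdU, hdUt] at e1
  have p1 : 0 < U i i' := by
    have := hU 1 (fun _ => i) (fun _ => i') (Subsingleton.strictMono _) (Subsingleton.strictMono _)
      (fun _ => hlt.le)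
    simpa using this
  have p2 : 0 < T' (Fin.rev i) (Fin.rev i') := by
    have := hT' 1 (fun _ => Fin.rev i') (fun _ => Fin.rev i) (Subsingleton.strictMono _)
      (Subsingleton.strictMono _) (fun _ => by rw [Fin.rev_le_rev]; exact hlt.le)
    simpa using this
  have p3 : Ut i i' < 0 := by
    rw [hJ.conj_apply hUt]
    have h3 := hJ.alt i i' hi
    have h4 : 0 < J (Fin.rev i) i * J (Fin.rev i) i := mul_self_pos.2 (hJ.ne i)
    have : T' i.rev i'.rev * J i'.rev i' / J i.rev i =
      T' i.rev i'.rev * (J i.rev i * J i'.rev i') / (J (Fin.rev i) i * J (Fin.rev i) i) := by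
      have := hJ.ne i
      field_simp
    rw [this]
    exact div_neg_of_neg_of_pos (mul_neg_of_pos_of_neg p2 h3) h4
  have := mul_pos p1 (hB i')
  have := mul_neg_of_pos_of_neg (hB i) p3
  linarith

lemma hom_conj_diag {U b D : Mat n} (hb : Up b) (hbd : b.det ≠ 0) (hU : Up U) (hD : Up D) (h : U * b = b * D) (i) :
    U i i = D i i := by
  have dg : ∀ X Y : Mat n, Up X → Up Y → (X * Y) i i = X i i * Y i i := by
    intro X Y hX hY
    rw [Matrix.mul_apply, Finset.sum_eq_single i]
    · intro x _ hx
      rcases lt_or_gt_of_ne hx with h | h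
      · rw [hX _ _ h, zero_mul]
      · rw [hY _ _ h, mul_zero]
    · simp
  have := congrFun (congrFun h i) i
  rw [dg _ _ hU hb, dg _ _ hb hD, mul_comm] at this
  exact mul_left_cancel₀ (hb.diag_ne hbd i) this

/-- relations for the collar at a frame -/
lemma Fr.collar_rel (hJ : Anti J) (h : Fr A J ρ M d) :
    A.TL ρ M A.σy * A.Bz J ρ M = A.Bz J ρ M * (J⁻¹ * (A.TR ρ M A.σy' * J)) ∧
    Up (J⁻¹ * (A.TR ρ M A.σy' * J)) ∧
    (∀ i, A.TL ρ M A.σy i i = d i) ∧ (∀ i, (J⁻¹ * (A.TR ρ M A.σy' * J)) i i = d i) := by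
  have hUt : Up (J⁻¹ * (A.TR ρ M A.σy' * J)) ∧ (∀ i, (J⁻¹ * (A.TR ρ M A.σy' * J)) i i = d i) := by
    have q := h.uq (A.src A.σy')
    have qd := h.detUQ hJ (A.src A.σy')
    set b := J⁻¹ * ((M (A.src A.σy'))⁻¹ * (ρ (A.qg (A.src A.σy')) * (M A.s0 * Jp J (A.qe (A.src A.σy')))))
      with hb
    have e : (J⁻¹ * (A.TR ρ M A.σy' * J)) * b = b * diagonal d := by
      rw [Aut.TR, A.sgy', one_smul, hb, A.qy', A.qye', A.gy', A.hy']
      simp only [Jp, map_one, Matrix.one_mul, Matrix.mul_one, Bool.false_eq_true, if_false]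
      simp only [Matrix.mul_assoc]
      rw [minvl hJ.det_ne, minvl (h.det _), h.eig]
    have hu : Up (J⁻¹ * (A.TR ρ M A.σy' * J)) := up_of_mul e q qd (q.mul (up_diagonal _))
    refine ⟨hu, fun i => ?_⟩
    have := hom_conj_diag q qd hu (up_diagonal d) e i
    rwa [diagonal_apply_eq] at this
  refine ⟨?_, hUt.1, ?_, hUt.2⟩
  · rw [Aut.Bz, TRinvTL h, A.sgz, one_smul, A.gzl, A.gzr, Aut.TL, Aut.TR, A.sgy', one_smul, A.hy, A.gy,
      A.hy', A.gy', A.hzl, A.hzr]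
    simp only [inv_one, mul_one, map_one, Matrix.one_mul, Matrix.mul_assoc]
    rw [minvl (h.det _), minvl hJ.det_ne, minvl (h.det _)]
  · intro i
    have q := h.up (A.src A.σy)
    have qd : ((M (A.src A.σy))⁻¹ * (ρ (A.pg (A.src A.σy)) * (M A.s0 * Jp J (A.pe (A.src A.σy))))).det ≠ 0 :=
      det_mul_ne (det_inv_ne (h.det _)) (det_mul_ne (hom_det _ _) (det_mul_ne (h.det _) (hJ.Jp_det _)))
    have e : A.TL ρ M A.σy * ((M (A.src A.σy))⁻¹ * (ρ (A.pg (A.src A.σy)) * (M A.s0 * Jp J (A.pe (A.src A.σy)))))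
       = ((M (A.src A.σy))⁻¹ * (ρ (A.pg (A.src A.σy)) * (M A.s0 * Jp J (A.pe (A.src A.σy))))) * diagonal d := by
      rw [Aut.TL, A.hy, A.gy, A.py, A.pye]
      simp only [Jp, map_one, Matrix.one_mul, Matrix.mul_one, Bool.false_eq_true, if_false]
      simp only [Matrix.mul_assoc]
      rw [minvl (h.det _), h.eig]
    have := hom_conj_diag q qd (h.upL hJ _) (up_diagonal d) e i
    rwa [diagonal_apply_eq] at this

lemma Pos.bz_strict (hJ : Anti J) (h : Pos A J ρ M d) (i i' : Fin n) (hi : i'.1 = i.1 + 1) :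
    A.Bz J ρ M i i' < 0 := by
  obtain ⟨c1, c2, c3, c4⟩ := h.toFr.collar_rel hJ
  have := collar (d := d) hJ ((h.good hJ A.σy).posL hJ) (h.toFr.upL hJ _)
    ((h.good hJ A.σy').posR hJ) (by rw [minvl hJ.det_ne]) c2 (h.toFr.upB hJ A.σz) c1 h.bz c3 c4 i i' hi
  have h2 : d i' < d i := h.danti (by rw [Fin.lt_def]; omega)
  by_contra hcon
  push Not at hcon
  exact absurd this (not_lt.2 (mul_nonneg (sub_nonneg.2 h2.le) hcon))

lemma PosMinors.entry {T : Mat n} (h : PosMinors T 1) {i j : Fin n} (hij : i ≤ j) : 0 < T i j := by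
  have := h (fun _ => i) (fun _ => j) (Subsingleton.strictMono _) (Subsingleton.strictMono _)
      (fun _ => hij)
  simpa using this

/-- lower times upper, both positive. -/
lemma prod_pos' {TR TL : Mat n} (hR : PosMinors TRᵀ 1) (hL : PosMinors TL 1) (hR0 : ∀ i j, 0 ≤ TR i j)
    (hL0 : ∀ i j, 0 ≤ TL i j) (i j : Fin n) : 0 < (TR * TL) i j := by
  rw [Matrix.mul_apply]
  let z : Fin n := ⟨0, by have := i.2; omega⟩
  refine Finset.sum_pos' (fun k _ => mul_nonneg (hR0 _ _) (hL0 _ _)) ⟨z, Finset.mem_univ _, ?_⟩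
  have h1 : 0 < TRᵀ z i := hR.entry (by rw [Fin.le_def]; exact Nat.zero_le _)
  exact mul_pos h1 (hL.entry (by rw [Fin.le_def]; exact Nat.zero_le _))

/-- Trivial centralizer. -/
theorem Pos.centralizer (hJ : Anti J) (h : Pos A J ρ M d) (X : Mat n)
    (hX : ∀ γ, ρ γ * X = X * ρ γ) : ∃ c : ℝ, X = c • (1 : Mat n) := by
  by_cases hn : n = 0
  · subst hn; exact ⟨0, by ext i; exact i.elim0⟩
  set N := M A.s0 with hN
  have hNd : N.det ≠ 0 := h.det _
  set Y := N⁻¹ * (X * N) with hY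
  have hXY : X * N = N * Y := by rw [hY, minvl hNd]
  have conjY : ∀ γ, (N⁻¹ * (ρ γ * N)) * Y = Y * (N⁻¹ * (ρ γ * N)) := by
    intro γ
    rw [hY]
    simp only [Matrix.mul_assoc]
    rw [minvl hNd, minvl hNd, ← Matrix.mul_assoc (ρ γ), hX, Matrix.mul_assoc]
  have e1 := conjY A.al
  rw [h.eig, invml hNd] at e1
  have hdiag : ∀ i j, i ≠ j → Y i j = 0 := by
    intro i j hij
    have := congrFun (congrFun e1 i) j
    rw [Matrix.diagonal_mul, Matrix.mul_diagonal] at this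
    have h2 : d i ≠ d j := fun h' => hij (h.danti.injective h')
    have h3 : (d i - d j) * Y i j = 0 := by linarith
    rcases mul_eq_zero.1 h3 with h4 | h4
    · exact absurd (sub_eq_zero.1 h4) h2
    · exact h4
  obtain ⟨σ, σ', k1, k2, k3⟩ := A.h1 A.s0
  have e2 := conjY (A.gR σ * A.gL σ')
  have e3 : A.TR ρ M σ * A.TL ρ M σ' = A.sg σ • (N⁻¹ * (ρ (A.gR σ * A.gL σ') * N)) := by
    rw [Aut.TR, Aut.TL, k1, k2, k3, Matrix.smul_mul, map_mul]
    simp only [Matrix.mul_assoc]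
    rw [minvl (h.det _)]
  have e4 : ∀ i j, (N⁻¹ * (ρ (A.gR σ * A.gL σ') * N)) i j ≠ 0 := by
    intro i j h0
    have := prod_pos' ((h.good hJ σ).posR hJ 1) ((h.good hJ σ').posL hJ 1) (h.tr σ).entry (h.tl σ').entry i j
    rw [e3, Matrix.smul_apply, h0, smul_zero] at this
    exact lt_irrefl _ this
  have hYd : Y = diagonal (fun i => Y i i) := by
    ext i j
    by_cases hij : i = j
    · subst hij; simp
    · rw [hdiag i j hij, diagonal_apply_ne _ hij]
  have hall : ∀ i j, Y i i = Y j j := by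
    intro i j
    rw [hYd] at e2
    have := congrFun (congrFun e2 i) j
    rw [Matrix.diagonal_mul, Matrix.mul_diagonal, mul_comm] at this
    exact (mul_right_cancel₀ (e4 i j) this).symm
  have i0 : Fin n := ⟨0, Nat.pos_of_ne_zero hn⟩
  refine ⟨Y i0 i0, ?_⟩
  have hY2 : Y = Y i0 i0 • (1 : Mat n) := by
    rw [smul_one_eq_diagonal]
    conv_lhs => rw [hYd]
    congr 1
    funext i
    exact hall i i0
  have : X = N * Y * N⁻¹ := by rw [← hXY, Matrix.mul_assoc, minv hNd, Matrix.mul_one]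
  rw [this]
  rw [hY2, Matrix.mul_smul, Matrix.smul_mul, Matrix.mul_one, minv hNd]
  simp

end TP


/-! ## Openness -/
namespace TP

section Calcs
open Filter Topology
variable {R : Type*} [NormedRing R] [NormedAlgebra ℝ R] [CompleteSpace R]

lemma abs_UL (u l : R →L[ℝ] R) (hul : ∀ w, u w + l w = w) :
    ∃ φ : R → R, Tendsto φ (𝓝 1) (𝓝 0) ∧ ∀ᶠ K in 𝓝 1, (1 + u (φ K)) * (1 + l (φ K)) = K := by
  let f : R → R := fun w => (1 + u w) * (1 + l w)
  have hf : HasStrictFDerivAt f ((ContinuousLinearEquiv.refl ℝ R : R ≃L[ℝ] R) : R →L[ℝ] R) 0 := by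
    have h1 : HasStrictFDerivAt (fun w => 1 + u w) u 0 := u.hasStrictFDerivAt.const_add 1
    have h2 : HasStrictFDerivAt (fun w => 1 + l w) l 0 := l.hasStrictFDerivAt.const_add 1
    refine (h1.mul' h2).congr_fderiv ?_
    ext w
    simp only [map_zero, add_zero]
    simp
    rw [add_comm]; exact hul w
  have hf0 : f 0 = 1 := by simp [f]
  refine ⟨hf.localInverse f _ 0, ?_, ?_⟩
  · have := hf.localInverse_tendsto
    rwa [hf0] at this
  · have := hf.eventually_right_inverse
    rwa [hf0] at this

lemma abs_eig (D : R) (u v : R →L[ℝ] R) (huv : ∀ w, D * u w - u w * D - v w = w) :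
    ∃ φ : R → R, Tendsto φ (𝓝 D) (𝓝 0) ∧
      ∀ᶠ A in 𝓝 D, A * (1 + u (φ A)) = (1 + u (φ A)) * (D + v (φ A)) := by
  let q : R × R → R := fun p => p.2 + (p.1 - D) * u p.2 - u p.2 * v p.2
  have hq : HasStrictFDerivAt q (ContinuousLinearMap.snd ℝ R R) (D, 0) := by
    have h0 : HasStrictFDerivAt (fun p : R × R => p.2) (ContinuousLinearMap.snd ℝ R R) (D, 0) :=
      hasStrictFDerivAt_snd
    have h1 : HasStrictFDerivAt (fun p : R × R => p.1 - D) (ContinuousLinearMap.fst ℝ R R) (D, 0) :=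
      hasStrictFDerivAt_fst.sub_const D
    have h2 : HasStrictFDerivAt (fun p : R × R => u p.2) (u.comp (ContinuousLinearMap.snd ℝ R R)) (D, 0) :=
      u.hasStrictFDerivAt.comp _ h0
    have h3 : HasStrictFDerivAt (fun p : R × R => v p.2) (v.comp (ContinuousLinearMap.snd ℝ R R)) (D, 0) :=
      v.hasStrictFDerivAt.comp _ h0
    refine ((h0.add (h1.mul' h2)).sub (h2.mul' h3)).congr_fderiv ?_
    apply ContinuousLinearMap.ext
    intro p
    simp
  let f : R × R → R × R := fun p => (p.1, q p)
  have hf : HasStrictFDerivAt f ((ContinuousLinearEquiv.refl ℝ (R × R) : (R × R) ≃L[ℝ] (R × R)) : (R × R) →L[ℝ] (R × R)) (D, 0) := by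
    refine (hasStrictFDerivAt_fst.prodMk hq).congr_fderiv ?_
    apply ContinuousLinearMap.ext
    intro p
    simp
  have hf0 : f (D, 0) = (D, 0) := by simp [f, q]
  have t1 := hf.localInverse_tendsto
  have t2 := hf.eventually_right_inverse
  rw [hf0] at t1 t2
  set h := hf.localInverse f _ (D, 0) with hh
  have t3 : Tendsto (fun A : R => (A, D - A)) (𝓝 D) (𝓝 (D, 0)) := by
    have : Continuous fun A : R => (A, D - A) := by fun_prop
    have := this.tendsto D
    rwa [sub_self] at this
  refine ⟨fun A => (h (A, D - A)).2, ?_, ?_⟩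
  · exact ((continuous_snd.tendsto _).comp t1).comp t3
  · filter_upwards [t3.eventually t2] with A hA
    have e1 : (h (A, D - A)).1 = A := congrArg Prod.fst hA
    have e2 : q (h (A, D - A)) = D - A := congrArg Prod.snd hA
    simp only [q, e1] at e2
    set w := (h (A, D - A)).2
    have := huv w
    have e3 : A * (1 + u w) - (1 + u w) * (D + v w) = (D * u w - u w * D - v w) - w +
      (w + (A - D) * u w - u w * v w) - (D - A) := by noncomm_ring
    rw [e2, this] at e3
    rw [← sub_eq_zero, e3]
    abel
end Calcs

variable {n : ℕ}
open Filter Topology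

def upPart : Mat n →ₗ[ℝ] Mat n where
  toFun w := Matrix.of fun i j => if j < i then 0 else w i j
  map_add' x y := by ext i j; by_cases h : j < i <;> simp [h]
  map_smul' c x := by ext i j; by_cases h : j < i <;> simp [h]

def loPart : Mat n →ₗ[ℝ] Mat n where
  toFun w := Matrix.of fun i j => if j < i then w i j else 0
  map_add' x y := by ext i j; by_cases h : j < i <;> simp [h]
  map_smul' c x := by ext i j; by_cases h : j < i <;> simp [h]

noncomputable def eigU (d : Fin n → ℝ) : Mat n →ₗ[ℝ] Mat n where
  toFun w := Matrix.of fun i j => if i = j then 0 else (d i - d j)⁻¹ * w i j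
  map_add' x y := by ext i j; by_cases h : i = j <;> simp [h, mul_add]
  map_smul' c x := by ext i j; by_cases h : i = j <;> simp [h]; ring

def eigV : Mat n →ₗ[ℝ] Mat n where
  toFun w := diagonal fun i => - w i i
  map_add' x y := by ext i j; by_cases h : i = j <;> simp [h, add_comm]
  map_smul' c x := by ext i j; by_cases h : i = j <;> simp [h]

lemma mat_UL : ∃ U L : Mat n → Mat n, Tendsto U (𝓝 1) (𝓝 1) ∧ Tendsto L (𝓝 1) (𝓝 1) ∧
    (∀ K, Up (U K) ∧ Up (L K)ᵀ) ∧ ∀ᶠ K in 𝓝 1, U K * L K = K := by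
  letI : NormedRing (Mat n) := Matrix.linftyOpNormedRing
  letI : NormedAlgebra ℝ (Mat n) := Matrix.linftyOpNormedAlgebra
  haveI : CompleteSpace (Mat n) := FiniteDimensional.complete ℝ _
  obtain ⟨φ, h1, h2⟩ := abs_UL (R := Mat n) (LinearMap.toContinuousLinearMap upPart)
    (LinearMap.toContinuousLinearMap loPart) (by
      intro w
      ext i j
      by_cases h : j < i <;> simp [upPart, loPart, h])
  refine ⟨fun K => 1 + upPart (φ K), fun K => 1 + loPart (φ K), ?_, ?_, fun K => ⟨?_, ?_⟩, h2⟩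
  · have c : Continuous fun w : Mat n => 1 + LinearMap.toContinuousLinearMap upPart w := by fun_prop
    have := (c.tendsto 0).comp h1
    rw [map_zero, add_zero] at this
    exact this
  · have c : Continuous fun w : Mat n => 1 + LinearMap.toContinuousLinearMap loPart w := by fun_prop
    have := (c.tendsto 0).comp h1
    rw [map_zero, add_zero] at this
    exact this
  · intro i j hij
    simp [upPart, hij, hij.ne']
  · intro i j hij
    simp [loPart, hij.ne, hij.le, not_lt.2 hij.le]

lemma mat_eig (d : Fin n → ℝ) (hd : Function.Injective d) : ∃ (N : Mat n → Mat n) (δ : Mat n → Fin n → ℝ),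
    Tendsto N (𝓝 (diagonal d)) (𝓝 1) ∧ Tendsto δ (𝓝 (diagonal d)) (𝓝 d) ∧
    ∀ᶠ K in 𝓝 (diagonal d), K * N K = N K * diagonal (δ K) := by
  letI : NormedRing (Mat n) := Matrix.linftyOpNormedRing
  letI : NormedAlgebra ℝ (Mat n) := Matrix.linftyOpNormedAlgebra
  haveI : CompleteSpace (Mat n) := FiniteDimensional.complete ℝ _
  obtain ⟨φ, h1, h2⟩ := abs_eig (R := Mat n) (diagonal d) (LinearMap.toContinuousLinearMap (eigU d))
    (LinearMap.toContinuousLinearMap eigV) (by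
      intro w
      ext i j
      simp only [LinearMap.coe_toContinuousLinearMap', Matrix.sub_apply, Matrix.diagonal_mul, Matrix.mul_diagonal]
      by_cases h : i = j
      · subst h; simp [eigU, eigV]
      · have : d i - d j ≠ 0 := sub_ne_zero.2 (fun h' => h (hd h'))
        simp [eigU, eigV, h]
        field_simp)
  refine ⟨fun K => 1 + eigU d (φ K), fun K i => d i - φ K i i, ?_, ?_, ?_⟩
  · have c : Continuous fun w : Mat n => 1 + LinearMap.toContinuousLinearMap (eigU d) w := by fun_prop
    have := (c.tendsto 0).comp h1
    rw [map_zero, add_zero] at this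
    exact this
  · rw [tendsto_pi_nhds]
    intro i
    have h3 : Tendsto (fun K => φ K i i) (𝓝 (diagonal d)) (𝓝 ((0 : Mat n) i i)) := tendsto_entry h1 i i
    have := (tendsto_const_nhds (x := d i)).sub h3
    simpa using this
  · filter_upwards [h2] with K hK
    refine Eq.trans hK ?_
    change (1 + eigU d (φ K)) * (diagonal d + eigV (φ K)) = _
    congr 1
    rw [eigV]
    simp [sub_eq_add_neg]

lemma Anti.upper {J : Mat n} (hJ : Anti J) {L : Mat n} (hL : Up Lᵀ) : Up (J⁻¹ * (L * J)) := by
  intro i j hij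
  rw [hJ.conj_apply (A := L) (U := J⁻¹ * (L * J)) (by rw [minvl hJ.det_ne])]
  have : L (Fin.rev i) (Fin.rev j) = 0 := hL _ _ (by rwa [Fin.rev_lt_rev])
  rw [this, zero_mul, zero_div]

/-- perturbing a pair of transverse flags -/
lemma frame_perturb {X : Type*} {l : Filter X} {J : Mat n} (hJ : Anti J) {P Q : X → Mat n} {P1 Q1 M1 : Mat n}
    (hP : Tendsto P l (𝓝 P1)) (hQ : Tendsto Q l (𝓝 Q1)) (dP : P1.det ≠ 0) (dQ : Q1.det ≠ 0)
    (dM : M1.det ≠ 0) (uP : Up (M1⁻¹ * P1)) (uQ : Up (J⁻¹ * (M1⁻¹ * Q1))) :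
    ∃ M : X → Mat n, Tendsto M l (𝓝 M1) ∧
      ∀ᶠ x in l, Up ((M x)⁻¹ * P x) ∧ Up (J⁻¹ * ((M x)⁻¹ * Q x)) := by
  obtain ⟨U, L, hU, hL, hUL, hev⟩ := mat_UL (n := n)
  set UP1 := M1⁻¹ * P1 with hUP1
  set UQ1 := J⁻¹ * (M1⁻¹ * Q1) with hUQ1
  have dUP : UP1.det ≠ 0 := det_mul_ne (det_inv_ne dM) dP
  have dUQ : UQ1.det ≠ 0 := det_mul_ne (det_inv_ne hJ.det_ne) (det_mul_ne (det_inv_ne dM) dQ)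
  have ePM : P1 * UP1⁻¹ = M1 := by
    have : P1 = M1 * UP1 := by rw [hUP1, minvl dM]
    rw [this, Matrix.mul_assoc, minv dUP, Matrix.mul_one]
  have eQM : M1 * (J * UQ1) = Q1 := by rw [hUQ1, minvl hJ.det_ne, minvl dM]
  let W : X → Mat n := fun x => UP1 * ((P x)⁻¹ * (Q x * (UQ1⁻¹ * J⁻¹)))
  have hW : Tendsto W l (𝓝 1) := by
    have h1 : Tendsto W l (𝓝 (UP1 * (P1⁻¹ * (Q1 * (UQ1⁻¹ * J⁻¹))))) :=
      tendsto_mul tendsto_const_nhds (tendsto_mul (tendsto_inv hP dP) (tendsto_mul hQ tendsto_const_nhds))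
    have h2 : UP1 * (P1⁻¹ * (Q1 * (UQ1⁻¹ * J⁻¹))) = 1 := by
      rw [← eQM]
      simp only [Matrix.mul_assoc]
      rw [minvl dUQ, minv hJ.det_ne, Matrix.mul_one, hUP1, Matrix.mul_assoc, minvl dP, invm dM]
    rwa [h2] at h1
  have dPx : ∀ᶠ x in l, (P x).det ≠ 0 := (tendsto_det hP).eventually_ne dP
  have dUx : ∀ᶠ x in l, (U (W x)).det ≠ 0 := by
    have := tendsto_det (hU.comp hW)
    exact this.eventually_ne (by simp)
  refine ⟨fun x => P x * (UP1⁻¹ * U (W x)), ?_, ?_⟩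
  · have := tendsto_mul hP (tendsto_mul (tendsto_const_nhds (x := UP1⁻¹)) (hU.comp hW))
    rw [Matrix.mul_one, ePM] at this
    exact this
  · filter_upwards [dPx, dUx, hW.eventually hev] with x h1 h2 h3
    have dd : (P x * (UP1⁻¹ * U (W x))).det ≠ 0 := det_mul_ne h1 (det_mul_ne (det_inv_ne dUP) h2)
    constructor
    · have e : P x = (P x * (UP1⁻¹ * U (W x))) * ((U (W x))⁻¹ * UP1) := by
        simp only [Matrix.mul_assoc]
        rw [minvl h2, invm dUP, Matrix.mul_one]
      have e2 : (P x * (UP1⁻¹ * U (W x)))⁻¹ * P x = (U (W x))⁻¹ * UP1 := by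
        have := invml dd ((U (W x))⁻¹ * UP1)
        rwa [← e] at this
      rw [e2]
      exact ((hUL _).1.inv h2).mul uP
    · have e : Q x = (P x * (UP1⁻¹ * U (W x))) * (L (W x) * (J * UQ1)) := by
        have : U (W x) * (L (W x) * (J * UQ1)) = UP1 * ((P x)⁻¹ * Q x) := by
          rw [← Matrix.mul_assoc, h3]
          simp only [W, Matrix.mul_assoc]
          rw [invml hJ.det_ne, invm dUQ, Matrix.mul_one]
        simp only [Matrix.mul_assoc]
        rw [this, invml dUP, minvl h1]
      have e2 : J⁻¹ * ((P x * (UP1⁻¹ * U (W x)))⁻¹ * Q x) = (J⁻¹ * (L (W x) * J)) * UQ1 := by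
        rw [e, invml dd]; simp only [Matrix.mul_assoc]
      rw [e2]
      exact (hJ.upper (hUL _).2).mul uQ

variable {G : Type} [Group G]

lemma tendsto_TL {X : Type*} {l : Filter X} {A : Aut G} {R : X → G →* Mat n} {ρ : G →* Mat n}
    (hR : ∀ γ, Tendsto (fun x => R x γ) l (𝓝 (ρ γ))) {M : X → A.S → Mat n} {M1 : A.S → Mat n}
    (hM : ∀ s, Tendsto (fun x => M x s) l (𝓝 (M1 s))) (hd : ∀ s, (M1 s).det ≠ 0) (σ) :
    Tendsto (fun x => A.TL (R x) (M x) σ) l (𝓝 (A.TL ρ M1 σ)) :=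
  tendsto_mul (tendsto_inv (hM _) (hd _)) (tendsto_mul (hR _) (hM _))

lemma tendsto_TR {X : Type*} {l : Filter X} {A : Aut G} {R : X → G →* Mat n} {ρ : G →* Mat n}
    (hR : ∀ γ, Tendsto (fun x => R x γ) l (𝓝 (ρ γ))) {M : X → A.S → Mat n} {M1 : A.S → Mat n}
    (hM : ∀ s, Tendsto (fun x => M x s) l (𝓝 (M1 s))) (hd : ∀ s, (M1 s).det ≠ 0) (σ) :
    Tendsto (fun x => A.TR (R x) (M x) σ) l (𝓝 (A.TR ρ M1 σ)) :=
  (tendsto_mul (tendsto_inv (hM _) (hd _)) (tendsto_mul (hR _) (hM _))).const_smul _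

theorem isOpen_pos {X : Type*} [TopologicalSpace X] (A : Aut G) {J : Mat n} (hJ : Anti J)
    (R : X → G →* Mat n) (hR : ∀ γ, Continuous fun x => R x γ) :
    IsOpen {x | ∃ M d, Pos A J (R x) M d} := by
  rw [isOpen_iff_mem_nhds]
  rintro x1 ⟨M1, d1, h⟩
  have hRt : ∀ γ, Tendsto (fun x => R x γ) (𝓝 x1) (𝓝 (R x1 γ)) := fun γ => (hR γ).tendsto x1
  obtain ⟨N', δ', hN', hδ', hev⟩ := mat_eig d1 h.danti.injective
  let K : X → Mat n := fun x => (M1 A.s0)⁻¹ * (R x A.al * M1 A.s0)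
  have d0 := h.det A.s0
  have hK : Tendsto K (𝓝 x1) (𝓝 (diagonal d1)) := by
    have h1 : Tendsto K (𝓝 x1) (𝓝 ((M1 A.s0)⁻¹ * (R x1 A.al * M1 A.s0))) :=
      tendsto_mul tendsto_const_nhds (tendsto_mul (hRt _) tendsto_const_nhds)
    rwa [h.eig, invml d0] at h1
  let N : X → Mat n := fun x => M1 A.s0 * N' (K x)
  let δ : X → Fin n → ℝ := fun x => δ' (K x)
  have hN : Tendsto N (𝓝 x1) (𝓝 (M1 A.s0)) := by
    have := tendsto_mul (tendsto_const_nhds (x := M1 A.s0)) (hN'.comp hK)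
    rwa [Matrix.mul_one] at this
  have hδ : Tendsto δ (𝓝 x1) (𝓝 d1) := hδ'.comp hK
  have heig : ∀ᶠ x in 𝓝 x1, R x A.al * N x = N x * diagonal (δ x) := by
    filter_upwards [hK.eventually hev] with x hx
    have := congrArg (fun Y => M1 A.s0 * Y) hx
    simp only [K, Matrix.mul_assoc, minvl d0] at this
    simp only [N, δ, Matrix.mul_assoc, K]
    exact this
  have hex : ∀ s, ∃ M : X → Mat n, Tendsto M (𝓝 x1) (𝓝 (M1 s)) ∧
      ∀ᶠ x in 𝓝 x1, Up ((M x)⁻¹ * (R x (A.pg s) * (N x * Jp J (A.pe s)))) ∧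
        Up (J⁻¹ * ((M x)⁻¹ * (R x (A.qg s) * (N x * Jp J (A.qe s))))) := by
    intro s
    refine frame_perturb hJ (P1 := R x1 (A.pg s) * (M1 A.s0 * Jp J (A.pe s)))
      (Q1 := R x1 (A.qg s) * (M1 A.s0 * Jp J (A.qe s))) ?_ ?_ ?_ ?_ (h.det s) (h.up s) (h.uq s)
    · exact tendsto_mul (hRt _) (tendsto_mul hN tendsto_const_nhds)
    · exact tendsto_mul (hRt _) (tendsto_mul hN tendsto_const_nhds)
    · exact det_mul_ne (hom_det _ _) (det_mul_ne d0 (hJ.Jp_det _))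
    · exact det_mul_ne (hom_det _ _) (det_mul_ne d0 (hJ.Jp_det _))
  choose M0 hM0 hM0' using hex
  let M : X → A.S → Mat n := fun x s => if s = A.s0 then N x else M0 s x
  have hM : ∀ s, Tendsto (fun x => M x s) (𝓝 x1) (𝓝 (M1 s)) := by
    intro s
    by_cases hs : s = A.s0
    · subst hs; simpa [M] using hN
    · simpa [M, hs] using hM0 s
  have hMs0 : ∀ x, M x A.s0 = N x := fun x => by simp [M]
  have hFr : ∀ᶠ x in 𝓝 x1, Fr A J (R x) (M x) (δ x) := by
    have e1 : ∀ᶠ x in 𝓝 x1, ∀ s, (M x s).det ≠ 0 := by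
      rw [eventually_all]
      exact fun s => (tendsto_det (hM s)).eventually_ne (h.det s)
    have e2 : ∀ᶠ x in 𝓝 x1, ∀ i, 0 < δ x i := by
      rw [eventually_all]
      exact fun i => ((tendsto_pi_nhds.1 hδ) i).eventually (lt_mem_nhds (h.dpos i))
    have e3 : ∀ᶠ x in 𝓝 x1, ∀ s, Up ((M0 s x)⁻¹ * (R x (A.pg s) * (N x * Jp J (A.pe s)))) ∧
        Up (J⁻¹ * ((M0 s x)⁻¹ * (R x (A.qg s) * (N x * Jp J (A.qe s))))) := by
      rw [eventually_all]
      exact hM0'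
    filter_upwards [e1, e2, e3, heig] with x h1 h2 h3 h4
    refine ⟨h1, h2, by rw [hMs0]; exact h4, ?_, ?_⟩
    · intro s
      by_cases hs : s = A.s0
      · subst hs
        rw [A.p0, A.p0e, map_one, Matrix.one_mul]
        simp only [Jp, Bool.false_eq_true, if_false, Matrix.mul_one]
        rw [invm (h1 _)]
        exact up_one
      · rw [hMs0]
        have : M x s = M0 s x := by simp [M, hs]
        rw [this]
        exact (h3 s).1
    · intro s
      by_cases hs : s = A.s0
      · subst hs
        rw [A.q0, A.q0e, map_one, Matrix.one_mul]
        simp only [Jp, if_true]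
        rw [invml (h1 _), invm hJ.det_ne]
        exact up_one
      · rw [hMs0]
        have : M x s = M0 s x := by simp [M, hs]
        rw [this]
        exact (h3 s).2
  have hTL := tendsto_TL hRt hM h.det
  have hTR := tendsto_TR hRt hM h.det
  have hB : Tendsto (fun x => A.Bz J (R x) (M x)) (𝓝 x1) (𝓝 (A.Bz J (R x1) M1)) :=
    tendsto_mul (tendsto_mul (tendsto_inv (hTR _) (h.toFr.detR _)) (hTL _)) tendsto_const_nhds
  have g1 : ∀ᶠ x in 𝓝 x1, StrictAnti (δ x) := by
    have : ∀ᶠ x in 𝓝 x1, ∀ i j, i < j → δ x j < δ x i := by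
      rw [eventually_all]; intro i
      rw [eventually_all]; intro j
      by_cases hij : i < j
      · filter_upwards [((tendsto_pi_nhds.1 hδ) j).eventually_lt ((tendsto_pi_nhds.1 hδ) i) (h.danti hij)]
          with x hx _
        exact hx
      · exact Eventually.of_forall fun x h' => absurd h' hij
    filter_upwards [this] with x hx i j hij using hx i j hij
  have g2 : ∀ᶠ x in 𝓝 x1, ∀ σ, TNN (A.TL (R x) (M x) σ) := by
    rw [eventually_all]; intro σ
    exact eventually_TNN (hTL σ) (by filter_upwards [hFr] with x hx using hx.upL hJ σ)
      ((h.good hJ σ).posL hJ)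
  have g3 : ∀ᶠ x in 𝓝 x1, ∀ σ, TNN (A.TR (R x) (M x) σ) := by
    rw [eventually_all]; intro σ
    have ht : Tendsto (fun x => (A.TR (R x) (M x) σ)ᵀ) (𝓝 x1) (𝓝 (A.TR (R x1) M1 σ)ᵀ) := by
      have : Continuous fun Y : Mat n => Yᵀ := by fun_prop
      exact (this.tendsto _).comp (hTR σ)
    have := eventually_TNN ht (by filter_upwards [hFr] with x hx using hx.upR hJ σ)
      ((h.good hJ σ).posR hJ)
    filter_upwards [this] with x hx
    simpa using hx.transpose
  have g4 : ∀ᶠ x in 𝓝 x1, ∀ i, 0 < A.Bz J (R x) (M x) i i := by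
    rw [eventually_all]; intro i
    exact (tendsto_entry hB i i).eventually (lt_mem_nhds (h.bz i))
  have g5 : ∀ᶠ x in 𝓝 x1, ∀ i i' : Fin n, i'.1 = i.1 + 1 → A.Bz J (R x) (M x) i i' ≤ 0 := by
    rw [eventually_all]; intro i
    rw [eventually_all]; intro i'
    by_cases hi : i'.1 = i.1 + 1
    · filter_upwards [(tendsto_entry hB i i').eventually (gt_mem_nhds (h.bz_strict hJ i i' hi))] with x hx _
      exact le_of_lt hx
    · exact Eventually.of_forall fun x h' => absurd h' hi
  filter_upwards [hFr, g1, g2, g3, g4, g5] with x f1 f2 f3 f4 f5 f6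
  exact ⟨M x, δ x, ⟨f1, f2, f3, f4, f5, f6⟩⟩

end TP

namespace TP
open Filter Topology

/-! ## closedness -/

lemma pow_nonneg_mat {V : Type*} [Fintype V] [DecidableEq V] {T : Matrix V V ℝ} (h : ∀ v w, 0 ≤ T v w) (m : ℕ) :
    ∀ v w, 0 ≤ (T ^ m) v w := by
  induction m with
  | zero => intro v w; rw [pow_zero, Matrix.one_apply]; split_ifs <;> norm_num
  | succ m ih =>
    intro v w
    rw [pow_succ, Matrix.mul_apply]
    exact Finset.sum_nonneg fun u _ => mul_nonneg (ih _ _) (h _ _)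

lemma pow_mul_le {V : Type*} [Fintype V] [DecidableEq V] {T : Matrix V V ℝ} (h : ∀ v w, 0 ≤ T v w) (m k : ℕ)
    (u v w) : (T ^ m) u v * (T ^ k) v w ≤ (T ^ (m + k)) u w := by
  rw [pow_add, Matrix.mul_apply]
  exact Finset.single_le_sum (f := fun v => (T ^ m) u v * (T ^ k) v w)
    (fun v _ => mul_nonneg (pow_nonneg_mat h m _ _) (pow_nonneg_mat h k _ _)) (Finset.mem_univ v)

lemma gauge {V : Type*} [Fintype V] [DecidableEq V] {T : Matrix V V ℝ} (h : ∀ v w, 0 ≤ T v w)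
    (v0 : V) (irr : ∀ w, ∃ m, 0 < (T ^ m) v0 w) (irr' : ∀ w, ∃ m, 0 < (T ^ m) w v0) {C D : ℝ} (hC : 0 < C)
    (hD : ∀ m, (T ^ m) v0 v0 ≤ D * C ^ m) :
    ∃ f : V → ℝ, (∀ v, 0 < f v) ∧ ∀ v w, f v * T v w ≤ C * f w := by
  have hb : ∀ w, BddAbove (Set.range fun m : ℕ => (T ^ m) v0 w * (C ^ m)⁻¹) := by
    intro w
    obtain ⟨k, hk⟩ := irr' w
    refine ⟨D * C ^ k / (T ^ k) w v0, ?_⟩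
    rintro _ ⟨m, rfl⟩
    have h1 := (pow_mul_le h m k v0 w v0).trans (hD (m + k))
    have hCm : 0 < C ^ m := pow_pos hC m
    simp only
    rw [le_div_iff₀ hk]
    rw [pow_add] at h1
    calc (T ^ m) v0 w * (C ^ m)⁻¹ * (T ^ k) w v0 = ((T ^ m) v0 w * (T ^ k) w v0) * (C ^ m)⁻¹ := by ring
      _ ≤ (D * (C ^ m * C ^ k)) * (C ^ m)⁻¹ := by gcongr
      _ = D * C ^ k := by field_simp
  refine ⟨fun w => ⨆ m : ℕ, (T ^ m) v0 w * (C ^ m)⁻¹, ?_, ?_⟩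
  · intro w
    obtain ⟨m, hm⟩ := irr w
    exact lt_of_lt_of_le (mul_pos hm (inv_pos.2 (pow_pos hC m))) (le_ciSup (hb w) m)
  · intro v w
    rw [Real.iSup_mul_of_nonneg (h v w)]
    refine ciSup_le fun m => ?_
    have h1 := pow_mul_le h m 1 v0 v w
    rw [pow_one] at h1
    have h2 := le_ciSup (hb w) (m + 1)
    have hCm : 0 < C ^ m := pow_pos hC m
    calc (T ^ m) v0 v * (C ^ m)⁻¹ * T v w = ((T ^ m) v0 v * T v w) * (C ^ m)⁻¹ := by ring
      _ ≤ (T ^ (m + 1)) v0 w * (C ^ m)⁻¹ := by gcongr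
      _ = C * ((T ^ (m + 1)) v0 w * (C ^ (m + 1))⁻¹) := by rw [pow_succ C]; field_simp
      _ ≤ _ := mul_le_mul_of_nonneg_left h2 hC.le

lemma pow_entry_bound {V : Type*} [Fintype V] [DecidableEq V] {R : Matrix V V ℝ} {K : ℝ} (hK : 0 ≤ K)
    (h : ∀ v w, |R v w| ≤ K) (m : ℕ) : ∀ v w, |(R ^ m) v w| ≤ (Fintype.card V * K) ^ m := by
  induction m with
  | zero => intro v w; rw [pow_zero, Matrix.one_apply]; split_ifs <;> simp
  | succ m ih =>
    intro v w
    rw [pow_succ, Matrix.mul_apply]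
    calc |∑ j, (R ^ m) v j * R j w| ≤ ∑ j, |(R ^ m) v j * R j w| := Finset.abs_sum_le_sum_abs _ _
      _ ≤ ∑ _j : V, (Fintype.card V * K) ^ m * K := by
        refine Finset.sum_le_sum fun j _ => ?_
        rw [abs_mul]
        gcongr
        · exact ih _ _
        · exact h _ _
      _ = _ := by simp; ring

lemma trace_pow_eq {V : Type*} [Fintype V] [DecidableEq V] {M T R : Matrix V V ℝ} (hM : IsUnit M.det)
    (h : M * T = R * M) (m : ℕ) : (T ^ m).trace = (R ^ m).trace := by
  have h1 : M * T ^ m = R ^ m * M := by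
    induction m with
    | zero => simp
    | succ m ih => rw [pow_succ, ← Matrix.mul_assoc, ih, Matrix.mul_assoc, h, pow_succ, Matrix.mul_assoc]
  have h2 : T ^ m = M⁻¹ * (R ^ m * M) := by rw [← h1, Matrix.nonsing_inv_mul_cancel_left _ _ hM]
  rw [h2, Matrix.trace_mul_comm, Matrix.mul_assoc, Matrix.mul_nonsing_inv _ hM, Matrix.mul_one]

variable {G : Type} [Group G] {n : ℕ} {A : Aut G} {J : Mat n} {ρ : G →* Mat n} {M : A.S → Mat n} {d : Fin n → ℝ}

lemma TNN.diag {T : Mat n} (h : TNN T) {a b : Fin n → ℝ} (ha : ∀ i, 0 < a i) (hb : ∀ i, 0 < b i) :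
    TNN (diagonal a * T * diagonal b) := by
  intro k r c hr hc
  have : (diagonal a * T * diagonal b).submatrix r c =
      diagonal (a ∘ r) * T.submatrix r c * diagonal (b ∘ c) := by
    ext i j; simp [Matrix.mul_diagonal, Matrix.diagonal_mul]
  rw [this, Matrix.det_mul, Matrix.det_mul, Matrix.det_diagonal, Matrix.det_diagonal]
  exact mul_nonneg (mul_nonneg (Finset.prod_nonneg fun i _ => (ha _).le) (h k r c hr hc))
    (Finset.prod_nonneg fun i _ => (hb _).le)

lemma inv_diag {e : Fin n → ℝ} (he : ∀ i, 0 < e i) : (diagonal e)⁻¹ = diagonal fun i => (e i)⁻¹ := by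
  apply Matrix.inv_eq_right_inv
  rw [diagonal_mul_diagonal]
  simp [(he _).ne']

noncomputable def resc (M : A.S → Mat n) (e : A.S → Fin n → ℝ) : A.S → Mat n := fun s => M s * diagonal (e s)

lemma resc_inv (M : A.S → Mat n) {e : A.S → Fin n → ℝ} (he : ∀ s i, 0 < e s i) (s) :
    (resc M e s)⁻¹ = diagonal (fun i => (e s i)⁻¹) * (M s)⁻¹ := by
  rw [resc, Matrix.mul_inv_rev, inv_diag (he s)]

lemma TL_resc (M : A.S → Mat n) {e : A.S → Fin n → ℝ} (he : ∀ s i, 0 < e s i) (σ) :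
    A.TL ρ (resc M e) σ = diagonal (fun i => (e (A.src σ) i)⁻¹) * A.TL ρ M σ * diagonal (e (A.lt σ)) := by
  rw [Aut.TL, resc_inv M he, Aut.TL, resc]
  simp only [Matrix.mul_assoc]

lemma TR_resc (M : A.S → Mat n) {e : A.S → Fin n → ℝ} (he : ∀ s i, 0 < e s i) (σ) :
    A.TR ρ (resc M e) σ = diagonal (fun i => (e (A.src σ) i)⁻¹) * A.TR ρ M σ * diagonal (e (A.rt σ)) := by
  rw [Aut.TR, resc_inv M he, Aut.TR, resc]
  simp only [Matrix.mul_assoc, Matrix.mul_smul, Matrix.smul_mul]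

lemma TL_resc_apply (M : A.S → Mat n) {e : A.S → Fin n → ℝ} (he : ∀ s i, 0 < e s i) (σ i j) :
    A.TL ρ (resc M e) σ i j = (e (A.src σ) i)⁻¹ * A.TL ρ M σ i j * e (A.lt σ) j := by
  rw [TL_resc M he, Matrix.mul_diagonal, Matrix.diagonal_mul]

lemma TR_resc_apply (M : A.S → Mat n) {e : A.S → Fin n → ℝ} (he : ∀ s i, 0 < e s i) (σ i j) :
    A.TR ρ (resc M e) σ i j = (e (A.src σ) i)⁻¹ * A.TR ρ M σ i j * e (A.rt σ) j := by
  rw [TR_resc M he, Matrix.mul_diagonal, Matrix.diagonal_mul]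

lemma Pos.resc (hJ : Anti J) (h : Pos A J ρ M d) {e : A.S → Fin n → ℝ} (he : ∀ s i, 0 < e s i) :
    Pos A J ρ (resc M e) d := by
  have hdd : ∀ s, (diagonal (e s)).det ≠ 0 := fun s => by
    rw [Matrix.det_diagonal]; exact Finset.prod_ne_zero_iff.2 fun i _ => (he s i).ne'
  have hB : A.Bz J ρ (TP.resc M e) = diagonal (fun i => (e (A.rt A.σz) i)⁻¹) *
      ((A.TR ρ M A.σz)⁻¹ * A.TL ρ M A.σz) * (diagonal (e (A.lt A.σz)) * J) := by
    rw [Aut.Bz, TR_resc M he, TL_resc M he, Matrix.mul_inv_rev, Matrix.mul_inv_rev, inv_diag (he _)]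
    simp only [Matrix.mul_assoc]
    congr 2
    rw [invml]
    rw [Matrix.det_diagonal]; exact Finset.prod_ne_zero_iff.2 fun i _ => inv_ne_zero (he _ i).ne'
  have hB' : ∀ i j, A.Bz J ρ (TP.resc M e) i j =
      (e (A.rt A.σz) i)⁻¹ * A.Bz J ρ M i j * (e (A.lt A.σz) (Fin.rev j)) := by
    intro i j
    rw [hB, Aut.Bz, ← Matrix.mul_assoc, hJ.mul_apply, hJ.mul_apply, Matrix.mul_diagonal, Matrix.diagonal_mul]
    ring
  refine ⟨⟨fun s => det_mul_ne (h.det s) (hdd s), h.dpos, ?_, fun s => ?_, fun s => ?_⟩, h.danti, fun σ => ?_, fun σ => ?_,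
    fun i => ?_, fun i i' hi => ?_⟩
  · rw [TP.resc, ← Matrix.mul_assoc, h.eig, Matrix.mul_assoc, Matrix.mul_assoc, diagonal_mul_diagonal, diagonal_mul_diagonal]
    simp only [mul_comm]
  · obtain ⟨d', hd'⟩ := hJ.diag_Jp (e A.s0) (A.pe s)
    rw [resc_inv M he, TP.resc, Matrix.mul_assoc (M A.s0), hd']
    have := ((up_diagonal (fun i => (e s i)⁻¹)).mul (h.up s)).mul (up_diagonal d')
    simpa only [Matrix.mul_assoc] using this
  · obtain ⟨d', hd'⟩ := hJ.diag_Jp (e A.s0) (A.qe s)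
    obtain ⟨d2, hd2⟩ := hJ.diag_Jp (fun i => (e s i)⁻¹) true
    simp only [Jp, if_true] at hd2
    rw [resc_inv M he, TP.resc, Matrix.mul_assoc (M A.s0), hd']
    have hJ2 : J⁻¹ * diagonal (fun i => (e s i)⁻¹) = diagonal d2 * J⁻¹ := by
      have : diagonal (fun i => (e s i)⁻¹) = J * (diagonal d2 * J⁻¹) := by
        rw [← Matrix.mul_assoc, ← hd2, Matrix.mul_assoc, minv hJ.det_ne, Matrix.mul_one]
      rw [this, invml hJ.det_ne]
    have := ((up_diagonal d2).mul (h.uq s)).mul (up_diagonal d')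
    simp only [← Matrix.mul_assoc] at this ⊢
    rw [hJ2]
    exact this
  · rw [TL_resc M he]; exact (h.tl σ).diag (fun i => inv_pos.2 (he _ i)) (he _)
  · rw [TR_resc M he]; exact (h.tr σ).diag (fun i => inv_pos.2 (he _ i)) (he _)
  · rw [hB']; exact mul_pos (mul_pos (inv_pos.2 (he _ _)) (h.bz i)) (he _ _)
  · rw [hB']
    exact mul_nonpos_of_nonpos_of_nonneg (mul_nonpos_of_nonneg_of_nonpos (inv_pos.2 (he _ _)).le (h.bz' i i' hi)) (he _ _).le

/-- the big transfer matrix -/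
noncomputable def bigT (A : Aut G) (TL TR : A.E → Mat n) : Matrix (Fin n × A.S) (Fin n × A.S) ℝ :=
  Matrix.of fun v w => ∑ σ, ((if A.src σ = v.2 ∧ A.lt σ = w.2 then TL σ v.1 w.1 else 0) +
    (if A.src σ = v.2 ∧ A.rt σ = w.2 then TR σ v.1 w.1 else 0))

lemma bigT_conj (h : ∀ s, (M s).det ≠ 0) :
    blockDiagonal M * bigT A (A.TL ρ M) (A.TR ρ M) =
      bigT A (fun σ => ρ (A.gL σ)) (fun σ => A.sg σ • ρ (A.gR σ)) * blockDiagonal M := by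
  ext ⟨i, s⟩ ⟨j, t⟩
  rw [Matrix.mul_apply, Matrix.mul_apply, Fintype.sum_prod_type_right, Fintype.sum_prod_type_right,
    Finset.sum_eq_single s, Finset.sum_eq_single t]
  · simp only [bigT, Matrix.of_apply, blockDiagonal_apply_eq, Finset.mul_sum, Finset.sum_mul]
    rw [Finset.sum_comm]
    conv_rhs => rw [Finset.sum_comm]
    refine Finset.sum_congr rfl fun σ _ => ?_
    simp only [mul_add, add_mul, Finset.sum_add_distrib, mul_ite, ite_mul, mul_zero, zero_mul]
    congr 1
    · by_cases hc : A.src σ = s ∧ A.lt σ = t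
      · simp only [hc, and_self, if_true]
        have : M (A.src σ) * A.TL ρ M σ = ρ (A.gL σ) * M (A.lt σ) := by
          rw [Aut.TL, minvl (h _)]
        rw [hc.1, hc.2] at this
        simpa only [Matrix.mul_apply] using congrFun (congrFun this i) j
      · simp [hc]
    · by_cases hc : A.src σ = s ∧ A.rt σ = t
      · simp only [hc, and_self, if_true]
        have : M (A.src σ) * A.TR ρ M σ = A.sg σ • ρ (A.gR σ) * M (A.rt σ) := by
          rw [Aut.TR, Matrix.mul_smul, minvl (h _), Matrix.smul_mul]
        rw [hc.1, hc.2] at this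
        simpa only [Matrix.mul_apply] using congrFun (congrFun this i) j
      · simp [hc]
  · intro b _ hb
    refine Finset.sum_eq_zero fun x _ => ?_
    rw [blockDiagonal_apply_ne _ _ _ hb, mul_zero]
  · simp
  · intro b _ hb
    refine Finset.sum_eq_zero fun x _ => ?_
    rw [blockDiagonal_apply_ne _ _ _ hb.symm, zero_mul]
  · simp

end TP

namespace TP
open Filter Topology
variable {G : Type} [Group G] {n : ℕ} {A : Aut G} {J : Mat n} {ρ : G →* Mat n} {M : A.S → Mat n} {d : Fin n → ℝ}

lemma bigT_nonneg {TL TR : A.E → Mat n} (hl : ∀ σ i j, 0 ≤ TL σ i j) (hr : ∀ σ i j, 0 ≤ TR σ i j) (v w) :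
    0 ≤ bigT A TL TR v w := by
  rw [bigT, Matrix.of_apply]
  refine Finset.sum_nonneg fun σ _ => add_nonneg ?_ ?_
  · split_ifs
    · exact hl _ _ _
    · exact le_rfl
  · split_ifs
    · exact hr _ _ _
    · exact le_rfl

lemma bigT_ge {TL TR : A.E → Mat n} (hl : ∀ σ i j, 0 ≤ TL σ i j) (hr : ∀ σ i j, 0 ≤ TR σ i j) (σ i j) :
    TL σ i j ≤ bigT A TL TR (i, A.src σ) (j, A.lt σ) ∧ TR σ i j ≤ bigT A TL TR (i, A.src σ) (j, A.rt σ) := by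
  have nn : ∀ (v w : Fin n × A.S) (σ : A.E), 0 ≤ (if A.src σ = v.2 ∧ A.lt σ = w.2 then TL σ v.1 w.1 else 0) := by
    intro v w σ
    split_ifs
    · exact hl _ _ _
    · exact le_rfl
  have nn' : ∀ (v w : Fin n × A.S) (σ : A.E), 0 ≤ (if A.src σ = v.2 ∧ A.rt σ = w.2 then TR σ v.1 w.1 else 0) := by
    intro v w σ
    split_ifs
    · exact hr _ _ _
    · exact le_rfl
  constructor
  · have := Finset.single_le_sum (fun σ' _ => add_nonneg (nn (i, A.src σ) (j, A.lt σ) σ') (nn' (i, A.src σ) (j, A.lt σ) σ')) (Finset.mem_univ σ)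
    rw [bigT, Matrix.of_apply]
    refine le_trans ?_ this
    simp only [and_self, if_true]
    have := nn' (i, A.src σ) (j, A.lt σ) σ
    simp only at this
    linarith
  · have := Finset.single_le_sum (fun σ' _ => add_nonneg (nn (i, A.src σ) (j, A.rt σ) σ') (nn' (i, A.src σ) (j, A.rt σ) σ')) (Finset.mem_univ σ)
    rw [bigT, Matrix.of_apply]
    refine le_trans ?_ this
    simp only [and_self, if_true]
    have := nn (i, A.src σ) (j, A.rt σ) σ
    simp only at this
    linarith

lemma bigT_abs {TL TR : A.E → Mat n} {K : ℝ} (hK : 0 ≤ K) (hl : ∀ σ i j, |TL σ i j| ≤ K) (hr : ∀ σ i j, |TR σ i j| ≤ K) (v w) :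
    |bigT A TL TR v w| ≤ Fintype.card A.E * (2 * K) := by
  rw [bigT, Matrix.of_apply]
  refine (Finset.abs_sum_le_sum_abs _ _).trans ?_
  have : ∀ σ ∈ (Finset.univ : Finset A.E), |(if A.src σ = v.2 ∧ A.lt σ = w.2 then TL σ v.1 w.1 else 0) +
    (if A.src σ = v.2 ∧ A.rt σ = w.2 then TR σ v.1 w.1 else 0)| ≤ 2 * K := by
    intro σ _
    refine (abs_add_le _ _).trans ?_
    have h1 : |(if A.src σ = v.2 ∧ A.lt σ = w.2 then TL σ v.1 w.1 else 0)| ≤ K := by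
      split_ifs
      · exact hl _ _ _
      · simpa using hK
    have h2 : |(if A.src σ = v.2 ∧ A.rt σ = w.2 then TR σ v.1 w.1 else 0)| ≤ K := by
      split_ifs
      · exact hr _ _ _
      · simpa using hK
    linarith
  refine (Finset.sum_le_card_nsmul _ _ _ this).trans ?_
  simp

/-- uniform normalisation of the frames -/
lemma Pos.normalize (hn : 0 < n) (hJ : Anti J) (h : Pos A J ρ M d) {K : ℝ} (hK : 0 ≤ K)
    (hL : ∀ σ i j, |ρ (A.gL σ) i j| ≤ K) (hR : ∀ σ i j, |ρ (A.gR σ) i j| ≤ K) :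
    ∃ M', Pos A J ρ M' d ∧ ∀ σ i j,
      A.TL ρ M' σ i j ≤ Fintype.card (Fin n × A.S) * (Fintype.card A.E * (2 * K)) + 1 ∧
      A.TR ρ M' σ i j ≤ Fintype.card (Fin n × A.S) * (Fintype.card A.E * (2 * K)) + 1 := by
  set N := Fintype.card (Fin n × A.S)
  set K' := Fintype.card A.E * (2 * K) with hK'
  have hK'0 : 0 ≤ K' := by positivity
  set T := bigT A (A.TL ρ M) (A.TR ρ M) with hT
  have hl : ∀ σ i j, 0 ≤ A.TL ρ M σ i j := fun σ => (h.tl σ).entry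
  have hr : ∀ σ i j, 0 ≤ A.TR ρ M σ i j := fun σ => (h.tr σ).entry
  have nn : ∀ v w, 0 ≤ T v w := bigT_nonneg hl hr
  let z : Fin n := ⟨0, hn⟩
  have zle : ∀ i, z ≤ i := fun i => by rw [Fin.le_def]; exact Nat.zero_le _
  let Re : Fin n × A.S → Fin n × A.S → Prop := fun v w => ∃ m, 0 < (T ^ m) v w
  have tr : ∀ {u v w}, Re u v → Re v w → Re u w := by
    rintro u v w ⟨m, hm⟩ ⟨k, hk⟩
    exact ⟨m + k, lt_of_lt_of_le (mul_pos hm hk) (pow_mul_le nn m k u v w)⟩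
  have eL : ∀ σ i j, i ≤ j → Re (i, A.src σ) (j, A.lt σ) := fun σ i j hij =>
    ⟨1, by rw [pow_one]; exact lt_of_lt_of_le (((h.good hJ σ).posL hJ 1).entry hij) (bigT_ge hl hr σ i j).1⟩
  have eR : ∀ σ i j, j ≤ i → Re (i, A.src σ) (j, A.rt σ) := fun σ i j hij =>
    ⟨1, by rw [pow_one]; exact lt_of_lt_of_le (((h.good hJ σ).posR hJ 1).entry hij) (bigT_ge hl hr σ i j).2⟩
  have to0 : ∀ s i j, Re (i, s) (j, A.s0) := by
    intro s i j
    obtain ⟨σ, σ', rfl, k2, k3⟩ := A.h1 s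
    rw [← k3]
    refine tr (eR σ i z (zle i)) ?_
    rw [← k2]
    exact eL σ' z j (zle j)
  have from0 : ∀ s j, Re (z, A.s0) (j, s) := by
    intro s j
    have := A.h2 s
    induction this with
    | refl => exact to0 _ _ _
    | tail _ hst ih =>
      obtain ⟨σ, rfl, rfl | rfl⟩ := hst
      · exact tr ih (eL σ j j le_rfl)
      · exact tr ih (eR σ j j le_rfl)
  have hC : 0 < N * K' + 1 := by positivity
  have hMu : IsUnit (blockDiagonal M).det := by
    rw [det_blockDiagonal, isUnit_iff_ne_zero]
    exact Finset.prod_ne_zero_iff.2 fun s _ => h.det s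
  have hsg : ∀ σ i j, |(A.sg σ • ρ (A.gR σ)) i j| ≤ K := by
    intro σ i j
    rcases A.hsg σ with h | h <;> rw [h] <;> simpa using hR σ i j
  have hD : ∀ m, (T ^ m) (z, A.s0) (z, A.s0) ≤ N * (N * K' + 1) ^ m := by
    intro m
    have h1 : (T ^ m) (z, A.s0) (z, A.s0) ≤ (T ^ m).trace :=
      Finset.single_le_sum (f := fun v => (T ^ m) v v) (fun v _ => pow_nonneg_mat nn m v v) (Finset.mem_univ _)
    rw [trace_pow_eq hMu (bigT_conj h.det)] at h1
    refine h1.trans ?_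
    have hb := pow_entry_bound hK'0 (bigT_abs (A := A) hK hL hsg) m
    rw [Matrix.trace]
    refine (Finset.sum_le_card_nsmul _ _ ((N * K' + 1) ^ m) fun v _ => ?_).trans ?_
    · refine (le_abs_self _).trans ((hb v v).trans ?_)
      gcongr
      linarith
    · simp [N]
  obtain ⟨f, f0, hf⟩ := gauge nn (z, A.s0) (fun w => from0 w.2 w.1) (fun w => to0 w.2 w.1 z) hC hD
  refine ⟨TP.resc M (fun s i => (f (i, s))⁻¹), h.resc hJ (fun s i => inv_pos.2 (f0 _)), fun σ i j => ?_⟩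
  rw [TL_resc_apply M (fun s i => inv_pos.2 (f0 _)), TR_resc_apply M (fun s i => inv_pos.2 (f0 _))]
  simp only [inv_inv]
  have g := bigT_ge hl hr σ i j
  constructor
  · rw [← div_eq_mul_inv, div_le_iff₀ (f0 _)]
    exact (mul_le_mul_of_nonneg_left g.1 (f0 _).le).trans (hf _ _)
  · rw [← div_eq_mul_inv, div_le_iff₀ (f0 _)]
    exact (mul_le_mul_of_nonneg_left g.2 (f0 _).le).trans (hf _ _)

end TP

namespace TP
open Filter Topology
variable {G : Type} [Group G] {n : ℕ} {A : Aut G} {J : Mat n}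

lemma ultra_real {X : Type*} (U : Ultrafilter X) {f : X → ℝ} {a b : ℝ} (h : ∀ᶠ x in U, a ≤ f x ∧ f x ≤ b) :
    ∃ c, Tendsto f U (𝓝 c) := by
  obtain ⟨c, _, hc⟩ := (isCompact_Icc (a := a) (b := b)).ultrafilter_le_nhds (U.map f)
    (by rw [le_principal_iff]; exact h)
  exact ⟨c, hc⟩

lemma ultra_mat {X : Type*} (U : Ultrafilter X) {f : X → Mat n} {a b : ℝ}
    (h : ∀ᶠ x in U, ∀ i j, a ≤ f x i j ∧ f x i j ≤ b) :
    ∃ c, Tendsto f U (𝓝 c) := by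
  have : ∀ i j, ∃ c, Tendsto (fun x => f x i j) U (𝓝 c) := fun i j =>
    ultra_real U (by filter_upwards [h] with x hx using hx i j)
  choose c hc using this
  refine ⟨Matrix.of c, ?_⟩
  refine tendsto_pi_nhds.2 fun i => ?_
  exact tendsto_pi_nhds.2 (hc i)

/-- eigenvectors for distinct eigenvalues -/
lemma eig_det {R V : Mat n} {d : Fin n → ℝ} (hd : Function.Injective d) (h : R * V = V * diagonal d)
    (hV : ∀ j, ∃ i, V i j ≠ 0) : V.det ≠ 0 := by
  have hli : LinearIndependent ℝ (fun j => V.col j) := by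
    refine Module.End.eigenvectors_linearIndependent' (Matrix.toLin' R) d hd _ fun j => ?_
    constructor
    · rw [Module.End.mem_eigenspace_iff, Matrix.toLin'_apply]
      ext i
      have := congrFun (congrFun h i) j
      rw [Matrix.mul_diagonal] at this
      simp only [Matrix.mulVec, dotProduct, Matrix.col_apply, Pi.smul_apply, smul_eq_mul]
      rw [Matrix.mul_apply] at this
      rw [this, mul_comm]
    · intro h0
      obtain ⟨i, hi⟩ := hV j
      exact hi (congrFun h0 i)
  have := Matrix.linearIndependent_cols_iff_isUnit.1 hli
  rw [Matrix.isUnit_iff_isUnit_det, isUnit_iff_ne_zero] at this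
  exact this

theorem isClosed_pos {X : Type*} [TopologicalSpace X] (hn : 0 < n) (A : Aut G) (hJ : Anti J)
    (R : X → G →* Mat n) (hR : ∀ γ, Continuous fun x => R x γ) (hdet : ∀ x γ, (R x γ).det = 1) :
    IsClosed {x | ∃ M d, Pos A J (R x) M d} := by
  rw [isClosed_iff_ultrafilter]
  intro x1 U hU hmem
  have hRt : ∀ γ, Tendsto (fun x => R x γ) U (𝓝 (R x1 γ)) := fun γ => ((hR γ).tendsto x1).mono_left hU
  -- a uniform bound
  obtain ⟨K, hK0, hK⟩ : ∃ K : ℝ, 0 ≤ K ∧ ∀ᶠ x in U, ∀ σ i j, |R x (A.gL σ) i j| ≤ K ∧ |R x (A.gR σ) i j| ≤ K := by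
    have hb : ∀ (γ : G) i j, ∀ᶠ x in U, |R x γ i j| ≤ |R x1 γ i j| + 1 := by
      intro γ i j
      have := (tendsto_entry (hRt γ) i j).abs
      filter_upwards [this.eventually (gt_mem_nhds (lt_add_one _))] with x hx using le_of_lt hx
    refine ⟨∑ σ, ∑ i, ∑ j, ((|R x1 (A.gL σ) i j| + 1) + (|R x1 (A.gR σ) i j| + 1)), by positivity, ?_⟩
    have hs : ∀ σ i j, (|R x1 (A.gL σ) i j| + 1) + (|R x1 (A.gR σ) i j| + 1) ≤
        ∑ σ, ∑ i, ∑ j, ((|R x1 (A.gL σ) i j| + 1) + (|R x1 (A.gR σ) i j| + 1)) := by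
      intro σ i j
      refine le_trans ?_ (Finset.single_le_sum (fun σ _ => by positivity) (Finset.mem_univ σ))
      refine le_trans ?_ (Finset.single_le_sum (fun i _ => by positivity) (Finset.mem_univ i))
      exact Finset.single_le_sum (f := fun j => (|R x1 (A.gL σ) i j| + 1) + (|R x1 (A.gR σ) i j| + 1))
        (fun j _ => by positivity) (Finset.mem_univ j)
    rw [eventually_all]; intro σ
    rw [eventually_all]; intro i
    rw [eventually_all]; intro j
    filter_upwards [hb (A.gL σ) i j, hb (A.gR σ) i j] with x h1 h2
    have := hs σ i j
    have := abs_nonneg (R x1 (A.gL σ) i j)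
    have := abs_nonneg (R x1 (A.gR σ) i j)
    constructor <;> linarith
  set C : ℝ := Fintype.card (Fin n × A.S) * (Fintype.card A.E * (2 * K)) + 1 with hC
  have hex : ∀ x, ∃ M d, x ∈ {x | ∃ M d, Pos A J (R x) M d} →
      (∀ σ i j, |R x (A.gL σ) i j| ≤ K ∧ |R x (A.gR σ) i j| ≤ K) →
      Pos A J (R x) M d ∧ ∀ σ i j, A.TL (R x) M σ i j ≤ C ∧ A.TR (R x) M σ i j ≤ C := by
    intro x
    by_cases hx : x ∈ {x | ∃ M d, Pos A J (R x) M d} ∧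
      (∀ σ i j, |R x (A.gL σ) i j| ≤ K ∧ |R x (A.gR σ) i j| ≤ K)
    · obtain ⟨⟨M, d, h⟩, hb⟩ := hx
      obtain ⟨M', hM', hb'⟩ := h.normalize hn hJ hK0 (fun σ i j => (hb σ i j).1) (fun σ i j => (hb σ i j).2)
      exact ⟨M', d, fun _ _ => ⟨hM', hb'⟩⟩
    · exact ⟨fun _ => 0, fun _ => 0, fun h1 h2 => absurd ⟨h1, h2⟩ hx⟩
  choose M d hMd using hex
  have hP : ∀ᶠ x in U, Pos A J (R x) (M x) (d x) := by
    filter_upwards [hmem, hK] with x h1 h2 using (hMd x h1 h2).1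
  have hB : ∀ᶠ x in U, ∀ σ i j, A.TL (R x) (M x) σ i j ≤ C ∧ A.TR (R x) (M x) σ i j ≤ C := by
    filter_upwards [hmem, hK] with x h1 h2 using (hMd x h1 h2).2
  have limL : ∀ σ, ∃ T, Tendsto (fun x => A.TL (R x) (M x) σ) U (𝓝 T) := fun σ =>
    ultra_mat U (a := 0) (b := C) (by
      filter_upwards [hP, hB] with x h1 h2 i j using ⟨(h1.tl σ).entry i j, (h2 σ i j).1⟩)
  have limR : ∀ σ, ∃ T, Tendsto (fun x => A.TR (R x) (M x) σ) U (𝓝 T) := fun σ =>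
    ultra_mat U (a := 0) (b := C) (by
      filter_upwards [hP, hB] with x h1 h2 i j using ⟨(h1.tr σ).entry i j, (h2 σ i j).2⟩)
  choose TL hTL using limL
  choose TR hTR using limR
  -- determinants
  let f : A.S → X → ℝ := fun s x => |(M x s).det|
  have hf : ∀ᶠ x in U, ∀ s, 0 < f s x := by
    filter_upwards [hP] with x h s using abs_pos.2 (h.det s)
  let Bd : A.S → A.S → Prop := fun s t => ∃ B : ℝ, ∀ᶠ x in U, f t x ≤ B * f s x
  have Bd_trans : ∀ {r s t}, Bd r s → Bd s t → Bd r t := by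
    rintro r s t ⟨B, hB⟩ ⟨B', hB'⟩
    refine ⟨|B'| * B, ?_⟩
    filter_upwards [hB, hB', hf] with x h1 h2 h3
    calc f t x ≤ B' * f s x := h2
      _ ≤ |B'| * f s x := mul_le_mul_of_nonneg_right (le_abs_self _) (h3 s).le
      _ ≤ |B'| * (B * f r x) := mul_le_mul_of_nonneg_left h1 (abs_nonneg _)
      _ = _ := by ring
  have edL : ∀ σ, ∀ᶠ x in U, |(A.TL (R x) (M x) σ).det| * f (A.src σ) x = f (A.lt σ) x := by
    intro σ
    filter_upwards [hP] with x h
    rw [← abs_mul, mul_comm, ← Matrix.det_mul, Aut.TL, minvl (h.det _), Matrix.det_mul, hdet, one_mul]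
  have edR : ∀ σ, ∀ᶠ x in U, |(A.TR (R x) (M x) σ).det| * f (A.src σ) x = f (A.rt σ) x := by
    intro σ
    filter_upwards [hP] with x h
    rw [← abs_mul, mul_comm, ← Matrix.det_mul, Aut.TR, Matrix.mul_smul, minvl (h.det _), Matrix.det_smul,
      Matrix.det_mul, hdet, one_mul, abs_mul, abs_pow]
    rcases A.hsg σ with h | h <;> rw [h] <;> simp [f]
  have evb : ∀ {g : X → ℝ} {c : ℝ}, Tendsto g U (𝓝 c) → ∀ᶠ x in U, g x ≤ c + 1 := by
    intro g c h
    filter_upwards [h.eventually (gt_mem_nhds (lt_add_one c))] with x hx using le_of_lt hx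
  have BL : ∀ σ, Bd (A.src σ) (A.lt σ) := by
    intro σ
    refine ⟨|(TL σ).det| + 1, ?_⟩
    filter_upwards [edL σ, evb (tendsto_det (hTL σ)).abs, hf] with x h1 h2 h3
    rw [← h1]
    exact mul_le_mul_of_nonneg_right h2 (h3 _).le
  have BR : ∀ σ, Bd (A.src σ) (A.rt σ) := by
    intro σ
    refine ⟨|(TR σ).det| + 1, ?_⟩
    filter_upwards [edR σ, evb (tendsto_det (hTR σ)).abs, hf] with x h1 h2 h3
    rw [← h1]
    exact mul_le_mul_of_nonneg_right h2 (h3 _).le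
  have Bto : ∀ s, Bd s A.s0 := by
    intro s
    obtain ⟨σ, σ', rfl, k2, k3⟩ := A.h1 s
    refine Bd_trans (BR σ) ?_
    rw [← k2, ← k3]
    exact BL σ'
  have Bfrom : ∀ s, Bd A.s0 s := by
    intro s
    have := A.h2 s
    induction this with
    | refl => exact Bto _
    | tail _ hst ih =>
      obtain ⟨σ, rfl, rfl | rfl⟩ := hst
      · exact Bd_trans ih (BL σ)
      · exact Bd_trans ih (BR σ)
  have lowb : ∀ {g : X → ℝ} {c : ℝ} {s t : A.S}, Tendsto g U (𝓝 c) → (∀ᶠ x in U, |g x| * f s x = f t x) → c ≠ 0 := by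
    intro g c s t hg h hc
    obtain ⟨B, hB⟩ := Bd_trans (Bto t) (Bfrom s)
    have h0 : Tendsto (fun x => B * |g x|) U (𝓝 (B * |c|)) := hg.abs.const_mul B
    have h1 : (1 : ℝ) ≤ B * |c| := by
      refine ge_of_tendsto h0 ?_
      filter_upwards [h, hB, hf] with x h1 h2 h3
      rw [← h1] at h2
      have := h3 s
      by_contra hcon
      push Not at hcon
      nlinarith
    rw [hc] at h1
    norm_num at h1
  have dTL : ∀ σ, (TL σ).det ≠ 0 := fun σ => lowb (tendsto_det (hTL σ)) (edL σ)
  have dTR : ∀ σ, (TR σ).det ≠ 0 := fun σ => lowb (tendsto_det (hTR σ)) (edR σ)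
  have good : ∀ σ, GoodPair J (TL σ) (TR σ) := by
    intro σ
    refine ⟨?_, ?_, dTL σ, dTR σ, ?_, ?_, ?_⟩
    · exact isClosed_TNN.mem_of_tendsto (hTL σ) (hP.mono fun x h => h.tl σ)
    · exact isClosed_TNN.mem_of_tendsto (hTR σ) (hP.mono fun x h => h.tr σ)
    · exact isClosed_Up.mem_of_tendsto (hTL σ) (hP.mono fun x h => h.toFr.upL hJ σ)
    · have : Continuous fun Y : Mat n => Yᵀ := by fun_prop
      exact isClosed_Up.mem_of_tendsto ((this.tendsto _).comp (hTR σ)) (hP.mono fun x h => h.toFr.upR hJ σ)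
    · exact isClosed_Up.mem_of_tendsto (tendsto_mul (tendsto_mul (tendsto_inv (hTR σ) (dTR σ)) (hTL σ)) tendsto_const_nhds)
        (hP.mono fun x h => h.toFr.upB hJ σ)
  set Bz : Mat n := (TR A.σz)⁻¹ * TL A.σz * J with hBz
  have tBz : Tendsto (fun x => A.Bz J (R x) (M x)) U (𝓝 Bz) :=
    tendsto_mul (tendsto_mul (tendsto_inv (hTR _) (dTR _)) (hTL _)) tendsto_const_nhds
  have uBz : Up Bz := (good A.σz).ub
  have Bz0 : ∀ i, 0 < Bz i i := by
    intro i
    refine lt_of_le_of_ne ?_ (uBz.diag_ne (det_mul_ne (det_mul_ne (det_inv_ne (dTR _)) (dTL _)) hJ.det_ne) i).symm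
    exact ge_of_tendsto (tendsto_entry tBz i i) (hP.mono fun x h => (h.bz i).le)
  have Bz1 : ∀ i i' : Fin n, i'.1 = i.1 + 1 → Bz i i' ≤ 0 := fun i i' hi =>
    le_of_tendsto (tendsto_entry tBz i i') (hP.mono fun x h => h.bz' i i' hi)
  set D : Fin n → ℝ := fun i => TL A.σy i i with hD
  have td : ∀ i, Tendsto (fun x => d x i) U (𝓝 (D i)) := by
    intro i
    refine (tendsto_entry (hTL A.σy) i i).congr' ?_
    filter_upwards [hP] with x h using (h.toFr.collar_rel hJ).2.2.1 i
  have Dpos : ∀ i, 0 < D i := fun i => ((good A.σy).posL hJ 1).entry le_rfl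
  have tUt : Tendsto (fun x => J⁻¹ * (A.TR (R x) (M x) A.σy' * J)) U (𝓝 (J⁻¹ * (TR A.σy' * J))) :=
    tendsto_mul tendsto_const_nhds (tendsto_mul (hTR _) tendsto_const_nhds)
  have c1 : TL A.σy * Bz = Bz * (J⁻¹ * (TR A.σy' * J)) := by
    refine tendsto_nhds_unique (tendsto_mul (hTL A.σy) tBz) ?_
    refine (tendsto_mul tBz tUt).congr' ?_
    filter_upwards [hP] with x h using (h.toFr.collar_rel hJ).1.symm
  have c2 : Up (J⁻¹ * (TR A.σy' * J)) :=
    isClosed_Up.mem_of_tendsto tUt (hP.mono fun x h => (h.toFr.collar_rel hJ).2.1)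
  have c4 : ∀ i, (J⁻¹ * (TR A.σy' * J)) i i = D i := by
    intro i
    refine tendsto_nhds_unique (tendsto_entry tUt i i) ((td i).congr' ?_)
    filter_upwards [hP] with x h using ((h.toFr.collar_rel hJ).2.2.2 i).symm
  have Dle : ∀ i j, i ≤ j → D j ≤ D i := fun i j hij =>
    le_of_tendsto_of_tendsto (td j) (td i) (hP.mono fun x h => h.danti.antitone hij)
  have Danti : StrictAnti D := by
    intro i j hij
    have hlt : i.1 + 1 < n := by have := j.2; rw [Fin.lt_def] at hij; omega
    set i' : Fin n := ⟨i.1 + 1, hlt⟩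
    have := collar (d := D) hJ ((good A.σy).posL hJ) (good A.σy).ul ((good A.σy').posR hJ)
      (by rw [minvl hJ.det_ne]) c2 uBz c1 Bz0 (fun i => rfl) c4 i i' rfl
    have h2 : D i' ≤ D i := Dle _ _ (by rw [Fin.le_def]; simp [i'])
    have h3 : D j ≤ D i' := Dle _ _ (by rw [Fin.lt_def] at hij; rw [Fin.le_def]; simp only [i']; omega)
    refine lt_of_le_of_lt h3 (lt_of_le_of_ne h2 fun h4 => ?_)
    rw [h4, sub_self, zero_mul] at this
    exact lt_irrefl _ this
  -- normalised eigenvectors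
  let δ : X → Fin n → ℝ := fun x j => ∑ i, |M x A.s0 i j|
  have hδ : ∀ᶠ x in U, ∀ j, 0 < δ x j := by
    filter_upwards [hP] with x h j
    refine lt_of_le_of_ne (Finset.sum_nonneg fun i _ => abs_nonneg _) fun h0 => ?_
    rw [eq_comm, Finset.sum_eq_zero_iff_of_nonneg (fun i _ => abs_nonneg _)] at h0
    refine h.det A.s0 (Matrix.det_eq_zero_of_column_eq_zero j fun i => ?_)
    simpa using h0 i (Finset.mem_univ i)
  let V : X → Mat n := fun x => M x A.s0 * diagonal (fun j => (δ x j)⁻¹)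
  have hVe : ∀ x i j, V x i j = M x A.s0 i j / δ x j := fun x i j => by
    simp only [V, Matrix.mul_diagonal, div_eq_mul_inv]
  have hVabs : ∀ᶠ x in U, ∀ i j, |V x i j| ≤ 1 := by
    filter_upwards [hδ] with x h i j
    rw [hVe, abs_div, abs_of_pos (h j), div_le_one (h j)]
    exact Finset.single_le_sum (f := fun i => |M x A.s0 i j|) (fun i _ => abs_nonneg _) (Finset.mem_univ i)
  obtain ⟨V1, hV1⟩ := ultra_mat U (f := V) (a := -1) (b := 1) (by
    filter_upwards [hVabs] with x h i j using abs_le.1 (h i j))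
  have hVsum : ∀ j, ∑ i, |V1 i j| = 1 := by
    intro j
    have h1 : Tendsto (fun x => ∑ i, |V x i j|) U (𝓝 (∑ i, |V1 i j|)) :=
      tendsto_finsetSum _ fun i _ => (tendsto_entry hV1 i j).abs
    refine tendsto_nhds_unique h1 (tendsto_const_nhds.congr' ?_)
    filter_upwards [hδ] with x h
    simp only [hVe, abs_div, abs_of_pos (h j)]
    rw [← Finset.sum_div]
    exact (div_self (h j).ne').symm
  have tD : Tendsto (fun x => diagonal (d x)) U (𝓝 (diagonal D)) := by
    have : Continuous fun e : Fin n → ℝ => (diagonal e : Mat n) := by fun_prop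
    exact (this.tendsto _).comp (tendsto_pi_nhds.2 td)
  have hVeig : R x1 A.al * V1 = V1 * diagonal D := by
    refine tendsto_nhds_unique (tendsto_mul (hRt A.al) hV1) ((tendsto_mul hV1 tD).congr' ?_)
    filter_upwards [hP] with x h
    simp only [V]
    rw [← Matrix.mul_assoc, h.eig, Matrix.mul_assoc, Matrix.mul_assoc, diagonal_mul_diagonal, diagonal_mul_diagonal]
    simp only [mul_comm]
  have dV1 : V1.det ≠ 0 := by
    refine eig_det Danti.injective hVeig fun j => ?_
    by_contra hcon
    push Not at hcon
    have := hVsum j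
    simp [hcon] at this
  -- ratios of the normalising factors
  obtain ⟨σ, σ', k1, k2, k3⟩ := A.h1 A.s0
  have tC : Tendsto (fun x => A.TR (R x) (M x) σ * A.TL (R x) (M x) σ') U (𝓝 (TR σ * TL σ')) :=
    tendsto_mul (hTR _) (hTL _)
  have Cpos : ∀ i j, 0 < (TR σ * TL σ') i j :=
    prod_pos' ((good σ).posR hJ 1) ((good σ').posL hJ 1) (good σ).tr.entry (good σ').tl.entry
  have tQ : Tendsto (fun x => A.sg σ • ((V x)⁻¹ * (R x (A.gR σ * A.gL σ') * V x))) U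
      (𝓝 (A.sg σ • (V1⁻¹ * (R x1 (A.gR σ * A.gL σ') * V1)))) :=
    (tendsto_mul (tendsto_inv hV1 dV1) (tendsto_mul (hRt _) hV1)).const_smul _
  have ratio : ∀ i j, ∃ r, Tendsto (fun x => δ x i / δ x j) U (𝓝 r) := by
    intro i j
    refine ⟨_, ((tendsto_entry tQ i j).div (tendsto_entry tC i j) (Cpos i j).ne').congr' ?_⟩
    filter_upwards [hP, hδ, (tendsto_entry tC i j).eventually_ne (Cpos i j).ne'] with x h hd hne
    have e3 : A.TR (R x) (M x) σ * A.TL (R x) (M x) σ' =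
        A.sg σ • ((M x A.s0)⁻¹ * (R x (A.gR σ * A.gL σ') * M x A.s0)) := by
      rw [Aut.TR, Aut.TL, k1, k2, k3, Matrix.smul_mul, map_mul]
      simp only [Matrix.mul_assoc]
      rw [minvl (h.det _)]
    have e4 : (A.sg σ • ((V x)⁻¹ * (R x (A.gR σ * A.gL σ') * V x))) i j =
        δ x i * (A.TR (R x) (M x) σ * A.TL (R x) (M x) σ') i j * (δ x j)⁻¹ := by
      have e5 : A.sg σ • ((V x)⁻¹ * (R x (A.gR σ * A.gL σ') * V x)) =
          diagonal (δ x) * (A.TR (R x) (M x) σ * A.TL (R x) (M x) σ') * diagonal (fun j => (δ x j)⁻¹) := by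
        rw [e3]
        simp only [V]
        rw [Matrix.mul_inv_rev, inv_diag (fun i => inv_pos.2 (hd i))]
        simp only [inv_inv, Matrix.mul_smul, Matrix.smul_mul, Matrix.mul_assoc]
      rw [e5, Matrix.mul_diagonal, Matrix.diagonal_mul]
    simp only [Pi.div_apply]
    rw [e4]
    have := (hd j).ne'
    field_simp
  choose r hr using ratio
  have rne : ∀ i j, r i j ≠ 0 := by
    intro i j h0
    have h1 := (hr i j).mul (hr j i)
    rw [h0, zero_mul] at h1
    have h2 : Tendsto (fun x => δ x i / δ x j * (δ x j / δ x i)) U (𝓝 1) := by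
      refine tendsto_const_nhds.congr' ?_
      filter_upwards [hδ] with x h
      have := (h i).ne'
      have := (h j).ne'
      field_simp
    exact zero_ne_one (tendsto_nhds_unique h1 h2)
  let z : Fin n := ⟨0, hn⟩
  let M' : X → A.S → Mat n := fun x => resc (M x) (fun _ _ => (δ x z)⁻¹)
  have hP' : ∀ᶠ x in U, Pos A J (R x) (M' x) (d x) := by
    filter_upwards [hP, hδ] with x h h2
    exact h.resc hJ fun _ _ => inv_pos.2 (h2 z)
  have hTL' : ∀ σ, Tendsto (fun x => A.TL (R x) (M' x) σ) U (𝓝 (TL σ)) := by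
    intro σ
    refine (hTL σ).congr' ?_
    filter_upwards [hδ] with x h
    ext i j
    simp only [M']
    rw [TL_resc_apply _ (fun _ _ => inv_pos.2 (h z))]
    have := (h z).ne'
    field_simp
  have hTR' : ∀ σ, Tendsto (fun x => A.TR (R x) (M' x) σ) U (𝓝 (TR σ)) := by
    intro σ
    refine (hTR σ).congr' ?_
    filter_upwards [hδ] with x h
    ext i j
    simp only [M']
    rw [TR_resc_apply _ (fun _ _ => inv_pos.2 (h z))]
    have := (h z).ne'
    field_simp
  have lim0 : ∃ L, Tendsto (fun x => M' x A.s0) U (𝓝 L) ∧ L.det ≠ 0 := by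
    refine ⟨V1 * diagonal (fun i => r i z), ?_, ?_⟩
    · have td : Tendsto (fun x => (diagonal (fun i => δ x i / δ x z) : Mat n)) U (𝓝 (diagonal fun i => r i z)) := by
        have : Continuous fun e : Fin n → ℝ => (diagonal e : Mat n) := by fun_prop
        exact (this.tendsto _).comp (tendsto_pi_nhds.2 fun i => hr i z)
      refine (tendsto_mul hV1 td).congr' ?_
      filter_upwards [hδ] with x h
      simp only [V, M', resc]
      rw [Matrix.mul_assoc, diagonal_mul_diagonal]
      congr 2
      funext i
      have := (h i).ne'
      field_simp
    · refine det_mul_ne dV1 ?_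
      rw [Matrix.det_diagonal]; exact Finset.prod_ne_zero_iff.2 fun i _ => rne _ _
  have lims : ∀ s, ∃ L, Tendsto (fun x => M' x s) U (𝓝 L) ∧ L.det ≠ 0 := by
    intro s
    have := A.h2 s
    induction this with
    | refl => exact lim0
    | tail _ hst ih =>
      obtain ⟨τ, rfl, rfl | rfl⟩ := hst
      · obtain ⟨L, hL, hL'⟩ := ih
        refine ⟨R x1 (A.gL τ)⁻¹ * (L * TL τ), ?_, det_mul_ne (hom_det _ _) (det_mul_ne hL' (dTL _))⟩
        refine (tendsto_mul (hRt _) (tendsto_mul hL (hTL' τ))).congr' ?_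
        filter_upwards [hP'] with x h
        rw [Aut.TL, minvl (h.det _), ← Matrix.mul_assoc, hom_inv_mul, Matrix.one_mul]
      · obtain ⟨L, hL, hL'⟩ := ih
        refine ⟨A.sg τ • (R x1 (A.gR τ)⁻¹ * (L * TR τ)), ?_, ?_⟩
        · refine ((tendsto_mul (hRt _) (tendsto_mul hL (hTR' τ))).const_smul (A.sg τ)).congr' ?_
          filter_upwards [hP'] with x h
          rw [Aut.TR, Matrix.mul_smul, minvl (h.det _), Matrix.mul_smul, ← Matrix.mul_assoc, hom_inv_mul, Matrix.one_mul,
            smul_smul]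
          rcases A.hsg τ with h | h <;> rw [h] <;> simp
        · rw [Matrix.det_smul]
          exact mul_ne_zero (pow_ne_zero _ (sg_ne _ _)) (det_mul_ne (hom_det _ _) (det_mul_ne hL' (dTR _)))
  choose L hL dL using lims
  have fL : ∀ σ, A.TL (R x1) L σ = TL σ := fun σ => tendsto_nhds_unique (tendsto_TL hRt hL dL σ) (hTL' σ)
  have fR : ∀ σ, A.TR (R x1) L σ = TR σ := fun σ => tendsto_nhds_unique (tendsto_TR hRt hL dL σ) (hTR' σ)
  have fB : A.Bz J (R x1) L = Bz := by rw [Aut.Bz, fL, fR]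
  refine ⟨L, D, ⟨dL, Dpos, ?_, fun s => ?_, fun s => ?_⟩, Danti, fun σ => ?_, fun σ => ?_, fun i => ?_, fun i i' hi => ?_⟩
  · refine tendsto_nhds_unique (tendsto_mul (hRt A.al) (hL _)) ((tendsto_mul (hL _) tD).congr' ?_)
    filter_upwards [hP'] with x h using h.eig.symm
  · exact isClosed_Up.mem_of_tendsto (tendsto_mul (tendsto_inv (hL s) (dL s)) (tendsto_mul (hRt _)
      (tendsto_mul (hL _) tendsto_const_nhds))) (hP'.mono fun x h => h.up s)
  · exact isClosed_Up.mem_of_tendsto (tendsto_mul tendsto_const_nhds (tendsto_mul (tendsto_inv (hL s) (dL s)) (tendsto_mul (hRt _)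
      (tendsto_mul (hL _) tendsto_const_nhds)))) (hP'.mono fun x h => h.uq s)
  · rw [fL]; exact (good σ).tl
  · rw [fR]; exact (good σ).tr
  · rw [fB]; exact Bz0 i
  · rw [fB]; exact Bz1 i i' hi

end TP


/-! ## One-parameter groups -/
namespace RT
open Filter Topology

section gen
variable {𝔸 : Type*} [NormedRing 𝔸] [NormedAlgebra ℝ 𝔸] [CompleteSpace 𝔸]

lemma oneparam_deriv {φ : ℝ → 𝔸} (hc : Continuous φ) (h0 : φ 0 = 1)
    (hm : ∀ s t, φ (s + t) = φ s * φ t) : ∃ X, HasDerivAt φ X 0 := by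
  let F : ℝ → 𝔸 := fun h => ∫ s in (0:ℝ)..h, φ s
  have hF : ∀ t, HasDerivAt F (φ t) t := fun t =>
    intervalIntegral.integral_hasDerivAt_right (hc.intervalIntegrable _ _)
      (hc.stronglyMeasurableAtFilter _ _) hc.continuousAt
  have h1 : Tendsto (fun t => t⁻¹ • F t) (𝓝[≠] 0) (𝓝 1) := by
    have := (hF 0).tendsto_slope_zero
    simpa [h0, F] using this
  have h2 : ∀ᶠ t in 𝓝[≠] (0:ℝ), IsUnit (t⁻¹ • F t) :=
    h1.eventually ((Units.isOpen (R := 𝔸)).mem_nhds isUnit_one)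
  obtain ⟨h, hu, hh⟩ := (h2.and self_mem_nhdsWithin).exists
  have hh : h ≠ 0 := hh
  obtain ⟨V, hV⟩ := hu
  have hFV : F h = h • (V : 𝔸) := by rw [hV, smul_smul, mul_inv_cancel₀ hh, one_smul]
  have key : ∀ t, φ t = (F (t + h) - F t) * (h⁻¹ • (↑V⁻¹ : 𝔸)) := by
    intro t
    have : F (t + h) - F t = φ t * F h := by
      simp only [F]
      rw [intervalIntegral.integral_interval_sub_left (hc.intervalIntegrable _ _) (hc.intervalIntegrable _ _)]
      have := (ContinuousLinearMap.mul ℝ 𝔸 (φ t)).intervalIntegral_comp_comm (hc.intervalIntegrable (μ := MeasureTheory.volume) 0 h)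
      simp only [ContinuousLinearMap.mul_apply'] at this
      rw [← this]
      simp_rw [← hm]
      rw [intervalIntegral.integral_comp_add_left]
      simp
    rw [this, hFV, mul_smul_comm, mul_smul_comm, smul_mul_assoc, smul_smul, mul_assoc, V.mul_inv,
      inv_mul_cancel₀ hh, one_smul, mul_one]
  refine ⟨(φ (0 + h) - φ 0) * (h⁻¹ • (↑V⁻¹ : 𝔸)), ?_⟩
  have h3 : HasDerivAt (fun t => (F (t + h) - F t) * (h⁻¹ • (↑V⁻¹ : 𝔸))) ((φ (0 + h) - φ 0) * (h⁻¹ • (↑V⁻¹ : 𝔸))) 0 := by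
    exact (((hF (0 + h)).comp_add_const 0 h).sub (hF 0)).mul_const _
  exact h3.congr_of_eventuallyEq (Eventually.of_forall key)

lemma oneparam_pow {φ : ℝ → 𝔸} (h0 : φ 0 = 1)
    (hm : ∀ s t, φ (s + t) = φ s * φ t) (x : ℝ) (k : ℕ) : φ (k * x) = φ x ^ k := by
  induction k with
  | zero => simp [h0]
  | succ k ih => rw [pow_succ, ← ih, ← hm]; push_cast; ring_nf

lemma pow_sub_bound {a b : 𝔸} {C D : ℝ} {k : ℕ} (hC : 0 ≤ C) (ha : ∀ i ≤ k, ‖a ^ i‖ ≤ C)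
    (hb : ∀ i ≤ k, ‖b ^ i‖ ≤ D) : ∀ i ≤ k, ‖a ^ i - b ^ i‖ ≤ i * (C * ‖a - b‖ * D) := by
  -- a^(i) - b^(i) telescoping
  intro i hi
  have : ∀ j ≤ i, ‖a ^ i - a ^ (i - j) * b ^ j‖ ≤ j * (C * ‖a - b‖ * D) := by
    intro j
    induction j with
    | zero => intro _; simp
    | succ j ih =>
      intro hj
      have e : a ^ i - a ^ (i - (j + 1)) * b ^ (j + 1)
          = (a ^ i - a ^ (i - j) * b ^ j) + a ^ (i - (j + 1)) * (a - b) * b ^ j := by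
        have : i - j = (i - (j + 1)) + 1 := by omega
        rw [this, pow_succ a, pow_succ' b]
        noncomm_ring
      rw [e]
      have h1 := ih (by omega)
      have h2 : ‖a ^ (i - (j + 1)) * (a - b) * b ^ j‖ ≤ C * ‖a - b‖ * D := by
        refine (norm_mul_le _ _).trans ?_
        refine mul_le_mul ((norm_mul_le _ _).trans ?_) (hb _ (by omega)) (norm_nonneg _) (by positivity)
        exact mul_le_mul_of_nonneg_right (ha _ (by omega)) (norm_nonneg _)
      calc _ ≤ _ := norm_add_le _ _
        _ ≤ j * (C * ‖a - b‖ * D) + C * ‖a - b‖ * D := add_le_add h1 h2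
        _ = _ := by push_cast; ring
  have := this i le_rfl
  simpa using this

lemma oneparam_limit {φ : ℝ → 𝔸} (hc : Continuous φ) (h0 : φ 0 = 1)
    (hm : ∀ s t, φ (s + t) = φ s * φ t) {X : 𝔸} (hX : HasDerivAt φ X 0) (x : ℝ) :
    Tendsto (fun k : ℕ => (1 + (x / k) • X) ^ k) atTop (𝓝 (φ x)) := by
  -- bound for φ
  obtain ⟨D, hD⟩ : ∃ D, ∀ t ∈ Set.Icc (-|x|) |x|, ‖φ t‖ ≤ D :=
    isCompact_Icc.exists_bound_of_continuousOn hc.continuousOn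
  set C : ℝ := (max ‖(1:𝔸)‖ 1) * Real.exp (|x| * ‖X‖) with hCdef
  have hC : 0 ≤ C := by positivity
  have hlim : Tendsto (fun k : ℕ => (k:ℝ) * ‖(1 + (x / k) • X) - φ (x / k)‖) atTop (𝓝 0) := by
    by_cases hx : x = 0
    · simp [hx, h0]
    have h1 : Tendsto (fun k : ℕ => x / (k:ℝ)) atTop (𝓝[≠] 0) := by
      rw [tendsto_nhdsWithin_iff]
      refine ⟨tendsto_const_div_atTop_nhds_zero_nat x, ?_⟩
      filter_upwards [eventually_gt_atTop 0] with k hk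
      have : (k:ℝ) ≠ 0 := by positivity
      exact div_ne_zero hx this
    have h2 := hX.tendsto_slope_zero.comp h1
    have h3 : Tendsto (fun k : ℕ => |x| * ‖X - (x / (k:ℝ))⁻¹ • (φ (x / k) - 1)‖) atTop (𝓝 0) := by
      have := ((tendsto_const_nhds (x := X)).sub h2).norm.const_mul |x|
      simpa [h0, Function.comp_def] using this
    refine h3.congr' ?_
    filter_upwards [eventually_gt_atTop 0] with k hk
    have hk' : (k:ℝ) ≠ 0 := by positivity
    have e : (1 + (x / k) • X) - φ (x / k) = (x / (k:ℝ)) • (X - (x / (k:ℝ))⁻¹ • (φ (x / k) - 1)) := by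
      rw [smul_sub, smul_smul, mul_inv_cancel₀ (div_ne_zero hx hk'), one_smul]; abel
    rw [e, norm_smul, ← mul_assoc]
    congr 1
    rw [Real.norm_eq_abs, abs_div, Nat.abs_cast]
    field_simp
  have hbd : ∀ᶠ k : ℕ in atTop, ‖(1 + (x / k) • X) ^ k - φ x‖ ≤
      (k * ‖(1 + (x / k) • X) - φ (x / k)‖) * (C * D) := by
    filter_upwards [eventually_gt_atTop 0] with k hk
    have hk' : (0:ℝ) < k := by positivity
    have hb : φ x = φ (x / k) ^ k := by
      rw [← oneparam_pow h0 hm]; congr 1; field_simp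
    rw [hb]
    have := pow_sub_bound (a := 1 + (x / k) • X) (b := φ (x / k)) (C := C) (D := D) (k := k) hC ?_ ?_ k le_rfl
    · refine this.trans (le_of_eq (by ring))
    · intro i hi
      have h1 : ‖(1 + (x / k) • X) ^ i‖ ≤ max ‖(1:𝔸)‖ 1 * (1 + |x| / k * ‖X‖) ^ i := by
        clear hi
        induction i with
        | zero => simp
        | succ i ih =>
          rw [pow_succ, mul_add, mul_one]
          refine (norm_add_le _ _).trans ?_
          have : ‖(1 + (x / ↑k) • X) ^ i * (x / ↑k) • X‖ ≤ ‖(1 + (x / k) • X) ^ i‖ * (|x| / k * ‖X‖) := by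
            refine (norm_mul_le _ _).trans ?_
            rw [norm_smul, Real.norm_eq_abs, abs_div, Nat.abs_cast]
          calc _ ≤ ‖(1 + (x / k) • X) ^ i‖ + ‖(1 + (x / k) • X) ^ i‖ * (|x| / k * ‖X‖) := by gcongr
            _ = ‖(1 + (x / k) • X) ^ i‖ * (1 + |x| / k * ‖X‖) := by ring
            _ ≤ (max ‖(1:𝔸)‖ 1 * (1 + |x| / k * ‖X‖) ^ i) * (1 + |x| / k * ‖X‖) := by gcongr
            _ = _ := by ring
      refine h1.trans ?_
      rw [hCdef]
      gcongr
      calc (1 + |x| / k * ‖X‖) ^ i ≤ Real.exp (|x| / k * ‖X‖) ^ i := by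
            gcongr; rw [add_comm]; exact Real.add_one_le_exp _
        _ ≤ Real.exp (|x| / k * ‖X‖) ^ k := by
            refine pow_le_pow_right₀ (Real.one_le_exp (by positivity)) hi
        _ = _ := by rw [← Real.exp_nat_mul]; congr 1; field_simp
    · intro i hi
      rw [← oneparam_pow h0 hm]
      apply hD
      rw [Set.mem_Icc, ← abs_le, abs_mul, abs_div, Nat.abs_cast, Nat.abs_cast]
      have : (i:ℝ) ≤ k := by exact_mod_cast hi
      rw [mul_div_assoc', div_le_iff₀ hk', mul_comm]
      gcongr
  rw [tendsto_iff_norm_sub_tendsto_zero]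
  refine squeeze_zero' (Eventually.of_forall fun _ => norm_nonneg _) hbd ?_
  simpa using hlim.mul_const (C * D)

end gen

/-- elements of SL2 -/
def eu (x : ℝ) : SL 2 ℝ := ⟨!![1, x; 0, 1], by simp⟩
def el (x : ℝ) : SL 2 ℝ := ⟨!![1, 0; x, 1], by simp⟩
noncomputable def ea (t : ℝ) : SL 2 ℝ := ⟨!![Real.exp t, 0; 0, Real.exp (-t)], by
  simp [← Real.exp_add]⟩
def ew : SL 2 ℝ := ⟨!![0, -1; 1, 0], by simp⟩

@[simp] lemma eu_coe (x) : (eu x : Matrix (Fin 2) (Fin 2) ℝ) = !![1, x; 0, 1] := rfl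
@[simp] lemma el_coe (x) : (el x : Matrix (Fin 2) (Fin 2) ℝ) = !![1, 0; x, 1] := rfl
@[simp] lemma ea_coe (x) : (ea x : Matrix (Fin 2) (Fin 2) ℝ) = !![Real.exp x, 0; 0, Real.exp (-x)] := rfl
@[simp] lemma ew_coe : (ew : Matrix (Fin 2) (Fin 2) ℝ) = !![0, -1; 1, 0] := rfl

lemma sl_ext {A B : SL 2 ℝ} (h : (A : Matrix (Fin 2) (Fin 2) ℝ) = B) : A = B := Subtype.ext h

lemma eu_add (x y) : eu (x + y) = eu x * eu y := by
  apply sl_ext; rw [SG.slmul]; ext i j; fin_cases i <;> fin_cases j <;> simp [add_comm]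
lemma el_add (x y) : el (x + y) = el x * el y := by
  apply sl_ext; rw [SG.slmul]; ext i j; fin_cases i <;> fin_cases j <;> simp [add_comm]
lemma ea_add (x y) : ea (x + y) = ea x * ea y := by
  apply sl_ext; rw [SG.slmul]; ext i j; fin_cases i <;> fin_cases j <;> simp [Real.exp_add, mul_comm]
lemma eu_zero : eu 0 = 1 := by
  apply sl_ext; rw [SG.slone]; ext i j; fin_cases i <;> fin_cases j <;> simp
lemma el_zero : el 0 = 1 := by
  apply sl_ext; rw [SG.slone]; ext i j; fin_cases i <;> fin_cases j <;> simp
lemma ea_zero : ea 0 = 1 := by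
  apply sl_ext; rw [SG.slone]; ext i j; fin_cases i <;> fin_cases j <;> simp

lemma cont_sl {X : Type*} [TopologicalSpace X] {F : X → SL 2 ℝ}
    (h : Continuous fun x => (F x : Matrix (Fin 2) (Fin 2) ℝ)) : Continuous F :=
  continuous_induced_rng.2 h

lemma eu_cont : Continuous eu := by
  apply cont_sl; refine continuous_matrix fun i j => ?_
  fin_cases i <;> fin_cases j <;> simp <;> fun_prop
lemma el_cont : Continuous el := by
  apply cont_sl; refine continuous_matrix fun i j => ?_
  fin_cases i <;> fin_cases j <;> simp <;> fun_prop
lemma ea_cont : Continuous ea := by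
  apply cont_sl; refine continuous_matrix fun i j => ?_
  fin_cases i <;> fin_cases j <;> simp <;> fun_prop

lemma ea_eu (t x) : ea t * eu x * ea (-t) = eu (Real.exp (2 * t) * x) := by
  apply sl_ext; rw [SG.slmul, SG.slmul]
  have h : Real.exp (2 * t) = Real.exp t * Real.exp t := by rw [← Real.exp_add]; ring_nf
  have h' : Real.exp t * Real.exp (-t) = 1 := by rw [← Real.exp_add]; simp
  ext i j; fin_cases i <;> fin_cases j <;> simp [h] <;> first | linear_combination h' | linear_combination x * h' | linarith | ring
lemma ea_el (t x) : ea t * el x * ea (-t) = el (Real.exp (-2 * t) * x) := by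
  apply sl_ext; rw [SG.slmul, SG.slmul]
  have h : Real.exp (-(2 * t)) = Real.exp (-t) * Real.exp (-t) := by rw [← Real.exp_add]; ring_nf
  have h' : Real.exp t * Real.exp (-t) = 1 := by rw [← Real.exp_add]; simp
  ext i j; fin_cases i <;> fin_cases j <;> simp [h] <;> first | linear_combination h' | linear_combination x * h' | linarith | ring

/-- Gauss decomposition -/
lemma gauss (g : SL 2 ℝ) (h : 0 < g.1 0 0) :
    g = el (g.1 1 0 / g.1 0 0) * ea (Real.log (g.1 0 0)) * eu (g.1 0 1 / g.1 0 0) := by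
  apply sl_ext; rw [SG.slmul, SG.slmul]
  have hd := g.2
  rw [Matrix.det_fin_two] at hd
  ext i j; fin_cases i <;> fin_cases j <;> simp [Real.exp_log h, Real.exp_neg] <;> field_simp <;> linarith

lemma eu_el (x y : ℝ) (h : 0 < 1 + x * y) :
    eu x * el y * eu (-x) = el (y / (1 + x * y)) * ea (Real.log (1 + x * y)) * eu (-x ^ 2 * y / (1 + x * y)) := by
  have e : (eu x * el y * eu (-x)).1 = !![1 + x * y, -x^2*y; y, 1 - x * y] := by
    change ((eu x * el y * eu (-x) : SL 2 ℝ) : Matrix (Fin 2) (Fin 2) ℝ) = _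
    rw [SG.slmul, SG.slmul]
    ext i j; fin_cases i <;> fin_cases j <;> simp <;> ring
  have := gauss (eu x * el y * eu (-x)) (by rw [e]; simpa using h)
  rw [e] at this
  simpa using this

section gen2
variable {𝔸 : Type*} [NormedRing 𝔸] [NormedAlgebra ℝ 𝔸] [CompleteSpace 𝔸]

theorem sl2_triple (f : SL 2 ℝ →* 𝔸) (hf : Continuous f) : ∃ X Y H : 𝔸,
    H * X - X * H = (2:ℝ) • X ∧ H * Y - Y * H = (-2:ℝ) • Y ∧ X * Y - Y * X = H ∧
    (∀ x : ℝ, Tendsto (fun k : ℕ => (1 + (x / k) • X) ^ k) atTop (𝓝 (f (eu x)))) ∧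
    (∀ x : ℝ, Tendsto (fun k : ℕ => (1 + (x / k) • Y) ^ k) atTop (𝓝 (f (el x)))) ∧
    (∀ x : ℝ, Tendsto (fun k : ℕ => (1 + (x / k) • H) ^ k) atTop (𝓝 (f (ea x)))) ∧
    (∀ g : SL 2 ℝ, ∀ c : ℝ, (∀ x, g * eu x * g⁻¹ = el (c * x)) → f g * X = c • (Y * f g)) ∧
    (∀ g : SL 2 ℝ, ∀ c : ℝ, (∀ x, g * el x * g⁻¹ = eu (c * x)) → f g * Y = c • (X * f g)) ∧
    (∀ g : SL 2 ℝ, ∀ c : ℝ, (∀ x, g * ea x * g⁻¹ = ea (c * x)) → f g * H = c • (H * f g)) ∧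
    (∀ g : SL 2 ℝ, (∀ x, g * eu x * g⁻¹ = eu x) → f g * X = X * f g) ∧
    (∀ g : SL 2 ℝ, (∀ x, g * el x * g⁻¹ = el x) → f g * Y = Y * f g) := by
  have hu0 : f (eu 0) = 1 := by rw [eu_zero, map_one]
  have hl0 : f (el 0) = 1 := by rw [el_zero, map_one]
  have ha0 : f (ea 0) = 1 := by rw [ea_zero, map_one]
  have hum : ∀ s t, f (eu (s + t)) = f (eu s) * f (eu t) := fun s t => by rw [eu_add, map_mul]
  have hlm : ∀ s t, f (el (s + t)) = f (el s) * f (el t) := fun s t => by rw [el_add, map_mul]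
  have ham : ∀ s t, f (ea (s + t)) = f (ea s) * f (ea t) := fun s t => by rw [ea_add, map_mul]
  obtain ⟨X, hX⟩ := oneparam_deriv (φ := fun x => f (eu x)) (hf.comp eu_cont) hu0 hum
  obtain ⟨Y, hY⟩ := oneparam_deriv (φ := fun x => f (el x)) (hf.comp el_cont) hl0 hlm
  obtain ⟨H, hH⟩ := oneparam_deriv (φ := fun x => f (ea x)) (hf.comp ea_cont) ha0 ham
  -- generic conj
  have conj : ∀ (φ ψ : ℝ → SL 2 ℝ) (P Q : 𝔸) (g g' : SL 2 ℝ) (c : ℝ), HasDerivAt (fun x => f (φ x)) P 0 →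
      HasDerivAt (fun x => f (ψ x)) Q 0 → (∀ x, g * φ x * g' = ψ (c * x)) → f g * P * f g' = c • Q := by
    intro φ ψ P Q g g' c hP hQ h
    have h1 : HasDerivAt (fun x => f g * f (φ x) * f g') (f g * P * f g') 0 := (hP.const_mul _).mul_const _
    have h2 : HasDerivAt (fun x => f (ψ (c * x))) (c • Q) 0 := by
      have hl : HasDerivAt (fun x : ℝ => c * x) c 0 := by simpa using (hasDerivAt_id (0:ℝ)).const_mul c
      have hQ' : HasDerivAt (fun x => f (ψ x)) Q (c * 0) := by simpa using hQ
      exact HasDerivAt.scomp (0:ℝ) hQ' hl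
    have e : (fun x => f g * f (φ x) * f g') = fun x => f (ψ (c * x)) := by
      funext x; rw [← h, map_mul, map_mul]
    rw [e] at h1
    exact h1.unique h2
  have conj' : ∀ (φ ψ : ℝ → SL 2 ℝ) (P Q : 𝔸) (g : SL 2 ℝ) (c : ℝ), HasDerivAt (fun x => f (φ x)) P 0 →
      HasDerivAt (fun x => f (ψ x)) Q 0 → (∀ x, g * φ x * g⁻¹ = ψ (c * x)) → f g * P = c • (Q * f g) := by
    intro φ ψ P Q g c hP hQ h
    have h1 := conj φ ψ P Q g g⁻¹ c hP hQ h
    have h2 : f g⁻¹ * f g = 1 := by rw [← map_mul, inv_mul_cancel, map_one]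
    calc f g * P = f g * P * (f g⁻¹ * f g) := by rw [h2, mul_one]
      _ = _ := by rw [← mul_assoc, h1, smul_mul_assoc]
  have hneg : ∀ {φ : ℝ → 𝔸} {P : 𝔸}, HasDerivAt φ P 0 → HasDerivAt (fun x => φ (-x)) (-P) 0 := by
    intro φ P h
    have h' : HasDerivAt φ P (-0) := by simpa using h
    have := HasDerivAt.scomp (0:ℝ) h' (hasDerivAt_neg (0:ℝ))
    exact HasDerivAt.congr_deriv this (by simp)
  have hprod : ∀ {φ : ℝ → 𝔸} {P : 𝔸} (Z : 𝔸), φ 0 = 1 → HasDerivAt φ P 0 →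
      HasDerivAt (fun x => φ x * Z * φ (-x)) (P * Z - Z * P) 0 := by
    intro φ P Z h0 h
    have := (h.mul_const Z).mul (hneg h)
    exact HasDerivAt.congr_deriv this (by simp [h0, sub_eq_add_neg])
  have hexp : ∀ c : ℝ, ∀ Z : 𝔸, HasDerivAt (fun t : ℝ => Real.exp (c * t) • Z) (c • Z) 0 := by
    intro c Z
    have h1 : HasDerivAt (fun t : ℝ => Real.exp (c * t)) c 0 := by
      have := ((hasDerivAt_id (0:ℝ)).const_mul c).exp
      simpa using this
    exact h1.smul_const Z
  refine ⟨X, Y, H, ?_, ?_, ?_, oneparam_limit (hf.comp eu_cont) hu0 hum hX,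
    oneparam_limit (hf.comp el_cont) hl0 hlm hY, oneparam_limit (hf.comp ea_cont) ha0 ham hH,
    fun g c h => conj' _ _ _ _ g c hX hY h, fun g c h => conj' _ _ _ _ g c hY hX h,
    fun g c h => conj' _ _ _ _ g c hH hH h, ?_, ?_⟩
  · have h1 := hprod X ha0 hH
    have e : (fun t => f (ea t) * X * f (ea (-t))) = fun t => Real.exp (2 * t) • X := by
      funext t
      exact conj _ _ _ _ _ _ _ hX hX (ea_eu t)
    rw [e] at h1
    exact h1.unique (hexp 2 X)
  · have h1 := hprod Y ha0 hH
    have e : (fun t => f (ea t) * Y * f (ea (-t))) = fun t => Real.exp (-2 * t) • Y := by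
      funext t
      exact conj _ _ _ _ _ _ _ hY hY (ea_el t)
    rw [e] at h1
    exact h1.unique (hexp (-2) Y)
  · have key : ∀ x : ℝ, f (eu x) * Y * f (eu (-x)) = Y + x • H - (x ^ 2) • X := by
      intro x
      have h1 : HasDerivAt (fun y => f (eu x) * f (el y) * f (eu (-x))) (f (eu x) * Y * f (eu (-x))) 0 :=
        (hY.const_mul _).mul_const _
      have hp : HasDerivAt (fun y : ℝ => 1 + x * y) x 0 := by
        simpa using ((hasDerivAt_id (0:ℝ)).const_mul x).const_add 1
      have d1 : HasDerivAt (fun y : ℝ => y / (1 + x * y)) 1 0 := by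
        have := (hasDerivAt_id (0:ℝ)).div hp (by simp)
        exact HasDerivAt.congr_deriv this (by simp)
      have d2 : HasDerivAt (fun y : ℝ => Real.log (1 + x * y)) x 0 := by
        have := hp.log (by simp)
        simpa using this
      have d3 : HasDerivAt (fun y : ℝ => -x ^ 2 * y / (1 + x * y)) (-x ^ 2) 0 := by
        have := ((hasDerivAt_id (0:ℝ)).const_mul (-x ^ 2)).div hp (by simp)
        exact HasDerivAt.congr_deriv this (by simp)
      have c1 : HasDerivAt (fun y : ℝ => f (el (y / (1 + x * y)))) ((1:ℝ) • Y) 0 :=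
        HasDerivAt.scomp (g₁ := fun z : ℝ => f (el z)) (0:ℝ) (by simpa using hY) d1
      have c2 : HasDerivAt (fun y : ℝ => f (ea (Real.log (1 + x * y)))) (x • H) 0 :=
        HasDerivAt.scomp (g₁ := fun z : ℝ => f (ea z)) (0:ℝ) (by simpa using hH) d2
      have c3 : HasDerivAt (fun y : ℝ => f (eu (-x ^ 2 * y / (1 + x * y)))) ((-x ^ 2) • X) 0 :=
        HasDerivAt.scomp (g₁ := fun z : ℝ => f (eu z)) (0:ℝ) (by simpa using hX) d3
      have h2 := (c1.mul c2).mul c3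
      have h3 : (fun y => f (eu x) * f (el y) * f (eu (-x))) =ᶠ[𝓝 0]
          ((fun y : ℝ => f (el (y / (1 + x * y)))) * (fun y : ℝ => f (ea (Real.log (1 + x * y))))) *
            (fun y : ℝ => f (eu (-x ^ 2 * y / (1 + x * y)))) := by
        have : ∀ᶠ y in 𝓝 (0:ℝ), 0 < 1 + x * y :=
          hp.continuousAt.eventually (lt_mem_nhds (by simp))
        filter_upwards [this] with y hy
        simp only [Pi.mul_apply]
        rw [← map_mul, ← map_mul, eu_el _ _ hy, map_mul, map_mul]
      have h4 := h1.unique (h2.congr_of_eventuallyEq h3)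
      rw [h4]
      simp [hl0, ha0, hu0, sub_eq_add_neg]
    have h1 := hprod Y hu0 hX
    have e : (fun t => f (eu t) * Y * f (eu (-t))) = fun x => Y + x • H - (x ^ 2) • X := by
      funext x; exact key x
    rw [e] at h1
    have h2 : HasDerivAt (fun x : ℝ => Y + x • H - (x ^ 2) • X) H 0 := by
      have h3 := (((hasDerivAt_id (0:ℝ)).smul_const H).const_add Y).sub (((hasDerivAt_id (0:ℝ)).pow 2).smul_const X)
      exact HasDerivAt.congr_deriv h3 (by simp)
    exact h1.unique h2
  · intro g h
    have := conj' _ _ _ _ g 1 hX hX (by simpa using h)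
    simpa using this
  · intro g h
    have := conj' _ _ _ _ g 1 hY hY (by simpa using h)
    simpa using this

end gen2
end RT


/-! ## Irreducible representations of SL2 -/
namespace RT
open Filter Topology TP

lemma sl2_gen (P : SL 2 ℝ → Prop) (hm : ∀ a b, P a → P b → P (a * b)) (hu : ∀ x, P (eu x)) (hl : ∀ x, P (el x))
    (ha : ∀ x, P (ea x)) (g : SL 2 ℝ) : P g := by
  have h0 : ∀ g : SL 2 ℝ, 0 < g.1 0 0 → P g := by
    intro g h
    rw [gauss g h]
    exact hm _ _ (hm _ _ (hl _) (ha _)) (hu _)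
  have h1 : ∀ g : SL 2 ℝ, g.1 1 0 ≠ 0 → P g := by
    intro g h
    set x := (1 - g.1 0 0) / g.1 1 0
    have e : g = eu (-x) * (eu x * g) := by
      rw [← mul_assoc, ← eu_add]; simp [eu_zero]
    rw [e]
    refine hm _ _ (hu _) (h0 _ ?_)
    have : (eu x * g).1 0 0 = 1 := by
      change ((eu x * g : SL 2 ℝ) : Matrix (Fin 2) (Fin 2) ℝ) 0 0 = 1
      rw [SG.slmul, Matrix.mul_apply]
      simp [x]
      change g.1 0 0 + (1 - g.1 0 0) / g.1 1 0 * g.1 1 0 = 1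
      field_simp; ring
    rw [this]; norm_num
  by_cases h : g.1 1 0 = 0
  · have e : g = el (-1) * (el 1 * g) := by
      rw [← mul_assoc, ← el_add]; simp [el_zero]
    rw [e]
    refine hm _ _ (hl _) (h1 _ ?_)
    have hd := g.2
    rw [Matrix.det_fin_two, h] at hd
    have : (el 1 * g).1 1 0 = g.1 0 0 + g.1 1 0 := by
      change ((el 1 * g : SL 2 ℝ) : Matrix (Fin 2) (Fin 2) ℝ) 1 0 = _
      rw [SG.slmul, Matrix.mul_apply]
      simp
    rw [this, h, add_zero]
    intro h'
    rw [h'] at hd; simp at hd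
  · exact h1 g h

section alg
variable {n : ℕ} {X Y H : Mat n}

lemma XY_pow (h2 : H * Y - Y * H = (-2:ℝ) • Y) (h3 : X * Y - Y * X = H) (k : ℕ) :
    X * Y ^ (k + 1) = Y ^ (k + 1) * X + ((k:ℝ) + 1) • (Y ^ k * (H - (k:ℝ) • 1)) := by
  have h2' : H * Y = Y * H - (2:ℝ) • Y := by
    have := eq_add_of_sub_eq h2; rw [this, neg_smul]; abel
  have h3' : X * Y = Y * X + H := by
    have := eq_add_of_sub_eq h3; rw [this]; abel
  induction k with
  | zero => simp [h3']
  | succ k ih =>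
    rw [pow_succ Y (k + 1), ← mul_assoc, ih, add_mul, mul_assoc, h3', smul_mul_assoc, mul_assoc, sub_mul, h2',
      smul_mul_assoc, one_mul]
    simp only [mul_add, mul_sub, mul_smul_comm, mul_one, ← mul_assoc, ← pow_succ, smul_sub, smul_smul]
    push_cast
    module

lemma HY_pow (h2 : H * Y - Y * H = (-2:ℝ) • Y) (k : ℕ) :
    H * Y ^ k = Y ^ k * (H - (2 * k : ℝ) • 1) := by
  have h2' : H * Y = Y * H - (2:ℝ) • Y := by
    have := eq_add_of_sub_eq h2; rw [this, neg_smul]; abel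
  induction k with
  | zero => simp
  | succ k ih =>
    rw [pow_succ Y, ← mul_assoc, ih, mul_assoc, sub_mul, h2', smul_mul_assoc, one_mul]
    simp only [mul_sub, mul_smul_comm, mul_one, mul_assoc]
    push_cast
    module

lemma nilp (Z : Mat n) (c : ℝ) (hc : c ≠ 0) (h : H * Z - Z * H = c • Z) : ∃ k, Z ^ k = 0 := by
  by_contra hk
  push Not at hk
  have hp : ∀ k : ℕ, H * Z ^ k - Z ^ k * H = (k * c : ℝ) • Z ^ k := by
    intro k
    induction k with
    | zero => simp
    | succ k ih =>
      have e : H * Z ^ (k + 1) - Z ^ (k + 1) * H = (H * Z ^ k - Z ^ k * H) * Z + Z ^ k * (H * Z - Z * H) := by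
        rw [pow_succ]; noncomm_ring
      rw [e, ih, h, smul_mul_assoc, mul_smul_comm, ← pow_succ]
      push_cast
      module
  let ad : Module.End ℝ (Mat n) := LinearMap.mulLeft ℝ H - LinearMap.mulRight ℝ H
  have hl := Module.End.eigenvectors_linearIndependent' ad (fun k : ℕ => (k * c : ℝ))
    (fun a b hab => by simpa [hc] using hab) (fun k => Z ^ k)
    (fun k => by
      refine ⟨?_, hk k⟩
      rw [Module.End.mem_eigenspace_iff]
      simpa [ad] using hp k)
  have := hl.finite
  exact not_finite ℕ
end alg

/-- standard matrices -/
def Xh (n : ℕ) : Mat n := Matrix.of fun i j => if j.1 = i.1 + 1 then (n:ℝ) - 1 - i.1 else 0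
def Yh (n : ℕ) : Mat n := Matrix.of fun i j => if i.1 = j.1 + 1 then (i.1:ℝ) else 0
def Hh (n : ℕ) : Mat n := diagonal fun i => (n:ℝ) - 1 - 2 * i.1

lemma exists_hw {n : ℕ} (hn : 0 < n) {X Y H : Mat n} (h1 : H * X - X * H = (2:ℝ) • X)
    (h2 : H * Y - Y * H = (-2:ℝ) • Y) (h3 : X * Y - Y * X = H) :
    ∃ (m : ℕ) (v : Fin n → ℝ), X *ᵥ v = 0 ∧ Y ^ (m + 1) *ᵥ v = 0 ∧ H *ᵥ v = (m:ℝ) • v ∧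
      (∀ k ≤ m, Y ^ k *ᵥ v ≠ 0) := by
  classical
  haveI : Nonempty (Fin n) := ⟨⟨0, hn⟩⟩
  haveI : Nontrivial (Mat n) := inferInstance
  obtain ⟨a, ha⟩ := nilp X 2 (by norm_num) h1
  obtain ⟨b, hb⟩ := nilp Y (-2) (by norm_num) h2
  have hdet : X.det = 0 := by
    have := congrArg Matrix.det ha
    rw [Matrix.det_pow, Matrix.det_zero] at this
    exact (pow_eq_zero_iff (by rintro rfl; simp at ha)).1 this
  obtain ⟨v0, hv0, hXv0⟩ := Matrix.exists_mulVec_eq_zero_iff.2 hdet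
  have hex : ∃ m : ℕ, ∃ v : Fin n → ℝ, v ≠ 0 ∧ X *ᵥ v = 0 ∧ Y ^ (m + 1) *ᵥ v = 0 :=
    ⟨b, v0, hv0, hXv0, by rw [pow_succ, hb, zero_mul, Matrix.zero_mulVec]⟩
  obtain ⟨v, hv, hXv, hYv⟩ := Nat.find_spec hex
  set m := Nat.find hex with hm
  have hmin : ∀ k < m, ∀ w : Fin n → ℝ, X *ᵥ w = 0 → Y ^ (k + 1) *ᵥ w = 0 → w = 0 := by
    intro k hk w h h'
    by_contra hw
    exact Nat.find_min hex hk ⟨w, hw, h, h'⟩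
  have hHv : (H - (m:ℝ) • 1) *ᵥ v = 0 := by
    have hX' : X *ᵥ ((H - (m:ℝ) • 1) *ᵥ v) = 0 := by
      have : X * (H - (m:ℝ) • 1) = (H - ((m:ℝ) + 2) • 1) * X := by
        have := eq_add_of_sub_eq h1
        rw [mul_sub, sub_mul, this, mul_smul_comm, smul_mul_assoc, mul_one, one_mul]
        module
      rw [Matrix.mulVec_mulVec, this, ← Matrix.mulVec_mulVec, hXv, Matrix.mulVec_zero]
    have hY' : Y ^ m *ᵥ ((H - (m:ℝ) • 1) *ᵥ v) = 0 := by
      have := congrArg (fun Z => Z *ᵥ v) (XY_pow (X := X) h2 h3 m)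
      simp only [Matrix.add_mulVec, Matrix.smul_mulVec] at this
      rw [← Matrix.mulVec_mulVec, ← Matrix.mulVec_mulVec, hXv, hYv, Matrix.mulVec_zero, Matrix.mulVec_zero, zero_add] at this
      rw [Matrix.mulVec_mulVec]
      have h0 : ((m:ℝ) + 1) ≠ 0 := by positivity
      exact (smul_eq_zero.1 this.symm).resolve_left h0
    rcases Nat.eq_zero_or_pos m with h0 | h0
    · rw [h0, pow_zero, Matrix.one_mulVec] at hY'
      rw [h0]; exact hY'
    · refine hmin (m - 1) (by omega) _ hX' ?_
      rwa [Nat.sub_add_cancel h0]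
  refine ⟨m, v, hXv, hYv, ?_, ?_⟩
  · rw [Matrix.sub_mulVec, Matrix.smul_mulVec, Matrix.one_mulVec] at hHv
    exact sub_eq_zero.1 hHv
  · intro k hk h
    have hm' : Y ^ m *ᵥ v = 0 := by
      have : m = (m - k) + k := by omega
      rw [this, pow_add, ← Matrix.mulVec_mulVec, h, Matrix.mulVec_zero]
    rcases Nat.eq_zero_or_pos m with h0 | h0
    · rw [h0, pow_zero, Matrix.one_mulVec] at hm'
      exact hv hm'
    · refine hv (hmin (m - 1) (by omega) _ hXv ?_)
      rwa [Nat.sub_add_cancel h0]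

lemma inv_of_limit {n : ℕ} {Z L : Mat n} {x : ℝ} (h : Tendsto (fun k : ℕ => (1 + (x / k) • Z) ^ k) atTop (𝓝 L))
    (W : Submodule ℝ (Fin n → ℝ)) (hW : ∀ w ∈ W, Z *ᵥ w ∈ W) : ∀ w ∈ W, L *ᵥ w ∈ W := by
  intro w hw
  have hcl : IsClosed (W : Set (Fin n → ℝ)) := W.closed_of_finiteDimensional
  have ht : Tendsto (fun k : ℕ => ((1 + (x / k) • Z) ^ k) *ᵥ w) atTop (𝓝 (L *ᵥ w)) :=
    ((continuous_id.matrix_mulVec continuous_const).tendsto L).comp h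
  refine hcl.mem_of_tendsto ht (Eventually.of_forall fun k => ?_)
  have : ∀ i : ℕ, (1 + (x / (k:ℝ)) • Z) ^ i *ᵥ w ∈ W := by
    intro i
    induction i with
    | zero => simpa using hw
    | succ i ih =>
      rw [pow_succ', ← Matrix.mulVec_mulVec, Matrix.add_mulVec, Matrix.one_mulVec, Matrix.smul_mulVec]
      exact W.add_mem ih (W.smul_mem _ (hW _ ih))
  exact this k

theorem exists_basis {n : ℕ} (hn : 0 < n) {f : SL 2 ℝ →* Mat n} {X Y H : Mat n} (h1 : H * X - X * H = (2:ℝ) • X)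
    (h2 : H * Y - Y * H = (-2:ℝ) • Y) (h3 : X * Y - Y * X = H)
    (hu : ∀ x : ℝ, Tendsto (fun k : ℕ => (1 + (x / k) • X) ^ k) atTop (𝓝 (f (eu x))))
    (hl : ∀ x : ℝ, Tendsto (fun k : ℕ => (1 + (x / k) • Y) ^ k) atTop (𝓝 (f (el x))))
    (ha : ∀ x : ℝ, Tendsto (fun k : ℕ => (1 + (x / k) • H) ^ k) atTop (𝓝 (f (ea x))))
    (irr : ∀ W : Submodule ℝ (Fin n → ℝ), (∀ g, ∀ v ∈ W, f g *ᵥ v ∈ W) → W = ⊥ ∨ W = ⊤) :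
    ∃ Ω : Mat n, Ω.det ≠ 0 ∧ X * Ω = Ω * Xh n ∧ Y * Ω = Ω * Yh n ∧ H * Ω = Ω * Hh n := by
  obtain ⟨m, v, hXv, hYv, hHv, hne⟩ := exists_hw hn h1 h2 h3
  let b : ℕ → Fin n → ℝ := fun i => ((i.factorial : ℝ)⁻¹) • (Y ^ i *ᵥ v)
  have bm : b (m + 1) = 0 := by simp [b, hYv]
  have hYb : ∀ i, Y *ᵥ b i = ((i:ℝ) + 1) • b (i + 1) := by
    intro i
    simp only [b, Matrix.mulVec_smul, Matrix.mulVec_mulVec, ← pow_succ', smul_smul]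
    congr 1
    rw [Nat.factorial_succ]; push_cast
    have : ((i:ℝ) + 1) ≠ 0 := by positivity
    field_simp
  have hHb : ∀ i, H *ᵥ b i = ((m:ℝ) - 2 * i) • b i := by
    intro i
    simp only [b, Matrix.mulVec_smul, Matrix.mulVec_mulVec, HY_pow h2]
    rw [← Matrix.mulVec_mulVec, Matrix.sub_mulVec, hHv, Matrix.smul_mulVec, Matrix.one_mulVec, ← sub_smul, Matrix.mulVec_smul,
      smul_comm]
  have hXb : ∀ i, X *ᵥ b (i + 1) = ((m:ℝ) - i) • b i := by
    intro i
    simp only [b, Matrix.mulVec_smul, Matrix.mulVec_mulVec, XY_pow h2 h3]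
    rw [Matrix.add_mulVec, ← Matrix.mulVec_mulVec, hXv, Matrix.mulVec_zero, zero_add, Matrix.smul_mulVec, ← Matrix.mulVec_mulVec,
      Matrix.sub_mulVec, hHv, Matrix.smul_mulVec, Matrix.one_mulVec, ← sub_smul, Matrix.mulVec_smul, smul_smul, smul_smul, smul_smul]
    congr 1
    rw [Nat.factorial_succ]; push_cast
    have : ((i:ℝ) + 1) ≠ 0 := by positivity
    field_simp
  have hX0 : X *ᵥ b 0 = 0 := by simp [b, hXv]
  have bne : ∀ i ≤ m, b i ≠ 0 := by
    intro i hi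
    refine smul_ne_zero (by positivity) (hne i hi)
  have hli : LinearIndependent ℝ (fun i : Fin (m + 1) => b i) := by
    refine Module.End.eigenvectors_linearIndependent' (Matrix.toLin' H) (fun i : Fin (m + 1) => (m:ℝ) - 2 * i.1) ?_ _ ?_
    · intro i j hij
      simpa [Fin.ext_iff] using hij
    · intro i
      refine ⟨?_, bne _ (by omega)⟩
      rw [Module.End.mem_eigenspace_iff, Matrix.toLin'_apply]
      exact hHb i
  set W : Submodule ℝ (Fin n → ℝ) := Submodule.span ℝ (Set.range fun i : Fin (m + 1) => b i) with hWdef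
  have hbW : ∀ i, i ≤ m + 1 → b i ∈ W := by
    intro i hi
    rcases hi.lt_or_eq with h | h
    · exact Submodule.subset_span ⟨⟨i, h⟩, rfl⟩
    · rw [h, bm]; exact W.zero_mem
  have hinv : ∀ Z : Mat n, (∀ i ≤ m, Z *ᵥ b i ∈ W) → ∀ w ∈ W, Z *ᵥ w ∈ W := by
    intro Z hZ w hw
    have : W ≤ W.comap (Matrix.toLin' Z) := by
      rw [hWdef, Submodule.span_le]
      rintro _ ⟨i, rfl⟩
      simpa [Matrix.toLin'_apply] using hZ i (by omega)
    have := this hw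
    simpa [Matrix.toLin'_apply] using this
  have hWX : ∀ w ∈ W, X *ᵥ w ∈ W := hinv X (by
    intro i hi
    rcases i with _ | i
    · rw [hX0]; exact W.zero_mem
    · rw [hXb]; exact W.smul_mem _ (hbW _ (by omega)))
  have hWY : ∀ w ∈ W, Y *ᵥ w ∈ W := hinv Y (by
    intro i hi
    rw [hYb]; exact W.smul_mem _ (hbW _ (by omega)))
  have hWH : ∀ w ∈ W, H *ᵥ w ∈ W := hinv H (by
    intro i hi
    rw [hHb]; exact W.smul_mem _ (hbW _ (by omega)))
  have hWg : ∀ g, ∀ w ∈ W, f g *ᵥ w ∈ W := by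
    intro g
    refine sl2_gen (fun g => ∀ w ∈ W, f g *ᵥ w ∈ W) ?_ (fun x => inv_of_limit (hu x) W hWX)
      (fun x => inv_of_limit (hl x) W hWY) (fun x => inv_of_limit (ha x) W hWH) g
    intro a b ha hb w hw
    rw [map_mul, ← Matrix.mulVec_mulVec]
    exact ha _ (hb _ hw)
  have htop : W = ⊤ := by
    rcases irr W hWg with h | h
    · exfalso
      have := hbW 0 (by omega)
      rw [h, Submodule.mem_bot] at this
      exact bne 0 (by omega) this
    · exact h
  have hnm : n = m + 1 := by
    have h4 := finrank_span_eq_card hli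
    rw [← hWdef, htop, finrank_top] at h4
    simpa using h4
  subst hnm
  refine ⟨Matrix.of fun i j => b j i, ?_, ?_, ?_, ?_⟩
  · have : IsUnit (Matrix.of fun i j : Fin (m + 1) => b j i) := by
      rw [← Matrix.linearIndependent_cols_iff_isUnit]
      exact hli
    exact isUnit_iff_ne_zero.1 ((Matrix.isUnit_iff_isUnit_det _).1 this)
  · ext i j
    have e : (X * Matrix.of fun i j : Fin (m + 1) => b j i) i j = (X *ᵥ b j) i := rfl
    rw [e, Matrix.mul_apply]
    rcases j with ⟨j, hj⟩
    rcases j with _ | j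
    · rw [hX0]; simp [Xh]
    · rw [hXb, Finset.sum_eq_single ⟨j, by omega⟩]
      · simp [Xh]; ring
      · intro c _ hc
        have : ¬ (j + 1 = c.1 + 1) := fun h => hc (Fin.ext (by simp; omega))
        simp only [Xh, Matrix.of_apply, this, if_false, mul_zero]
      · simp
  · ext i j
    have e : (Y * Matrix.of fun i j : Fin (m + 1) => b j i) i j = (Y *ᵥ b j) i := rfl
    rw [e, Matrix.mul_apply, hYb]
    by_cases hj : j.1 = m
    · rw [hj, bm]
      symm
      simp only [smul_zero, Pi.zero_apply]
      refine Finset.sum_eq_zero fun c _ => ?_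
      have : ¬ (c.1 = j.1 + 1) := by omega
      simp only [Yh, Matrix.of_apply, this, if_false, mul_zero]
    · rw [Finset.sum_eq_single ⟨j + 1, by omega⟩]
      · simp [Yh]; ring
      · intro c _ hc
        have : ¬ (c.1 = j.1 + 1) := fun h => hc (Fin.ext (by simp; omega))
        simp only [Yh, Matrix.of_apply, this, if_false, mul_zero]
      · simp
  · ext i j
    have e : (H * Matrix.of fun i j : Fin (m + 1) => b j i) i j = (H *ᵥ b j) i := rfl
    rw [e, hHb, Hh, Matrix.mul_diagonal]
    simp; ring

structure StdRep (n : ℕ) (F : SL 2 ℝ →* Mat n) : Prop where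
  u : ∀ x : ℝ, Tendsto (fun k : ℕ => (1 + (x / k) • Xh n) ^ k) atTop (𝓝 (F (eu x)))
  l : ∀ x : ℝ, Tendsto (fun k : ℕ => (1 + (x / k) • Yh n) ^ k) atTop (𝓝 (F (el x)))
  a : ∀ x : ℝ, Tendsto (fun k : ℕ => (1 + (x / k) • Hh n) ^ k) atTop (𝓝 (F (ea x)))
  wY : F ew * Yh n = - (Xh n * F ew)
  wH : F ew * Hh n = - (Hh n * F ew)
  cX : F (-1) * Xh n = Xh n * F (-1)
  cH : F (-1) * Hh n = Hh n * F (-1)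

lemma tendsto_conj {n : ℕ} {Ω Z Zh L : Mat n} (hΩ : Ω.det ≠ 0) (hZ : Z * Ω = Ω * Zh) {x : ℝ}
    (h : Tendsto (fun k : ℕ => (1 + (x / k) • Z) ^ k) atTop (𝓝 L)) :
    Tendsto (fun k : ℕ => (1 + (x / k) • Zh) ^ k) atTop (𝓝 (Ω⁻¹ * L * Ω)) := by
  have h1 : Tendsto (fun k : ℕ => Ω⁻¹ * (1 + (x / k) • Z) ^ k * Ω) atTop (𝓝 (Ω⁻¹ * L * Ω)) :=
    TP.tendsto_mul (TP.tendsto_mul tendsto_const_nhds h) tendsto_const_nhds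
  refine h1.congr fun k => ?_
  have : ∀ i : ℕ, (1 + (x / (k:ℝ)) • Z) ^ i * Ω = Ω * (1 + (x / (k:ℝ)) • Zh) ^ i := by
    intro i
    induction i with
    | zero => simp
    | succ i ih =>
      rw [pow_succ', pow_succ', mul_assoc, ih, ← mul_assoc, add_mul, one_mul, smul_mul_assoc, hZ, ← mul_smul_comm,
        ← mul_assoc, mul_add, mul_one]
  rw [mul_assoc, this, invml hΩ]

theorem stdRep {n : ℕ} (hn : 0 < n) (f : SL 2 ℝ →* Mat n) (hf : Continuous f)
    (irr : ∀ W : Submodule ℝ (Fin n → ℝ), (∀ g, ∀ v ∈ W, f g *ᵥ v ∈ W) → W = ⊥ ∨ W = ⊤) :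
    ∃ (Ω : Mat n) (F : SL 2 ℝ →* Mat n), Ω.det ≠ 0 ∧ (∀ g, f g * Ω = Ω * F g) ∧ StdRep n F := by
  letI : NormedRing (Mat n) := Matrix.linftyOpNormedRing
  letI : NormedAlgebra ℝ (Mat n) := Matrix.linftyOpNormedAlgebra
  haveI : CompleteSpace (Mat n) := FiniteDimensional.complete ℝ (Mat n)
  obtain ⟨X, Y, H, h1, h2, h3, hu, hl, ha, -, cY, cH, dX, -⟩ := sl2_triple f hf
  obtain ⟨Ω, hΩ, eX, eY, eH⟩ := exists_basis hn h1 h2 h3 hu hl ha irr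
  let F : SL 2 ℝ →* Mat n :=
    { toFun := fun g => Ω⁻¹ * f g * Ω
      map_one' := by rw [map_one, mul_one, invm hΩ]
      map_mul' := fun a b => by
        rw [map_mul]
        simp only [mul_assoc]
        rw [minvl hΩ] }
  have hF : ∀ g, f g * Ω = Ω * F g := fun g => by
    change f g * Ω = Ω * (Ω⁻¹ * f g * Ω)
    rw [mul_assoc Ω⁻¹, minvl hΩ]
  have eX' : Ω⁻¹ * X = Xh n * Ω⁻¹ := by
    rw [← mul_one (Ω⁻¹ * X), ← minv hΩ, ← mul_assoc, mul_assoc Ω⁻¹, eX, invml hΩ]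
  have eH' : Ω⁻¹ * H = Hh n * Ω⁻¹ := by
    rw [← mul_one (Ω⁻¹ * H), ← minv hΩ, ← mul_assoc, mul_assoc Ω⁻¹, eH, invml hΩ]
  have tr : ∀ (g : SL 2 ℝ) (P Q Ph Qh : Mat n) (c : ℝ), P * Ω = Ω * Ph → Ω⁻¹ * Q = Qh * Ω⁻¹ →
      f g * P = c • (Q * f g) → F g * Ph = c • (Qh * F g) := by
    intro g P Q Ph Qh c hP hQ h
    change Ω⁻¹ * f g * Ω * Ph = c • (Qh * (Ω⁻¹ * f g * Ω))
    rw [mul_assoc, ← hP, ← mul_assoc, mul_assoc Ω⁻¹, h, mul_smul_comm, smul_mul_assoc, ← mul_assoc, hQ]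
    simp only [mul_assoc]
  have hw1 : ∀ x, ew * el x * ew⁻¹ = eu (-1 * x) := by
    intro x
    rw [mul_inv_eq_iff_eq_mul]
    apply sl_ext; rw [SG.slmul, SG.slmul]; ext i j; fin_cases i <;> fin_cases j <;> simp
  have hw2 : ∀ x, ew * ea x * ew⁻¹ = ea (-1 * x) := by
    intro x
    rw [mul_inv_eq_iff_eq_mul]
    apply sl_ext; rw [SG.slmul, SG.slmul]; ext i j; fin_cases i <;> fin_cases j <;> simp
  have hc1 : ∀ g : SL 2 ℝ, (-1) * g * (-1)⁻¹ = g := by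
    intro g
    rw [mul_inv_eq_iff_eq_mul]; simp
  refine ⟨Ω, F, hΩ, hF, ⟨fun x => tendsto_conj hΩ eX (hu x), fun x => tendsto_conj hΩ eY (hl x),
    fun x => tendsto_conj hΩ eH (ha x), ?_, ?_, ?_, ?_⟩⟩
  · have := tr ew Y X (Yh n) (Xh n) (-1) eY eX' (cY ew (-1) hw1)
    rw [this, neg_one_smul]
  · have := tr ew H H (Hh n) (Hh n) (-1) eH eH' (cH ew (-1) hw2)
    rw [this, neg_one_smul]
  · have := tr (-1) X X (Xh n) (Xh n) 1 eX eX' (by rw [one_smul]; exact dX _ (fun x => hc1 _))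
    rw [this, one_smul]
  · have := tr (-1) H H (Hh n) (Hh n) 1 eH eH' (cH _ 1 (fun x => by rw [one_mul]; exact hc1 _))
    rw [this, one_smul]

end RT


/-! ## Positivity of the standard representation -/
namespace RT
open Filter Topology TP

lemma TNN_elem {n : ℕ} {T : Mat n} (hT : TNN T) (p q : Fin n) (hpq : q.1 = p.1 + 1) (c : ℝ) (hc : 0 ≤ c) :
    TNN (Matrix.updateRow T p (T p + c • T q)) := by
  intro k r s hr hs
  by_cases h : ∃ a, r a = p
  · obtain ⟨a, rfl⟩ := h
    have e : (Matrix.updateRow T (r a) (T (r a) + c • T q)).submatrix r s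
        = Matrix.updateRow (T.submatrix r s) a (T.submatrix r s a + c • fun j => T q (s j)) := by
      ext i j
      by_cases hi : i = a
      · subst hi; simp
      · have : r i ≠ r a := fun h => hi (hr.injective h)
        simp [hi, this]
    rw [e, Matrix.det_updateRow_add, Matrix.det_updateRow_smul, Matrix.updateRow_eq_self]
    have e2 : Matrix.updateRow (T.submatrix r s) a (fun j => T q (s j)) = T.submatrix (Function.update r a q) s := by
      ext i j
      by_cases hi : i = a
      · subst hi; simp
      · simp [hi]
    rw [e2]
    refine add_nonneg (hT k r s hr hs) (mul_nonneg hc ?_)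
    by_cases hb : ∃ b, r b = q
    · obtain ⟨b, hb⟩ := hb
      have hab : a ≠ b := by rintro rfl; rw [hb] at hpq; omega
      rw [Matrix.det_zero_of_row_eq hab]
      ext j; simp [hab.symm, hb]
    · refine hT k _ s (strictMono_update hr ?_ ?_) hs
      · intro x hx
        have := hr hx
        rw [Fin.lt_def] at this ⊢; omega
      · intro x hx
        have h1 := hr hx
        have h2 : r x ≠ q := fun h => hb ⟨x, h⟩
        rw [Fin.lt_def] at h1 ⊢
        have : (r x).1 ≠ q.1 := fun h => h2 (Fin.ext h)
        omega
  · have e : (Matrix.updateRow T p (T p + c • T q)).submatrix r s = T.submatrix r s := by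
      ext i j
      have : r i ≠ p := fun h' => h ⟨i, h'⟩
      simp [this]
    rw [e]; exact hT k r s hr hs

lemma TNN_bidiag {n : ℕ} {T C : Mat n} (hT : TNN T) (hC : ∀ i j : Fin n, j.1 ≠ i.1 + 1 → C i j = 0)
    (hC' : ∀ i j, 0 ≤ C i j) : TNN ((1 + C) * T) := by
  let S : ℕ → Mat n := fun k => Matrix.of fun i j => if i.1 < k then ((1 + C) * T) i j else T i j
  have hrow : ∀ i q : Fin n, q.1 = i.1 + 1 → ∀ j, ((1 + C) * T) i j = T i j + C i q * T q j := by
    intro i q hq j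
    rw [add_mul, one_mul, Matrix.add_apply, Matrix.mul_apply, Finset.sum_eq_single q]
    · intro b _ hb
      rw [hC _ _ (fun h => hb (Fin.ext (by omega))), zero_mul]
    · simp
  have hlast : ∀ i : Fin n, i.1 + 1 = n → ∀ j, ((1 + C) * T) i j = T i j := by
    intro i hi j
    rw [add_mul, one_mul, Matrix.add_apply, Matrix.mul_apply, Finset.sum_eq_zero, add_zero]
    intro b _
    rw [hC _ _ (by omega), zero_mul]
  have hS : ∀ k ≤ n, TNN (S k) := by
    intro k
    induction k with
    | zero =>
      intro _
      have e : S 0 = T := by ext i j; simp [S]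
      rw [e]; exact hT
    | succ k ih =>
      intro hk
      have h0 := ih (by omega)
      by_cases hkn : k + 1 = n
      · have : S (k + 1) = S k := by
          ext i j
          simp only [S, Matrix.of_apply]
          by_cases h : i.1 < k
          · simp [h, Nat.lt_succ_of_lt h]
          · have hik : i.1 = k := by omega
            simp [hik, hlast i (by omega)]
        rw [this]; exact h0
      · have : S (k + 1) = Matrix.updateRow (S k) ⟨k, by omega⟩
            (S k ⟨k, by omega⟩ + C ⟨k, by omega⟩ ⟨k + 1, by omega⟩ • S k ⟨k + 1, by omega⟩) := by
          ext i j
          by_cases hik : i = ⟨k, by omega⟩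
          · subst hik
            rw [Matrix.updateRow_self]
            simp [S, hrow ⟨k, by omega⟩ ⟨k + 1, by omega⟩ rfl]
          · rw [Matrix.updateRow_ne hik]
            have : i.1 ≠ k := fun h => hik (Fin.ext h)
            simp only [S, Matrix.of_apply]
            by_cases h : i.1 < k
            · simp [h, Nat.lt_succ_of_lt h]
            · have : ¬ i.1 < k + 1 := by omega
              simp [h, this]
        rw [this]
        exact TNN_elem h0 _ _ rfl _ (hC' _ _)
  have := hS n le_rfl
  have e : S n = (1 + C) * T := by ext i j; simp [S]
  rwa [e] at this

lemma TNN_one {n : ℕ} : TNN (1 : Mat n) := by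
  intro k r c hr hc
  by_cases h : r = c
  · subst h
    rw [Matrix.submatrix_one _ hr.injective, Matrix.det_one]; norm_num
  · -- some row of the submatrix is zero
    have h2 : ∃ a, ∀ b, r a ≠ c b := by
      by_contra h2
      push Not at h2
      choose g hg using h2
      apply h
      have hgm : StrictMono g := by
        intro x y hxy
        have := hr hxy
        rw [hg x, hg y] at this
        exact hc.lt_iff_lt.1 this
      have : g = id := by
        have := hgm.range_inj (g := id) strictMono_id |>.1 (by
          rw [Set.range_id]
          exact Set.range_eq_univ.2 (Finite.surjective_of_injective hgm.injective))
        exact this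
      funext x
      rw [hg x, this]; rfl
    obtain ⟨a, ha⟩ := h2
    rw [Matrix.det_eq_zero_of_row_eq_zero a (fun b => by rw [Matrix.submatrix_apply, Matrix.one_apply_ne (ha b)])]

lemma TNN_bidiag_pow {n : ℕ} {C : Mat n} (hC : ∀ i j : Fin n, j.1 ≠ i.1 + 1 → C i j = 0)
    (hC' : ∀ i j, 0 ≤ C i j) (k : ℕ) : TNN ((1 + C) ^ k) := by
  induction k with
  | zero => simpa using TNN_one
  | succ k ih => rw [pow_succ']; exact TNN_bidiag ih hC hC'

lemma Xh_zero {n : ℕ} (i j : Fin n) (h : j.1 ≠ i.1 + 1) : Xh n i j = 0 := by simp [Xh, h]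
lemma Xh_nonneg {n : ℕ} (i j : Fin n) : 0 ≤ Xh n i j := by
  simp only [Xh, Matrix.of_apply]; split_ifs
  · have : (i.1:ℝ) + 1 ≤ n := by exact_mod_cast i.2
    linarith
  · exact le_rfl

/-- strictly upper part of powers -/
lemma upper_pow {n : ℕ} {C : Mat n} (hC : ∀ i j : Fin n, j.1 ≠ i.1 + 1 → C i j = 0) (k : ℕ) :
    Up ((1 + C) ^ k) ∧ (∀ i, ((1 + C) ^ k) i i = 1) ∧
    ∀ i j : Fin n, j.1 = i.1 + 1 → ((1 + C) ^ k) i j = k * C i j := by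
  induction k with
  | zero =>
    refine ⟨by simpa using up_one, by simp, fun i j h => ?_⟩
    have : i ≠ j := fun h' => by rw [h'] at h; omega
    simp [this]
  | succ k ih =>
    obtain ⟨h1, h2, h3⟩ := ih
    have hrow : ∀ i j, ((1 + C) ^ (k + 1)) i j = ((1 + C) ^ k) i j + ∑ l, C i l * ((1 + C) ^ k) l j := by
      intro i j
      rw [pow_succ', add_mul, one_mul, Matrix.add_apply, Matrix.mul_apply]
    refine ⟨fun i j h => ?_, fun i => ?_, fun i j h => ?_⟩
    · rw [hrow, h1 i j h, zero_add]
      refine Finset.sum_eq_zero fun l _ => ?_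
      by_cases hl : l.1 = i.1 + 1
      · rw [h1 l j (by rw [Fin.lt_def] at h ⊢; omega), mul_zero]
      · rw [hC i l hl, zero_mul]
    · rw [hrow, h2, Finset.sum_eq_zero, add_zero]
      intro l _
      by_cases hl : l.1 = i.1 + 1
      · rw [h1 l i (by rw [Fin.lt_def]; omega), mul_zero]
      · rw [hC i l hl, zero_mul]
    · rw [hrow, h3 i j h, Finset.sum_eq_single j]
      · rw [h2]; push_cast; ring
      · intro l _ hl
        rw [hC i l (fun h' => hl (Fin.ext (by omega))), zero_mul]
      · simp

variable {n : ℕ} {F : SL 2 ℝ →* Mat n}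

lemma StdRep.eu_up (h : StdRep n F) (x : ℝ) : Up (F (eu x)) :=
  isClosed_Up.mem_of_tendsto (h.u x) (Eventually.of_forall fun k =>
    (upper_pow (fun i j hij => by simp [Xh_zero i j hij]) k).1)

lemma StdRep.eu_diag (h : StdRep n F) (x : ℝ) (i) : F (eu x) i i = 1 := by
  refine tendsto_nhds_unique (tendsto_entry (h.u x) i i) ?_
  refine tendsto_const_nhds.congr fun k => ?_
  rw [(upper_pow (fun i j hij => by simp [Xh_zero i j hij]) k).2.1]

lemma StdRep.eu_super (h : StdRep n F) (x : ℝ) (i j : Fin n) (hij : j.1 = i.1 + 1) : F (eu x) i j = x * Xh n i j := by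
  refine tendsto_nhds_unique (tendsto_entry (h.u x) i j) ?_
  refine tendsto_const_nhds.congr' ?_
  filter_upwards [eventually_gt_atTop 0] with k hk
  rw [(upper_pow (fun i j hij => by simp [Xh_zero i j hij]) k).2.2 i j hij]
  have : (k:ℝ) ≠ 0 := by positivity
  simp; field_simp

lemma StdRep.eu_tnn (h : StdRep n F) (x : ℝ) (hx : 0 ≤ x) : TNN (F (eu x)) :=
  isClosed_TNN.mem_of_tendsto (h.u x) (Eventually.of_forall fun k => by
    refine TNN_bidiag_pow (fun i j hij => by simp [Xh_zero i j hij]) (fun i j => ?_) k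
    have := Xh_nonneg i j
    simp only [Matrix.smul_apply, smul_eq_mul]
    positivity)

lemma StdRep.el_tnn (h : StdRep n F) (x : ℝ) (hx : 0 ≤ x) : TNN (F (el x)) :=
  isClosed_TNN.mem_of_tendsto (h.l x) (Eventually.of_forall fun k => by
    have : (1 + (x / (k:ℝ)) • Yh n) ^ k = ((1 + (x / (k:ℝ)) • (Yh n)ᵀ) ^ k)ᵀ := by
      rw [Matrix.transpose_pow]; simp
    change TNN _
    rw [this]
    refine TNN.transpose (TNN_bidiag_pow (fun i j hij => by simp [Yh, hij]) (fun i j => ?_) k)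
    simp only [Matrix.smul_apply, smul_eq_mul, Matrix.transpose_apply, Yh, Matrix.of_apply]
    split_ifs <;> positivity)

lemma StdRep.ea_eq (h : StdRep n F) (x : ℝ) : F (ea x) = diagonal fun i => Real.exp (x * ((n:ℝ) - 1 - 2 * i.1)) := by
  refine tendsto_nhds_unique (h.a x) ?_
  have e : ∀ k : ℕ, (1 + (x / (k:ℝ)) • Hh n) ^ k = diagonal fun i : Fin n => (1 + (x * ((n:ℝ) - 1 - 2 * i.1)) / k) ^ k := by
    intro k
    have : (1 + (x / (k:ℝ)) • Hh n) = diagonal fun i : Fin n => (1 + (x * ((n:ℝ) - 1 - 2 * i.1)) / k) := by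
      ext i j
      by_cases hij : i = j
      · subst hij; simp [Hh]; ring
      · simp [Hh, hij, Matrix.one_apply_ne hij]
    rw [this, Matrix.diagonal_pow]; rfl
  simp_rw [e]
  refine tendsto_pi_nhds.2 fun i => tendsto_pi_nhds.2 fun j => ?_
  by_cases hij : i = j
  · subst hij
    simpa using Real.tendsto_one_add_div_pow_exp (x * ((n:ℝ) - 1 - 2 * i.1))
  · simp [hij]

lemma Hh_inj {n : ℕ} {i j : Fin n} (h : ((n:ℝ) - 1 - 2 * i.1) = (n:ℝ) - 1 - 2 * j.1) : i = j := by
  apply Fin.ext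
  have : (i.1:ℝ) = j.1 := by linarith
  exact_mod_cast this

lemma StdRep.anti (h : StdRep n F) : Anti (F ew) := by
  have hz : ∀ r c, r ≠ Fin.rev c → F ew r c = 0 := by
    intro r c hrc
    have := congrFun (congrFun h.wH r) c
    rw [Hh, Matrix.mul_diagonal, Matrix.neg_apply, Matrix.diagonal_mul] at this
    have h2 : F ew r c * (((n:ℝ) - 1 - 2 * c.1) + ((n:ℝ) - 1 - 2 * r.1)) = 0 := by linarith
    rcases mul_eq_zero.1 h2 with h3 | h3
    · exact h3
    · exfalso; apply hrc
      apply Fin.ext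
      have h5 : (n:ℝ) = r.1 + c.1 + 1 := by linarith
      have h4 : n = r.1 + c.1 + 1 := by exact_mod_cast h5
      rw [Fin.val_rev]; omega
  have hdet := hom_det F ew
  have hne : ∀ c, F ew (Fin.rev c) c ≠ 0 := by
    intro c hc
    apply hdet
    apply Matrix.det_eq_zero_of_column_eq_zero c
    intro i
    by_cases hi : i = Fin.rev c
    · rw [hi, hc]
    · exact hz i c hi
  refine ⟨hz, hne, ?_⟩
  intro c c' hcc
  have h1 := congrFun (congrFun h.wY (Fin.rev c)) c
  -- (F w * Yh) (rev c) c ; Yh c' c = c' ; also wants (rev c) = row; use row rev c'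
  have h1 := congrFun (congrFun h.wY (Fin.rev c')) c
  have h2 : (F ew * Yh n) (Fin.rev c') c = F ew (Fin.rev c') c' * (c'.1:ℝ) := by
    rw [Matrix.mul_apply, Finset.sum_eq_single c']
    · simp [Yh, hcc]
    · intro b _ hb
      have : ¬ b.1 = c.1 + 1 := fun h => hb (Fin.ext (by omega))
      simp [Yh, this]
    · simp
  have h3 : (Xh n * F ew) (Fin.rev c') c = (c'.1:ℝ) * F ew (Fin.rev c) c := by
    rw [Matrix.mul_apply, Finset.sum_eq_single (Fin.rev c)]
    · have : (Fin.rev c).1 = (Fin.rev c').1 + 1 := by rw [Fin.val_rev, Fin.val_rev]; omega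
      simp only [Xh, Matrix.of_apply, this, if_true]
      congr 1
      rw [Fin.val_rev, Nat.cast_sub (by omega)]; push_cast; ring
    · intro b _ hb
      rw [hz b c hb, mul_zero]
    · simp
  rw [h2, Matrix.neg_apply, h3] at h1
  have hc' : (0:ℝ) < c'.1 := by rw [hcc]; positivity
  have h4 : F ew (Fin.rev c') c' = - F ew (Fin.rev c) c := by
    have : (c'.1:ℝ) * (F ew (Fin.rev c') c' + F ew (Fin.rev c) c) = 0 := by linarith
    rcases mul_eq_zero.1 this with h5 | h5
    · linarith
    · linarith
  rw [h4]
  have := mul_self_pos.2 (hne c)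
  linarith

lemma StdRep.neg (hn : 0 < n) (h : StdRep n F) : ∃ c : ℝ, (c = 1 ∨ c = -1) ∧ F (-1) = c • 1 := by
  have hz : ∀ r c, r ≠ c → F (-1) r c = 0 := by
    intro r c hrc
    have := congrFun (congrFun h.cH r) c
    rw [Hh, Matrix.mul_diagonal, Matrix.diagonal_mul] at this
    have h2 : F (-1) r c * (((n:ℝ) - 1 - 2 * c.1) - ((n:ℝ) - 1 - 2 * r.1)) = 0 := by linarith
    rcases mul_eq_zero.1 h2 with h3 | h3
    · exact h3
    · exact absurd (Hh_inj (sub_eq_zero.1 h3)).symm hrc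
  have hs : ∀ i j : Fin n, j.1 = i.1 + 1 → F (-1) i i = F (-1) j j := by
    intro i j hij
    have h1 := congrFun (congrFun h.cX i) j
    rw [Matrix.mul_apply, Finset.sum_eq_single i, Matrix.mul_apply, Finset.sum_eq_single j] at h1
    · have : Xh n i j ≠ 0 := by
        simp only [Xh, Matrix.of_apply, hij, if_true]
        have : (j.1:ℝ) + 1 ≤ n := by exact_mod_cast j.2
        rw [hij] at this; push_cast at this
        intro h; linarith
      rw [mul_comm] at h1
      exact mul_left_cancel₀ this h1
    · intro b _ hb; rw [hz b j hb, mul_zero]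
    · simp
    · intro b _ hb; rw [hz i b hb.symm, zero_mul]
    · simp
  have hall : ∀ k (hk : k < n), F (-1) ⟨k, hk⟩ ⟨k, hk⟩ = F (-1) ⟨0, hn⟩ ⟨0, hn⟩ := by
    intro k
    induction k with
    | zero => intro _; rfl
    | succ k ih => intro hk; rw [← ih (by omega), hs ⟨k, by omega⟩ ⟨k + 1, hk⟩ rfl]
  set c := F (-1) ⟨0, hn⟩ ⟨0, hn⟩ with hc
  have hF : F (-1) = c • 1 := by
    ext i j
    by_cases hij : i = j
    · subst hij; simp [hall i.1 i.2]
    · simp [hz i j hij, hij]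
  refine ⟨c, ?_, hF⟩
  have h1 : F (-1) * F (-1) = 1 := by rw [← map_mul]; simp
  rw [hF] at h1
  have h2 := congrFun (congrFun h1 ⟨0, hn⟩) ⟨0, hn⟩
  simp [-inv_eq_one] at h2
  exact mul_self_eq_one_iff.1 h2

end RT


/-! ## From SL2 data to positivity -/
namespace RT
open Filter Topology TP

def wp (e : Bool) : SL 2 ℝ := if e then ew else 1

structure SL2Pos {G : Type} [Group G] (A : Aut G) (ρ : G →* SL 2 ℝ) (m : A.S → SL 2 ℝ) (t : ℝ) : Prop where
  tpos : 0 < t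
  eig : ρ A.al * m A.s0 = m A.s0 * ea t
  up : ∀ s, ((m s)⁻¹ * (ρ (A.pg s) * (m A.s0 * wp (A.pe s)))).1 1 0 = 0
  uq : ∀ s, (ew⁻¹ * ((m s)⁻¹ * (ρ (A.qg s) * (m A.s0 * wp (A.qe s))))).1 1 0 = 0
  tl : ∀ σ, ((m (A.src σ))⁻¹ * (ρ (A.gL σ) * m (A.lt σ))).1 1 0 = 0 ∧
    0 < ((m (A.src σ))⁻¹ * (ρ (A.gL σ) * m (A.lt σ))).1 0 0 ∧
    0 ≤ ((m (A.src σ))⁻¹ * (ρ (A.gL σ) * m (A.lt σ))).1 0 1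
  tr : ∀ σ, ((m (A.src σ))⁻¹ * (ρ (A.gR σ) * m (A.rt σ))).1 0 1 = 0 ∧
    0 < A.sg σ * ((m (A.src σ))⁻¹ * (ρ (A.gR σ) * m (A.rt σ))).1 0 0 ∧
    0 ≤ A.sg σ * ((m (A.src σ))⁻¹ * (ρ (A.gR σ) * m (A.rt σ))).1 1 0
  bz : ((m (A.rt A.σz))⁻¹ * (m (A.lt A.σz) * ew)).1 1 0 = 0 ∧ 0 < ((m (A.rt A.σz))⁻¹ * (m (A.lt A.σz) * ew)).1 0 0 ∧
    ((m (A.rt A.σz))⁻¹ * (m (A.lt A.σz) * ew)).1 0 1 ≤ 0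

variable {n : ℕ} {F : SL 2 ℝ →* Mat n}

lemma gauss_up (g : SL 2 ℝ) (h : g.1 1 0 = 0) (h' : 0 < g.1 0 0) :
    g = ea (Real.log (g.1 0 0)) * eu (g.1 0 1 / g.1 0 0) := by
  have := gauss g h'
  rw [h, zero_div, el_zero, one_mul] at this
  exact this

lemma gauss_lo (g : SL 2 ℝ) (h : g.1 0 1 = 0) (h' : 0 < g.1 0 0) :
    g = el (g.1 1 0 / g.1 0 0) * ea (Real.log (g.1 0 0)) := by
  have := gauss g h'
  rw [h, zero_div, eu_zero, mul_one] at this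
  exact this

lemma neg_coe (g : SL 2 ℝ) : ((-1 * g : SL 2 ℝ)).1 = - g.1 := by
  change ((-1 * g : SL 2 ℝ) : Matrix (Fin 2) (Fin 2) ℝ) = _
  simp

lemma StdRep.up (hn : 0 < n) (h : StdRep n F) (g : SL 2 ℝ) (hg : g.1 1 0 = 0) : Up (F g) := by
  have h0 : ∀ g : SL 2 ℝ, g.1 1 0 = 0 → 0 < g.1 0 0 → Up (F g) := by
    intro g hg hp
    rw [gauss_up g hg hp, map_mul, h.ea_eq]
    exact (up_diagonal _).mul (h.eu_up _)
  rcases lt_trichotomy (g.1 0 0) 0 with hp | hp | hp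
  · have e : g = -1 * (-1 * g) := by simp
    obtain ⟨c, -, hc⟩ := h.neg hn
    rw [e, map_mul, hc, smul_mul_assoc, one_mul]
    refine (h0 _ ?_ ?_).smul c
    · rw [neg_coe]; simp [hg]
    · rw [neg_coe]; simpa using hp
  · exfalso
    have hd := g.2
    rw [Matrix.det_fin_two, hg, hp] at hd
    simp at hd
  · exact h0 g hg hp

lemma StdRep.tl (h : StdRep n F) (g : SL 2 ℝ) (hg : g.1 1 0 = 0) (hp : 0 < g.1 0 0) (hx : 0 ≤ g.1 0 1) : TNN (F g) := by
  rw [gauss_up g hg hp, map_mul, h.ea_eq]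
  have := TNN.diag (h.eu_tnn (g.1 0 1 / g.1 0 0) (by positivity))
    (a := fun i => Real.exp (Real.log (g.1 0 0) * ((n:ℝ) - 1 - 2 * i.1))) (b := fun _ => 1) (fun i => Real.exp_pos _) (fun _ => one_pos)
  simpa using this

lemma StdRep.tr (h : StdRep n F) (g : SL 2 ℝ) (hg : g.1 0 1 = 0) (hp : 0 < g.1 0 0) (hx : 0 ≤ g.1 1 0) : TNN (F g) := by
  rw [gauss_lo g hg hp, map_mul, h.ea_eq]
  have := TNN.diag (h.el_tnn (g.1 1 0 / g.1 0 0) (by positivity))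
    (b := fun i => Real.exp (Real.log (g.1 0 0) * ((n:ℝ) - 1 - 2 * i.1))) (a := fun _ => 1) (fun _ => one_pos) (fun i => Real.exp_pos _)
  simpa using this

lemma hom_inv_eq (F : SL 2 ℝ →* Mat n) (g : SL 2 ℝ) : (F g)⁻¹ = F g⁻¹ := by
  apply Matrix.inv_eq_right_inv
  exact hom_mul_inv F g

theorem pos_of_SL2Pos {G : Type} [Group G] {A : Aut G} {ρ : G →* SL 2 ℝ} {m : A.S → SL 2 ℝ} {t : ℝ}
    (hA : SL2Pos A ρ m t) (hn : 0 < n) (f : SL 2 ℝ →* Mat n) (hf : Continuous f)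
    (irr : ∀ W : Submodule ℝ (Fin n → ℝ), (∀ g, ∀ v ∈ W, f g *ᵥ v ∈ W) → W = ⊥ ∨ W = ⊤) :
    ∃ (A' : Aut G) (J : Mat n), Anti J ∧ ∃ M d, Pos A' J (f.comp ρ) M d := by
  obtain ⟨Ω, F, hΩ, hF, hS⟩ := stdRep hn f hf irr
  obtain ⟨c, hc, hFc⟩ := hS.neg hn
  let A' : Aut G := { A with
    sg := fun σ => if A.sg σ = 1 then 1 else c
    hsg := fun σ => by
      by_cases h : A.sg σ = 1
      · simp [h]
      · simpa [h] using hc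
    sgy' := by simp [A.sgy']
    sgz := by simp [A.sgz] }
  let M : A.S → Mat n := fun s => f (m s) * Ω
  have hM : ∀ s, M s = Ω * F (m s) := fun s => hF _
  have hMd : ∀ s, (M s).det ≠ 0 := fun s => det_mul_ne (hom_det _ _) hΩ
  have key : ∀ s γ s', (M s)⁻¹ * ((f.comp ρ) γ * M s') = F ((m s)⁻¹ * (ρ γ * m s')) := by
    intro s γ s'
    have e : (f.comp ρ) γ * M s' = Ω * (F (ρ γ * m s')) := by
      change f (ρ γ) * (f (m s') * Ω) = _
      rw [← mul_assoc, ← map_mul, hF]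
    rw [e, hM, Matrix.mul_inv_rev, hom_inv_eq, mul_assoc, invml hΩ, ← map_mul]
  have hJp : ∀ e, Jp (F ew) e = F (wp e) := by
    intro e; cases e <;> simp [Jp, wp]
  have key2 : ∀ s γ s' e, (M s)⁻¹ * ((f.comp ρ) γ * (M s' * Jp (F ew) e)) = F ((m s)⁻¹ * (ρ γ * (m s' * wp e))) := by
    intro s γ s' e
    rw [hJp, ← mul_assoc, ← mul_assoc, mul_assoc (M s)⁻¹, key, ← map_mul]
    simp only [mul_assoc]
  refine ⟨A', F ew, hS.anti, M, fun i => Real.exp (t * ((n:ℝ) - 1 - 2 * i.1)), ?_⟩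
  have hfr : Fr A' (F ew) (f.comp ρ) M (fun i => Real.exp (t * ((n:ℝ) - 1 - 2 * i.1))) :=
    { det := hMd
      dpos := fun i => Real.exp_pos _
      eig := by
        change f (ρ A.al) * (f (m A.s0) * Ω) = f (m A.s0) * Ω * _
        rw [← mul_assoc, ← map_mul, hA.eig, hF, map_mul, ← mul_assoc, ← hF, hS.ea_eq]
      up := fun s => by
        change Up ((M s)⁻¹ * ((f.comp ρ) (A.pg s) * (M A.s0 * Jp (F ew) (A.pe s))))
        rw [key2]; exact hS.up hn _ (hA.up s)
      uq := fun s => by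
        change Up ((F ew)⁻¹ * ((M s)⁻¹ * ((f.comp ρ) (A.qg s) * (M A.s0 * Jp (F ew) (A.qe s)))))
        rw [key2, hom_inv_eq, ← map_mul]; exact hS.up hn _ (hA.uq s) }
  have hBz : A'.Bz (F ew) (f.comp ρ) M = F ((m (A.rt A.σz))⁻¹ * (m (A.lt A.σz) * ew)) := by
    have e1 : A'.TR (f.comp ρ) M A'.σz = F ((m (A.src A.σz))⁻¹ * (ρ (A.gR A.σz) * m (A.rt A.σz))) := by
      change (if A.sg A.σz = 1 then (1:ℝ) else c) • _ = _
      rw [if_pos A.sgz, one_smul]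
      exact key _ _ _
    have e2 : A'.TL (f.comp ρ) M A'.σz = F ((m (A.src A.σz))⁻¹ * (ρ (A.gL A.σz) * m (A.lt A.σz))) := key _ _ _
    rw [Aut.Bz, e1, e2, hom_inv_eq, ← map_mul, ← map_mul, A.gzl, A.gzr, map_one]
    congr 1
    group
  obtain ⟨z1, z2, z3⟩ := hA.bz
  have hlog := gauss_up _ z1 z2
  set bb := (m (A.rt A.σz))⁻¹ * (m (A.lt A.σz) * ew) with hbb
  have hent : ∀ i j, F bb i j = Real.exp (Real.log (bb.1 0 0) * ((n:ℝ) - 1 - 2 * i.1)) * F (eu (bb.1 0 1 / bb.1 0 0)) i j := by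
    intro i j
    conv_lhs => rw [hlog]
    rw [map_mul, hS.ea_eq, Matrix.diagonal_mul]
  exact
    { toFr := hfr
      danti := by
        intro i j hij
        simp only
        rw [Real.exp_lt_exp]
        have h1 : (i.1:ℝ) < j.1 := by exact_mod_cast hij
        have := hA.tpos
        nlinarith
      tl := fun σ => by
        have e : A'.TL (f.comp ρ) M σ = F ((m (A.src σ))⁻¹ * (ρ (A.gL σ) * m (A.lt σ))) := key _ _ _
        rw [e]
        obtain ⟨h1, h2, h3⟩ := hA.tl σ
        exact hS.tl _ h1 h2 h3
      tr := fun σ => by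
        have e : A'.TR (f.comp ρ) M σ = (if A.sg σ = 1 then (1:ℝ) else c) • F ((m (A.src σ))⁻¹ * (ρ (A.gR σ) * m (A.rt σ))) := by
          rw [← key]; rfl
        rw [e]
        obtain ⟨h1, h2, h3⟩ := hA.tr σ
        set g := (m (A.src σ))⁻¹ * (ρ (A.gR σ) * m (A.rt σ)) with hg
        by_cases hs : A.sg σ = 1
        · rw [hs, one_mul] at h2 h3
          rw [if_pos hs, one_smul]
          exact hS.tr _ h1 h2 h3
        · have hs' := (A.hsg σ).resolve_left hs
          rw [hs'] at h2 h3
          rw [if_neg hs]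
          have e : c • F g = F (-1 * g) := by rw [map_mul F (-1) g, hFc, smul_mul_assoc, one_mul]
          rw [e]
          refine hS.tr _ ?_ ?_ ?_
          · rw [neg_coe]; simp [h1]
          · rw [neg_coe]; simp only [Matrix.neg_apply]; linarith
          · rw [neg_coe]; simp only [Matrix.neg_apply]; linarith
      bz := fun i => by
        rw [hBz, hent, hS.eu_diag, mul_one]; exact Real.exp_pos _
      bz' := fun i i' hi => by
        rw [hBz, hent, hS.eu_super _ _ _ hi]
        have h1 := Xh_nonneg i i'
        have h2 : bb.1 0 1 / bb.1 0 0 ≤ 0 := div_nonpos_of_nonpos_of_nonneg z3 z2.le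
        have h3 := Real.exp_pos (Real.log (bb.1 0 0) * ((n:ℝ) - 1 - 2 * i.1))
        exact mul_nonpos_of_nonneg_of_nonpos h3.le (mul_nonpos_of_nonpos_of_nonneg h2 h1) }

end RT


/-! ## Plane geometry and discreteness -/
namespace PG
open Filter Topology

abbrev V2 := Fin 2 → ℝ

def ac (g : SL 2 ℝ) (v : V2) : V2 := (g : Matrix (Fin 2) (Fin 2) ℝ) *ᵥ v
def om (v w : V2) : ℝ := v 0 * w 1 - v 1 * w 0
def ip (v w : V2) : ℝ := v 0 * w 0 + v 1 * w 1
def qq (v : V2) : ℝ := v 0 ^ 2 + v 1 ^ 2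
def ns (g : Matrix (Fin 2) (Fin 2) ℝ) : ℝ := g 0 0 ^ 2 + g 0 1 ^ 2 + g 1 0 ^ 2 + g 1 1 ^ 2

lemma ac0 (g : SL 2 ℝ) (v : V2) : ac g v 0 = g.1 0 0 * v 0 + g.1 0 1 * v 1 := by
  simp [ac, Matrix.mulVec, dotProduct, Fin.sum_univ_two]
lemma ac1 (g : SL 2 ℝ) (v : V2) : ac g v 1 = g.1 1 0 * v 0 + g.1 1 1 * v 1 := by
  simp [ac, Matrix.mulVec, dotProduct, Fin.sum_univ_two]
lemma ac_mul (g h : SL 2 ℝ) (v : V2) : ac (g * h) v = ac g (ac h v) := by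
  rw [ac, SG.slmul, ac, ac, Matrix.mulVec_mulVec]
lemma ac_one (v : V2) : ac 1 v = v := by rw [ac, SG.slone, Matrix.one_mulVec]
lemma ac_smul (g : SL 2 ℝ) (t : ℝ) (v : V2) : ac g (t • v) = t • ac g v := Matrix.mulVec_smul _ _ _
lemma ac_add (g : SL 2 ℝ) (v w : V2) : ac g (v + w) = ac g v + ac g w := Matrix.mulVec_add _ _ _
lemma ac_neg (g : SL 2 ℝ) (v : V2) : ac g (-v) = - ac g v := Matrix.mulVec_neg _ _
lemma ac_inv (g : SL 2 ℝ) (v : V2) : ac g⁻¹ (ac g v) = v := by rw [← ac_mul, inv_mul_cancel, ac_one]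
lemma ac_inv' (g : SL 2 ℝ) (v : V2) : ac g (ac g⁻¹ v) = v := by rw [← ac_mul, mul_inv_cancel, ac_one]
lemma det2 (g : SL 2 ℝ) : g.1 0 0 * g.1 1 1 - g.1 0 1 * g.1 1 0 = 1 := by
  have := g.2; rwa [Matrix.det_fin_two] at this
lemma om_ac (g : SL 2 ℝ) (v w : V2) : om (ac g v) (ac g w) = om v w := by
  simp only [om, ac0, ac1]; linear_combination (v 0 * w 1 - v 1 * w 0) * det2 g
lemma om_smul_left (t : ℝ) (v w) : om (t • v) w = t * om v w := by simp [om]; ring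
lemma om_smul_right (t : ℝ) (v w) : om v (t • w) = t * om v w := by simp [om]; ring
lemma om_add_left (u v w) : om (u + v) w = om u w + om v w := by simp [om]; ring
lemma om_add_right (u v w) : om u (v + w) = om u v + om u w := by simp [om]; ring
lemma om_swap (v w) : om w v = - om v w := by simp [om]; ring
lemma om_self (v) : om v v = 0 := by simp [om]; ring
lemma lagr (v w) : ip v w ^ 2 + om v w ^ 2 = qq v * qq w := by simp [om, ip, qq]; ring
lemma ip3 (a b c) : ip a c * qq b = ip a b * ip b c - om a b * om b c := by simp [om, ip, qq]; ring
lemma qq_nonneg (v) : 0 ≤ qq v := by simp only [qq]; positivity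
lemma qq_eq_zero {v} : qq v = 0 ↔ v = 0 := by
  constructor
  · intro h
    have h0 : v 0 = 0 := by simp only [qq] at h; nlinarith [sq_nonneg (v 0), sq_nonneg (v 1)]
    have h1 : v 1 = 0 := by simp only [qq] at h; nlinarith [sq_nonneg (v 0), sq_nonneg (v 1)]
    ext i; fin_cases i <;> simp [h0, h1]
  · rintro rfl; simp [qq]
lemma qq_pos {v} (h : v ≠ 0) : 0 < qq v := lt_of_le_of_ne (qq_nonneg v) (fun h' => h (qq_eq_zero.1 h'.symm))
lemma parallel {v w : V2} (hw : w ≠ 0) (h : om v w = 0) : ∃ t : ℝ, v = t • w := by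
  have hq := qq_pos hw
  refine ⟨ip v w / qq w, ?_⟩
  ext i
  have : qq w * v i = ip v w * w i := by
    simp only [om] at h
    fin_cases i <;> simp [qq, ip] <;> first | linear_combination w 1 * h | linear_combination - w 0 * h
  simp; field_simp; linarith
lemma ac_ne {g : SL 2 ℝ} {v : V2} (h : v ≠ 0) : ac g v ≠ 0 := fun h' => h (by
  rw [← ac_inv g v, h', ac]; simp)
lemma om_ne_left {v w} (h : om v w ≠ 0) : v ≠ 0 := by rintro rfl; simp [om] at h
lemma om_ne_right {v w} (h : om v w ≠ 0) : w ≠ 0 := by rintro rfl; simp [om] at h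
/-- expansion in a basis -/
lemma expand (v a b : V2) : om a b • v = om v b • a + om a v • b := by
  ext i; fin_cases i <;> simp [om] <;> ring
lemma sl_ext_ac {g h : SL 2 ℝ} (H : ∀ v, ac g v = ac h v) : g = h := by
  apply Subtype.ext
  exact Matrix.ext_of_mulVec_single (fun i => H _)

lemma qq_ac_le (g : SL 2 ℝ) (v : V2) : qq (ac g v) ≤ ns g.1 * qq v := by
  simp only [qq, ac0, ac1, ns]
  nlinarith [sq_nonneg (g.1 0 0 * v 1 - g.1 0 1 * v 0), sq_nonneg (g.1 1 0 * v 1 - g.1 1 1 * v 0)]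
lemma ns_inv (g : SL 2 ℝ) : ns (g⁻¹).1 = ns g.1 := by
  have : (g⁻¹).1 = !![g.1 1 1, - g.1 0 1; - g.1 1 0, g.1 0 0] := by
    change ((g⁻¹ : SL 2 ℝ) : Matrix (Fin 2) (Fin 2) ℝ) = _
    rw [Matrix.SpecialLinearGroup.coe_inv, Matrix.adjugate_fin_two]
  rw [this]; simp [ns]; ring
lemma qq_ac_ge (g : SL 2 ℝ) (v : V2) : qq v ≤ ns g.1 * qq (ac g v) := by
  have := qq_ac_le g⁻¹ (ac g v)
  rwa [ac_inv, ns_inv] at this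

/-- change of the sign of the scalar product -/
lemma sign_change (g : SL 2 ℝ) (a b : V2) (h1 : 0 ≤ ip a b) (h2 : ip (ac g a) (ac g b) ≤ 0) :
    qq a * qq b ≤ om a b ^ 2 * (1 + ns g.1 ^ 4) := by
  by_cases ha : a = 0
  · subst ha; simp [qq]; positivity
  have hqa := qq_pos ha
  set a' : V2 := ![- a 1, a 0] with ha'
  have e : qq a • b = ip a b • a + om a b • a' := by
    ext i; fin_cases i <;> simp [qq, ip, om, ha'] <;> ring
  have e2 : qq a * ip (ac g a) (ac g b) = ip a b * qq (ac g a) + om a b * ip (ac g a) (ac g a') := by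
    have : ac g (qq a • b) = ac g (ip a b • a + om a b • a') := by rw [e]
    rw [ac_smul, ac_add, ac_smul, ac_smul] at this
    have h0 := congrFun this 0
    have h1 := congrFun this 1
    simp only [Pi.smul_apply, Pi.add_apply, smul_eq_mul] at h0 h1
    simp only [ip, qq] at *
    linear_combination (ac g a 0) * h0 + (ac g a 1) * h1
  have h3 : ip a b * qq (ac g a) ≤ - (om a b * ip (ac g a) (ac g a')) := by nlinarith
  have hq' : qq a' = qq a := by simp [qq, ha']; ring
  have h4 : (ip a b * qq (ac g a)) ^ 2 ≤ om a b ^ 2 * (qq (ac g a) * qq (ac g a')) := by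
    have h5 : 0 ≤ ip a b * qq (ac g a) := mul_nonneg h1 (qq_nonneg _)
    have h6 := lagr (ac g a) (ac g a')
    have h7 : (ip a b * qq (ac g a)) ^ 2 ≤ (om a b * ip (ac g a) (ac g a')) ^ 2 := by nlinarith
    have h8 : om a b ^ 2 * ip (ac g a) (ac g a') ^ 2 ≤ om a b ^ 2 * (qq (ac g a) * qq (ac g a')) := by
      rw [← h6]
      nlinarith [mul_nonneg (sq_nonneg (om a b)) (sq_nonneg (om (ac g a) (ac g a')))]
    nlinarith
  have hqg : 0 < qq (ac g a) := qq_pos (ac_ne ha)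
  have h5 : ip a b ^ 2 * qq (ac g a) ≤ om a b ^ 2 * qq (ac g a') := by
    have : qq (ac g a) * (ip a b ^ 2 * qq (ac g a)) ≤ qq (ac g a) * (om a b ^ 2 * qq (ac g a')) := by nlinarith
    exact le_of_mul_le_mul_left this hqg
  have h6 := qq_ac_le g a'
  have h7 := qq_ac_ge g a
  rw [hq'] at h6
  have hns : 0 ≤ ns g.1 := by simp only [ns]; positivity
  have h8 : qq (ac g a') ≤ ns g.1 ^ 2 * qq (ac g a) := by nlinarith
  have h9 : ip a b ^ 2 ≤ om a b ^ 2 * ns g.1 ^ 2 := by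
    have : qq (ac g a) * ip a b ^ 2 ≤ qq (ac g a) * (om a b ^ 2 * ns g.1 ^ 2) := by
      nlinarith [mul_le_mul_of_nonneg_left h8 (sq_nonneg (om a b))]
    exact le_of_mul_le_mul_left this hqg
  have hns1 : 1 ≤ ns g.1 := by
    have := det2 g
    simp only [ns]; nlinarith [sq_nonneg (g.1 0 0 - g.1 1 1), sq_nonneg (g.1 0 1 + g.1 1 0)]
  have h10 : ns g.1 ^ 2 ≤ ns g.1 ^ 4 := pow_le_pow_right₀ hns1 (by norm_num)
  rw [← lagr]
  nlinarith [mul_le_mul_of_nonneg_left h10 (sq_nonneg (om a b))]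

variable {Γ : Type} [Group Γ] {ρ : Γ →* SL 2 ℝ}

/-- properness -/
def Prop2 (ρ : Γ →* SL 2 ℝ) : Prop := ∀ C : ℝ, {γ | ns (ρ γ).1 ≤ C}.Finite

lemma ns_cont : Continuous ns := by unfold ns; fun_prop

lemma compact_ns (C : ℝ) : IsCompact {A : Matrix (Fin 2) (Fin 2) ℝ | ns A ≤ C} := by
  have h : {A : Matrix (Fin 2) (Fin 2) ℝ | ns A ≤ C} ⊆
      Set.pi Set.univ (fun _ : Fin 2 => Set.pi Set.univ fun _ : Fin 2 => Set.Icc (-(1 + C)) (1 + C)) := by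
    intro A hA
    simp only [Set.mem_setOf_eq, ns] at hA
    have : ∀ x : ℝ, x ^ 2 ≤ C → x ∈ Set.Icc (-(1 + C)) (1 + C) := fun x hx => ⟨by nlinarith [sq_nonneg (x + 1), sq_nonneg x], by nlinarith [sq_nonneg (x - 1), sq_nonneg x]⟩
    intro i _ j _
    apply this
    fin_cases i <;> fin_cases j <;> simp <;> nlinarith [sq_nonneg (A 0 0), sq_nonneg (A 0 1), sq_nonneg (A 1 0), sq_nonneg (A 1 1)]
  exact (isCompact_univ_pi fun _ => isCompact_univ_pi fun _ => isCompact_Icc).of_isClosed_subset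
    (isClosed_le ns_cont continuous_const) h

lemma proper_of_discrete (hinj : Function.Injective ρ) (hd : DiscreteTopology (ρ.range : Subgroup (SL 2 ℝ))) :
    Prop2 ρ := by
  intro C
  haveI : IsTopologicalGroup (SL 2 ℝ) := Matrix.SpecialLinearGroup.topologicalGroup
  haveI : T2Space (SL 2 ℝ) := inferInstanceAs (T2Space {A : Matrix (Fin 2) (Fin 2) ℝ // A.det = 1})
  have hcl : IsClosed (ρ.range : Set (SL 2 ℝ)) := Subgroup.isClosed_of_discrete
  have hemb : IsClosedEmbedding (fun A : SL 2 ℝ => (A : Matrix (Fin 2) (Fin 2) ℝ)) := by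
    refine ⟨⟨⟨rfl⟩, Subtype.val_injective⟩, ?_⟩
    have : Set.range (fun A : SL 2 ℝ => (A : Matrix (Fin 2) (Fin 2) ℝ)) = {A | A.det = 1} := by
      ext A; constructor
      · rintro ⟨B, rfl⟩; exact B.2
      · intro h; exact ⟨⟨A, h⟩, rfl⟩
    rw [this]
    exact isClosed_eq (by fun_prop) continuous_const
  have hK : IsCompact {A : SL 2 ℝ | ns A.1 ≤ C} := hemb.isCompact_preimage (compact_ns C)
  have hK2 : IsCompact ({A : SL 2 ℝ | ns A.1 ≤ C} ∩ (ρ.range : Set (SL 2 ℝ))) := hK.inter_right hcl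
  have hfin : ({A : SL 2 ℝ | ns A.1 ≤ C} ∩ (ρ.range : Set (SL 2 ℝ))).Finite := by
    have hd' : IsDiscrete (ρ.range : Set (SL 2 ℝ)) := ⟨hd⟩
    exact hK2.finite (hd'.mono Set.inter_subset_right)
  refine (hfin.preimage (f := ρ) hinj.injOn).subset ?_
  intro γ hγ
  exact ⟨hγ, ⟨γ, rfl⟩⟩

lemma ns_le_of (g : SL 2 ℝ) (a b : V2) : om a b ^ 2 * ns g.1 ≤ 2 * (qq a + qq b) * (qq (ac g a) + qq (ac g b)) := by
  have h : ∀ i, om a b * g.1 i 0 = b 1 * (g.1 i 0 * a 0 + g.1 i 1 * a 1) - a 1 * (g.1 i 0 * b 0 + g.1 i 1 * b 1) := by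
    intro i; simp only [om]; ring
  have h' : ∀ i, om a b * g.1 i 1 = a 0 * (g.1 i 0 * b 0 + g.1 i 1 * b 1) - b 0 * (g.1 i 0 * a 0 + g.1 i 1 * a 1) := by
    intro i; simp only [om]; ring
  have e : om a b ^ 2 * ns g.1 = (om a b * g.1 0 0) ^ 2 + (om a b * g.1 0 1) ^ 2 + (om a b * g.1 1 0) ^ 2 + (om a b * g.1 1 1) ^ 2 := by
    simp only [ns]; ring
  rw [e, h 0, h' 0, h 1, h' 1, ← ac0, ← ac0, ← ac1, ← ac1]
  simp only [qq]
  nlinarith [sq_nonneg (b 1 * ac g a 0 + a 1 * ac g b 0), sq_nonneg (a 0 * ac g b 0 + b 0 * ac g a 0),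
    sq_nonneg (b 1 * ac g a 1 + a 1 * ac g b 1), sq_nonneg (a 0 * ac g b 1 + b 0 * ac g a 1),
    sq_nonneg (a 0 * ac g a 0), sq_nonneg (a 0 * ac g a 1), sq_nonneg (a 1 * ac g a 0), sq_nonneg (a 1 * ac g a 1),
    sq_nonneg (b 0 * ac g b 0), sq_nonneg (b 0 * ac g b 1), sq_nonneg (b 1 * ac g b 0), sq_nonneg (b 1 * ac g b 1)]

lemma finite_vec (hp : Prop2 ρ) {a b : V2} (hab : om a b ≠ 0) (C : ℝ) :
    {γ | qq (ac (ρ γ) a) ≤ C ∧ qq (ac (ρ γ) b) ≤ C}.Finite := by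
  refine (hp (2 * (qq a + qq b) * (C + C) / om a b ^ 2)).subset ?_
  rintro γ ⟨h1, h2⟩
  have h3 := ns_le_of (ρ γ) a b
  have h4 : 0 < om a b ^ 2 := by positivity
  change ns (ρ γ).1 ≤ _
  rw [le_div_iff₀ h4]
  have h5 := qq_nonneg a
  have h6 := qq_nonneg b
  nlinarith [mul_le_mul_of_nonneg_left (add_le_add h1 h2) (add_nonneg h5 h6)]

end PG


/-! ## Cocompactness -/
namespace PG
open Filter Topology

section surf
variable {g : ℕ}

/-- a homomorphism to a group, nontrivial only on two of the generators `a_i` -/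
noncomputable def homA {H : Type} [Group H] (f : Fin g → H) : SurfaceGroup g →* H :=
  PresentedGroup.toGroup (f := fun x : Fin g × Bool => if x.2 then 1 else f x.1) (by
    intro r hr
    rw [Set.mem_singleton_iff] at hr
    subst hr
    rw [SG.lift_relator]
    simp [commutatorElement_def, Fin.partialProd])

lemma homA_ga {H : Type} [Group H] (f : Fin g → H) (i : Fin g) : homA f (SG.ga i) = f i := by
  unfold homA SG.ga
  rw [PresentedGroup.toGroup.of]; simp

lemma infinite_surf (hg : 2 ≤ g) : Infinite (SurfaceGroup g) := by
  have : Function.Surjective (homA (g := g) (fun _ => Multiplicative.ofAdd (1 : ℤ))) := by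
    intro k
    refine ⟨SG.ga ⟨0, by omega⟩ ^ (Multiplicative.toAdd k), ?_⟩
    rw [map_zpow, homA_ga, ← ofAdd_zsmul]; simp
  exact Infinite.of_surjective _ this

set_option maxRecDepth 100000 in
lemma not_metabelian (hg : 2 ≤ g) : ∃ a b c d : SurfaceGroup g, ⁅⁅a, b⁆, ⁅c, d⁆⁆ ≠ 1 := by
  let f : Fin g → Equiv.Perm (Fin 4) := fun i => if i.1 = 0 then Equiv.swap 0 1 else Equiv.swap 1 2 * Equiv.swap 2 3
  let x : SurfaceGroup g := SG.ga ⟨0, by omega⟩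
  let y : SurfaceGroup g := SG.ga ⟨1, by omega⟩
  refine ⟨x, y, x, y * y, ?_⟩
  intro h
  have := congrArg (homA f) h
  rw [map_commutatorElement, map_commutatorElement, map_commutatorElement, map_mul, homA_ga, homA_ga, map_one] at this
  simp only [f, if_true, if_neg one_ne_zero] at this
  revert this
  clear h f x y
  clear hg
  decide

lemma no_line (hg : 2 ≤ g) {ρ : SurfaceGroup g →* SL 2 ℝ} (hinj : Function.Injective ρ) {w : V2} (hw : w ≠ 0) :
    ∃ γ, om (ac (ρ γ) w) w ≠ 0 := by
  by_contra! hc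
  choose χ hχ using fun γ => parallel hw (hc γ)
  have hχ1 : ∀ s t : ℝ, s • w = t • w → s = t := fun s t h => smul_left_injective ℝ hw h
  have hm : ∀ a b, χ (a * b) = χ a * χ b := by
    intro a b
    apply hχ1
    rw [← hχ, map_mul, ac_mul, hχ b, ac_smul, hχ a, smul_smul, mul_comm]
  have h1 : χ 1 = 1 := by
    apply hχ1; rw [← hχ, map_one, ac_one, one_smul]
  have hi : ∀ a, χ a * χ a⁻¹ = 1 := fun a => by rw [← hm, mul_inv_cancel, h1]
  have hcom : ∀ a b : SurfaceGroup g, χ ⁅a, b⁆ = 1 := by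
    intro a b
    rw [commutatorElement_def, hm, hm, hm]
    linear_combination (χ b * χ b⁻¹) * hi a + hi b
  have hfix : ∀ a b : SurfaceGroup g, ac (ρ ⁅a, b⁆) w = w := fun a b => by rw [hχ, hcom, one_smul]
  have hcm : ∀ A B : SL 2 ℝ, ac A w = w → ac B w = w → A * B = B * A := by
    intro A B hA hB
    have key : ∀ C : SL 2 ℝ, ac C w = w → ∀ x, ∃ t : ℝ, ac C x = x + t • w := by
      intro C hC x
      have : om (ac C x - x) w = 0 := by
        have h := om_ac C x w
        rw [hC] at h
        have h2 : om (ac C x - x) w = om (ac C x) w - om x w := by simp [om]; ring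
        rw [h2, h, sub_self]
      obtain ⟨t, ht⟩ := parallel hw this
      exact ⟨t, by rw [← ht]; abel⟩
    apply sl_ext_ac
    intro v
    obtain ⟨s, hs⟩ := key A hA v
    obtain ⟨t, ht⟩ := key B hB v
    rw [ac_mul, ac_mul, hs, ht, ac_add, ac_add, ac_smul, ac_smul, hs, ht, hA, hB]
    abel
  obtain ⟨a, b, c, d, h⟩ := not_metabelian hg
  apply h
  rw [commutatorElement_eq_one_iff_mul_comm]
  apply hinj
  rw [map_mul, map_mul]
  exact hcm _ _ (hfix _ _) (hfix _ _)
end surf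

lemma compact_qq (C : ℝ) : IsCompact {v : V2 | qq v = C} := by
  have h : {v : V2 | qq v = C} ⊆
      Set.pi Set.univ (fun _ : Fin 2 => Set.Icc (-(1 + C)) (1 + C)) := by
    intro A hA
    simp only [Set.mem_setOf_eq, qq] at hA
    have : ∀ x : ℝ, x ^ 2 ≤ C → x ∈ Set.Icc (-(1 + C)) (1 + C) := fun x hx => ⟨by nlinarith [sq_nonneg (x + 1), sq_nonneg x], by nlinarith [sq_nonneg (x - 1), sq_nonneg x]⟩
    intro i _
    apply this
    fin_cases i <;> simp <;> nlinarith [sq_nonneg (A 0), sq_nonneg (A 1)]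
  exact (isCompact_univ_pi fun _ => isCompact_Icc).of_isClosed_subset
    (isClosed_eq (by unfold qq; fun_prop) continuous_const) h

lemma ns_mul_le (A B : Matrix (Fin 2) (Fin 2) ℝ) : ns (A * B) ≤ ns A * ns B := by
  simp only [ns, Matrix.mul_apply, Fin.sum_univ_two]
  have key : ∀ a b c d : ℝ, (a * b + c * d) ^ 2 ≤ (a ^ 2 + c ^ 2) * (b ^ 2 + d ^ 2) := by
    intro a b c d; nlinarith [sq_nonneg (a * d - c * b)]
  have h1 := key (A 0 0) (B 0 0) (A 0 1) (B 1 0)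
  have h2 := key (A 0 0) (B 0 1) (A 0 1) (B 1 1)
  have h3 := key (A 1 0) (B 0 0) (A 1 1) (B 1 0)
  have h4 := key (A 1 0) (B 0 1) (A 1 1) (B 1 1)
  nlinarith

lemma ns_nonneg (A : Matrix (Fin 2) (Fin 2) ℝ) : 0 ≤ ns A := by simp only [ns]; positivity
lemma ns_smul (t : ℝ) (A : Matrix (Fin 2) (Fin 2) ℝ) : ns (t • A) = t ^ 2 * ns A := by simp [ns]; ring
lemma ns_ge (g : SL 2 ℝ) : 1 ≤ ns g.1 := by
  have := det2 g
  simp only [ns]; nlinarith [sq_nonneg (g.1 0 0 - g.1 1 1), sq_nonneg (g.1 0 1 + g.1 1 0)]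

variable {Γ : Type} [Group Γ] {ρ : Γ →* SL 2 ℝ}

lemma exists_min (hp : Prop2 ρ) (h : SL 2 ℝ) : ∃ γ₀, ∀ γ, ns (ρ γ₀ * h).1 ≤ ns (ρ γ * h).1 := by
  have hfin : {γ | ns (ρ γ * h).1 ≤ ns h.1}.Finite := by
    refine (hp (ns h.1 * ns (h⁻¹).1)).subset ?_
    intro γ hγ
    have e : (ρ γ).1 = (ρ γ * h).1 * (h⁻¹).1 := by
      have : ρ γ = (ρ γ * h) * h⁻¹ := by group
      exact (congrArg Subtype.val this).trans (SG.slmul _ _)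
    change ns (ρ γ).1 ≤ _
    rw [e]
    refine (ns_mul_le _ _).trans ?_
    exact mul_le_mul_of_nonneg_right hγ (ns_nonneg _)
  have h1 : (1 : Γ) ∈ {γ | ns (ρ γ * h).1 ≤ ns h.1} := by simp
  obtain ⟨γ₀, h₀, hmin⟩ := Set.exists_min_image _ (fun γ => ns (ρ γ * h).1) hfin ⟨1, h1⟩
  refine ⟨γ₀, fun γ => ?_⟩
  by_cases hγ : ns (ρ γ * h).1 ≤ ns h.1
  · exact hmin γ hγ
  · exact le_trans h₀ (le_of_not_ge hγ)

lemma min_vec (hp : Prop2 ρ) (hc : ¬ ∃ C : ℝ, ∀ h : SL 2 ℝ, ∃ γ, ns (ρ γ * h).1 ≤ C) :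
    ∃ w : V2, w ≠ 0 ∧ ∀ γ, qq w ≤ qq (ac (ρ γ) w) := by
  push Not at hc
  have : ∀ k : ℕ, ∃ h : SL 2 ℝ, (k : ℝ) < ns h.1 ∧ ∀ γ, ns h.1 ≤ ns (ρ γ * h).1 := by
    intro k
    obtain ⟨h, hh⟩ := hc k
    obtain ⟨γ₀, h₀⟩ := exists_min hp h
    refine ⟨ρ γ₀ * h, hh _, fun γ => ?_⟩
    rw [← mul_assoc, ← map_mul]
    exact h₀ _
  choose h hk hmin using this
  let s : ℕ → ℝ := fun k => (Real.sqrt (ns (h k).1))⁻¹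
  have hpos : ∀ k, 0 < ns (h k).1 := fun k => lt_of_lt_of_le one_pos (ns_ge _)
  have hs2 : ∀ k, s k ^ 2 = (ns (h k).1)⁻¹ := fun k => by
    simp only [s, inv_pow, Real.sq_sqrt (hpos k).le]
  let B : ℕ → Matrix (Fin 2) (Fin 2) ℝ := fun k => s k • (h k).1
  have hB1 : ∀ k, ns (B k) = 1 := fun k => by
    simp only [B, ns_smul, hs2]; exact inv_mul_cancel₀ (hpos k).ne'
  haveI : FirstCountableTopology (Matrix (Fin 2) (Fin 2) ℝ) := inferInstanceAs (FirstCountableTopology (Fin 2 → Fin 2 → ℝ))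
  obtain ⟨L, -, φ, hφ, hL⟩ := (compact_ns 1).tendsto_subseq (x := B) (fun k => (hB1 k).le)
  have hdet : L.det = 0 := by
    have h1 : Tendsto (fun k => (B (φ k)).det) atTop (𝓝 L.det) :=
      ((Continuous.matrix_det continuous_id).tendsto L).comp hL
    have h2 : ∀ k, (B (φ k)).det = (ns (h (φ k)).1)⁻¹ := fun k => by
      simp only [B]
      rw [Matrix.det_smul, (h (φ k)).2, Fintype.card_fin, hs2, mul_one]
    have h3 : Tendsto (fun k => (ns (h (φ k)).1)⁻¹) atTop (𝓝 0) := by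
      apply Tendsto.inv_tendsto_atTop
      have h4 : Tendsto (fun k => ((φ k : ℕ) : ℝ)) atTop atTop :=
        tendsto_natCast_atTop_atTop.comp hφ.tendsto_atTop
      exact tendsto_atTop_mono (fun k => (hk (φ k)).le) h4
    simp only [h2] at h1
    exact tendsto_nhds_unique h1 h3
  have hn1 : ns L = 1 := by
    have h1 : Tendsto (fun k => ns (B (φ k))) atTop (𝓝 (ns L)) := (ns_cont.tendsto L).comp hL
    simp only [hB1] at h1
    exact tendsto_nhds_unique h1 tendsto_const_nhds
  have hge : ∀ γ, 1 ≤ ns ((ρ γ).1 * L) := by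
    intro γ
    have hcont : Continuous fun M : Matrix (Fin 2) (Fin 2) ℝ => ns ((ρ γ).1 * M) :=
      ns_cont.comp (continuous_const.matrix_mul continuous_id)
    have h1 : Tendsto (fun k => ns ((ρ γ).1 * B (φ k))) atTop (𝓝 (ns ((ρ γ).1 * L))) := (hcont.tendsto L).comp hL
    refine ge_of_tendsto' h1 (fun k => ?_)
    have e : (ρ γ).1 * B (φ k) = s (φ k) • (ρ γ * h (φ k)).1 := by
      simp only [B]; rw [Matrix.mul_smul]; congr 1
    rw [e, ns_smul, hs2]
    refine le_trans (inv_mul_cancel₀ (hpos (φ k)).ne').symm.le ?_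
    exact mul_le_mul_of_nonneg_left (hmin _ _) (inv_nonneg.2 (hpos _).le)
  have hcol : ∀ γ, ns ((ρ γ).1 * L) = qq (ac (ρ γ) ![L 0 0, L 1 0]) + qq (ac (ρ γ) ![L 0 1, L 1 1]) := by
    intro γ
    simp only [ns, qq, ac0, ac1, Matrix.mul_apply, Fin.sum_univ_two]
    simp; ring
  have hcol1 : qq ![L 0 0, L 1 0] + qq ![L 0 1, L 1 1] = 1 := by
    rw [← hn1]; simp [ns, qq]; ring
  have fin : ∀ a b : V2, a ≠ 0 → om b a = 0 → qq a + qq b = 1 → (∀ γ, 1 ≤ qq (ac (ρ γ) a) + qq (ac (ρ γ) b)) →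
      ∃ w : V2, w ≠ 0 ∧ ∀ γ, qq w ≤ qq (ac (ρ γ) w) := by
    intro a b ha hab h1 h2
    obtain ⟨t, rfl⟩ := parallel ha hab
    refine ⟨a, ha, fun γ => ?_⟩
    have e : ∀ v : V2, qq (t • v) = t ^ 2 * qq v := fun v => by simp [qq]; ring
    have h3 := h2 γ
    rw [ac_smul, e] at h3
    rw [e] at h1
    have : (1 + t ^ 2) * qq a ≤ (1 + t ^ 2) * qq (ac (ρ γ) a) := by linarith
    exact le_of_mul_le_mul_left this (by positivity)
  rw [Matrix.det_fin_two] at hdet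
  by_cases h0 : (![L 0 0, L 1 0] : V2) = 0
  · refine fin ![L 0 1, L 1 1] ![L 0 0, L 1 0] ?_ (by simp [om]; linarith) (by linarith) (fun γ => by have := hge γ; rw [hcol] at this; linarith)
    intro h1
    rw [h0, h1] at hcol1
    simp [qq] at hcol1
  · exact fin _ _ h0 (by simp [om]; linarith) hcol1 (fun γ => by have := hge γ; rwa [hcol] at this)

section horo
variable {g : ℕ} {ρ : SurfaceGroup g →* SL 2 ℝ}

lemma ip_neg_right (a b : V2) : ip a (-b) = - ip a b := by simp [ip]; ring

lemma exists_eps (hp : Prop2 ρ) {w : V2} (hw : w ≠ 0) (hmin : ∀ γ, qq w ≤ qq (ac (ρ γ) w)) (δ : SurfaceGroup g) :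
    ∃ ε : ℝ, (ε = 1 ∨ ε = -1) ∧ ∀ᶠ γ in cofinite, |om w (ac (ρ δ) w)| < ε * ip (ac (ρ γ) w) (ac (ρ γ) (ac (ρ δ) w)) := by
  have hc := qq_pos hw
  by_cases ho : om (ac (ρ δ) w) w = 0
  · obtain ⟨t, ht⟩ := parallel hw ho
    have ht0 : t ≠ 0 := by
      rintro rfl
      rw [zero_smul] at ht
      exact ac_ne hw ht
    have e : ∀ γ, ip (ac (ρ γ) w) (ac (ρ γ) (ac (ρ δ) w)) = t * qq (ac (ρ γ) w) := by
      intro γ; rw [ht, ac_smul]; simp [ip, qq]; ring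
    have hq : ∀ γ, 0 < qq (ac (ρ γ) w) := fun γ => lt_of_lt_of_le hc (hmin γ)
    have ho' : om w (ac (ρ δ) w) = 0 := by rw [om_swap, ho, neg_zero]
    simp only [e, ho', abs_zero]
    rcases lt_or_gt_of_ne ht0 with h | h
    · exact ⟨-1, Or.inr rfl, Eventually.of_forall fun γ => by nlinarith [mul_pos (neg_pos.2 h) (hq γ)]⟩
    · exact ⟨1, Or.inl rfl, Eventually.of_forall fun γ => by nlinarith [mul_pos h (hq γ)]⟩
  have ho' : om w (ac (ρ δ) w) ≠ 0 := fun h => ho (by rw [om_swap, h, neg_zero])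
  have hfinK : ∀ K : ℝ, {γ | qq (ac (ρ γ) w) * qq (ac (ρ γ) (ac (ρ δ) w)) ≤ K}.Finite := by
    intro K
    refine (finite_vec hp ho' (K / qq w)).subset ?_
    intro γ hγ
    have h1 := hmin γ
    have h2 := hmin (γ * δ)
    rw [map_mul, ac_mul] at h2
    change _ * _ ≤ K at hγ
    constructor
    · rw [le_div_iff₀ hc]; nlinarith
    · rw [le_div_iff₀ hc]; nlinarith
  set A : Set (SurfaceGroup g) := {γ | 0 < ip (ac (ρ γ⁻¹) w) (ac (ρ γ⁻¹) (ac (ρ δ) w))} with hA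
  have hend : A.Finite ∨ Aᶜ.Finite := by
    apply SG.one_ended
    intro x
    set k : SL 2 ℝ := ρ (PresentedGroup.of x)⁻¹
    refine ((hfinK (om w (ac (ρ δ) w) ^ 2 * (1 + ns k.1 ^ 4))).preimage inv_injective.injOn).subset ?_
    intro γ hγ
    change qq (ac (ρ γ⁻¹) w) * qq (ac (ρ γ⁻¹) (ac (ρ δ) w)) ≤ _
    have hγ' : ¬ ((0 < ip (ac k (ac (ρ γ⁻¹) w)) (ac k (ac (ρ γ⁻¹) (ac (ρ δ) w)))) ↔
        (0 < ip (ac (ρ γ⁻¹) w) (ac (ρ γ⁻¹) (ac (ρ δ) w)))) := by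
      have e : ρ (γ * PresentedGroup.of x)⁻¹ = k * ρ γ⁻¹ := by
        simp only [k]; rw [← map_mul, _root_.mul_inv_rev]
      simpa only [hA, Set.mem_setOf_eq, e, ac_mul] using hγ
    set a := ac (ρ γ⁻¹) w
    set b := ac (ρ γ⁻¹) (ac (ρ δ) w)
    have hom : om w (ac (ρ δ) w) = om a b := (om_ac _ _ _).symm
    rw [hom]
    by_cases h0 : 0 < ip a b
    · have h1 : ip (ac k a) (ac k b) ≤ 0 := by
        by_contra h2; exact hγ' ⟨fun _ => h0, fun _ => not_le.1 h2⟩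
      exact sign_change k a b h0.le h1
    · have h1 : 0 < ip (ac k a) (ac k b) := by
        by_contra h2; exact hγ' ⟨fun h => absurd h h2, fun h => absurd h h0⟩
      have := sign_change k a (-b) (by rw [ip_neg_right]; linarith) (by rw [ac_neg, ip_neg_right]; linarith)
      have e1 : qq (-b) = qq b := by simp [qq]
      have e2 : om a (-b) ^ 2 = om a b ^ 2 := by simp [om]; ring
      rwa [e1, e2] at this
  have hbig : ∀ᶠ γ in cofinite, om w (ac (ρ δ) w) ^ 2 < ip (ac (ρ γ) w) (ac (ρ γ) (ac (ρ δ) w)) ^ 2 := by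
    have := hfinK (2 * om w (ac (ρ δ) w) ^ 2)
    have h2 : ∀ᶠ γ in cofinite, ¬ (qq (ac (ρ γ) w) * qq (ac (ρ γ) (ac (ρ δ) w)) ≤ 2 * om w (ac (ρ δ) w) ^ 2) := by
      rw [eventually_cofinite]; simpa using this
    filter_upwards [h2] with γ hγ
    rw [← lagr, om_ac] at hγ
    linarith
  have hinv : Tendsto (fun γ : SurfaceGroup g => γ⁻¹) cofinite cofinite := inv_injective.tendsto_cofinite
  rcases hend with h | h
  · refine ⟨-1, Or.inr rfl, ?_⟩
    have h1 : ∀ᶠ γ in cofinite, γ ∉ A := by rw [eventually_cofinite]; simpa using h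
    filter_upwards [hbig, hinv.eventually h1] with γ h2 h3
    simp only [hA, Set.mem_setOf_eq, inv_inv, not_lt] at h3
    have := sq_lt_sq.1 h2
    rwa [abs_of_nonpos h3, ← neg_one_mul] at this
  · refine ⟨1, Or.inl rfl, ?_⟩
    have h1 : ∀ᶠ γ in cofinite, γ ∈ A := by rw [eventually_cofinite]; exact h
    filter_upwards [hbig, hinv.eventually h1] with γ h2 h3
    simp only [hA, Set.mem_setOf_eq, inv_inv] at h3
    have := sq_lt_sq.1 h2
    rwa [abs_of_pos h3, ← one_mul (ip _ _)] at this

lemma line_of_min (hg : 2 ≤ g) (hp : Prop2 ρ) {w : V2} (hw : w ≠ 0) (hmin : ∀ γ, qq w ≤ qq (ac (ρ γ) w)) :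
    ∃ x : V2, x ≠ 0 ∧ ∀ γ, om (ac (ρ γ) x) x = 0 := by
  haveI := infinite_surf hg
  choose ε hε1 hε using exists_eps hp hw hmin
  have hεsq : ∀ δ, ε δ * ε δ = 1 := fun δ => by rcases hε1 δ with h | h <;> rw [h] <;> norm_num
  have hmul : ∀ a b, ε (a * b) = ε a * ε b := by
    intro δ δ'
    have hr : Tendsto (fun γ : SurfaceGroup g => γ * δ) cofinite cofinite := (mul_left_injective δ).tendsto_cofinite
    obtain ⟨γ, h1, h2, h3⟩ := ((hε δ).and ((hr.eventually (hε δ')).and (hε (δ * δ')))).exists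
    rw [map_mul, ac_mul] at h2
    rw [map_mul, ac_mul] at h3
    set a := ac (ρ γ) w
    set b := ac (ρ γ) (ac (ρ δ) w) with hb
    have e : ac (ρ γ) (ac (ρ δ) (ac (ρ δ') w)) = ac (ρ (γ * δ)) (ac (ρ δ') w) := by
      rw [map_mul, ac_mul]
    rw [e] at h3
    rw [map_mul, ac_mul] at h3
    set c := ac (ρ γ) (ac (ρ δ) (ac (ρ δ') w)) with hcc
    rw [ac_mul] at h2
    have o1 : om w (ac (ρ δ) w) = om a b := (om_ac _ _ _).symm
    have o2 : om w (ac (ρ δ') w) = om b c := by rw [hb, hcc, om_ac, om_ac]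
    rw [o1] at h1
    rw [o2] at h2
    have h4 := ip3 a b c
    have hq : 0 ≤ qq b := qq_nonneg b
    have hac : 0 < ε (δ * δ') * ip a c := lt_of_le_of_lt (abs_nonneg _) h3
    have h5 : |om a b| * |om b c| < (ε δ * ip a b) * (ε δ' * ip b c) :=
      mul_lt_mul'' h1 h2 (abs_nonneg _) (abs_nonneg _)
    have h6 : ε δ * ε δ' * (om a b * om b c) ≤ |om a b| * |om b c| := by
      rw [← abs_mul]
      have h7 := le_abs_self (om a b * om b c)
      have h8 := neg_abs_le (om a b * om b c)
      rcases hε1 δ with h | h <;> rcases hε1 δ' with h' | h' <;> rw [h, h'] <;> linarith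
    have h7 : 0 < ε δ * ε δ' * (ip a c * qq b) := by
      rw [h4]; nlinarith
    have h8 : 0 < ε δ * ε δ' * ε (δ * δ') := by
      have h9 : 0 < (ε δ * ε δ' * (ip a c * qq b)) * (ε (δ * δ') * ip a c) := mul_pos h7 hac
      have h10 : 0 ≤ ip a c ^ 2 * qq b := by positivity
      by_contra h11
      push Not at h11
      nlinarith [mul_nonneg (neg_nonneg.2 h11) h10]
    rcases hε1 δ with h | h <;> rcases hε1 δ' with h' | h' <;> rcases hε1 (δ * δ') with h'' | h'' <;>
      rw [h, h', h''] at h8 <;> rw [h, h', h''] <;> norm_num at h8 <;> norm_num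
  have hε_one : ε 1 = 1 := by
    have := hmul 1 1
    rw [mul_one, hεsq] at this
    exact this
  set D : Set V2 := {u | ∀ δ, 0 ≤ om u (ε δ • ac (ρ δ) w)} with hD
  have hDinv : ∀ γ, ∀ u ∈ D, ε γ • ac (ρ γ) u ∈ D := by
    intro γ u hu δ
    have h1 := hu (γ⁻¹ * δ)
    have h2 : om (ac (ρ γ) u) (ac (ρ δ) w) = om u (ac (ρ (γ⁻¹ * δ)) w) := by
      rw [← om_ac (ρ γ) u, ← ac_mul, ← map_mul]; simp
    rw [om_smul_right, hmul] at h1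
    rw [om_smul_right, om_smul_left, h2]
    have h3 : ε γ⁻¹ = ε γ := by
      have h4 := hmul γ γ⁻¹
      rw [mul_inv_cancel, hε_one] at h4
      calc ε γ⁻¹ = (ε γ * ε γ) * ε γ⁻¹ := by rw [hεsq, one_mul]
        _ = ε γ * (ε γ * ε γ⁻¹) := by ring
        _ = ε γ := by rw [← h4, mul_one]
    rw [h3] at h1
    linarith
  have hDsm : ∀ u ∈ D, ∀ t : ℝ, 0 ≤ t → t • u ∈ D := by
    intro u hu t ht δ
    rw [om_smul_left]; exact mul_nonneg ht (hu δ)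
  have hnorm : ∀ u : V2, u ≠ 0 → qq ((Real.sqrt (qq u))⁻¹ • u) = 1 := by
    intro u hu
    have e : ∀ (t : ℝ) (v : V2), qq (t • v) = t ^ 2 * qq v := fun t v => by simp [qq]; ring
    rw [e, inv_pow, Real.sq_sqrt (qq_nonneg u), inv_mul_cancel₀ (qq_pos hu).ne']
  have hDclosed : IsClosed D := by
    have : D = ⋂ δ, {u | 0 ≤ om u (ε δ • ac (ρ δ) w)} := by ext; simp [hD]
    rw [this]
    exact isClosed_iInter fun δ => isClosed_le continuous_const (by unfold om; fun_prop)
  have hK : IsCompact ({v : V2 | qq v = 1} ∩ D) := (compact_qq 1).inter_right hDclosed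
  have hKne : ({v : V2 | qq v = 1} ∩ D).Nonempty := by
    let R : V2 → V2 := fun a => ![a 1, - a 0]
    have hR : ∀ a b, om (R a) b = ip a b := fun a b => by simp [R, om, ip]; ring
    let F : SurfaceGroup g → V2 := fun γ => ac (ρ γ)⁻¹ (R (ac (ρ γ) w))
    have hF0 : ∀ γ, F γ ≠ 0 := by
      intro γ h
      have h1 : R (ac (ρ γ) w) ≠ 0 := by
        intro h2
        have h3 := hR (ac (ρ γ) w) (ac (ρ γ) w)
        rw [h2] at h3
        have h4 : qq (ac (ρ γ) w) = 0 := by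
          have : ip (ac (ρ γ) w) (ac (ρ γ) w) = 0 := by rw [← h3]; simp [om]
          rw [← this]; simp [qq, ip]; ring
        exact ac_ne hw (qq_eq_zero.1 h4)
      exact ac_ne h1 h
    let Fn : SurfaceGroup g → V2 := fun γ => (Real.sqrt (qq (F γ)))⁻¹ • F γ
    obtain ⟨u, hu, hlim⟩ := (compact_qq 1).ultrafilter_le_nhds ((hyperfilter (SurfaceGroup g)).map Fn) (by
      rw [Ultrafilter.coe_map, le_principal_iff, mem_map]
      exact univ_mem' fun γ => hnorm _ (hF0 γ))
    refine ⟨u, hu, fun δ => ?_⟩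
    have hcl : IsClosed {u : V2 | 0 ≤ om u (ε δ • ac (ρ δ) w)} := isClosed_le continuous_const (by unfold om; fun_prop)
    have hlim' : Tendsto Fn (hyperfilter (SurfaceGroup g) : Filter _) (𝓝 u) := hlim
    refine hcl.mem_of_tendsto hlim' ?_
    have hle : (hyperfilter (SurfaceGroup g) : Filter (SurfaceGroup g)) ≤ cofinite := hyperfilter_le_cofinite
    filter_upwards [hle (hε δ)] with γ hγ
    change 0 ≤ om ((Real.sqrt (qq (F γ)))⁻¹ • F γ) _
    rw [om_smul_left]
    refine mul_nonneg (inv_nonneg.2 (Real.sqrt_nonneg _)) ?_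
    rw [← om_ac (ρ γ)]
    simp only [F]
    rw [ac_inv', hR, ac_smul]
    have : ip (ac (ρ γ) w) (ε δ • ac (ρ γ) (ac (ρ δ) w)) = ε δ * ip (ac (ρ γ) w) (ac (ρ γ) (ac (ρ δ) w)) := by
      simp [ip]; ring
    rw [this]
    exact le_trans (abs_nonneg _) (le_of_lt hγ)
  by_cases hpar : ∀ δ, om (ac (ρ δ) w) w = 0
  · exact ⟨w, hw, hpar⟩
  push Not at hpar
  obtain ⟨δ₀, hδ₀⟩ := hpar
  set v : V2 := ε δ₀ • ac (ρ δ₀) w with hv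
  have hvw : om w v ≠ 0 := by
    rw [hv, om_smul_right, om_swap]
    refine mul_ne_zero ?_ (neg_ne_zero.2 hδ₀)
    intro h; have := hεsq δ₀; rw [h] at this; norm_num at this
  have hα : ∀ u ∈ D, 0 ≤ om u w := by
    intro u hu
    have := hu 1
    rwa [map_one, ac_one, hε_one, one_smul] at this
  have hβ : ∀ u ∈ D, 0 ≤ om u v := fun u hu => hu δ₀
  have hαβ : ∀ u ∈ D, u ≠ 0 → 0 < om u w + om u v := by
    intro u hu h0
    refine lt_of_le_of_ne (add_nonneg (hα u hu) (hβ u hu)) ?_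
    intro h
    have h1 : om u w = 0 := by linarith [hα u hu, hβ u hu]
    have h2 : om u v = 0 := by linarith [hα u hu, hβ u hu]
    have h3 := expand u w v
    rw [h2, om_swap u w, h1] at h3
    simp only [zero_smul, neg_zero, add_zero] at h3
    exact (smul_ne_zero hvw h0) h3
  have hne0 : ∀ u : V2, qq u = 1 → u ≠ 0 := by
    rintro u h rfl; simp [qq] at h
  obtain ⟨x, ⟨hx1, hxD⟩, hxm⟩ := hK.exists_isMinOn hKne (f := fun u => om u w / (om u w + om u v)) (by
    apply ContinuousOn.div
    · exact Continuous.continuousOn (by unfold om; fun_prop)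
    · exact Continuous.continuousOn (by unfold om; fun_prop)
    · intro u hu; exact (hαβ u hu.2 (hne0 u hu.1)).ne')
  have hx0 := hne0 x hx1
  have key : ∀ u ∈ D, 0 ≤ om w v * om u x := by
    intro u hu
    by_cases hu0 : u = 0
    · subst hu0; simp [om]
    set t := (Real.sqrt (qq u))⁻¹
    have ht : 0 < t := inv_pos.2 (Real.sqrt_pos.2 (qq_pos hu0))
    have h1 : om x w / (om x w + om x v) ≤ om (t • u) w / (om (t • u) w + om (t • u) v) :=
      hxm ⟨hnorm u hu0, hDsm u hu t ht.le⟩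
    rw [om_smul_left, om_smul_left, ← mul_add, mul_div_mul_left _ _ ht.ne',
      div_le_div_iff₀ (hαβ x hxD hx0) (hαβ u hu hu0)] at h1
    have e : om w v * om u x = om u w * (om x w + om x v) - om x w * (om u w + om u v) := by
      simp only [om]; ring
    rw [e]; linarith
  refine ⟨x, hx0, fun γ => ?_⟩
  have h1 := key _ (hDinv γ x hxD)
  have h2 := key _ (hDinv γ⁻¹ x hxD)
  have h3 : ε γ⁻¹ = ε γ := by
    have h4 := hmul γ γ⁻¹
    rw [mul_inv_cancel, hε_one] at h4
    calc ε γ⁻¹ = (ε γ * ε γ) * ε γ⁻¹ := by rw [hεsq, one_mul]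
      _ = ε γ * (ε γ * ε γ⁻¹) := by ring
      _ = ε γ := by rw [← h4, mul_one]
  have h4 : om (ac (ρ γ⁻¹) x) x = - om (ac (ρ γ) x) x := by
    rw [← om_ac (ρ γ), map_inv, ac_inv', om_swap]
  rw [om_smul_left] at h1 h2
  rw [h3, h4] at h2
  have h5 : om w v * (ε γ * om (ac (ρ γ) x) x) = 0 := by linarith
  have hεne : ε γ ≠ 0 := by
    intro h; have := hεsq γ; rw [h] at this; norm_num at this
  rcases mul_eq_zero.1 h5 with h | h
  · exact absurd h hvw
  · exact (mul_eq_zero.1 h).resolve_left hεne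

theorem cocompact (hg : 2 ≤ g) (hinj : Function.Injective ρ) (hp : Prop2 ρ) :
    ∃ C : ℝ, ∀ h : SL 2 ℝ, ∃ γ, ns (ρ γ * h).1 ≤ C := by
  by_contra hc
  obtain ⟨w, hw, hmin⟩ := min_vec hp hc
  obtain ⟨x, hx, hxl⟩ := line_of_min hg hp hw hmin
  obtain ⟨γ, hγ⟩ := no_line hg hinj hx
  exact hγ (hxl γ)
end horo
end PG


/-! ## Density -/
namespace PG
open Filter Topology

abbrev M2 := Matrix (Fin 2) (Fin 2) ℝ

variable {g : ℕ} {ρ : SurfaceGroup g →* SL 2 ℝ}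

def LL (ρ : SurfaceGroup g →* SL 2 ℝ) : Set M2 := closure {M | ∃ s : ℝ, 0 < s ∧ ∃ γ, M = s • (ρ γ).1}

lemma LL_mul {A B : M2} (hA : A ∈ LL ρ) (hB : B ∈ LL ρ) : A * B ∈ LL ρ := by
  refine map_mem_closure₂ (f := fun A B : M2 => A * B) ?_ hA hB ?_
  · exact (continuous_fst.matrix_mul continuous_snd)
  · rintro _ ⟨s, hs, γ, rfl⟩ _ ⟨t, ht, δ, rfl⟩
    refine ⟨s * t, mul_pos hs ht, γ * δ, ?_⟩
    have : (ρ (γ * δ)).1 = (ρ γ).1 * (ρ δ).1 := by rw [map_mul]; exact SG.slmul _ _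
    rw [this]
    simp [smul_smul, mul_comm]

lemma LL_adj {A : M2} (hA : A ∈ LL ρ) : A.adjugate ∈ LL ρ := by
  refine map_mem_closure (f := fun A : M2 => A.adjugate) ?_ hA ?_
  · exact Continuous.matrix_adjugate continuous_id
  · rintro _ ⟨s, hs, γ, rfl⟩
    refine ⟨s, hs, γ⁻¹, ?_⟩
    have : (ρ γ⁻¹).1 = (ρ γ).1.adjugate := by
      rw [map_inv]; exact Matrix.SpecialLinearGroup.coe_inv _
    rw [this]; beta_reduce; rw [Matrix.adjugate_smul]; simp

lemma LL_smul {A : M2} (hA : A ∈ LL ρ) {t : ℝ} (ht : 0 < t) : t • A ∈ LL ρ := by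
  refine map_mem_closure (f := fun A : M2 => t • A) (continuous_const_smul t) hA ?_
  rintro _ ⟨s, hs, γ, rfl⟩
  exact ⟨t * s, mul_pos ht hs, γ, smul_smul _ _ _⟩

lemma LL_coe (γ) : (ρ γ).1 ∈ LL ρ := subset_closure ⟨1, one_pos, γ, by rw [one_smul]⟩

def ro (u φ : V2) : M2 := !![u 0 * φ 0, u 0 * φ 1; u 1 * φ 0, u 1 * φ 1]

lemma exists_sl (u : V2) (hu : u ≠ 0) : ∃ R : SL 2 ℝ, R.1 0 0 = u 0 ∧ R.1 1 0 = u 1 := by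
  have hq := qq_pos hu
  refine ⟨⟨!![u 0, - u 1 / qq u; u 1, u 0 / qq u], ?_⟩, rfl, rfl⟩
  rw [Matrix.det_fin_two_of]
  field_simp
  simp [qq]

lemma LL_first (hC : ∃ C : ℝ, ∀ h : SL 2 ℝ, ∃ γ, ns (ρ γ * h).1 ≤ C) (u : V2) (hu : u ≠ 0) :
    ∃ φ : V2, φ ≠ 0 ∧ ro u φ ∈ LL ρ := by
  obtain ⟨C, hC⟩ := hC
  obtain ⟨R, hR0, hR1⟩ := exists_sl u hu
  let D : ℕ → SL 2 ℝ := fun k => ⟨!![(k + 1 : ℝ), 0; 0, (k + 1 : ℝ)⁻¹], by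
    rw [Matrix.det_fin_two_of, mul_inv_cancel₀ (by positivity)]; ring⟩
  choose γ hγ using fun k => hC (R * D k)
  let κ : ℕ → M2 := fun k => ((ρ (γ k) * (R * D k))⁻¹).1
  have hκ : ∀ k, κ k ∈ {A : M2 | ns A ≤ C} := fun k => by
    change ns _ ≤ C
    rw [ns_inv]; exact hγ k
  haveI : FirstCountableTopology (Matrix (Fin 2) (Fin 2) ℝ) := inferInstanceAs (FirstCountableTopology (Fin 2 → Fin 2 → ℝ))
  obtain ⟨K, -, f, hf, hK⟩ := (compact_ns C).tendsto_subseq hκ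
  have hdet : K.det = 1 := by
    have h1 : Tendsto (fun k => (κ (f k)).det) atTop (𝓝 K.det) :=
      ((Continuous.matrix_det continuous_id).tendsto K).comp hK
    have h2 : ∀ k, (κ (f k)).det = 1 := fun k => ((ρ (γ (f k)) * (R * D (f k)))⁻¹).2
    simp only [h2] at h1
    exact tendsto_nhds_unique h1 tendsto_const_nhds
  refine ⟨![K 0 0, K 0 1], ?_, ?_⟩
  · intro h
    have h0 := congrFun h 0
    have h1 := congrFun h 1
    simp at h0 h1
    rw [Matrix.det_fin_two, h0, h1] at hdet
    simp at hdet
  · let E : ℕ → M2 := fun k => !![(1 : ℝ), 0; 0, ((k + 1 : ℝ)⁻¹) ^ 2]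
    have hE : Tendsto (fun k => E (f k)) atTop (𝓝 !![(1 : ℝ), 0; 0, 0]) := by
      have h0 : Tendsto (fun k : ℕ => ((k + 1 : ℝ)⁻¹) ^ 2) atTop (𝓝 0) := by
        have := (tendsto_one_div_add_atTop_nhds_zero_nat (𝕜 := ℝ)).pow 2
        simpa using this
      have h1 := h0.comp hf.tendsto_atTop
      refine tendsto_pi_nhds.2 fun i => tendsto_pi_nhds.2 fun j => ?_
      fin_cases i <;> fin_cases j <;> simp only [E]
      · exact tendsto_const_nhds
      · exact tendsto_const_nhds
      · exact tendsto_const_nhds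
      · exact h1
    have hlim : Tendsto (fun k => R.1 * (E (f k) * κ (f k))) atTop (𝓝 (R.1 * (!![(1 : ℝ), 0; 0, 0] * K))) := by
      exact TP.tendsto_mul tendsto_const_nhds (TP.tendsto_mul hE hK)
    have e : R.1 * (!![(1 : ℝ), 0; 0, 0] * K) = ro u ![K 0 0, K 0 1] := by
      ext i j
      fin_cases i <;> fin_cases j <;> simp [Matrix.mul_apply, Fin.sum_univ_two, ro, hR0, hR1, Matrix.vecMul, dotProduct]
    rw [e] at hlim
    refine mem_closure_of_tendsto hlim (Eventually.of_forall fun k => ?_)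
    refine ⟨((f k + 1 : ℝ))⁻¹, by positivity, (γ (f k))⁻¹, ?_⟩
    have e2 : (ρ (γ (f k))⁻¹) = R * (D (f k) * (ρ (γ (f k)) * (R * D (f k)))⁻¹) := by
      rw [map_inv]; group
    have e3 : (ρ (γ (f k))⁻¹).1 = R.1 * ((D (f k)).1 * κ (f k)) := by
      rw [e2]
      exact (SG.slmul _ _).trans (congrArg (R.1 * ·) (SG.slmul _ _))
    have e4 : E (f k) = ((f k + 1 : ℝ))⁻¹ • (D (f k)).1 := by
      ext i j
      have : ((f k : ℝ) + 1) ≠ 0 := by positivity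
      fin_cases i <;> fin_cases j <;> simp [E, D, this, pow_two]
    rw [e3, e4]
    simp

lemma ro_ac (A : M2) (u φ : V2) : A * ro u φ = ro (A *ᵥ u) φ := by
  ext i j
  fin_cases i <;> fin_cases j <;> simp [Matrix.mul_apply, Fin.sum_univ_two, ro, Matrix.mulVec, dotProduct] <;> ring

lemma ro_ro (u φ v ψ : V2) : ro u φ * ro v ψ = ip φ v • ro u ψ := by
  ext i j
  fin_cases i <;> fin_cases j <;> simp [Matrix.mul_apply, Fin.sum_univ_two, ro, ip] <;> ring

lemma LL_all (hg : 2 ≤ g) (hinj : Function.Injective ρ)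
    (hC : ∃ C : ℝ, ∀ h : SL 2 ℝ, ∃ γ, ns (ρ γ * h).1 ≤ C) (u φ : V2) (hu : u ≠ 0) (hφ : φ ≠ 0) :
    ∃ η : ℝ, (η = 1 ∨ η = -1) ∧ η • ro u φ ∈ LL ρ := by
  obtain ⟨ψ, hψ, h1⟩ := LL_first hC u hu
  obtain ⟨χ, hχ, h2⟩ := LL_first hC ![-φ 1, φ 0] (by
    intro h; apply hφ
    have h0 := congrFun h 0
    have h1 := congrFun h 1
    simp at h0 h1
    ext i; fin_cases i <;> simp [h0, h1])
  have h3 := LL_adj h2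
  have e : (ro ![-φ 1, φ 0] χ).adjugate = ro ![χ 1, - χ 0] φ := by
    rw [Matrix.adjugate_fin_two]
    ext i j
    fin_cases i <;> fin_cases j <;> simp [ro] <;> ring
  rw [e] at h3
  set v : V2 := ![χ 1, - χ 0]
  have hv : v ≠ 0 := by
    intro h; apply hχ
    have h0 := congrFun h 0
    have h1 := congrFun h 1
    simp [v] at h0 h1
    ext i; fin_cases i <;> simp [h0, h1]
  obtain ⟨γ, hγ⟩ : ∃ γ, ip ψ (ac (ρ γ) v) ≠ 0 := by
    by_contra! hc
    obtain ⟨γ, hγ⟩ := no_line hg hinj hv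
    apply hγ
    have a1 := hc γ
    have a2 := hc 1
    rw [map_one, ac_one] at a2
    have hq := qq_pos hψ
    have : qq ψ * om (ac (ρ γ) v) v = 0 := by
      simp only [ip, qq, om] at *
      linear_combination (ψ 0 * v 1 - ψ 1 * v 0) * a1 + (ψ 1 * ac (ρ γ) v 0 - ψ 0 * ac (ρ γ) v 1) * a2
    exact (mul_eq_zero.1 this).resolve_left hq.ne'
  have h4 := LL_mul h1 (LL_mul (LL_coe γ) h3)
  rw [ro_ac, ro_ro] at h4
  change ip ψ (ac (ρ γ) v) • _ ∈ _ at h4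
  set c := ip ψ (ac (ρ γ) v)
  have h5 := LL_smul h4 (abs_pos.2 (inv_ne_zero hγ))
  rw [smul_smul] at h5
  refine ⟨|c⁻¹| * c, ?_, h5⟩
  rcases lt_or_gt_of_ne hγ with h | h
  · right; rw [abs_of_neg (inv_lt_zero.2 h)]; field_simp
  · left; rw [abs_of_pos (inv_pos.2 h)]; field_simp

lemma LL_open {A : M2} (hA : A ∈ LL ρ) {U : Set M2} (hU : IsOpen U) (h : A ∈ U) :
    ∃ s : ℝ, 0 < s ∧ ∃ γ, s • (ρ γ).1 ∈ U := by
  obtain ⟨M, h1, s, hs, γ, rfl⟩ := mem_closure_iff.1 hA U hU h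
  exact ⟨s, hs, γ, h1⟩

/-- both vectors can be moved, simultaneously, to the open cone spanned by `a` and `b` -/
lemma dens (hg : 2 ≤ g) (hinj : Function.Injective ρ)
    (hC : ∃ C : ℝ, ∀ h : SL 2 ℝ, ∃ γ, ns (ρ γ * h).1 ≤ C) (x y a b : V2) (hxy : om x y ≠ 0) (hab : 0 < om a b) :
    ∃ γ, ∃ η : ℝ, (η = 1 ∨ η = -1) ∧ (0 < η * om a (ac (ρ γ) x) ∧ 0 < η * om (ac (ρ γ) x) b) ∧
      (0 < η * om a (ac (ρ γ) y) ∧ 0 < η * om (ac (ρ γ) y) b) := by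
  have hu : a + b ≠ 0 := by
    intro h
    have : om a (a + b) = 0 := by rw [h]; simp [om]
    rw [om_add_right, om_self] at this; linarith
  set φ : V2 := (om x y)⁻¹ • ![y 1 - x 1, x 0 - y 0] with hφd
  have hφx : ip φ x = 1 := by
    have : ip φ x = (om x y)⁻¹ * om x y := by simp [ip, hφd, om]; ring
    rw [this, inv_mul_cancel₀ hxy]
  have hφy : ip φ y = 1 := by
    have : ip φ y = (om x y)⁻¹ * om x y := by simp [ip, hφd, om]; ring
    rw [this, inv_mul_cancel₀ hxy]
  have hφ : φ ≠ 0 := by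
    intro h; rw [h] at hφx; simp [ip] at hφx
  obtain ⟨η, hη, hL⟩ := LL_all hg hinj hC (a + b) φ hu hφ
  have hη2 : η * η = 1 := by rcases hη with h | h <;> rw [h] <;> norm_num
  have hop : ∀ z : V2, IsOpen {M : M2 | 0 < η * om a (M *ᵥ z) ∧ 0 < η * om (M *ᵥ z) b} := by
    intro z
    have hc : ∀ i, Continuous fun M : M2 => (M *ᵥ z) i := fun i =>
      by
        simp only [Matrix.mulVec, dotProduct, Fin.sum_univ_two]; fun_prop
    have h0 := hc 0
    have h1 := hc 1
    refine (isOpen_lt (f := fun _ : M2 => (0 : ℝ)) continuous_const ?_).inter (isOpen_lt (f := fun _ : M2 => (0 : ℝ)) continuous_const ?_)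
    · unfold om; fun_prop
    · unfold om; fun_prop
  have hro : ∀ z, (η • ro (a + b) φ) *ᵥ z = (η * ip φ z) • (a + b) := by
    intro z; ext i; fin_cases i <;> simp [ro, ip, Matrix.mulVec, dotProduct, Fin.sum_univ_two] <;> ring
  have hmem : ∀ z, ip φ z = 1 → (η • ro (a + b) φ) ∈ {M : M2 | 0 < η * om a (M *ᵥ z) ∧ 0 < η * om (M *ᵥ z) b} := by
    intro z hz
    simp only [Set.mem_setOf_eq, hro, hz, mul_one, om_smul_right, om_smul_left, om_add_left, om_add_right, om_self,
      ← mul_assoc, hη2]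
    constructor <;> linarith
  obtain ⟨s, hs, γ, h1, h2⟩ := LL_open hL ((hop x).inter (hop y)) ⟨hmem x hφx, hmem y hφy⟩
  have hs' : ∀ z, (s • (ρ γ).1) *ᵥ z = s • ac (ρ γ) z := fun z => Matrix.smul_mulVec _ _ _
  simp only [Set.mem_setOf_eq, hs', om_smul_left, om_smul_right] at h1 h2
  have hd : ∀ r : ℝ, 0 < η * (s * r) → 0 < η * r := by
    intro r hr
    have : η * (s * r) = s * (η * r) := by ring
    rw [this] at hr
    exact (mul_pos_iff_of_pos_left hs).1 hr
  exact ⟨γ, η, hη, ⟨hd _ h1.1, hd _ h1.2⟩, ⟨hd _ h2.1, hd _ h2.2⟩⟩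

lemma exists_hyp (hg : 2 ≤ g) (hinj : Function.Injective ρ)
    (hC : ∃ C : ℝ, ∀ h : SL 2 ℝ, ∃ γ, ns (ρ γ * h).1 ≤ C) :
    ∃ α, ∃ a : ℝ, 1 < a ∧ ∃ p q : V2, om p q = 1 ∧ ac (ρ α) p = a • p ∧ ac (ρ α) q = a⁻¹ • q := by
  have h1 : (![1, 0] : V2) ≠ 0 := fun h => by simpa using congrFun h 0
  obtain ⟨η, hη, hL⟩ := LL_all hg hinj hC ![1, 0] ![1, 0] h1 h1
  have hη2 : η ^ 2 = 1 := by rcases hη with h | h <;> rw [h] <;> norm_num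
  have hop : IsOpen {M : M2 | 4 * M.det < M.trace ^ 2} := by
    refine isOpen_lt (continuous_const.mul (Continuous.matrix_det continuous_id)) ?_
    exact (Continuous.matrix_trace continuous_id).pow 2
  obtain ⟨s, hs, γ, h2⟩ := LL_open hL hop (by
    simp only [Set.mem_setOf_eq, Matrix.det_fin_two, Matrix.trace_fin_two, ro]
    simp [hη2])
  simp only [Set.mem_setOf_eq] at h2
  rw [Matrix.det_smul, Matrix.trace_smul, (ρ γ).2] at h2
  simp only [Fintype.card_fin, mul_one, smul_eq_mul] at h2
  have hs2 : 0 < s ^ 2 := by positivity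
  have h3 : 4 < (ρ γ).1.trace ^ 2 := by
    have : s ^ 2 * 4 < s ^ 2 * (ρ γ).1.trace ^ 2 := by linarith
    exact lt_of_mul_lt_mul_left this hs2.le
  set A : SL 2 ℝ := ρ (γ * γ) with hA
  have htr : 2 < A.1 0 0 + A.1 1 1 := by
    have e : A.1 = (ρ γ).1 * (ρ γ).1 := by rw [hA, map_mul]; exact SG.slmul _ _
    rw [Matrix.trace_fin_two] at h3
    have hd := det2 (ρ γ)
    rw [e]
    simp only [Matrix.mul_apply, Fin.sum_univ_two]
    nlinarith
  set τ := A.1 0 0 + A.1 1 1 with hτ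
  have hdA := det2 A
  have hdis : 0 < τ ^ 2 - 4 := by nlinarith
  set r := Real.sqrt (τ ^ 2 - 4) with hr
  have hr2 : r ^ 2 = τ ^ 2 - 4 := Real.sq_sqrt hdis.le
  have hrp : 0 < r := Real.sqrt_pos.2 hdis
  set a := (τ + r) / 2 with ha
  have ha1 : 1 < a := by rw [ha]; linarith
  have hai : a⁻¹ = (τ - r) / 2 := by
    apply inv_eq_of_mul_eq_one_right
    rw [ha]; linear_combination -(1/4 : ℝ) * hr2
  have hev : ∀ b : ℝ, b ^ 2 - τ * b + 1 = 0 → ∃ v : V2, v ≠ 0 ∧ ac A v = b • v := by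
    intro b hb
    have hdet : (A.1 - b • (1 : M2)).det = 0 := by
      rw [Matrix.det_fin_two]; simp
      linear_combination hb + hdA
    obtain ⟨v, hv, hv2⟩ := Matrix.exists_mulVec_eq_zero_iff.2 hdet
    refine ⟨v, hv, ?_⟩
    rw [Matrix.sub_mulVec, Matrix.smul_mulVec, Matrix.one_mulVec, sub_eq_zero] at hv2
    exact hv2
  obtain ⟨p, hp, hp2⟩ := hev a (by rw [ha]; linear_combination (1/4 : ℝ) * hr2)
  obtain ⟨q, hq, hq2⟩ := hev a⁻¹ (by rw [hai]; linear_combination (1/4 : ℝ) * hr2)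
  have hpq : om p q ≠ 0 := by
    intro h
    obtain ⟨t, rfl⟩ := parallel hq h
    rw [ac_smul, hq2, smul_smul, smul_smul] at hp2
    have ht : t ≠ 0 := by rintro rfl; simp at hp
    have : t * a⁻¹ = a * t := smul_left_injective ℝ hq hp2
    have h5 : a⁻¹ = a := by
      apply mul_left_cancel₀ ht; rw [this, mul_comm]
    rw [hai, ha] at h5
    linarith
  refine ⟨γ * γ, a, ha1, p, (om p q)⁻¹ • q, ?_, hp2, ?_⟩
  · rw [om_smul_right, inv_mul_cancel₀ hpq]
  · rw [← hA, ac_smul, hq2, smul_comm]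
end PG


/-! ## Labels -/
namespace PG
open Filter Topology

lemma qq_smul (t : ℝ) (v : V2) : qq (t • v) = t ^ 2 * qq v := by simp [qq]; ring
lemma om_sq_le (v w : V2) : om v w ^ 2 ≤ qq v * qq w := by rw [← lagr]; nlinarith [sq_nonneg (ip v w)]

/-- axis data -/
structure Ax (G : Type) [Group G] where
  ρ : G →* SL 2 ℝ
  P : V2
  Q : V2
  al : G
  a : ℝ
  ha : 1 < a
  hPQ : om P Q = 1
  hP : ac (ρ al) P = a • P
  hQ : ac (ρ al) Q = a⁻¹ • Q

variable {G : Type} [Group G] (X : Ax G)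

abbrev Lb (G : Type) := G × Bool

def opp (l : Lb G) : Lb G := (l.1, !l.2)
def sm (γ : G) (l : Lb G) : Lb G := (γ * l.1, l.2)

namespace Ax

lemma apos : 0 < X.a := lt_trans one_pos X.ha

def ba (e : Bool) : V2 := if e then X.Q else X.P
def lv (l : Lb G) : V2 := ac (X.ρ l.1) (X.ba l.2)
def Eqv (l l' : Lb G) : Prop := (∃ m : ℤ, l'.1 = l.1 * X.al ^ m) ∧ l'.2 = l.2
noncomputable def cost (p q : Lb G) : ℝ := |om (X.lv (opp p)) (X.lv q) * om (X.lv p) (X.lv (opp q))|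
def CC (p r q : Lb G) : Prop := 0 < om (X.lv p) (X.lv r) * om (X.lv r) (X.lv q) * om (X.lv p) (X.lv q)
def o (p q : Lb G) : ℝ := om (X.lv p) (X.lv q)

lemma lv_sm (γ : G) (l : Lb G) : X.lv (sm γ l) = ac (X.ρ γ) (X.lv l) := by
  simp [lv, sm, ac_mul]
lemma opp_sm (γ : G) (l : Lb G) : opp (sm γ l) = sm γ (opp l) := rfl
lemma opp_opp (l : Lb G) : opp (opp l) = l := by simp [opp]
lemma sm_sm (γ δ : G) (l : Lb G) : sm γ (sm δ l) = sm (γ * δ) l := by simp [sm, mul_assoc]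
lemma sm_one (l : Lb G) : sm 1 l = l := by simp [sm]

lemma o_sm (γ : G) (p q : Lb G) : X.o (sm γ p) (sm γ q) = X.o p q := by
  simp only [o, lv_sm, om_ac]
lemma cost_sm (γ : G) (p q : Lb G) : X.cost (sm γ p) (sm γ q) = X.cost p q := by
  simp only [cost, opp_sm, lv_sm, om_ac]
lemma CC_sm (γ : G) (p r q : Lb G) : X.CC (sm γ p) (sm γ r) (sm γ q) ↔ X.CC p r q := by
  simp only [CC, lv_sm, om_ac]

lemma om_opp (l : Lb G) : |om (X.lv l) (X.lv (opp l))| = 1 := by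
  rcases l with ⟨γ, e⟩
  cases e
  · simp [lv, opp, om_ac, ba, X.hPQ]
  · simp [lv, opp, om_ac, ba, om_swap X.P X.Q, X.hPQ]

lemma zpowP (m : ℤ) : ac (X.ρ (X.al ^ m)) X.P = X.a ^ m • X.P ∧ ac (X.ρ (X.al ^ m)) X.Q = (X.a ^ m)⁻¹ • X.Q := by
  have h0 := X.apos.ne'
  have hP' : ac (X.ρ X.al)⁻¹ X.P = X.a⁻¹ • X.P := by
    have := congrArg (fun v => X.a⁻¹ • ac (X.ρ X.al)⁻¹ v) X.hP
    simp only [ac_inv, ac_smul, smul_smul, inv_mul_cancel₀ h0, one_smul] at this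
    exact this.symm
  have hQ' : ac (X.ρ X.al)⁻¹ X.Q = X.a • X.Q := by
    have := congrArg (fun v => X.a • ac (X.ρ X.al)⁻¹ v) X.hQ
    simp only [ac_inv, ac_smul, smul_smul, mul_inv_cancel₀ h0, one_smul] at this
    exact this.symm
  induction m using Int.induction_on with
  | zero => simp [ac_one]
  | succ k ih =>
    rw [_root_.zpow_add_one, map_mul, ac_mul, ac_mul, X.hP, X.hQ, ac_smul, ac_smul, ih.1, ih.2, zpow_add_one₀ h0,
      _root_.mul_inv, smul_smul, smul_smul, mul_comm X.a, mul_comm X.a⁻¹]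
    exact ⟨rfl, rfl⟩
  | pred k ih =>
    rw [_root_.zpow_sub_one, map_mul, ac_mul, ac_mul, map_inv, hP', hQ', ac_smul, ac_smul, ih.1, ih.2, zpow_sub_one₀ h0,
      _root_.mul_inv, inv_inv, smul_smul, smul_smul, mul_comm X.a, mul_comm X.a⁻¹]
    exact ⟨rfl, rfl⟩

lemma Eqv.refl (l : Lb G) : X.Eqv l l := ⟨⟨0, by simp⟩, rfl⟩
variable {X}
lemma Eqv.symm {l l' : Lb G} (h : X.Eqv l l') : X.Eqv l' l := by
  obtain ⟨⟨m, hm⟩, he⟩ := h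
  exact ⟨⟨-m, by rw [hm]; simp⟩, he.symm⟩
lemma Eqv.trans {l l' l'' : Lb G} (h : X.Eqv l l') (h' : X.Eqv l' l'') : X.Eqv l l'' := by
  obtain ⟨⟨m, hm⟩, he⟩ := h
  obtain ⟨⟨k, hk⟩, he'⟩ := h'
  exact ⟨⟨m + k, by rw [hk, hm, mul_assoc, _root_.zpow_add]⟩, he'.trans he⟩
lemma Eqv.sm {l l' : Lb G} (h : X.Eqv l l') (γ : G) : X.Eqv (sm γ l) (sm γ l') := by
  obtain ⟨⟨m, hm⟩, he⟩ := h
  exact ⟨⟨m, by simp [PG.sm, hm, mul_assoc]⟩, he⟩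
lemma Eqv.opp {l l' : Lb G} (h : X.Eqv l l') : X.Eqv (opp l) (opp l') := by
  obtain ⟨⟨m, hm⟩, he⟩ := h
  exact ⟨⟨m, hm⟩, by simp [PG.opp, he]⟩
lemma Eqv.vec {l l' : Lb G} (h : X.Eqv l l') : ∃ t : ℝ, 0 < t ∧ X.lv l' = t • X.lv l ∧
    X.lv (PG.opp l') = t⁻¹ • X.lv (PG.opp l) := by
  obtain ⟨⟨m, hm⟩, he⟩ := h
  have hz := X.zpowP m
  rcases l with ⟨γ, e⟩
  rcases l' with ⟨γ', e'⟩
  simp only at hm he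
  subst hm he
  cases e'
  · refine ⟨X.a ^ m, zpow_pos X.apos _, ?_, ?_⟩
    · change ac (X.ρ (γ * X.al ^ m)) X.P = _ • ac (X.ρ γ) X.P
      rw [map_mul, ac_mul, hz.1, ac_smul]
    · change ac (X.ρ (γ * X.al ^ m)) X.Q = _ • ac (X.ρ γ) X.Q
      rw [map_mul, ac_mul, hz.2, ac_smul]
  · refine ⟨(X.a ^ m)⁻¹, inv_pos.2 (zpow_pos X.apos _), ?_, ?_⟩
    · change ac (X.ρ (γ * X.al ^ m)) X.Q = _ • ac (X.ρ γ) X.Q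
      rw [map_mul, ac_mul, hz.2, ac_smul]
    · change ac (X.ρ (γ * X.al ^ m)) X.P = _ • ac (X.ρ γ) X.P
      rw [inv_inv, map_mul, ac_mul, hz.1, ac_smul]

lemma o_eqv {p q p' q' : Lb G} (hp : X.Eqv p p') (hq : X.Eqv q q') (h : X.o p q ≠ 0) : X.o p' q' ≠ 0 := by
  obtain ⟨s, hs, e1, -⟩ := hp.vec
  obtain ⟨t, ht, e2, -⟩ := hq.vec
  simp only [o] at *
  rw [e1, e2, om_smul_left, om_smul_right]
  exact mul_ne_zero hs.ne' (mul_ne_zero ht.ne' h)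

lemma cost_eqv {p q p' q' : Lb G} (hp : X.Eqv p p') (hq : X.Eqv q q') : X.cost p' q' = X.cost p q := by
  obtain ⟨s, hs, e1, e1'⟩ := hp.vec
  obtain ⟨t, ht, e2, e2'⟩ := hq.vec
  simp only [cost, e1, e1', e2, e2', om_smul_left, om_smul_right]
  congr 1
  field_simp

lemma CC_eqv {p r q p' r' q' : Lb G} (hp : X.Eqv p p') (hr : X.Eqv r r') (hq : X.Eqv q q') (h : X.CC p r q) :
    X.CC p' r' q' := by
  obtain ⟨s, hs, e1, -⟩ := hp.vec
  obtain ⟨t, ht, e2, -⟩ := hq.vec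
  obtain ⟨u, hu, e3, -⟩ := hr.vec
  simp only [CC, e1, e2, e3, om_smul_left, om_smul_right]
  rw [CC] at h
  have : u * (s * om (X.lv p) (X.lv r)) * (t * (u * om (X.lv r) (X.lv q))) * (t * (s * om (X.lv p) (X.lv q))) =
    (s * u * t) ^ 2 * (om (X.lv p) (X.lv r) * om (X.lv r) (X.lv q) * om (X.lv p) (X.lv q)) := by ring
  rw [this]; positivity

variable (X)
/-- normalising a label -/
lemma normLabel (γ : G) (l : Lb G) (s C : ℝ) (hs : 0 < s) (h1 : qq (s • ac (X.ρ γ) (X.lv l)) ≤ C)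
    (h2 : qq (s⁻¹ • ac (X.ρ γ) (X.lv (opp l))) ≤ C) :
    ∃ l' : Lb G, X.Eqv l (sm γ⁻¹ l') ∧ qq (ac (X.ρ l'.1) X.P) ≤ X.a ^ 2 * C ∧ qq (ac (X.ρ l'.1) X.Q) ≤ X.a ^ 2 * C := by
  obtain ⟨i, hi1, hi2⟩ := exists_mem_Ico_zpow hs X.ha
  have hai : 0 < X.a ^ i := zpow_pos X.apos _
  rw [zpow_add_one₀ X.apos.ne'] at hi2
  have ha2 : 1 ≤ X.a ^ 2 := one_le_pow₀ X.ha.le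
  rw [qq_smul] at h1 h2
  have hC : 0 ≤ C := le_trans (mul_nonneg (sq_nonneg _) (qq_nonneg _)) h1
  have b1 : qq (X.a ^ i • ac (X.ρ γ) (X.lv l)) ≤ X.a ^ 2 * C := by
    rw [qq_smul]
    have : (X.a ^ i) ^ 2 ≤ s ^ 2 := pow_le_pow_left₀ hai.le hi1 2
    nlinarith [mul_le_mul_of_nonneg_right this (qq_nonneg (ac (X.ρ γ) (X.lv l)))]
  have b2 : qq ((X.a ^ i)⁻¹ • ac (X.ρ γ) (X.lv (opp l))) ≤ X.a ^ 2 * C := by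
    rw [qq_smul]
    have h3 : (X.a ^ i)⁻¹ ≤ X.a * s⁻¹ := by
      rw [← div_eq_mul_inv, inv_eq_one_div, div_le_div_iff₀ hai hs]; linarith
    have : ((X.a ^ i)⁻¹) ^ 2 ≤ (X.a * s⁻¹) ^ 2 := pow_le_pow_left₀ (inv_pos.2 hai).le h3 2
    calc _ ≤ (X.a * s⁻¹) ^ 2 * qq (ac (X.ρ γ) (X.lv (opp l))) := mul_le_mul_of_nonneg_right this (qq_nonneg _)
      _ = X.a ^ 2 * (s⁻¹ ^ 2 * qq (ac (X.ρ γ) (X.lv (opp l)))) := by ring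
      _ ≤ _ := mul_le_mul_of_nonneg_left h2 (by positivity)
  rcases l with ⟨γ₁, e⟩
  have hz := X.zpowP i
  have hz' := X.zpowP (-i)
  rw [zpow_neg X.a, inv_inv] at hz'
  cases e
  · refine ⟨(γ * γ₁ * X.al ^ i, false), ⟨⟨i, by simp [sm, mul_assoc]⟩, rfl⟩, ?_, ?_⟩
    · rw [map_mul, map_mul, ac_mul, ac_mul, hz.1, ac_smul, ac_smul]; exact b1
    · rw [map_mul, map_mul, ac_mul, ac_mul, hz.2, ac_smul, ac_smul]; exact b2
  · refine ⟨(γ * γ₁ * X.al ^ (-i), true), ⟨⟨-i, by simp [sm, mul_assoc]⟩, rfl⟩, ?_, ?_⟩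
    · rw [map_mul, map_mul, ac_mul, ac_mul, hz'.1, ac_smul, ac_smul]; exact b2
    · rw [map_mul, map_mul, ac_mul, ac_mul, hz'.2, ac_smul, ac_smul]; exact b1

/-- the balanced frame of a pair of labels -/
lemma frame {C M : ℝ} (hC : ∀ h : SL 2 ℝ, ∃ γ, ns (X.ρ γ * h).1 ≤ C) (hM : 0 < M) (p q : Lb G) (ho : X.o p q ≠ 0)
    (hc : X.cost p q ≤ M ^ 2) :
    ∃ γ, ∃ s t : ℝ, 0 < s ∧ 0 < t ∧
      |om (s • ac (X.ρ γ) (X.lv p)) (t • ac (X.ρ γ) (X.lv q))| = 1 ∧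
      qq (s • ac (X.ρ γ) (X.lv p)) + qq (t • ac (X.ρ γ) (X.lv q)) ≤ C ∧
      |om (s⁻¹ • ac (X.ρ γ) (X.lv (opp p))) (t • ac (X.ρ γ) (X.lv q))| ≤ M + 1 ∧
      |om (s • ac (X.ρ γ) (X.lv p)) (t⁻¹ • ac (X.ρ γ) (X.lv (opp q)))| ≤ M + 1 := by
  set A := |om (X.lv (opp p)) (X.lv q)| with hA
  set B := |om (X.lv p) (X.lv (opp q))| with hB
  have hA0 : 0 ≤ A := abs_nonneg _
  have hB0 : 0 ≤ B := abs_nonneg _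
  have hAB : A * B ≤ M ^ 2 := by rw [hA, hB, ← abs_mul]; exact hc
  set w := |om (X.lv p) (X.lv q)| with hw
  have hw0 : 0 < w := abs_pos.2 ho
  set z := (A / M + 1 / (B + 1)) / w with hz
  have hz0 : 0 < z := by positivity
  set s := Real.sqrt z with hs
  have hs0 : 0 < s := Real.sqrt_pos.2 hz0
  have hs2 : s ^ 2 = z := Real.sq_sqrt hz0.le
  set t := (w * s)⁻¹ with ht
  have ht0 : 0 < t := by positivity
  have hst : s * t * w = 1 := by rw [ht]; field_simp
  let η : ℝ := if 0 < om (X.lv p) (X.lv q) then 1 else -1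
  have hη : η * om (X.lv p) (X.lv q) = w := by
    simp only [η]
    split_ifs with h
    · rw [hw, abs_of_pos h, one_mul]
    · rw [hw, abs_of_nonpos (not_lt.1 h)]; ring
  have hη2 : η ^ 2 = 1 := by simp only [η]; split_ifs <;> norm_num
  let h : SL 2 ℝ := ⟨!![s * X.lv p 0, η * t * X.lv q 0; s * X.lv p 1, η * t * X.lv q 1], by
    rw [Matrix.det_fin_two_of]
    rw [← hst, ← hη]; simp only [om]; ring⟩
  obtain ⟨γ, hγ⟩ := hC h
  refine ⟨γ, s, t, hs0, ht0, ?_, ?_, ?_, ?_⟩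
  · rw [om_smul_left, om_smul_right, om_ac, abs_mul, abs_mul, abs_of_pos hs0, abs_of_pos ht0, ← hw, ← mul_assoc, hst]
  · have e : ns (X.ρ γ * h).1 = qq (s • ac (X.ρ γ) (X.lv p)) + qq (t • ac (X.ρ γ) (X.lv q)) := by
      have e1 : (X.ρ γ * h).1 = (X.ρ γ).1 * h.1 := SG.slmul _ _
      rw [e1, qq_smul, qq_smul]
      simp only [ns, qq, ac0, ac1, Matrix.mul_apply, Fin.sum_univ_two, h]
      simp
      linear_combination (t ^ 2 * (((X.ρ γ).1 0 0 * X.lv q 0 + (X.ρ γ).1 0 1 * X.lv q 1) ^ 2 + ((X.ρ γ).1 1 0 * X.lv q 0 + (X.ρ γ).1 1 1 * X.lv q 1) ^ 2)) * hη2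
    rw [← e]; exact hγ
  · rw [om_smul_left, om_smul_right, om_ac, abs_mul, abs_mul, abs_of_pos (inv_pos.2 hs0), abs_of_pos ht0, ← hA]
    have e : s⁻¹ * (t * A) = A / (w * s ^ 2) := by rw [ht]; field_simp
    rw [e, hs2, hz, mul_div_cancel₀ _ hw0.ne', div_le_iff₀ (by positivity)]
    have h1 : 0 < 1 / (B + 1) := by positivity
    have h2 : M * (A / M) = A := by field_simp
    have h3 : 0 ≤ A / M := by positivity
    nlinarith
  · rw [om_smul_left, om_smul_right, om_ac, abs_mul, abs_mul, abs_of_pos (inv_pos.2 ht0), abs_of_pos hs0, ← hB]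
    have e : s * (t⁻¹ * B) = B * (w * s ^ 2) := by rw [ht]; field_simp
    rw [e, hs2, hz, mul_div_cancel₀ _ hw0.ne', mul_add]
    have h1 : B * (1 / (B + 1)) ≤ 1 := by
      rw [mul_one_div, div_le_one (by positivity)]; linarith
    have h2 : B * (A / M) ≤ M := by
      rw [mul_div_assoc', div_le_iff₀ hM]; nlinarith
    linarith

end Ax
end PG


/-! ## Splitting and normalising pairs of labels -/
namespace PG
open Filter Topology

lemma qq_add_le (v w : V2) : qq (v + w) ≤ 2 * qq v + 2 * qq w := by
  simp only [qq, Pi.add_apply]; nlinarith [sq_nonneg (v 0 - w 0), sq_nonneg (v 1 - w 1)]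

lemma abs_om_le {v w : V2} {κ : ℝ} (hκ : 0 ≤ κ) (h : qq v * qq w ≤ κ ^ 2) : |om v w| ≤ κ :=
  abs_le_of_sq_le_sq ((om_sq_le v w).trans h) hκ

namespace Ax
variable {G : Type} [Group G] (X : Ax G)

/-- density of pairs -/
def Dn : Prop := ∀ x y a b : V2, om x y ≠ 0 → 0 < om a b →
    ∃ γ, ∃ η : ℝ, (η = 1 ∨ η = -1) ∧ (0 < η * om a (ac (X.ρ γ) x) ∧ 0 < η * om (ac (X.ρ γ) x) b) ∧
      (0 < η * om a (ac (X.ρ γ) y) ∧ 0 < η * om (ac (X.ρ γ) y) b)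

lemma cover (hD : X.Dn) (C : ℝ) : ∃ κ : ℝ, 0 ≤ κ ∧ ∀ u v : V2, om u v = 1 → qq u + qq v ≤ C →
    ∃ δ, ∃ η : ℝ, (η = 1 ∨ η = -1) ∧ (0 < η * om u (ac (X.ρ δ) X.P) ∧ 0 < η * om (ac (X.ρ δ) X.P) v) ∧
      (0 < η * om u (ac (X.ρ δ) X.Q) ∧ 0 < η * om (ac (X.ρ δ) X.Q) v) ∧
      qq (ac (X.ρ δ) X.P) ≤ κ ∧ qq (ac (X.ρ δ) X.Q) ≤ κ := by
  let c0 : Matrix (Fin 2) (Fin 2) ℝ → V2 := fun A i => A i 0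
  let c1 : Matrix (Fin 2) (Fin 2) ℝ → V2 := fun A i => A i 1
  have hd : IsClosed {A : Matrix (Fin 2) (Fin 2) ℝ | om (c0 A) (c1 A) = 1} := by
    refine isClosed_eq ?_ continuous_const
    simp only [om, c0, c1]; fun_prop
  have hK := (compact_ns C).inter_right hd
  have key : ∃ κ : ℝ, ∀ A ∈ {A : Matrix (Fin 2) (Fin 2) ℝ | ns A ≤ C} ∩ {A : Matrix (Fin 2) (Fin 2) ℝ | om (c0 A) (c1 A) = 1},
      ∃ δ, ∃ η : ℝ, (η = 1 ∨ η = -1) ∧ (0 < η * om (c0 A) (ac (X.ρ δ) X.P) ∧ 0 < η * om (ac (X.ρ δ) X.P) (c1 A)) ∧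
      (0 < η * om (c0 A) (ac (X.ρ δ) X.Q) ∧ 0 < η * om (ac (X.ρ δ) X.Q) (c1 A)) ∧
      qq (ac (X.ρ δ) X.P) ≤ κ ∧ qq (ac (X.ρ δ) X.Q) ≤ κ := by
    refine hK.induction_on (p := fun s => ∃ κ : ℝ, ∀ A ∈ s,
      ∃ δ, ∃ η : ℝ, (η = 1 ∨ η = -1) ∧ (0 < η * om (c0 A) (ac (X.ρ δ) X.P) ∧ 0 < η * om (ac (X.ρ δ) X.P) (c1 A)) ∧
      (0 < η * om (c0 A) (ac (X.ρ δ) X.Q) ∧ 0 < η * om (ac (X.ρ δ) X.Q) (c1 A)) ∧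
      qq (ac (X.ρ δ) X.P) ≤ κ ∧ qq (ac (X.ρ δ) X.Q) ≤ κ) ?_ ?_ ?_ ?_
    · exact ⟨0, fun A hA => absurd hA (Set.notMem_empty A)⟩
    · rintro s t hst ⟨κ, hκ⟩
      exact ⟨κ, fun A hA => hκ A (hst hA)⟩
    · rintro s t ⟨κ, hκ⟩ ⟨κ', hκ'⟩
      refine ⟨max κ κ', fun A hA => ?_⟩
      rcases hA with hA | hA
      · obtain ⟨δ, η, h1, h2, h3, h4, h5⟩ := hκ A hA
        exact ⟨δ, η, h1, h2, h3, h4.trans (le_max_left _ _), h5.trans (le_max_left _ _)⟩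
      · obtain ⟨δ, η, h1, h2, h3, h4, h5⟩ := hκ' A hA
        exact ⟨δ, η, h1, h2, h3, h4.trans (le_max_right _ _), h5.trans (le_max_right _ _)⟩
    · rintro A ⟨-, hA⟩
      obtain ⟨δ, η, h1, h2, h3⟩ := hD X.P X.Q (c0 A) (c1 A) (by rw [X.hPQ]; exact one_ne_zero) (by
        rw [Set.mem_setOf_eq] at hA; rw [hA]; exact one_pos)
      refine ⟨{B : Matrix (Fin 2) (Fin 2) ℝ | (0 < η * om (c0 B) (ac (X.ρ δ) X.P) ∧ 0 < η * om (ac (X.ρ δ) X.P) (c1 B)) ∧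
        (0 < η * om (c0 B) (ac (X.ρ δ) X.Q) ∧ 0 < η * om (ac (X.ρ δ) X.Q) (c1 B))}, ?_,
        max (qq (ac (X.ρ δ) X.P)) (qq (ac (X.ρ δ) X.Q)), ?_⟩
      · refine mem_nhdsWithin_of_mem_nhds (IsOpen.mem_nhds ?_ ⟨h2, h3⟩)
        have hop : ∀ f : Matrix (Fin 2) (Fin 2) ℝ → ℝ, Continuous f → IsOpen {B | 0 < f B} :=
          fun f hf => isOpen_lt continuous_const hf
        refine ((hop _ ?_).inter (hop _ ?_)).inter ((hop _ ?_).inter (hop _ ?_))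
        all_goals simp only [om, c0, c1]; fun_prop
      · rintro B ⟨h4, h5⟩
        exact ⟨δ, η, h1, h4, h5, le_max_left _ _, le_max_right _ _⟩
  obtain ⟨κ, hκ⟩ := key
  refine ⟨max κ 0, le_max_right _ _, fun u v huv hq => ?_⟩
  let A : Matrix (Fin 2) (Fin 2) ℝ := !![u 0, v 0; u 1, v 1]
  have e0 : c0 A = u := by funext i; fin_cases i <;> rfl
  have e1 : c1 A = v := by funext i; fin_cases i <;> rfl
  obtain ⟨δ, η, h1, h2, h3, h4, h5⟩ := hκ A ⟨by
    have : ns A = qq u + qq v := by simp [ns, qq, A]; ring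
    rw [Set.mem_setOf_eq, this]; exact hq, by rw [Set.mem_setOf_eq, e0, e1]; exact huv⟩
  rw [e0, e1] at h2 h3
  exact ⟨δ, η, h1, h2, h3, h4.trans (le_max_left _ _), h5.trans (le_max_left _ _)⟩

lemma CC.o1 {p r q : Lb G} (h : X.CC p r q) : X.o p r ≠ 0 := fun h' => by
  rw [o] at h'; rw [CC, h'] at h; simp at h
lemma CC.o2 {p r q : Lb G} (h : X.CC p r q) : X.o r q ≠ 0 := fun h' => by
  rw [o] at h'; rw [CC, h'] at h; simp at h
lemma CC.o3 {p r q : Lb G} (h : X.CC p r q) : X.o p q ≠ 0 := fun h' => by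
  rw [o] at h'; rw [CC, h'] at h; simp at h

lemma CC_of {p r q : V2} {s t : ℝ} (hs : 0 < s) (ht : 0 < t) (h : 0 < om (s • p) r * om r (t • q) * om (s • p) (t • q)) :
    0 < om p r * om r q * om p q := by
  rw [om_smul_left, om_smul_right, om_smul_left, om_smul_right] at h
  have e : s * om p r * (t * om r q) * (s * (t * om p q)) = (s * t) ^ 2 * (om p r * om r q * om p q) := by ring
  rw [e] at h
  exact pos_of_mul_pos_right h (by positivity)

lemma CC_of' {p r q : V2} {t : ℝ} (ht : 0 < t) (h : 0 < om p r * om r (t • q) * om p (t • q)) :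
    0 < om p r * om r q * om p q := by
  have := CC_of (p := p) (r := r) (q := q) one_pos ht (by rwa [one_smul])
  exact this

/-- bounds in the balanced frame -/
lemma balanced (u v u' : V2) {M κ : ℝ} (hM : 0 < M) (h1 : |om u v| = 1) (h2 : |om u' v| ≤ M + 1) (h3 : |om u u'| = 1)
    (x : V2) (hu : |om u x| ≤ κ) (hv : |om v x| ≤ κ) : |om u' x| ≤ (M + 2) * κ := by
  have e := congrArg (fun w => om w x) (expand u' u v)
  simp only [om_smul_left, om_add_left] at e
  have e2 := congrArg abs e
  rw [abs_mul, h1, one_mul] at e2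
  rw [e2]
  refine (abs_add_le _ _).trans ?_
  rw [abs_mul, abs_mul, h3, one_mul]
  have := mul_le_mul h2 hu (abs_nonneg _) (by linarith)
  linarith

lemma balanced_qq (u v u' : V2) {M C : ℝ} (hM : 0 < M) (h1 : |om u v| = 1) (h2 : |om u' v| ≤ M + 1) (h3 : |om u u'| = 1)
    (hu : qq u ≤ C) (hv : qq v ≤ C) : qq u' ≤ 2 * ((M + 1) ^ 2 * C) + 2 * C := by
  have e := congrArg qq (expand u' u v)
  rw [qq_smul, ← sq_abs, h1, one_pow, one_mul] at e
  rw [e]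
  refine (qq_add_le _ _).trans ?_
  rw [qq_smul, qq_smul, ← sq_abs (om u u'), h3, one_pow, one_mul, ← sq_abs]
  have : |om u' v| ^ 2 ≤ (M + 1) ^ 2 := pow_le_pow_left₀ (abs_nonneg _) h2 2
  have := mul_le_mul this hu (qq_nonneg _) (by positivity)
  linarith

lemma abs_om_swap (v w : V2) : |om w v| = |om v w| := by rw [om_swap, abs_neg]

lemma split {C : ℝ} (hC : ∀ h : SL 2 ℝ, ∃ γ, ns (X.ρ γ * h).1 ≤ C) (hD : X.Dn) :
    ∃ M0 : ℝ, 0 < M0 ∧ ∀ M, M0 ≤ M → ∀ p q, X.o p q ≠ 0 → X.cost p q ≤ M ^ 2 → ∃ γ,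
      X.CC p (γ, false) q ∧ X.CC (γ, false) (γ, true) q ∧ X.cost p (γ, false) ≤ M ^ 2 ∧
      X.cost (γ, false) q ≤ M ^ 2 ∧ X.cost (γ, true) q ≤ M ^ 2 := by
  obtain ⟨κ0, hκ0, H⟩ := X.cover hD C
  have hC0 : 0 ≤ C := by
    obtain ⟨γ, hγ⟩ := hC 1
    exact (ns_nonneg _).trans hγ
  set K := C * κ0 with hK
  have hK0 : 0 ≤ K := mul_nonneg hC0 hκ0
  refine ⟨K + 2, by linarith, fun M hM p q ho hc => ?_⟩
  have hM0 : 0 < M := by linarith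
  obtain ⟨γ, s, t, hs, ht, f1, f2, f3, f4⟩ := X.frame hC hM0 p q ho hc
  set u := s • ac (X.ρ γ) (X.lv p) with hu
  set v := t • ac (X.ρ γ) (X.lv q) with hv
  set u' := s⁻¹ • ac (X.ρ γ) (X.lv (opp p)) with hu'
  set v' := t⁻¹ • ac (X.ρ γ) (X.lv (opp q)) with hv'
  have huu : |om u u'| = 1 := by
    rw [hu, hu', om_smul_left, om_smul_right, om_ac, ← mul_assoc, mul_inv_cancel₀ hs.ne', one_mul, X.om_opp]
  have hvv : |om v v'| = 1 := by
    rw [hv, hv', om_smul_left, om_smul_right, om_ac, ← mul_assoc, mul_inv_cancel₀ ht.ne', one_mul, X.om_opp]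
  have hε : om u v = 1 ∨ om u v = -1 := by
    rcases abs_choice (om u v) with h | h <;> rw [f1] at h
    · exact Or.inl h.symm
    · right; linarith
  have hε2 : om u v * om u v = 1 := by rcases hε with h | h <;> rw [h] <;> norm_num
  obtain ⟨δ, η, hη, ⟨a1, a2⟩, ⟨a3, a4⟩, b1, b2⟩ := H u (om u v • v) (by rw [om_smul_right, hε2])
    (by rw [qq_smul (om u v) v, sq, hε2, one_mul]; exact f2)
  have hη2 : η * η = 1 := by rcases hη with h | h <;> rw [h] <;> norm_num
  rw [om_smul_right] at a2 a4
  have hqu : qq u ≤ C := by linarith [qq_nonneg v]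
  have hqv : qq v ≤ C := by linarith [qq_nonneg u]
  set x := ac (X.ρ δ) X.P with hx
  set y := ac (X.ρ δ) X.Q with hy
  have hxy : om x y = 1 := by rw [hx, hy, om_ac, X.hPQ]
  have hκ := Real.sqrt_nonneg K
  have hsq := Real.sq_sqrt hK0
  set κ := Real.sqrt K with hκd
  have hux : |om u x| ≤ κ := abs_om_le hκ (by rw [hsq]; exact mul_le_mul hqu b1 (qq_nonneg _) hC0)
  have huy : |om u y| ≤ κ := abs_om_le hκ (by rw [hsq]; exact mul_le_mul hqu b2 (qq_nonneg _) hC0)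
  have hvx : |om v x| ≤ κ := abs_om_le hκ (by rw [hsq]; exact mul_le_mul hqv b1 (qq_nonneg _) hC0)
  have hvy : |om v y| ≤ κ := abs_om_le hκ (by rw [hsq]; exact mul_le_mul hqv b2 (qq_nonneg _) hC0)
  have hu'x := balanced u v u' hM0 f1 f3 huu x hux hvx
  have hu'y := balanced u v u' hM0 f1 f3 huu y huy hvy
  have hv'x := balanced v u v' hM0 (by rw [abs_om_swap]; exact f1) (by rw [abs_om_swap]; exact f4) hvv x hvx hux
  have hv'y := balanced v u v' hM0 (by rw [abs_om_swap]; exact f1) (by rw [abs_om_swap]; exact f4) hvv y hvy huy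
  have hbig : (M + 2) * κ * κ ≤ M ^ 2 := by
    have : (M + 2) * κ * κ = (M + 2) * K := by rw [← hsq]; ring
    rw [this]; nlinarith
  have hlx : X.lv (γ⁻¹ * δ, false) = ac (X.ρ γ)⁻¹ x := by
    change ac (X.ρ (γ⁻¹ * δ)) X.P = _
    rw [map_mul, ac_mul, map_inv]
  have hly : X.lv (γ⁻¹ * δ, true) = ac (X.ρ γ)⁻¹ y := by
    change ac (X.ρ (γ⁻¹ * δ)) X.Q = _
    rw [map_mul, ac_mul, map_inv]
  have hgx : ac (X.ρ γ) (X.lv (γ⁻¹ * δ, false)) = x := by rw [hlx, ac_inv']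
  have hgy : ac (X.ρ γ) (X.lv (γ⁻¹ * δ, true)) = y := by rw [hly, ac_inv']
  have hgx' : ac (X.ρ γ) (X.lv (opp (γ⁻¹ * δ, true))) = x := hgx
  have hgy' : ac (X.ρ γ) (X.lv (opp (γ⁻¹ * δ, false))) = y := hgy
  have ox : ∀ l w : Lb G, om (X.lv l) (X.lv w) = om (ac (X.ρ γ) (X.lv l)) (ac (X.ρ γ) (X.lv w)) := fun l w => (om_ac _ _ _).symm
  refine ⟨γ⁻¹ * δ, ?_, ?_, ?_, ?_, ?_⟩
  · rw [CC, ox p, ox (γ⁻¹ * δ, false), ox p, hgx]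
    refine CC_of hs ht ?_
    have := mul_pos a1 a2
    have e : η * om u x * (η * (om u v * om x v)) = η * η * (om u x * om x v * om u v) := by ring
    rw [e, hη2, one_mul] at this
    exact this
  · rw [CC, ox _ (γ⁻¹ * δ, true), ox (γ⁻¹ * δ, true), ox (γ⁻¹ * δ, false), hgx, hgy]
    refine CC_of' ht ?_
    have := mul_pos a2 a4
    have e : η * (om u v * om x v) * (η * (om u v * om y v)) = (η * η) * (om u v * om u v) * (om y v * om x v) := by ring
    rw [e, hη2, hε2, one_mul, one_mul] at this
    rw [← hv, hxy, one_mul]; exact this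
  · rw [cost, ox, ox p, hgx, hgy']
    have e : om (ac (X.ρ γ) (X.lv (opp p))) x * om (ac (X.ρ γ) (X.lv p)) y = om u' x * om u y := by
      rw [hu, hu', om_smul_left, om_smul_left]; field_simp
    rw [e, abs_mul]
    exact (mul_le_mul hu'x huy (abs_nonneg _) (by positivity)).trans hbig
  · rw [cost, ox, ox _ (opp q), hgx, hgy']
    have e : om y (ac (X.ρ γ) (X.lv q)) * om x (ac (X.ρ γ) (X.lv (opp q))) = om v' x * om v y := by
      rw [hv, hv', om_smul_left, om_smul_left, om_swap _ y, om_swap _ x]; field_simp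
    rw [e, abs_mul]
    exact (mul_le_mul hv'x hvy (abs_nonneg _) (by positivity)).trans hbig
  · rw [cost, ox, ox _ (opp q), hgx', hgy]
    have e : om x (ac (X.ρ γ) (X.lv q)) * om y (ac (X.ρ γ) (X.lv (opp q))) = om v' y * om v x := by
      rw [hv, hv', om_smul_left, om_smul_left, om_swap _ y, om_swap _ x]; field_simp
    rw [e, abs_mul]
    exact (mul_le_mul hv'y hvx (abs_nonneg _) (by positivity)).trans hbig

lemma normPair {C M : ℝ} (hC : ∀ h : SL 2 ℝ, ∃ γ, ns (X.ρ γ * h).1 ≤ C) (hM : 0 < M) : ∃ C2 : ℝ,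
    ∀ p q, X.o p q ≠ 0 → X.cost p q ≤ M ^ 2 → ∃ γ, ∃ p' q' : Lb G, X.Eqv p (sm γ p') ∧ X.Eqv q (sm γ q') ∧
      (qq (ac (X.ρ p'.1) X.P) ≤ C2 ∧ qq (ac (X.ρ p'.1) X.Q) ≤ C2) ∧
      (qq (ac (X.ρ q'.1) X.P) ≤ C2 ∧ qq (ac (X.ρ q'.1) X.Q) ≤ C2) := by
  have hC0 : 0 ≤ C := by
    obtain ⟨γ, hγ⟩ := hC 1
    exact (ns_nonneg _).trans hγ
  refine ⟨X.a ^ 2 * (2 * ((M + 1) ^ 2 * C) + 2 * C), fun p q ho hc => ?_⟩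
  obtain ⟨γ, s, t, hs, ht, f1, f2, f3, f4⟩ := X.frame hC hM p q ho hc
  set u := s • ac (X.ρ γ) (X.lv p) with hu
  set v := t • ac (X.ρ γ) (X.lv q) with hv
  set u' := s⁻¹ • ac (X.ρ γ) (X.lv (opp p)) with hu'
  set v' := t⁻¹ • ac (X.ρ γ) (X.lv (opp q)) with hv'
  have huu : |om u u'| = 1 := by
    rw [hu, hu', om_smul_left, om_smul_right, om_ac, ← mul_assoc, mul_inv_cancel₀ hs.ne', one_mul, X.om_opp]
  have hvv : |om v v'| = 1 := by
    rw [hv, hv', om_smul_left, om_smul_right, om_ac, ← mul_assoc, mul_inv_cancel₀ ht.ne', one_mul, X.om_opp]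
  have hqu : qq u ≤ C := by linarith [qq_nonneg v]
  have hqv : qq v ≤ C := by linarith [qq_nonneg u]
  have hCC : C ≤ 2 * ((M + 1) ^ 2 * C) + 2 * C := by
    have : 0 ≤ (M + 1) ^ 2 * C := by positivity
    linarith
  obtain ⟨p', hp', h1, h2⟩ := X.normLabel γ p s _ hs (hqu.trans hCC) (balanced_qq u v u' hM f1 f3 huu hqu hqv)
  obtain ⟨q', hq', h3, h4⟩ := X.normLabel γ q t _ ht (hqv.trans hCC) (balanced_qq v u v' hM (by rw [abs_om_swap]; exact f1)
    (by rw [abs_om_swap]; exact f4) hvv hqv hqu)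
  exact ⟨γ⁻¹, p', q', hp', hq', ⟨h1, h2⟩, ⟨h3, h4⟩⟩

end Ax
end PG


/-! ## Building the automaton from edges -/
namespace PG
open Filter Topology TP RT

noncomputable def mk2 (u v : V2) (h : om u v ≠ 0) : SL 2 ℝ :=
  ⟨!![u 0, v 0 / om u v; u 1, v 1 / om u v], by
    rw [Matrix.det_fin_two_of]
    have : u 0 * (v 1 / om u v) - v 0 / om u v * u 1 = (u 0 * v 1 - u 1 * v 0) / om u v := by ring
    rw [this]; exact div_self h⟩

lemma mk2_coe (u v : V2) (h : om u v ≠ 0) : (mk2 u v h).1 = !![u 0, v 0 / om u v; u 1, v 1 / om u v] := rfl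

lemma mk2_congr {u v u' v' : V2} (hu : u = u') (hv : v = v') (h : om u v ≠ 0) (h' : om u' v' ≠ 0) :
    mk2 u v h = mk2 u' v' h' := by subst hu hv; rfl

lemma mk2_ac (g : SL 2 ℝ) (u v : V2) (h : om u v ≠ 0) :
    g * mk2 u v h = mk2 (ac g u) (ac g v) (by rw [om_ac]; exact h) := by
  apply sl_ext
  have e : (g * mk2 u v h).1 = g.1 * (mk2 u v h).1 := SG.slmul _ _
  change (g * mk2 u v h).1 = (mk2 (ac g u) (ac g v) _).1
  rw [e, mk2_coe, mk2_coe, om_ac]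
  ext i j
  fin_cases i <;> fin_cases j <;> simp [Matrix.mul_apply, Fin.sum_univ_two, ac0, ac1] <;> ring

lemma inv_coe (g : SL 2 ℝ) : (g⁻¹).1 = !![g.1 1 1, - g.1 0 1; - g.1 1 0, g.1 0 0] := by
  have : (g⁻¹).1 = g.1.adjugate := rfl
  rw [this, Matrix.adjugate_fin_two]

lemma inv_mk2 (u v u' v' : V2) (h : om u v ≠ 0) (h' : om u' v' ≠ 0) :
    ((mk2 u v h)⁻¹ * mk2 u' v' h').1 =
    !![om u' v / om u v, om v' v / (om u v * om u' v'); om u u', om u v' / om u' v'] := by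
  have e : ((mk2 u v h)⁻¹ * mk2 u' v' h').1 = ((mk2 u v h)⁻¹).1 * (mk2 u' v' h').1 := SG.slmul _ _
  rw [e, inv_coe, mk2_coe, mk2_coe]
  ext i j
  fin_cases i <;> fin_cases j <;> simp [Matrix.mul_apply, Fin.sum_univ_two]
  · rw [eq_div_iff h]; field_simp; simp only [om]; ring
  · field_simp; simp only [om]; ring
  · simp only [om]; ring
  · field_simp; simp only [om]; ring

lemma mk2_ew (u v : V2) (h : om u v ≠ 0) : mk2 u v h * ew = mk2 ((om u v)⁻¹ • v) (- u) (by
    have : om ((om u v)⁻¹ • v) (-u) = (om u v)⁻¹ * om u v := by simp only [om, Pi.smul_apply, Pi.neg_apply, smul_eq_mul]; ring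
    rw [this, inv_mul_cancel₀ h]; exact one_ne_zero) := by
  have h1 : om ((om u v)⁻¹ • v) (-u) = 1 := by
    have : om ((om u v)⁻¹ • v) (-u) = (om u v)⁻¹ * om u v := by simp only [om, Pi.smul_apply, Pi.neg_apply, smul_eq_mul]; ring
    rw [this, inv_mul_cancel₀ h]
  apply sl_ext
  have e : (mk2 u v h * ew).1 = (mk2 u v h).1 * ew.1 := SG.slmul _ _
  have ee : ew.1 = !![0, -1; 1, 0] := rfl
  change (mk2 u v h * ew).1 = (mk2 _ _ _).1
  rw [e, mk2_coe, mk2_coe, ee, h1]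
  ext i j
  fin_cases i <;> fin_cases j <;> simp [Matrix.mul_apply, Fin.sum_univ_two] <;> ring

lemma ew_inv_10 (g : SL 2 ℝ) : (ew⁻¹ * g).1 1 0 = - g.1 0 0 := by
  have e : (ew⁻¹ * g).1 = (ew⁻¹).1 * g.1 := SG.slmul _ _
  have ee : ew.1 = !![0, -1; 1, 0] := rfl
  rw [e, inv_coe, ee]
  simp [Matrix.mul_apply, Fin.sum_univ_two]

/-- edges -/
structure Ed (G : Type) where
  s : Lb G × Lb G
  t : Lb G × Lb G
  u : Lb G × Lb G
  gL : G
  gR : G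

namespace Ax
variable {G : Type} [Group G] (X : Ax G)

structure ED (e : Ed G) : Prop where
  hL : X.Eqv e.s.1 (sm e.gL e.t.1)
  hR : X.Eqv e.s.2 (sm e.gR e.u.2)
  hm : X.Eqv (sm e.gR e.u.1) (sm e.gL e.t.2)
  hc : X.CC e.s.1 (sm e.gL e.t.2) e.s.2

def S00 : Lb G × Lb G := ((1, false), (1, true))

def Stp (𝓔 : Set (Ed G)) (s t : Lb G × Lb G) : Prop := ∃ e ∈ 𝓔, e.s = s ∧ (e.t = t ∨ e.u = t)
def Rch (𝓔 : Set (Ed G)) (s : Lb G × Lb G) : Prop := Relation.ReflTransGen (Stp 𝓔) S00 s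

open Classical in
noncomputable def sgE (e : Ed G) : ℝ := if 0 < X.o (sm e.gR e.u.1) e.s.2 * X.o e.s.1 e.s.2 then 1 else -1

variable {X}
lemma ED.ot {e : Ed G} (h : X.ED e) : X.o e.t.1 e.t.2 ≠ 0 := by
  rw [← X.o_sm e.gL]
  exact o_eqv h.hL (Eqv.refl X _) (CC.o1 X h.hc)
lemma ED.ou {e : Ed G} (h : X.ED e) : X.o e.u.1 e.u.2 ≠ 0 := by
  rw [← X.o_sm e.gR]
  exact o_eqv h.hm.symm h.hR (CC.o2 X h.hc)
lemma ED.os {e : Ed G} (h : X.ED e) : X.o e.s.1 e.s.2 ≠ 0 := CC.o3 X h.hc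

lemma o00 : X.o (1, false) (1, true) = 1 := by
  simp only [o, lv, map_one, ac_one]
  exact X.hPQ

lemma lv1 : X.lv (1, false) = X.P := by
  simp only [lv, map_one, ac_one]; rfl
lemma lv2 : X.lv (1, true) = X.Q := by
  simp only [lv, map_one, ac_one]; rfl

theorem build (𝓔 : Set (Ed G)) (fin : 𝓔.Finite) (hED : ∀ e ∈ 𝓔, X.ED e)
    (h1 : ∀ s, Rch 𝓔 s → ∃ σ ∈ 𝓔, ∃ σ' ∈ 𝓔, σ.s = s ∧ σ'.s = σ.u ∧ σ'.t = S00)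
    (ey ey' ez : Ed G) (my : ey ∈ 𝓔) (my' : ey' ∈ 𝓔) (mz : ez ∈ 𝓔) (hz : Rch 𝓔 ez.s)
    (e1 : ey.t = ey.s) (e2 : ey'.u = ey'.s) (e3 : ey.gL = X.al) (e4 : ey'.gR = X.al)
    (e5 : ez.t = ey'.s) (e6 : ez.u = ey.s) (e7 : ez.gL = 1) (e8 : ez.gR = 1)
    (e9 : ey.s.1 = (1, false)) (e10 : ey'.s.2 = (1, false))
    (e11 : ez.s = (ey'.s.1, ey.s.2)) (hpos : 0 < X.o ey'.s.1 (1, false)) :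
    ∃ (A : Aut G) (m : A.S → SL 2 ℝ) (t : ℝ), SL2Pos A X.ρ m t := by
  classical
  have step : ∀ {e : Ed G}, e ∈ 𝓔 → Rch 𝓔 e.s → Rch 𝓔 e.t ∧ Rch 𝓔 e.u := fun {e} he hr =>
    ⟨hr.tail ⟨e, he, rfl, Or.inl rfl⟩, hr.tail ⟨e, he, rfl, Or.inr rfl⟩⟩
  let S := {s // Rch 𝓔 s}
  let E := {e : Ed G // e ∈ 𝓔 ∧ Rch 𝓔 e.s}
  have finS : {s | Rch 𝓔 s}.Finite := by
    refine (((Set.finite_singleton (S00 : Lb G × Lb G)).union (fin.image Ed.t)).union (fin.image Ed.u)).subset ?_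
    intro s hs
    rcases Relation.ReflTransGen.cases_tail hs with h | ⟨c, -, e, he, -, h | h⟩
    · exact Or.inl (Or.inl h)
    · exact Or.inl (Or.inr ⟨e, he, h⟩)
    · exact Or.inr ⟨e, he, h⟩
  have finE : {e : Ed G | e ∈ 𝓔 ∧ Rch 𝓔 e.s}.Finite := fin.subset fun e he => he.1
  have ry' : Rch 𝓔 ey'.s := by rw [← e5]; exact (step mz hz).1
  have ry : Rch 𝓔 ey.s := by rw [← e6]; exact (step mz hz).2
  have ho : ∀ s, Rch 𝓔 s → om (X.lv s.1) (X.lv s.2) ≠ 0 := by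
    intro s hs
    obtain ⟨σ, hσ, -, -, rfl, -⟩ := h1 s hs
    exact (hED σ hσ).os
  have sgpos : ∀ e : Ed G, 0 < X.o (sm e.gR e.u.1) e.s.2 * X.o e.s.1 e.s.2 → X.sgE e = 1 := fun e h => if_pos h
  let A : Aut G :=
    { S := S
      E := E
      fS := finS.fintype
      dS := Classical.decEq S
      fE := finE.fintype
      src := fun e => ⟨e.1.s, e.2.2⟩
      lt := fun e => ⟨e.1.t, (step e.2.1 e.2.2).1⟩
      rt := fun e => ⟨e.1.u, (step e.2.1 e.2.2).2⟩
      gL := fun e => e.1.gL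
      gR := fun e => e.1.gR
      sg := fun e => X.sgE e.1
      hsg := fun e => by
        change X.sgE e.1 = 1 ∨ X.sgE e.1 = -1
        unfold sgE; split_ifs
        · exact Or.inl rfl
        · exact Or.inr rfl
      s0 := ⟨S00, Relation.ReflTransGen.refl⟩
      al := X.al
      pg := fun s => s.1.1.1
      qg := fun s => s.1.2.1
      pe := fun s => s.1.1.2
      qe := fun s => s.1.2.2
      hLp := fun e => (hED e.1 e.2.1).hL.1
      hLpe := fun e => (hED e.1 e.2.1).hL.2
      hRq := fun e => (hED e.1 e.2.1).hR.1
      hRqe := fun e => (hED e.1 e.2.1).hR.2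
      hmid := fun e => (hED e.1 e.2.1).hm.1
      hmide := fun e => (hED e.1 e.2.1).hm.2
      h1 := fun s => by
        obtain ⟨σ, hσ, σ', hσ', a1, a2, a3⟩ := h1 s.1 s.2
        refine ⟨⟨σ, hσ, by rw [a1]; exact s.2⟩, ⟨σ', hσ', ?_⟩, Subtype.ext a1, Subtype.ext a2, Subtype.ext a3⟩
        rw [a2]
        exact (step hσ (by rw [a1]; exact s.2)).2
      h2 := by
        rintro ⟨s, hs⟩
        induction hs with
        | refl => exact Relation.ReflTransGen.refl
        | tail hb hbc ih =>
          refine ih.tail ?_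
          obtain ⟨e, he, a1, a2⟩ := hbc
          refine ⟨⟨e, he, by rw [a1]; exact hb⟩, Subtype.ext a1, ?_⟩
          rcases a2 with a2 | a2
          · exact Or.inl (Subtype.ext a2)
          · exact Or.inr (Subtype.ext a2)
      σy := ⟨ey, my, ry⟩
      σy' := ⟨ey', my', ry'⟩
      σz := ⟨ez, mz, hz⟩
      hy := Subtype.ext e1
      hy' := Subtype.ext e2
      gy := e3
      gy' := e4
      sgy' := by
        apply sgpos
        rw [e4, e2, e10]
        have : X.o (sm X.al ey'.s.1) (1, false) = X.a⁻¹ * X.o ey'.s.1 (1, false) := by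
          simp only [o, lv_sm]
          have h := om_ac (X.ρ X.al) (X.lv ey'.s.1) (X.lv (1, false))
          rw [lv1, X.hP, om_smul_right] at h
          rw [lv1, ← h, inv_mul_cancel_left₀ X.apos.ne']
        rw [this]
        have := X.apos
        positivity
      hzl := Subtype.ext e5
      hzr := Subtype.ext e6
      gzl := e7
      gzr := e8
      sgz := by
        apply sgpos
        have := (hED ez mz).hc
        rw [CC, e7, e5, e11, sm_one, e10] at this
        rw [e8, e6, e11, sm_one, e9]
        simp only [o] at *
        rw [mul_assoc] at this
        exact pos_of_mul_pos_right this hpos.le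
      py := by change ey.s.1.1 = 1; rw [e9]
      pye := by change ey.s.1.2 = false; rw [e9]
      qy' := by change ey'.s.2.1 = 1; rw [e10]
      qye' := by change ey'.s.2.2 = false; rw [e10]
      p0 := rfl
      p0e := rfl
      q0 := rfl
      q0e := rfl }
  let m : A.S → SL 2 ℝ := fun s => mk2 (X.lv s.1.1) (X.lv s.1.2) (ho s.1 s.2)
  have hm : ∀ s : A.S, m s = mk2 (X.lv s.1.1) (X.lv s.1.2) (ho s.1 s.2) := fun s => rfl
  have hPQ0 : om X.P X.Q ≠ 0 := by rw [X.hPQ]; exact one_ne_zero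
  have m0 : m A.s0 = mk2 X.P X.Q hPQ0 := by
    exact mk2_congr lv1 lv2 _ _
  have mw : ∀ (e : Bool), ∃ w h, m A.s0 * wp e = mk2 (X.ba e) w h := by
    intro e
    cases e
    · refine ⟨X.Q, hPQ0, ?_⟩
      rw [m0]; simp only [wp]; simp; rfl
    · refine ⟨-X.P, ?_, ?_⟩
      · have : om (X.ba true) (-X.P) = om X.P X.Q := by
          change om X.Q (-X.P) = _
          simp only [om, Pi.neg_apply]; ring
        rw [this]; exact hPQ0
      · rw [m0]
        simp only [wp, if_true]
        rw [mk2_ew]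
        apply sl_ext
        change (mk2 _ _ _).1 = (mk2 _ _ _).1
        rw [mk2_coe, mk2_coe, X.hPQ]
        simp [ba]
  refine ⟨A, m, Real.log X.a, ?_, ?_, ?_, ?_, ?_, ?_, ?_⟩
  · exact Real.log_pos X.ha
  · rw [m0, mk2_ac]
    apply sl_ext
    have e : (mk2 X.P X.Q hPQ0 * ea (Real.log X.a)).1 = (mk2 X.P X.Q hPQ0).1 * (ea (Real.log X.a)).1 := SG.slmul _ _
    have ee : (ea (Real.log X.a)).1 = !![X.a, 0; 0, X.a⁻¹] := by
      change !![Real.exp _, 0; 0, Real.exp _] = _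
      rw [Real.exp_neg, Real.exp_log X.apos]
    change (mk2 _ _ _).1 = (mk2 X.P X.Q hPQ0 * ea (Real.log X.a)).1
    rw [e, ee, mk2_coe, mk2_coe, om_ac, X.hPQ]
    change !![ac (X.ρ X.al) X.P 0, ac (X.ρ X.al) X.Q 0 / 1; ac (X.ρ X.al) X.P 1, ac (X.ρ X.al) X.Q 1 / 1] = _
    rw [X.hP, X.hQ]
    ext i j
    fin_cases i <;> fin_cases j <;> simp [Matrix.mul_apply, Fin.sum_univ_two, mul_comm]
  · intro s
    obtain ⟨w, h, e⟩ := mw (A.pe s)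
    rw [e, mk2_ac, hm, inv_mk2]
    change om (X.lv s.1.1) (X.lv s.1.1) = 0
    exact om_self _
  · intro s
    obtain ⟨w, h, e⟩ := mw (A.qe s)
    rw [e, mk2_ac, hm, ew_inv_10, inv_mk2]
    change - (om (X.lv s.1.2) (X.lv s.1.2) / _) = 0
    rw [om_self]; simp
  · intro σ
    have h := hED σ.1 σ.2.1
    obtain ⟨μ, hμ, v1, -⟩ := h.hL.vec
    rw [hm, hm, mk2_ac, inv_mk2]
    change om (X.lv σ.1.s.1) (ac (X.ρ σ.1.gL) (X.lv σ.1.t.1)) = 0 ∧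
      0 < om (ac (X.ρ σ.1.gL) (X.lv σ.1.t.1)) (X.lv σ.1.s.2) / om (X.lv σ.1.s.1) (X.lv σ.1.s.2) ∧
      0 ≤ om (ac (X.ρ σ.1.gL) (X.lv σ.1.t.2)) (X.lv σ.1.s.2) / (om (X.lv σ.1.s.1) (X.lv σ.1.s.2) *
        om (ac (X.ρ σ.1.gL) (X.lv σ.1.t.1)) (ac (X.ρ σ.1.gL) (X.lv σ.1.t.2)))
    have hc := h.hc
    have hos := h.os
    simp only [CC, o] at hc hos
    rw [← lv_sm, ← lv_sm, v1, om_smul_right, om_smul_left, om_smul_left, om_self]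
    refine ⟨mul_zero _, ?_, ?_⟩
    · rw [mul_div_assoc, div_self hos, mul_one]; exact hμ
    · set x := om (X.lv (sm σ.1.gL σ.1.t.2)) (X.lv σ.1.s.2)
      set y := om (X.lv σ.1.s.1) (X.lv (sm σ.1.gL σ.1.t.2))
      set z := om (X.lv σ.1.s.1) (X.lv σ.1.s.2)
      have e : x / (z * (μ * y)) = (y * x * z) / (z * z * (y * y) * μ) := by
        have hy : y ≠ 0 := fun h => by rw [h] at hc; simp at hc
        field_simp
      rw [e]
      apply div_nonneg hc.le
      have := mul_self_nonneg z
      have := mul_self_nonneg y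
      positivity
  · intro σ
    have h := hED σ.1 σ.2.1
    obtain ⟨μ, hμ, v1, -⟩ := h.hR.vec
    obtain ⟨ν, hν, v2, -⟩ := h.hm.vec
    rw [hm, hm, mk2_ac, inv_mk2]
    change om (ac (X.ρ σ.1.gR) (X.lv σ.1.u.2)) (X.lv σ.1.s.2) / (om (X.lv σ.1.s.1) (X.lv σ.1.s.2) *
        om (ac (X.ρ σ.1.gR) (X.lv σ.1.u.1)) (ac (X.ρ σ.1.gR) (X.lv σ.1.u.2))) = 0 ∧
      0 < X.sgE σ.1 * (om (ac (X.ρ σ.1.gR) (X.lv σ.1.u.1)) (X.lv σ.1.s.2) / om (X.lv σ.1.s.1) (X.lv σ.1.s.2)) ∧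
      0 ≤ X.sgE σ.1 * om (X.lv σ.1.s.1) (ac (X.ρ σ.1.gR) (X.lv σ.1.u.1))
    have hc := h.hc
    have hos := h.os
    simp only [CC, o] at hc hos
    rw [v2, om_smul_left, om_smul_right] at hc
    rw [← lv_sm, v1, om_smul_left, om_self, ← lv_sm]
    have hsg : (0 < om (X.lv (sm σ.1.gR σ.1.u.1)) (X.lv σ.1.s.2) * om (X.lv σ.1.s.1) (X.lv σ.1.s.2) ∧ X.sgE σ.1 = 1) ∨
        (¬ 0 < om (X.lv (sm σ.1.gR σ.1.u.1)) (X.lv σ.1.s.2) * om (X.lv σ.1.s.1) (X.lv σ.1.s.2) ∧ X.sgE σ.1 = -1) := by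
      by_cases h0 : 0 < om (X.lv (sm σ.1.gR σ.1.u.1)) (X.lv σ.1.s.2) * om (X.lv σ.1.s.1) (X.lv σ.1.s.2)
      · exact Or.inl ⟨h0, if_pos h0⟩
      · exact Or.inr ⟨h0, if_neg h0⟩
    set x := om (X.lv (sm σ.1.gR σ.1.u.1)) (X.lv σ.1.s.2)
    set y := om (X.lv σ.1.s.1) (X.lv (sm σ.1.gR σ.1.u.1))
    set z := om (X.lv σ.1.s.1) (X.lv σ.1.s.2)
    have hc' : 0 < y * (x * z) := by
      have e : ν * y * (ν * x) * z = (ν * ν) * (y * (x * z)) := by ring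
      rw [e] at hc
      exact pos_of_mul_pos_right hc (by positivity)
    have hxz : x / z = (x * z) / (z * z) := by field_simp
    have hzz : 0 < z * z := mul_self_pos.2 hos
    refine ⟨by simp, ?_, ?_⟩
    · rcases hsg with ⟨h0, hs⟩ | ⟨h0, hs⟩ <;> rw [hs]
      · rw [hxz, one_mul]; positivity
      · have : x * z < 0 := lt_of_le_of_ne (not_lt.1 h0) (fun h => by rw [h] at hc'; simp at hc')
        rw [hxz]
        have := div_neg_of_neg_of_pos this hzz
        linarith
    · rcases hsg with ⟨h0, hs⟩ | ⟨h0, hs⟩ <;> rw [hs]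
      · rw [one_mul]; exact (pos_of_mul_pos_left hc' h0.le).le
      · by_contra hneg
        push Not at hneg
        have : y * (x * z) ≤ 0 := mul_nonpos_of_nonneg_of_nonpos (by linarith) (not_lt.1 h0)
        linarith
  · rw [hm, hm, mk2_ew, inv_mk2]
    change om (X.lv ez.u.1) ((om (X.lv ez.t.1) (X.lv ez.t.2))⁻¹ • X.lv ez.t.2) = 0 ∧
      0 < om ((om (X.lv ez.t.1) (X.lv ez.t.2))⁻¹ • X.lv ez.t.2) (X.lv ez.u.2) / om (X.lv ez.u.1) (X.lv ez.u.2) ∧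
      om (- X.lv ez.t.1) (X.lv ez.u.2) / (om (X.lv ez.u.1) (X.lv ez.u.2) *
        om ((om (X.lv ez.t.1) (X.lv ez.t.2))⁻¹ • X.lv ez.t.2) (-X.lv ez.t.1)) ≤ 0
    have hc := (hED ez mz).hc
    have h1 := (hED ez mz).ou
    rw [CC, e7, e5, e11, sm_one, e10] at hc
    simp only [o] at h1 hpos
    rw [e6, e9] at h1
    rw [e6, e5, e10, e9]
    simp only [om_smul_left, om_smul_right, om_self, mul_zero]
    set x := om (X.lv (1, false)) (X.lv ey.s.2)
    set y := om (X.lv ey'.s.1) (X.lv (1, false))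
    refine ⟨trivial, ?_, ?_⟩
    · rw [mul_div_assoc, div_self h1, mul_one]; exact inv_pos.2 hpos
    · have a1 : om (X.lv (1, false)) (-X.lv ey'.s.1) = y := by simp only [y, om, Pi.neg_apply]; ring
      have a2 : om (-X.lv ey'.s.1) (X.lv ey.s.2) = - om (X.lv ey'.s.1) (X.lv ey.s.2) := by
        simp only [om, Pi.neg_apply]; ring
      rw [a1, a2, inv_mul_cancel₀ hpos.ne', mul_one]
      set w := om (X.lv ey'.s.1) (X.lv ey.s.2)
      rw [mul_assoc] at hc
      have hxw : 0 < x * w := pos_of_mul_pos_right hc hpos.le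
      have : -w / x = - ((x * w) / (x * x)) := by field_simp
      rw [this]
      have := div_nonneg hxw.le (mul_self_nonneg x)
      linarith

end Ax
end PG


/-! ## The automaton of a discrete faithful representation -/
namespace PG
open Filter Topology TP RT

namespace Ax
variable {G : Type} [Group G] {X : Ax G}

/-- `t` represents the pair `(p, q)` up to the group element `g`. -/
def Rp (X : Ax G) (p q : Lb G) (g : G) (t : Lb G × Lb G) : Prop := X.Eqv p (sm g t.1) ∧ X.Eqv q (sm g t.2)

lemma Rp.o {p q : Lb G} {g : G} {t : Lb G × Lb G} (h : X.Rp p q g t) (ho : X.o p q ≠ 0) : X.o t.1 t.2 ≠ 0 := by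
  rw [← X.o_sm g]; exact o_eqv h.1 h.2 ho
lemma Rp.cost {p q : Lb G} {g : G} {t : Lb G × Lb G} (h : X.Rp p q g t) : X.cost t.1 t.2 = X.cost p q := by
  rw [← X.cost_sm g]; exact cost_eqv h.1 h.2

lemma mkE {p q r : Lb G} {t u : Lb G × Lb G} {gL gR : G} (hc : X.CC p r q) (hL : X.Rp p r gL t) (hR : X.Rp r q gR u) :
    X.ED ⟨(p, q), t, u, gL, gR⟩ :=
  ⟨hL.1, hR.2, hR.1.symm.trans hL.2, CC_eqv (Eqv.refl X _) hL.2 (Eqv.refl X _) hc⟩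

lemma Rp.self (p q : Lb G) : X.Rp p q 1 (p, q) := ⟨by rw [sm_one]; exact Eqv.refl X _, by rw [sm_one]; exact Eqv.refl X _⟩
lemma Rp.mv (p q : Lb G) (g : G) : X.Rp (sm g p) (sm g q) g (p, q) := ⟨Eqv.refl X _, Eqv.refl X _⟩

lemma exM (M0 : ℝ) (hM0 : 0 < M0) (L : List (Lb G × Lb G)) : ∃ M, M0 ≤ M ∧ ∀ x ∈ L, X.cost x.1 x.2 ≤ M ^ 2 := by
  induction L with
  | nil => exact ⟨M0, le_rfl, fun x hx => absurd hx List.not_mem_nil⟩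
  | cons y L ih =>
    obtain ⟨M, hM, h⟩ := ih
    have hc : 0 ≤ X.cost y.1 y.2 := abs_nonneg _
    refine ⟨M + X.cost y.1 y.2 + 1, by linarith, fun x hx => ?_⟩
    rcases List.mem_cons.1 hx with rfl | hx
    · nlinarith
    · have := h x hx
      nlinarith

lemma om_PQ (v w : V2) : om v w = om v X.Q * om X.P w - om X.P v * om w X.Q := by
  have h := congrArg (fun z => om z w) (expand v X.P X.Q)
  simp only [om_smul_left, om_add_left, X.hPQ, one_mul] at h
  rw [h, om_swap w X.Q]; ring

lemma om_P_al (v : V2) : om X.P (ac (X.ρ X.al) v) = X.a⁻¹ * om X.P v := by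
  have h := om_ac (X.ρ X.al) X.P v
  rw [X.hP, om_smul_left] at h
  rw [← h, inv_mul_cancel_left₀ X.apos.ne']
lemma om_al_Q (v : V2) : om (ac (X.ρ X.al) v) X.Q = X.a * om v X.Q := by
  have h := om_ac (X.ρ X.al) v X.Q
  rw [X.hQ, om_smul_right] at h
  rw [← h, mul_inv_cancel_left₀ X.apos.ne']

lemma om_v_al (v : V2) : om v (ac (X.ρ X.al) v) = - ((X.a - X.a⁻¹) * (om v X.Q * om X.P v)) := by
  rw [om_PQ (X := X), om_P_al, om_al_Q]; ring

lemma a_sub_pos : 0 < X.a - X.a⁻¹ := by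
  have := inv_lt_one_of_one_lt₀ X.ha
  linarith [X.ha]

/-- special labels -/
lemma exists_r (hD : X.Dn) : ∃ r : Lb G, 0 < om X.P (X.lv r) * om (X.lv r) X.Q := by
  obtain ⟨γ, η, hη, ⟨h1, h2⟩, -⟩ := hD X.P X.Q X.P X.Q (by rw [X.hPQ]; exact one_ne_zero) (by rw [X.hPQ]; exact one_pos)
  refine ⟨(γ, false), ?_⟩
  change 0 < om X.P (ac (X.ρ γ) X.P) * om (ac (X.ρ γ) X.P) X.Q
  have := mul_pos h1 h2
  rcases hη with rfl | rfl <;> linarith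

lemma exists_r2 (hD : X.Dn) : ∃ r : Lb G, 0 < om (X.lv r) X.P ∧ 0 < om (X.lv r) X.Q := by
  obtain ⟨γ, η, hη, ⟨h1, h2⟩, ⟨h3, h4⟩⟩ := hD X.P X.Q (-X.Q) X.P (by rw [X.hPQ]; exact one_ne_zero) (by
    have : om (-X.Q) X.P = om X.P X.Q := by simp only [om, Pi.neg_apply]; ring
    rw [this, X.hPQ]; exact one_pos)
  have e : ∀ v, om (-X.Q) v = om v X.Q := fun v => by simp only [om, Pi.neg_apply]; ring
  rw [e] at h1 h3
  rcases hη with rfl | rfl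
  · refine ⟨(γ, false), ?_, ?_⟩
    · change 0 < om (ac (X.ρ γ) X.P) X.P; linarith
    · change 0 < om (ac (X.ρ γ) X.P) X.Q; linarith
  · have e2 : ∀ w, om (ac (X.ρ γ⁻¹) X.P) w = - om (ac (X.ρ γ) w) X.P := fun w => by
      have := om_ac (X.ρ γ) (ac (X.ρ γ⁻¹) X.P) w
      rw [map_inv, ac_inv'] at this
      rw [map_inv, ← this, om_swap]
    refine ⟨(γ⁻¹, false), ?_, ?_⟩
    · change 0 < om (ac (X.ρ γ⁻¹) X.P) X.P; rw [e2]; linarith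
    · change 0 < om (ac (X.ρ γ⁻¹) X.P) X.Q; rw [e2]; linarith

theorem exists_SL2Pos {C : ℝ} (hC : ∀ h : SL 2 ℝ, ∃ γ, ns (X.ρ γ * h).1 ≤ C) (hD : X.Dn)
    (hF : ∀ C : ℝ, {γ | qq (ac (X.ρ γ) X.P) ≤ C ∧ qq (ac (X.ρ γ) X.Q) ≤ C}.Finite) :
    ∃ (A : Aut G) (m : A.S → SL 2 ℝ) (t : ℝ), SL2Pos A X.ρ m t := by
  classical
  obtain ⟨r, hr⟩ := exists_r hD
  obtain ⟨r2, hr2, hr2'⟩ := exists_r2 hD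
  have ha := X.apos
  have haa := a_sub_pos (X := X)
  let l1 : Lb G := (1, false)
  let l2 : Lb G := (1, true)
  have L1 : X.lv l1 = X.P := lv1
  have L2 : X.lv l2 = X.Q := lv2
  set w := om (X.lv r2) (X.lv r) with hw
  -- orientation facts
  have hw' : 0 < om X.P (X.lv r) * w := by
    have e : om X.P (X.lv r) * w = om (X.lv r2) X.Q * (om X.P (X.lv r) * om X.P (X.lv r)) +
        om (X.lv r2) X.P * (om X.P (X.lv r) * om (X.lv r) X.Q) := by
      have h := om_PQ (X := X) (X.lv r2) (X.lv r)
      rw [hw, h, om_swap (X.lv r2) X.P]; ring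
    rw [e]
    have := mul_self_nonneg (om X.P (X.lv r))
    have := mul_pos hr2 hr
    have := mul_nonneg hr2'.le (mul_self_nonneg (om X.P (X.lv r)))
    linarith
  have hw0 : w ≠ 0 := fun h => by rw [h] at hw'; simp at hw'
  have cz : X.CC r2 l1 r := by
    rw [CC, L1, mul_assoc]; exact mul_pos hr2 hw'
  have cy : X.CC l1 (sm X.al r) r := by
    rw [CC, lv_sm, L1, om_P_al, om_swap (X.lv r) (ac (X.ρ X.al) (X.lv r)), om_v_al, neg_neg]
    have h0 : om X.P (X.lv r) ≠ 0 := fun h => by rw [h] at hr; simp at hr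
    have e : X.a⁻¹ * om X.P (X.lv r) * ((X.a - X.a⁻¹) * (om (X.lv r) X.Q * om X.P (X.lv r))) * om X.P (X.lv r) =
      X.a⁻¹ * (X.a - X.a⁻¹) * (om X.P (X.lv r) * om X.P (X.lv r)) * (om X.P (X.lv r) * om (X.lv r) X.Q) := by ring
    rw [e]
    have := mul_self_pos.2 h0
    positivity
  have cy' : X.CC r2 (sm X.al r2) l1 := by
    rw [CC, lv_sm, L1, om_v_al, om_swap X.P (ac _ _), om_P_al, om_swap (X.lv r2) X.P]
    have e : -((X.a - X.a⁻¹) * (om (X.lv r2) X.Q * -om (X.lv r2) X.P)) * -(X.a⁻¹ * -om (X.lv r2) X.P) * om (X.lv r2) X.P =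
      (X.a - X.a⁻¹) * om (X.lv r2) X.Q * X.a⁻¹ * om (X.lv r2) X.P * om (X.lv r2) X.P * om (X.lv r2) X.P := by ring
    rw [e]
    positivity
  obtain ⟨δ, η, hη, ⟨d1, d2⟩, ⟨d3, d4⟩⟩ := hD (X.lv r2) (w • X.lv r) X.P X.Q (by
    rw [om_smul_right]; exact mul_ne_zero hw0 hw0) (by rw [X.hPQ]; exact one_pos)
  rw [ac_smul, ← lv_sm, om_smul_right] at d3
  rw [ac_smul, ← lv_sm, om_smul_left] at d4
  rw [← lv_sm] at d1 d2
  have hη2 : η * η = 1 := by rcases hη with h | h <;> rw [h] <;> norm_num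
  have c1 : X.CC l1 (sm δ r) l2 := by
    rw [CC, L1, L2, X.hPQ, mul_one]
    have := mul_pos d3 d4
    have e : η * (w * om X.P (X.lv (sm δ r))) * (η * (w * om (X.lv (sm δ r)) X.Q)) = η * η * ((w * w) * (om X.P (X.lv (sm δ r)) *
      om (X.lv (sm δ r)) X.Q)) := by ring
    rw [e, hη2, one_mul] at this
    exact pos_of_mul_pos_right this (mul_self_nonneg w)
  have c2 : X.CC l1 (sm δ r2) (sm δ r) := by
    have e0 : om (X.lv (sm δ r2)) (X.lv (sm δ r)) = w := by rw [lv_sm, lv_sm, om_ac]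
    rw [CC, L1, e0]
    have := mul_pos d1 d3
    have e : η * om X.P (X.lv (sm δ r2)) * (η * (w * om X.P (X.lv (sm δ r)))) = η * η * (om X.P (X.lv (sm δ r2)) * w *
      om X.P (X.lv (sm δ r))) := by ring
    rw [e, hη2, one_mul] at this
    exact this
  -- the constant
  obtain ⟨M0, hM0, hS⟩ := X.split hC hD
  obtain ⟨M, hM, hcost⟩ := exM (X := X) M0 hM0 [(l1, l2), (l1, r), (sm X.al r, r), (r2, l1), (r2, sm X.al r2), (r2, r),
    (l1, sm δ r), (sm δ r, l2), (l1, sm δ r2)]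
  have hMp : 0 < M := lt_of_lt_of_le hM0 hM
  replace hS := hS M hM
  obtain ⟨C2, hN⟩ := X.normPair hC hMp
  let F : Set G := {γ | qq (ac (X.ρ γ) X.P) ≤ C2 ∧ qq (ac (X.ρ γ) X.Q) ≤ C2} ∪ {1, r.1, r2.1}
  have finF : F.Finite := (hF C2).union (by simp)
  let FL : Set (Lb G) := F ×ˢ Set.univ
  have finFL : FL.Finite := finF.prod Set.finite_univ
  let S0 : Set (Lb G × Lb G) := {s | s ∈ FL ×ˢ FL ∧ X.o s.1 s.2 ≠ 0 ∧ X.cost s.1 s.2 ≤ M ^ 2}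
  have finS0 : S0.Finite := (finFL.prod finFL).subset fun s hs => hs.1
  have norm : ∀ p q, X.o p q ≠ 0 → X.cost p q ≤ M ^ 2 → ∃ g, ∃ t ∈ S0, X.Rp p q g t := by
    intro p q ho hc
    obtain ⟨g, p', q', h1, h2, h3, h4⟩ := hN p q ho hc
    have hR : X.Rp p q g (p', q') := ⟨h1, h2⟩
    exact ⟨g, (p', q'), ⟨⟨⟨Or.inl h3, trivial⟩, ⟨Or.inl h4, trivial⟩⟩, hR.o ho, hR.cost.trans_le hc⟩, hR⟩
  have ml1 : l1 ∈ FL := ⟨Or.inr (by simp [l1]), trivial⟩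
  have ml2 : l2 ∈ FL := ⟨Or.inr (by simp [l2]), trivial⟩
  have mr : r ∈ FL := ⟨Or.inr (by simp), trivial⟩
  have mr2 : r2 ∈ FL := ⟨Or.inr (by simp), trivial⟩
  have m0 : (l1, l2) ∈ S0 := ⟨⟨ml1, ml2⟩, CC.o3 X c1, hcost (l1, l2) (by simp)⟩
  have mmy : (l1, r) ∈ S0 := ⟨⟨ml1, mr⟩, CC.o3 X cy, hcost (l1, r) (by simp)⟩
  have mmy' : (r2, l1) ∈ S0 := ⟨⟨mr2, ml1⟩, CC.o3 X cy', hcost (r2, l1) (by simp)⟩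
  have mmz : (r2, r) ∈ S0 := ⟨⟨mr2, mr⟩, CC.o3 X cz, hcost (r2, r) (by simp)⟩
  -- general edges
  have gen : ∀ s ∈ S0, ∃ σ σ' : Ed G, X.ED σ ∧ X.ED σ' ∧ σ.s = s ∧ σ.t ∈ S0 ∧ σ.u ∈ S0 ∧ σ'.s = σ.u ∧ σ'.t = S00 ∧ σ'.u ∈ S0 := by
    rintro ⟨p, q⟩ ⟨-, ho, hc⟩
    obtain ⟨γ, k1, k2, k3, k4, k5⟩ := hS p q ho hc
    obtain ⟨gL, t, mt, ht⟩ := norm _ _ (CC.o1 X k1) k3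
    obtain ⟨gR, u, mu, hu⟩ := norm _ _ (CC.o2 X k1) k4
    have hu1 : u.1.2 = false := hu.1.2
    have e1 : opp (γ, false) = ((γ, true) : Lb G) := rfl
    have k6 : X.CC u.1 (opp u.1) u.2 := by
      rw [← X.CC_sm gR]
      refine CC_eqv hu.1 ?_ hu.2 k2
      exact hu.1.opp
    have hRp : X.Rp (γ, true) q gR (opp u.1, u.2) := ⟨hu.1.opp, hu.2⟩
    obtain ⟨g', u', mu', hu'⟩ := norm (opp u.1) u.2 (CC.o2 X k6) (hRp.cost.trans_le k5)
    have hS0 : X.Rp u.1 (opp u.1) u.1.1 S00 := by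
      have a1 : u.1 = sm u.1.1 (1, false) := by
        rw [sm, mul_one]; exact Prod.ext rfl hu1
      have a2 : opp u.1 = sm u.1.1 (1, true) := by
        rw [sm, mul_one]; refine Prod.ext rfl ?_
        change (!u.1.2) = true
        rw [hu1]; rfl
      constructor
      · have := Eqv.refl X u.1
        rw [a1] at this ⊢
        simpa [S00, sm] using this
      · have := Eqv.refl X (opp u.1)
        rw [a2] at this ⊢
        simpa [S00, sm] using this
    exact ⟨⟨(p, q), t, u, gL, gR⟩, ⟨(u.1, u.2), S00, u', u.1.1, g'⟩, mkE k1 ht hu, mkE k6 hS0 hu', rfl, mt, mu, rfl, rfl, mu'⟩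
  haveI : Nonempty (Ed G) := ⟨⟨S00, S00, S00, 1, 1⟩⟩
  choose! fA fB gA gB hA1 hA2 hA3 hB1 hB2 hB3 using gen
  -- special edges
  obtain ⟨gy, uy, muy, huy⟩ := norm _ _ (CC.o2 X cy) (hcost (sm X.al r, r) (by simp))
  obtain ⟨gy', ty', mty', hty'⟩ := norm _ _ (CC.o1 X cy') (hcost (r2, sm X.al r2) (by simp))
  obtain ⟨g1, t1, mt1, ht1⟩ := norm _ _ (CC.o1 X c1) (hcost (l1, sm δ r) (by simp))
  obtain ⟨g1', u1, mu1, hu1⟩ := norm _ _ (CC.o2 X c1) (hcost (sm δ r, l2) (by simp))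
  obtain ⟨g2, t2, mt2, ht2⟩ := norm _ _ (CC.o1 X c2) (hcost (l1, sm δ r2) (by simp))
  have hal1 : X.Eqv l1 (sm X.al l1) := ⟨⟨1, by simp [l1, sm]⟩, rfl⟩
  let ey : Ed G := ⟨(l1, r), (l1, r), uy, X.al, gy⟩
  let ey' : Ed G := ⟨(r2, l1), ty', (r2, l1), gy', X.al⟩
  let ez : Ed G := ⟨(r2, r), (r2, l1), (l1, r), 1, 1⟩
  let e1 : Ed G := ⟨(l1, l2), t1, u1, g1, g1'⟩
  let e2 : Ed G := ⟨(t1.1, t1.2), t2, (r2, r), g1⁻¹ * g2, g1⁻¹ * δ⟩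
  have Ey : X.ED ey := mkE cy ⟨hal1, Eqv.refl X _⟩ huy
  have Ey' : X.ED ey' := mkE cy' hty' ⟨Eqv.refl X _, hal1⟩
  have Ez : X.ED ez := mkE cz (Rp.self _ _) (Rp.self _ _)
  have E1 : X.ED e1 := mkE c1 ht1 hu1
  have q1 : ∀ {l l' : Lb G}, X.Eqv l (sm g1 l') → X.Eqv l' (sm g1⁻¹ l) := fun {l l'} h => by
    have := (h.sm g1⁻¹).symm
    rwa [sm_sm, inv_mul_cancel, sm_one] at this
  have E2 : X.ED e2 := by
    have c2' : X.CC t1.1 (sm (g1⁻¹ * δ) r2) t1.2 := by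
      rw [← X.CC_sm g1⁻¹] at c2
      rw [← sm_sm]
      exact CC_eqv (q1 ht1.1).symm (Eqv.refl X _) (q1 ht1.2).symm c2
    refine mkE c2' ⟨?_, ?_⟩ ⟨Eqv.refl X _, ?_⟩
    · rw [← sm_sm]
      exact (q1 ht1.1).trans (ht2.1.sm _)
    · rw [← sm_sm, ← sm_sm]
      exact ht2.2.sm _
    · rw [← sm_sm]
      exact q1 ht1.2
  let 𝓔 : Set (Ed G) := (fA '' S0 ∪ fB '' S0) ∪ {ey, ey', ez, e1, e2}
  have finE : 𝓔.Finite := ((finS0.image _).union (finS0.image _)).union (by simp)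
  have hE : ∀ e ∈ 𝓔, X.ED e ∧ e.t ∈ S0 ∧ e.u ∈ S0 := by
    rintro e ((⟨s, hs, rfl⟩ | ⟨s, hs, rfl⟩) | h)
    · exact ⟨gA s hs, hA2 s hs, hA3 s hs⟩
    · exact ⟨gB s hs, by rw [hB2 s hs]; exact m0, hB3 s hs⟩
    · simp only [Set.mem_insert_iff, Set.mem_singleton_iff] at h
      rcases h with rfl | rfl | rfl | rfl | rfl
      · exact ⟨Ey, mmy, muy⟩
      · exact ⟨Ey', mty', mmy'⟩
      · exact ⟨Ez, mmy', mmy⟩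
      · exact ⟨E1, mt1, mu1⟩
      · exact ⟨E2, mt2, mmz⟩
  have hR : ∀ s, Rch 𝓔 s → s ∈ S0 := by
    intro s hs
    rcases Relation.ReflTransGen.cases_tail hs with h | ⟨c, -, e, he, -, h | h⟩
    · rw [h]; exact m0
    · rw [← h]; exact (hE e he).2.1
    · rw [← h]; exact (hE e he).2.2
  refine build 𝓔 finE (fun e he => (hE e he).1) (fun s hs => ?_) ey ey' ez (Or.inr (by simp)) (Or.inr (by simp)) (Or.inr (by simp))
    ?_ rfl rfl rfl rfl rfl rfl rfl rfl rfl rfl rfl ?_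
  · have h := hR s hs
    exact ⟨fA s, Or.inl (Or.inl ⟨s, h, rfl⟩), fB s, Or.inl (Or.inr ⟨s, h, rfl⟩), hA1 s h, hB1 s h, hB2 s h⟩
  · have s1 : Rch 𝓔 t1 := (Relation.ReflTransGen.refl).tail ⟨e1, Or.inr (by simp), rfl, Or.inl rfl⟩
    exact s1.tail ⟨e2, Or.inr (by simp), rfl, Or.inr rfl⟩
  · change 0 < om (X.lv r2) (X.lv l1)
    rw [L1]; exact hr2

end Ax

/-- every discrete faithful representation has a positive structure -/
theorem exists_pos {g : ℕ} (hg : 2 ≤ g) {ρ : SurfaceGroup g →* SL 2 ℝ} (hinj : Function.Injective ρ)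
    (hd : DiscreteTopology (ρ.range : Subgroup (SL 2 ℝ))) :
    ∃ (A : Aut (SurfaceGroup g)) (m : A.S → SL 2 ℝ) (t : ℝ), SL2Pos A ρ m t := by
  have hp := proper_of_discrete hinj hd
  have hC := cocompact hg hinj hp
  obtain ⟨α, a, ha, p, q, hpq, h1, h2⟩ := exists_hyp hg hinj hC
  let X : Ax (SurfaceGroup g) := ⟨ρ, p, q, α, a, ha, hpq, h1, h2⟩
  obtain ⟨C, hC'⟩ := hC
  exact Ax.exists_SL2Pos (X := X) (C := C) hC' (fun x y a b hxy hab => dens hg hinj ⟨C, hC'⟩ x y a b hxy hab)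
    (fun C => finite_vec hp (a := p) (b := q) (by rw [hpq]; exact one_ne_zero) C)

end PG


namespace VA
open TP RT
variable {g n : ℕ}

/-- The generators of a point of the representation variety, as elements of `SL n ℝ`. -/
def slOf (x : RepVariety g n ℝ) (i : Fin g × Bool) : SL n ℝ := ⟨x.1 i, x.2.1 i⟩

theorem coe_list_prod (l : List (SL n ℝ)) :
    (l.prod : SL n ℝ).1 = (l.map (fun A => A.1)).prod := by
  induction l with
  | nil => simpa using SG.slone
  | cons a l ih => rw [List.prod_cons, List.map_cons, List.prod_cons, SG.slmul, ih]

theorem inv_coe (A : SL n ℝ) : (A⁻¹).1 = (A.1)⁻¹ := by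
  have h : A.1 * (A⁻¹).1 = 1 := SG.sl_mul_inv A
  exact (Matrix.inv_eq_right_inv h).symm

theorem slOf_rel (x : RepVariety g n ℝ) :
    ∀ r ∈ ({surfaceRelator g} : Set (FreeGroup (Fin g × Bool))), FreeGroup.lift (slOf x) r = 1 := by
  intro r hr
  rw [Set.mem_singleton_iff] at hr
  subst hr
  rw [SG.map_relator]
  apply Subtype.ext
  rw [coe_list_prod, List.map_ofFn]
  have h := x.2.2
  have e : (1 : SL n ℝ).1 = 1 := SG.slone
  rw [e, ← h]
  congr 2
  funext i
  simp only [Function.comp, FreeGroup.lift_apply_of, commutatorElement_def, SG.slmul, inv_coe]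
  rfl

/-- The homomorphism attached to a point of the representation variety. -/
def homOf (x : RepVariety g n ℝ) : SurfaceGroup g →* SL n ℝ := PresentedGroup.toGroup (slOf_rel x)

theorem homOf_of (x : RepVariety g n ℝ) (i : Fin g × Bool) :
    homOf x (PresentedGroup.of i) = slOf x i := PresentedGroup.toGroup.of _

/-- The inclusion of `SL n ℝ` into matrices. -/
def slc (n : ℕ) : SL n ℝ →* Mat n where
  toFun A := A.1
  map_one' := SG.slone
  map_mul' := SG.slmul

theorem hom_cont (γ : SurfaceGroup g) : Continuous fun x : RepVariety g n ℝ => (homOf x γ).1 := by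
  let H : Subgroup (SurfaceGroup g) :=
    { carrier := {γ | Continuous fun x : RepVariety g n ℝ => (homOf x γ).1}
      one_mem' := by
        have : (fun x : RepVariety g n ℝ => (homOf x 1).1) = fun _ => (1 : SL n ℝ).1 := by
          funext x; rw [map_one]
        rw [Set.mem_setOf_eq, this]; exact continuous_const
      mul_mem' := by
        intro a b ha hb
        have : (fun x : RepVariety g n ℝ => (homOf x (a * b)).1) =
            fun x => (homOf x a).1 * (homOf x b).1 := by
          funext x; rw [map_mul, SG.slmul]
        rw [Set.mem_setOf_eq, this]; exact Continuous.matrix_mul ha hb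
      inv_mem' := by
        intro a ha
        have : (fun x : RepVariety g n ℝ => (homOf x a⁻¹).1) =
            fun x => ((homOf x a).1).adjugate := by
          funext x; rw [map_inv]; rfl
        rw [Set.mem_setOf_eq, this]; exact Continuous.matrix_adjugate ha }
  have hg : ∀ i, PresentedGroup.of i ∈ H := fun i => by
    have : (fun x : RepVariety g n ℝ => (homOf x (PresentedGroup.of i)).1) = fun x => x.1 i := by
      funext x; rw [homOf_of]; rfl
    change Continuous _
    rw [this]
    exact (continuous_apply i).comp continuous_subtype_val
  have hH : H = ⊤ := SG.gen_induction H (fun i => hg _) (fun i => hg _)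
  have : γ ∈ H := hH ▸ Subgroup.mem_top γ
  exact this

theorem homOf_eq (ρ : SurfaceGroup g →* SL n ℝ) (h : repTuple ρ ∈ RepVariety g n ℝ) :
    homOf ⟨repTuple ρ, h⟩ = ρ := by
  apply PresentedGroup.ext
  intro i
  rw [homOf_of]
  rfl

theorem centralizer_of_HIT (hg : 2 ≤ g) (hn : 2 ≤ n)
    (T : (Fin g × Bool) → Matrix (Fin n) (Fin n) ℝ) (hT : IsTeichmuller g n T)
    (ρ : SurfaceGroup g →* SL n ℝ) (hρ : repTuple ρ ∈ HIT g n T)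
    (X : Mat n) (hX : ∀ γ, (ρ γ).1 * X = X * (ρ γ).1) : ∃ c : ℝ, X = c • (1 : Mat n) := by
  obtain ⟨ρ₀, j, ⟨hinj, hd⟩, ⟨hj, irr⟩, rfl⟩ := hT
  obtain ⟨A0, m, t, h0⟩ := PG.exists_pos hg hinj hd
  have hs : Continuous (fun B : SL n ℝ => B.1) := continuous_induced_dom
  have hc : Continuous ((slc n).comp j) := by
    have h : Continuous (fun x => (j x).1) := hs.comp hj
    exact h
  obtain ⟨A, J, hJ, hP⟩ := RT.pos_of_SL2Pos h0 (by omega) ((slc n).comp j) hc irr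
  have hTm : repTuple (j.comp ρ₀) ∈ RepVariety g n ℝ := by
    by_contra hno
    rw [HIT, connectedComponentIn_eq_empty hno] at hρ
    exact hρ
  have hρm : repTuple ρ ∈ RepVariety g n ℝ := connectedComponentIn_subset _ _ hρ
  let R : RepVariety g n ℝ → SurfaceGroup g →* Mat n := fun x => (slc n).comp (homOf x)
  have hR : ∀ γ, Continuous fun x => R x γ := fun γ => hom_cont γ
  have ho := TP.isOpen_pos A hJ R hR
  have hcl := TP.isClosed_pos (by omega) A hJ R hR (fun x γ => (homOf x γ).2)
  have hmem : (⟨repTuple ρ, hρm⟩ : RepVariety g n ℝ) ∈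
      connectedComponent (⟨repTuple (j.comp ρ₀), hTm⟩ : RepVariety g n ℝ) := by
    rw [HIT, connectedComponentIn_eq_image hTm] at hρ
    obtain ⟨y, hy, e⟩ := hρ
    have : y = ⟨repTuple ρ, hρm⟩ := Subtype.ext e
    rwa [this] at hy
  have hTP : (⟨repTuple (j.comp ρ₀), hTm⟩ : RepVariety g n ℝ) ∈
      {x | ∃ M d, TP.Pos A J (R x) M d} := by
    change ∃ M d, TP.Pos A J ((slc n).comp (homOf _)) M d
    rw [homOf_eq]
    exact hP
  have := IsClopen.connectedComponent_subset ⟨hcl, ho⟩ hTP hmem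
  obtain ⟨M, d, hPos⟩ := this
  refine TP.Pos.centralizer hJ hPos X fun γ => ?_
  change (homOf _ γ).1 * X = X * (homOf _ γ).1
  rw [homOf_eq]
  exact hX γ

end VA

/-- For a Hitchin representation `ρ`, the space of 1-cocycles `Z¹(Γ_g, sl_n(ℝ))` has
dimension `(2g−1)(n²−1)`. -/
theorem finrank_cocycles_of_Hitchin (g n : ℕ) (hg : 2 ≤ g) (hn : 2 ≤ n)
    (T : (Fin g × Bool) → Matrix (Fin n) (Fin n) ℝ) (hT : IsTeichmuller g n T)
    (ρ : SurfaceGroup g →* SL n ℝ) (hρ : repTuple ρ ∈ HIT g n T) :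
    Module.finrank ℝ (cocycles ρ) = (2 * g - 1) * (n ^ 2 - 1) := by
  refine SG.finrank_of_centralizer (by omega) ρ fun X htr hX => ?_
  obtain ⟨c, rfl⟩ := VA.centralizer_of_HIT hg hn T hT ρ hρ X hX
  rw [Matrix.trace_smul, Matrix.trace_one, Fintype.card_fin, smul_eq_mul] at htr
  have hn0 : (n : ℝ) ≠ 0 := by
    have : n ≠ 0 := by omega
    exact_mod_cast this
  have : c = 0 := (mul_eq_zero.1 htr).resolve_right hn0
  rw [this, zero_smul]
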